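/- Let Ω ⊆ ℝ^{n+1} be a nonempty proper open convex domain. Then there exists a C^∞ function F : Ω → ℝ such that the Hessian D²F(x) is positive definite for every x ∈ Ω, det D²F(x) = e^{2F(x)} for every x ∈ Ω, and F(x_k) → +∞ for every sequence (x_k) in Ω converging to a point of the boundary of Ω. -/

import Mathlib

open scoped RealInnerProductSpace

noncomputable section

abbrev Euc (m : ℕ) : Type := EuclideanSpace ℝ (Fin m)

/-- The Hessian matrix of `F` at `x` in the standard coordinates. -/
def hessMatrix {m : ℕ} (F : Euc m → ℝ) (x : Euc m) : Matrix (Fin m) (Fin m) ℝ :=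
  fun i j => iteratedFDeriv ℝ 2 F x ![EuclideanSpace.single i 1, EuclideanSpace.single j 1]

/-- A nonempty proper open convex cone in `ℝ^m`. -/
def IsOpenProperConvexCone {m : ℕ} (Ω : Set (Euc m)) : Prop :=
  Ω.Nonempty ∧ IsOpen Ω ∧ Convex ℝ Ω ∧
    (∀ x ∈ Ω, ∀ t : ℝ, Real.exp t • x ∈ Ω) ∧
    ¬ ∃ p v : Euc m, v ≠ 0 ∧ ∀ t : ℝ, p + t • v ∈ closure Ω

/-- `F` tends to `+∞` along every sequence in `Ω` converging to a boundary point of `Ω`. -/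
def BlowsUpOnBoundary {m : ℕ} (Ω : Set (Euc m)) (F : Euc m → ℝ) : Prop :=
  ∀ z ∈ frontier Ω, ∀ x : ℕ → Euc m, (∀ k, x k ∈ Ω) →
    Filter.Tendsto x Filter.atTop (nhds z) →
    Filter.Tendsto (fun k => F (x k)) Filter.atTop Filter.atTop

/-- The canonical potential of a proper open convex cone `Ω ⊆ ℝ^{n+1}`. -/
def IsCanonicalPotential (n : ℕ) (Ω : Set (Euc (n+1))) (F : Euc (n+1) → ℝ) : Prop :=
  ContDiffOn ℝ (⊤ : ℕ∞) F Ω ∧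
  (∀ x ∈ Ω, (hessMatrix F x).PosDef) ∧
  (∀ x ∈ Ω, (hessMatrix F x).det = Real.exp (2 * F x)) ∧
  (∀ x ∈ Ω, ∀ t : ℝ, F (Real.exp t • x) = F x - (n + 1) * t) ∧
  BlowsUpOnBoundary Ω F

/-- The open dual cone of `Ω`. -/
def openDualCone {m : ℕ} (Ω : Set (Euc m)) : Set (Euc m) :=
  {y | ∀ x ∈ closure Ω, x ≠ 0 → 0 < ⟪x, y⟫}

/-- A nonempty proper open convex domain in `ℝ^m`: an open convex set whose closure
contains no complete affine line. -/
def IsOpenProperConvexDomain {m : ℕ} (Ω : Set (Euc m)) : Prop :=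
  Ω.Nonempty ∧ IsOpen Ω ∧ Convex ℝ Ω ∧
    ¬ ∃ p v : Euc m, v ≠ 0 ∧ ∀ t : ℝ, p + t • v ∈ closure Ω

section
open scoped ContDiff
namespace CY

/-- smooth functions on `ℝ^m` -/
def SFsub (m : ℕ) : Subalgebra ℝ (Euc m → ℝ) where
  carrier := {f | ContDiff ℝ ∞ f}
  mul_mem' := fun {f g} (ha : ContDiff ℝ ∞ f) (hb : ContDiff ℝ ∞ g) => ContDiff.mul ha hb
  add_mem' := fun {f g} (ha : ContDiff ℝ ∞ f) (hb : ContDiff ℝ ∞ g) => ContDiff.add ha hb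
  algebraMap_mem' := fun r => (contDiff_const : ContDiff ℝ ∞ (fun _ : Euc m => r))

/-- the type of smooth functions -/
def SF (m : ℕ) : Type := ↥(SFsub m)

variable {m : ℕ}

instance : CommRing (SF m) := inferInstanceAs (CommRing ↥(SFsub m))
instance : Algebra ℝ (SF m) := inferInstanceAs (Algebra ℝ ↥(SFsub m))

instance : CoeFun (SF m) (fun _ => Euc m → ℝ) := ⟨Subtype.val⟩

theorem SF.cd (f : SF m) : ContDiff ℝ ∞ (f : Euc m → ℝ) := f.2

@[ext] theorem SF.ext' {f g : SF m} (h : ∀ x, f x = g x) : f = g := Subtype.ext (funext h)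

@[simp] theorem SF.add_apply (f g : SF m) (x : Euc m) : (f + g) x = f x + g x := rfl
@[simp] theorem SF.sub_apply (f g : SF m) (x : Euc m) : (f - g) x = f x - g x := rfl
@[simp] theorem SF.mul_apply (f g : SF m) (x : Euc m) : (f * g) x = f x * g x := rfl
@[simp] theorem SF.neg_apply (f : SF m) (x : Euc m) : (-f) x = - f x := rfl
@[simp] theorem SF.smul_apply (c : ℝ) (f : SF m) (x : Euc m) : (c • f) x = c * f x := rfl
@[simp] theorem SF.one_apply (x : Euc m) : (1 : SF m) x = 1 := rfl
@[simp] theorem SF.zero_apply (x : Euc m) : (0 : SF m) x = 0 := rfl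
@[simp] theorem SF.pow_apply (f : SF m) (k : ℕ) (x : Euc m) : (f ^ k) x = f x ^ k := rfl
@[simp] theorem SF.algebraMap_apply (c : ℝ) (x : Euc m) : (algebraMap ℝ (SF m) c) x = c := rfl

/-- evaluation at a point -/
def ev (x : Euc m) : SF m →ₐ[ℝ] ℝ :=
  (Pi.evalAlgHom ℝ (fun _ : Euc m => ℝ) x).comp (SFsub m).val

theorem ev_apply (x : Euc m) (f : SF m) : ev x f = f x := rfl

@[simp] theorem SF.natCast_apply (n : ℕ) (x : Euc m) : ((n : SF m)) x = n := by
  rw [← ev_apply, map_natCast]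
@[simp] theorem SF.ofNat_apply (n : ℕ) [n.AtLeastTwo] (x : Euc m) :
    ((OfNat.ofNat n : SF m)) x = OfNat.ofNat n := by
  rw [← ev_apply, map_ofNat]

@[simp] theorem SF.sum_apply {κ : Type*} (s : Finset κ) (f : κ → SF m) (x : Euc m) :
    (∑ i ∈ s, f i) x = ∑ i ∈ s, f i x := by
  simp only [← ev_apply, map_sum]

theorem SF.prod_apply {κ : Type*} (s : Finset κ) (f : κ → SF m) (x : Euc m) :
    (∏ i ∈ s, f i) x = ∏ i ∈ s, f i x := by
  simp only [← ev_apply, map_prod]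

theorem SF.diff (f : SF m) : Differentiable ℝ (f : Euc m → ℝ) := f.cd.differentiable (by simp)

theorem SF.cont (f : SF m) : Continuous (f : Euc m → ℝ) := f.cd.continuous

/-- directional derivative as a derivation -/
def D (v : Euc m) : Derivation ℝ (SF m) (SF m) :=
  Derivation.mk'
    { toFun := fun f => ⟨fun x => fderiv ℝ (f : Euc m → ℝ) x v,
        (f.cd.fderiv_right (m := ∞) (by simp)).clm_apply contDiff_const⟩
      map_add' := by
        intro f g; ext x
        change fderiv ℝ ((f : Euc m → ℝ) + (g : Euc m → ℝ)) x v = _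
        rw [fderiv_add (f.diff x) (g.diff x)]; rfl
      map_smul' := by
        intro c f; ext x
        change fderiv ℝ (c • (f : Euc m → ℝ)) x v = _
        rw [fderiv_const_smul (f.diff x)]; rfl }
    (by
      intro f g; ext x
      change fderiv ℝ ((f : Euc m → ℝ) * (g : Euc m → ℝ)) x v = _
      rw [fderiv_mul (f.diff x) (g.diff x)]
      simp; rfl)

theorem D_apply (v : Euc m) (f : SF m) (x : Euc m) : D v f x = fderiv ℝ (f : Euc m → ℝ) x v := rfl

theorem D_add (v w : Euc m) (f : SF m) : D (v + w) f = D v f + D w f := by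
  ext x; simp [D_apply]

theorem D_smul (c : ℝ) (v : Euc m) (f : SF m) : D (c • v) f = c • D v f := by
  ext x; simp [D_apply]

theorem D_sum {κ : Type*} (s : Finset κ) (v : κ → Euc m) (f : SF m) :
    D (∑ i ∈ s, v i) f = ∑ i ∈ s, D (v i) f := by
  ext x; simp [D_apply]

theorem D_zero (f : SF m) : D 0 f = 0 := by
  ext x; simp [D_apply]

theorem hasFDerivAt_D (f : SF m) (v x : Euc m) :
    HasFDerivAt (D v f : Euc m → ℝ) ((fderiv ℝ (fderiv ℝ (f : Euc m → ℝ)) x).flip v) x := by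
  have h1 : DifferentiableAt ℝ (fderiv ℝ (f : Euc m → ℝ)) x :=
    ((f.cd.fderiv_right (m := ∞) (by simp)).differentiable (by simp)) x
  have := h1.hasFDerivAt.clm_apply (hasFDerivAt_const v x)
  simp only [ContinuousLinearMap.comp_zero, zero_add] at this
  exact this

theorem D_D_apply (v w : Euc m) (f : SF m) (x : Euc m) :
    D v (D w f) x = fderiv ℝ (fderiv ℝ (f : Euc m → ℝ)) x v w := by
  rw [D_apply, (hasFDerivAt_D f w x).fderiv]; rfl

theorem D_comm (v w : Euc m) (f : SF m) : D v (D w f) = D w (D v f) := by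
  ext x
  rw [D_D_apply, D_D_apply]
  have : IsSymmSndFDerivAt ℝ (f : Euc m → ℝ) x :=
    f.cd.contDiffAt.isSymmSndFDerivAt (by simp; exact WithTop.coe_le_coe.2 le_top)
  exact this v w

/-- composition with a smooth real function -/
def SF.comp (g : ℝ → ℝ) (hg : ContDiff ℝ ∞ g) (f : SF m) : SF m :=
  ⟨fun x => g (f x), hg.comp f.cd⟩

/-- exponential -/
def SF.exp (f : SF m) : SF m := SF.comp Real.exp Real.contDiff_exp f

@[simp] theorem SF.exp_apply (f : SF m) (x : Euc m) : f.exp x = Real.exp (f x) := rfl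

theorem D_exp (v : Euc m) (f : SF m) : D v f.exp = f.exp * D v f := by
  ext x
  rw [D_apply]
  have := ((f.diff x).hasFDerivAt).exp
  change fderiv ℝ (fun x => Real.exp (f x)) x v = _
  rw [this.fderiv]; rfl

/-- inverse of a nowhere vanishing function -/
def SF.inv (f : SF m) (h : ∀ x, f x ≠ 0) : SF m := ⟨fun x => (f x)⁻¹, f.cd.inv h⟩

@[simp] theorem SF.inv_apply (f : SF m) (h : ∀ x, f x ≠ 0) (x : Euc m) : f.inv h x = (f x)⁻¹ := rfl

theorem SF.mul_inv (f : SF m) (h : ∀ x, f x ≠ 0) : f * f.inv h = 1 := by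
  ext x; simp [h x]

/-- basis vector -/
def e (i : Fin m) : Euc m := EuclideanSpace.single i 1

theorem eq_sum_e (v : Euc m) : v = ∑ i, v i • e i := by
  have := (EuclideanSpace.basisFun (Fin m) ℝ).sum_repr v
  simpa [e] using this.symm

theorem D_eq_sum (v : Euc m) (f : SF m) : D v f = ∑ i, v i • D (e i) f := by
  conv_lhs => rw [eq_sum_e v]
  rw [D_sum]; simp [D_smul]

/-- Hessian matrix in the frame `b` -/
def Hf (b : Fin m → Euc m) (u : SF m) : Matrix (Fin m) (Fin m) (SF m) :=
  fun i j => D (b i) (D (b j) u)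

theorem hess_eq (u : SF m) (x : Euc m) (i j : Fin m) :
    hessMatrix (u : Euc m → ℝ) x i j = Hf e u i j x := by
  simp [hessMatrix, iteratedFDeriv_two_apply, Hf, D_D_apply, e]

/-- restriction to a line -/
theorem hasDerivAt_line (f : SF m) (x v : Euc m) (t : ℝ) :
    HasDerivAt (fun t : ℝ => f (x + t • v)) (D v f (x + t • v)) t := by
  have h1 : HasDerivAt (fun t : ℝ => x + t • v) v t := by
    simpa using ((hasDerivAt_id t).smul_const v).const_add x
  exact ((f.diff (x + t • v)).hasFDerivAt.comp_hasDerivAt t h1)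

theorem snd_deriv_test {g g' : ℝ → ℝ} {g'' : ℝ} (h1 : ∀ t, HasDerivAt g (g' t) t)
    (h2 : HasDerivAt g' g'' 0) (hm : IsLocalMax g 0) : g' 0 = 0 ∧ g'' ≤ 0 := by
  have h0 : g' 0 = 0 := hm.hasDerivAt_eq_zero (h1 0)
  refine ⟨h0, ?_⟩
  by_contra hc
  push Not at hc
  have hd : deriv g = g' := funext fun t => (h1 t).deriv
  have hmin : IsLocalMin g 0 := by
    apply isLocalMin_of_deriv_deriv_pos
    · rw [hd, h2.deriv]; exact hc
    · rw [hd]; exact h0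
    · exact (h1 0).continuousAt
  have hconst : g =ᶠ[nhds 0] fun _ => g 0 := by
    filter_upwards [hm, hmin] with t ht1 ht2
    exact le_antisymm ht1 ht2
  have : g' =ᶠ[nhds 0] fun _ => 0 := by
    have := hconst.deriv
    rw [hd] at this
    simpa using this
  have h3 : HasDerivAt (fun _ : ℝ => (0:ℝ)) g'' 0 := h2.congr_of_eventuallyEq this.symm
  have := h3.unique (hasDerivAt_const 0 0)
  linarith

theorem localMax_test {f : SF m} {x : Euc m} (h : IsLocalMax (f : Euc m → ℝ) x) (v : Euc m) :
    D v f x = 0 ∧ D v (D v f) x ≤ 0 := by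
  have := snd_deriv_test (fun t => hasDerivAt_line f x v t)
    (g'' := D v (D v f) x) (by simpa using hasDerivAt_line (D v f) x v 0) (by
      have hc : Continuous (fun t : ℝ => x + t • v) := by fun_prop
      have ht : Filter.Tendsto (fun t : ℝ => x + t • v) (nhds 0) (nhds x) := by
        simpa using hc.tendsto 0
      have := ht.eventually h
      simpa [IsLocalMax, IsMaxFilter] using this)
  simpa using this

end CY
end

section
open scoped ContDiff
open scoped ContDiff
namespace CY
variable {m : ℕ}

theorem det_deriv_alg {R : Type*} [CommRing R] {n : Type*} [Fintype n] [DecidableEq n]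
    (A B : Matrix n n R) :
    ∑ s : Equiv.Perm n, Equiv.Perm.sign s • ∑ i, B (s i) i * ∏ j ∈ Finset.univ.erase i, A (s j) j
      = (A.adjugate * B).trace := by
  have h1 : (A.adjugate * B).trace = ∑ i, (A.updateCol i (fun k => B k i)).det := by
    simp only [Matrix.trace, Matrix.diag_apply]
    refine Finset.sum_congr rfl fun i _ => ?_
    rw [← Matrix.cramer_apply, Matrix.cramer_eq_adjugate_mulVec]
    rfl
  rw [h1]
  simp only [Matrix.det_apply]
  rw [Finset.sum_comm]
  refine Finset.sum_congr rfl fun s _ => ?_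
  rw [Finset.smul_sum]
  refine Finset.sum_congr rfl fun i _ => ?_
  rw [← Finset.mul_prod_erase _ _ (Finset.mem_univ i)]
  congr 1
  congr 1
  · simp
  · refine Finset.prod_congr rfl fun j hj => ?_
    rw [Matrix.updateCol_apply, if_neg (Finset.ne_of_mem_erase hj)]

theorem deriv_prod {R A : Type*} [CommRing R] [CommRing A] [Algebra R A] (d : Derivation R A A)
    {κ : Type*} [DecidableEq κ] (s : Finset κ) (f : κ → A) :
    d (∏ i ∈ s, f i) = ∑ i ∈ s, d (f i) * ∏ j ∈ s.erase i, f j := by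
  induction s using Finset.induction_on with
  | empty => simp
  | insert a s ha ih =>
    rw [Finset.prod_insert ha, d.leibniz, ih, Finset.sum_insert ha, Finset.erase_insert ha]
    simp only [smul_eq_mul]
    rw [add_comm, mul_comm (∏ i ∈ s, f i)]
    congr 1
    rw [Finset.mul_sum]
    refine Finset.sum_congr rfl fun i hi => ?_
    have hia : a ≠ i := fun h => ha (h ▸ hi)
    rw [Finset.erase_insert_of_ne hia, Finset.prod_insert (by simp [ha])]
    ring

/-- entrywise derivative of a matrix -/
def dM (v : Euc m) {p q : Type*} (A : Matrix p q (SF m)) : Matrix p q (SF m) := A.map (D v)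

theorem dM_apply (v : Euc m) {p q : Type*} (A : Matrix p q (SF m)) (i j) :
    dM v A i j = D v (A i j) := rfl

theorem D_det (v : Euc m) (A : Matrix (Fin m) (Fin m) (SF m)) :
    D v A.det = (A.adjugate * dM v A).trace := by
  rw [← det_deriv_alg, Matrix.det_apply, map_sum]
  refine Finset.sum_congr rfl fun s _ => ?_
  have : ∀ x : SF m, D v (Equiv.Perm.sign s • x) = Equiv.Perm.sign s • D v x := by
    intro x
    rcases Int.units_eq_one_or (Equiv.Perm.sign s) with h | h <;> simp [h]
  rw [this, deriv_prod]
  rfl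

theorem dM_mul (v : Euc m) {p q r : Type*} [Fintype q] (A : Matrix p q (SF m))
    (B : Matrix q r (SF m)) : dM v (A * B) = dM v A * B + A * dM v B := by
  ext1 i j
  simp only [dM_apply, Matrix.mul_apply, Matrix.add_apply, map_sum, Derivation.leibniz,
    smul_eq_mul, ← Finset.sum_add_distrib]
  refine Finset.sum_congr rfl fun k _ => ?_
  ring

theorem dM_add (v : Euc m) {p q : Type*} (A B : Matrix p q (SF m)) :
    dM v (A + B) = dM v A + dM v B := by ext1 i j; simp [dM_apply]

theorem dM_sub (v : Euc m) {p q : Type*} (A B : Matrix p q (SF m)) :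
    dM v (A - B) = dM v A - dM v B := by ext1 i j; simp [dM_apply]

theorem dM_neg (v : Euc m) {p q : Type*} (A : Matrix p q (SF m)) :
    dM v (-A) = - dM v A := by ext1 i j; simp [dM_apply]

theorem dM_one (v : Euc m) : dM v (1 : Matrix (Fin m) (Fin m) (SF m)) = 0 := by
  ext1 i j
  rw [dM_apply, Matrix.one_apply]
  split_ifs <;> simp

theorem dM_comm (v w : Euc m) {p q : Type*} (A : Matrix p q (SF m)) :
    dM v (dM w A) = dM w (dM v A) := by
  ext1 i j; simp only [dM_apply]; exact D_comm _ _ _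

theorem dM_transpose (v : Euc m) {p q : Type*} (A : Matrix p q (SF m)) :
    dM v A.transpose = (dM v A).transpose := rfl

theorem D_trace (v : Euc m) (A : Matrix (Fin m) (Fin m) (SF m)) :
    D v A.trace = (dM v A).trace := by
  simp [Matrix.trace, dM_apply]

/-- constant matrices -/
def cM {p q : Type*} (A : Matrix p q ℝ) : Matrix p q (SF m) := A.map (algebraMap ℝ (SF m))

theorem cM_mul {p q r : Type*} [Fintype q] (A : Matrix p q ℝ) (B : Matrix q r ℝ) :
    cM (A * B) = (cM A : Matrix p q (SF m)) * (cM B : Matrix q r (SF m)) := by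
  rw [cM, Matrix.map_mul]; rfl

theorem cM_one : (cM (1 : Matrix (Fin m) (Fin m) ℝ) : Matrix (Fin m) (Fin m) (SF m)) = 1 := by
  simp [cM, Matrix.map_one]

theorem dM_cM (v : Euc m) {p q : Type*} (A : Matrix p q ℝ) :
    dM v (cM A : Matrix p q (SF m)) = 0 := by
  ext1 i j; simp [dM_apply, cM]

theorem cM_transpose {p q : Type*} (A : Matrix p q ℝ) :
    (cM A.transpose : Matrix q p (SF m)) = (cM A).transpose := rfl

/-- evaluate a matrix of functions -/
def eM (x : Euc m) {p q : Type*} (A : Matrix p q (SF m)) : Matrix p q ℝ := A.map (ev x)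

theorem eM_apply (x : Euc m) {p q : Type*} (A : Matrix p q (SF m)) (i j) :
    eM x A i j = A i j x := rfl

theorem eM_mul (x : Euc m) {p q r : Type*} [Fintype q] (A : Matrix p q (SF m))
    (B : Matrix q r (SF m)) : eM x (A * B) = eM x A * eM x B := by
  simp [eM, Matrix.map_mul]
theorem eM_add (x : Euc m) {p q : Type*} (A B : Matrix p q (SF m)) :
    eM x (A + B) = eM x A + eM x B := by ext i j; simp [eM_apply]
theorem eM_sub (x : Euc m) {p q : Type*} (A B : Matrix p q (SF m)) :
    eM x (A - B) = eM x A - eM x B := by ext i j; simp [eM_apply]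
theorem eM_neg (x : Euc m) {p q : Type*} (A : Matrix p q (SF m)) :
    eM x (-A) = - eM x A := by ext i j; simp [eM_apply]
theorem eM_one (x : Euc m) : eM x (1 : Matrix (Fin m) (Fin m) (SF m)) = 1 := by
  simp [eM, Matrix.map_one]
theorem eM_cM (x : Euc m) {p q : Type*} (A : Matrix p q ℝ) : eM x (cM A) = A := by
  ext i j; simp [eM_apply, cM]
theorem eM_trace (x : Euc m) (A : Matrix (Fin m) (Fin m) (SF m)) :
    A.trace x = (eM x A).trace := by simp [Matrix.trace, eM_apply]
theorem eM_transpose (x : Euc m) {p q : Type*} (A : Matrix p q (SF m)) :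
    eM x A.transpose = (eM x A).transpose := rfl
theorem eM_det (x : Euc m) (A : Matrix (Fin m) (Fin m) (SF m)) :
    A.det x = (eM x A).det := by
  rw [← ev_apply, AlgHom.map_det]; rfl


open scoped MatrixOrder in
theorem psd_factor {n : Type*} [Fintype n] [DecidableEq n] {A : Matrix n n ℝ}
    (hA : A.PosSemidef) : ∃ B : Matrix n n ℝ, A = B.transpose * B := by
  obtain ⟨B, hB⟩ := CStarAlgebra.nonneg_iff_eq_star_mul_self.mp hA.nonneg
  exact ⟨B, by rw [hB, Matrix.star_eq_conjTranspose, Matrix.conjTranspose_eq_transpose_of_trivial]⟩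

theorem psd_of {n : Type*} [Fintype n] {A : Matrix n n ℝ} (hs : A.transpose = A)
    (h : ∀ x : n → ℝ, 0 ≤ x ⬝ᵥ A.mulVec x) : A.PosSemidef := by
  refine Matrix.PosSemidef.of_dotProduct_mulVec_nonneg ?_ ?_
  · rw [Matrix.IsHermitian, Matrix.conjTranspose_eq_transpose_of_trivial, hs]
  · intro x; simpa using h x

theorem posDef_of {n : Type*} [Fintype n] {A : Matrix n n ℝ} (hs : A.transpose = A)
    (h : ∀ x : n → ℝ, x ≠ 0 → 0 < x ⬝ᵥ A.mulVec x) : A.PosDef := by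
  refine Matrix.PosDef.of_dotProduct_mulVec_pos ?_ ?_
  · rw [Matrix.IsHermitian, Matrix.conjTranspose_eq_transpose_of_trivial, hs]
  · intro x hx; simpa using h x hx

theorem PosDef.symm {n : Type*} {A : Matrix n n ℝ} (h : A.PosDef) : A.transpose = A := by
  have := h.isHermitian
  rwa [Matrix.IsHermitian, Matrix.conjTranspose_eq_transpose_of_trivial] at this

theorem PosDef.pos {n : Type*} [Fintype n] {A : Matrix n n ℝ} (h : A.PosDef) {x : n → ℝ}
    (hx : x ≠ 0) : 0 < x ⬝ᵥ A.mulVec x := by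
  simpa using h.dotProduct_mulVec_pos hx

/-- frames -/
theorem exists_frame {n : Type*} [Fintype n] [DecidableEq n] {A : Matrix n n ℝ} (hA : A.PosDef) :
    ∃ F F' : Matrix n n ℝ, F * F' = 1 ∧ F' * F = 1 ∧ F.transpose * A * F = 1 ∧
      A = F'.transpose * F' ∧ A⁻¹ = F * F.transpose := by
  obtain ⟨B, hB⟩ := psd_factor hA.posSemidef
  have hd : IsUnit B.det := by
    have h1 := hA.det_pos
    rw [hB, Matrix.det_mul] at h1
    exact isUnit_iff_ne_zero.2 (fun h => by simp [h] at h1)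
  have h1 := Matrix.mul_nonsing_inv B hd
  have h2 := Matrix.nonsing_inv_mul B hd
  refine ⟨B⁻¹, B, h2, h1, ?_, hB, ?_⟩
  · have h3 : (B⁻¹).transpose * B.transpose = 1 := by
      rw [← Matrix.transpose_mul, h1, Matrix.transpose_one]
    calc (B⁻¹).transpose * A * B⁻¹ = ((B⁻¹).transpose * B.transpose) * (B * B⁻¹) := by
          rw [hB]; simp only [Matrix.mul_assoc]
      _ = 1 := by rw [h3, h1, Matrix.one_mul]
  · rw [hB, Matrix.mul_inv_rev, Matrix.transpose_nonsing_inv]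

theorem one_le_det {n : Type*} [Fintype n] [DecidableEq n] {B : Matrix n n ℝ}
    (hBs : B.transpose = B) (h : ∀ x : n → ℝ, x ⬝ᵥ x ≤ x ⬝ᵥ B.mulVec x) : 1 ≤ B.det := by
  have hH : B.IsHermitian := by
    rw [Matrix.IsHermitian, Matrix.conjTranspose_eq_transpose_of_trivial, hBs]
  rw [hH.det_eq_prod_eigenvalues]
  have : ∀ i, 1 ≤ hH.eigenvalues i := by
    intro i
    rw [hH.eigenvalues_eq]
    have h1 := h (hH.eigenvectorBasis i)
    have h2 : (hH.eigenvectorBasis i).ofLp ⬝ᵥ (hH.eigenvectorBasis i).ofLp = 1 := by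
      have h3 := hH.eigenvectorBasis.orthonormal.1 i
      have h4 : inner ℝ (hH.eigenvectorBasis i) (hH.eigenvectorBasis i) = (1:ℝ) := by
        rw [real_inner_self_eq_norm_sq, h3]; norm_num
      rw [EuclideanSpace.inner_eq_star_dotProduct, star_trivial] at h4
      exact h4
    rw [h2] at h1
    simpa using h1
  simpa using Finset.one_le_prod (s := Finset.univ) (fun i _ => this i)

theorem det_mono {n : Type*} [Fintype n] [DecidableEq n] {A B : Matrix n n ℝ} (hA : A.PosDef)
    (hBs : B.transpose = B) (h : ∀ x : n → ℝ, x ⬝ᵥ A.mulVec x ≤ x ⬝ᵥ B.mulVec x) :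
    A.det ≤ B.det := by
  obtain ⟨F, F', h1, h2, h3, h4, h5⟩ := exists_frame hA
  have hq : ∀ (C : Matrix n n ℝ) (x : n → ℝ),
      x ⬝ᵥ (F.transpose * C * F).mulVec x = (F.mulVec x) ⬝ᵥ C.mulVec (F.mulVec x) := by
    intro C x
    rw [Matrix.mul_assoc, ← Matrix.mulVec_mulVec, Matrix.dotProduct_mulVec,
      Matrix.vecMul_transpose, Matrix.mulVec_mulVec]
  have key : 1 ≤ (F.transpose * B * F).det := by
    apply one_le_det
    · simp [Matrix.transpose_mul, hBs, Matrix.mul_assoc]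
    · intro x
      have := hq A x
      rw [h3, Matrix.one_mulVec] at this
      rw [hq, this]
      exact h _
  have hdA : F.det ^ 2 * A.det = 1 := by
    have := congrArg Matrix.det h3
    simp only [Matrix.det_mul, Matrix.det_transpose, Matrix.det_one] at this
    linarith
  have hdB : 1 ≤ F.det ^ 2 * B.det := by
    simp only [Matrix.det_mul, Matrix.det_transpose] at key
    linarith
  have hpos : 0 < F.det ^ 2 := by
    by_contra hc
    have : F.det ^ 2 = 0 := le_antisymm (not_lt.1 hc) (sq_nonneg _)
    simp [this] at hdA
  have : F.det ^ 2 * A.det ≤ F.det ^ 2 * B.det := by linarith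
  exact le_of_mul_le_mul_left this hpos

end CY
end

section
open scoped ContDiff
open scoped ContDiff
namespace CY
variable {m : ℕ}

/-- a global solution of the Monge-Ampere equation -/
structure Sol (m : ℕ) where
  u : SF m
  h : SF m
  pos : ∀ x, (eM x (Hf e u)).PosDef
  pde : ∀ x, (eM x (Hf e u)).det = Real.exp (2 * u x - h x)

/-- abstract pair of a matrix and its inverse satisfying the once differentiated equation -/
structure GN (m : ℕ) where
  G : Matrix (Fin m) (Fin m) (SF m)
  N : Matrix (Fin m) (Fin m) (SF m)
  ψ : SF m
  NG : N * G = 1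
  hGN : G * N = 1
  symG : G.transpose = G
  symN : N.transpose = N
  tr : ∀ v, (N * dM v G).trace = D v ψ

theorem Hf_symm (b : Fin m → Euc m) (u : SF m) : (Hf b u).transpose = Hf b u := by
  ext1 i j; exact D_comm _ _ _

/-- the right hand side exponent -/
def Sol.ψ (s : Sol m) : SF m := (2:ℝ) • s.u - s.h

theorem Sol.det_eq (s : Sol m) : (Hf e s.u).det = (s.ψ).exp := by
  ext x
  rw [eM_det, s.pde]; rfl

theorem SF.exp_neg_mul (f : SF m) : (-f).exp * f.exp = 1 := by
  ext x; simp [← Real.exp_add]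

/-- standard coordinates data -/
def Sol.gn (s : Sol m) : GN m where
  G := Hf e s.u
  N := (-s.ψ).exp • (Hf e s.u).adjugate
  ψ := s.ψ
  NG := by
    rw [Matrix.smul_mul, Matrix.adjugate_mul, s.det_eq, smul_smul, SF.exp_neg_mul, one_smul]
  hGN := by
    rw [Matrix.mul_smul, Matrix.mul_adjugate, s.det_eq, smul_smul, SF.exp_neg_mul, one_smul]
  symG := Hf_symm _ _
  symN := by
    rw [Matrix.transpose_smul, Matrix.adjugate_transpose, Hf_symm]
  tr := by
    intro v
    rw [Matrix.smul_mul, Matrix.trace_smul, ← D_det, s.det_eq, D_exp, smul_eq_mul, ← mul_assoc,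
      SF.exp_neg_mul, one_mul]

/-- frame vectors -/
def fr (F : Matrix (Fin m) (Fin m) ℝ) (a : Fin m) : Euc m := ∑ i, F i a • e i

theorem Hf_fr (F : Matrix (Fin m) (Fin m) ℝ) (u : SF m) :
    Hf (fr F) u = (cM F).transpose * Hf e u * cM F := by
  ext1 a b
  simp only [Hf, fr, D_sum, D_smul, map_sum, Matrix.mul_apply, Matrix.transpose_apply, cM,
    Matrix.map_apply, Derivation.map_smul, Finset.sum_mul]
  refine Finset.sum_congr rfl fun i _ => ?_
  rw [Finset.smul_sum]
  refine Finset.sum_congr rfl fun j _ => ?_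
  ext x; simp; ring

theorem dM_fr (F : Matrix (Fin m) (Fin m) ℝ) {p q : Type*} (A : Matrix p q (SF m)) (a : Fin m) :
    dM (fr F a) A = ∑ i, F i a • dM (e i) A := by
  ext1 i j
  simp only [dM_apply, fr, D_sum, D_smul, Matrix.sum_apply, Matrix.smul_apply]

theorem trace_cyc3 {R : Type*} [CommRing R] (F F' A B : Matrix (Fin m) (Fin m) R)
    (h : F * F' = 1) :
    ((F' * A * F'.transpose) * (F.transpose * B * F)).trace = (A * B).trace := by
  have h2 : F'.transpose * F.transpose = 1 := by
    rw [← Matrix.transpose_mul, h, Matrix.transpose_one]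
  calc ((F' * A * F'.transpose) * (F.transpose * B * F)).trace
      = (F' * (A * (F'.transpose * F.transpose) * B * F)).trace := by
        simp only [Matrix.mul_assoc]
    _ = (A * B * (F * F')).trace := by
        rw [h2, Matrix.mul_one, Matrix.trace_mul_comm]; simp only [Matrix.mul_assoc]
    _ = _ := by rw [h, Matrix.mul_one]

theorem cMF {F F' : Matrix (Fin m) (Fin m) ℝ} (h : F * F' = 1) :
    (cM F : Matrix (Fin m) (Fin m) (SF m)) * (cM F' : Matrix (Fin m) (Fin m) (SF m)) = 1 := by
  rw [← cM_one, ← h, cM_mul]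

theorem cMFt {F F' : Matrix (Fin m) (Fin m) ℝ} (h : F * F' = 1) :
    (cM F' : Matrix _ _ (SF m)).transpose * (cM F).transpose = 1 := by
  rw [← Matrix.transpose_mul, cMF h, Matrix.transpose_one]

theorem dM_conj (v : Euc m) (F : Matrix (Fin m) (Fin m) ℝ) (A : Matrix (Fin m) (Fin m) (SF m)) :
    dM v ((cM F).transpose * A * cM F) = (cM F).transpose * dM v A * cM F := by
  rw [dM_mul, dM_mul, ← cM_transpose, dM_cM, dM_cM]; simp

/-- change of frame -/
def GN.fr (g : GN m) (F F' : Matrix (Fin m) (Fin m) ℝ) (h : F * F' = 1) (h' : F' * F = 1) :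
    GN m where
  G := (cM F).transpose * g.G * cM F
  N := cM F' * g.N * (cM F').transpose
  ψ := g.ψ
  NG := by
    calc cM F' * g.N * (cM F').transpose * ((cM F).transpose * g.G * cM F)
      = cM F' * (g.N * ((cM F').transpose * (cM F).transpose) * g.G) * cM F := by
          simp only [Matrix.mul_assoc]
      _ = 1 := by rw [cMFt h, Matrix.mul_one, g.NG, Matrix.mul_one, cMF h']
  hGN := by
    calc ((cM F).transpose * g.G * cM F) * (cM F' * g.N * (cM F').transpose)
      = (cM F).transpose * (g.G * (cM F * cM F') * g.N) * (cM F').transpose := by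
          simp only [Matrix.mul_assoc]
      _ = 1 := by rw [cMF h, Matrix.mul_one, g.hGN, Matrix.mul_one, cMFt h']
  symG := by simp [Matrix.transpose_mul, g.symG, Matrix.mul_assoc]
  symN := by simp [Matrix.transpose_mul, g.symN, Matrix.mul_assoc]
  tr := by
    intro v
    rw [dM_conj, trace_cyc3 _ _ _ _ (cMF h), g.tr]

theorem GN.dN (g : GN m) (v : Euc m) : dM v g.N = -(g.N * dM v g.G * g.N) := by
  have h1 : dM v (g.N * g.G) = 0 := by rw [g.NG, dM_one]
  rw [dM_mul] at h1
  have h2 : dM v g.N * g.G = -(g.N * dM v g.G) := eq_neg_of_add_eq_zero_left h1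
  calc dM v g.N = dM v g.N * (g.G * g.N) := by rw [g.hGN, Matrix.mul_one]
    _ = -(g.N * dM v g.G) * g.N := by rw [← Matrix.mul_assoc, h2]
    _ = _ := by rw [Matrix.neg_mul]

theorem GN.tr2 (g : GN m) (v w : Euc m) : (g.N * dM w (dM v g.G)).trace =
    D w (D v g.ψ) + (g.N * dM w g.G * (g.N * dM v g.G)).trace := by
  rw [← g.tr v, D_trace, dM_mul, g.dN, Matrix.trace_add, Matrix.neg_mul, Matrix.trace_neg]
  simp only [Matrix.mul_assoc]; ring

theorem GN.tr3 (g : GN m) (v w z : Euc m) : (g.N * dM z (dM w (dM v g.G))).trace =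
    D z (D w (D v g.ψ)) + (g.N * dM z g.G * (g.N * dM w (dM v g.G))).trace
    + (g.N * dM z (dM w g.G) * (g.N * dM v g.G)).trace
    + (g.N * dM w g.G * (g.N * dM z (dM v g.G))).trace
    - (g.N * dM z g.G * (g.N * dM w g.G * (g.N * dM v g.G))).trace
    - (g.N * dM w g.G * (g.N * dM z g.G * (g.N * dM v g.G))).trace := by
  have h := congrArg (D z) (g.tr2 v w)
  rw [map_add, D_trace, D_trace, dM_mul, dM_mul, dM_mul, dM_mul, g.dN] at h
  simp only [Matrix.trace_add, Matrix.neg_mul, Matrix.mul_neg, Matrix.trace_neg, Matrix.add_mul,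
    Matrix.mul_add, Matrix.mul_assoc] at h ⊢
  linear_combination h

/-- linearized operator -/
def Sol.L (s : Sol m) (φ : SF m) : SF m := (s.gn.N * Hf e φ).trace

/-- a frame at a point -/
structure Frame (s : Sol m) (x : Euc m) where
  F : Matrix (Fin m) (Fin m) ℝ
  F' : Matrix (Fin m) (Fin m) ℝ
  h : F * F' = 1
  h' : F' * F = 1
  hG : F.transpose * eM x (Hf e s.u) * F = 1
  hH : eM x (Hf e s.u) = F'.transpose * F'
  hN : eM x s.gn.N = F * F.transpose

theorem Sol.exists_frame (s : Sol m) (x : Euc m) : Nonempty (Frame s x) := by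
  obtain ⟨F, F', h1, h2, h3, h4, h5⟩ := CY.exists_frame (s.pos x)
  refine ⟨⟨F, F', h1, h2, h3, h4, ?_⟩⟩
  rw [← h5]
  symm
  apply Matrix.inv_eq_left_inv
  have := congrArg (eM x) s.gn.NG
  rwa [eM_mul, eM_one] at this

variable {s : Sol m} {x : Euc m}

/-- data in the frame -/
def Frame.g (f : Frame s x) : GN m := s.gn.fr f.F f.F' f.h f.h'

/-- vectors -/
def Frame.b (f : Frame s x) (a : Fin m) : Euc m := fr f.F a

theorem Frame.G_eq (f : Frame s x) : f.g.G = Hf f.b s.u := (Hf_fr f.F s.u).symm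

theorem Frame.eG (f : Frame s x) : eM x f.g.G = 1 := by
  change eM x ((cM f.F).transpose * Hf e s.u * cM f.F) = 1
  rw [eM_mul, eM_mul, eM_transpose, eM_cM, f.hG]

theorem Frame.eN (f : Frame s x) : eM x f.g.N = 1 := by
  have := congrArg (eM x) f.g.NG
  rw [eM_mul, f.eG, eM_one, Matrix.mul_one] at this
  exact this

theorem Frame.L_eq (f : Frame s x) (φ : SF m) : s.L φ = (f.g.N * Hf f.b φ).trace := by
  have : Hf f.b φ = (cM f.F).transpose * Hf e φ * cM f.F := Hf_fr f.F φ
  rw [this]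
  exact (trace_cyc3 _ _ _ _ (cMF f.h)).symm

theorem Frame.L_apply (f : Frame s x) (φ : SF m) : s.L φ x = ∑ a, D (f.b a) (D (f.b a) φ) x := by
  rw [f.L_eq, eM_trace, eM_mul, f.eN, Matrix.one_mul]; rfl

theorem Frame.ψ_eq (f : Frame s x) : f.g.ψ = s.ψ := rfl

/-- at the point: differentiated equations in the frame -/
theorem Frame.tr1 (f : Frame s x) (v : Euc m) :
    ∑ a, D v (D (f.b a) (D (f.b a) s.u)) x = D v s.ψ x := by
  have := congrArg (fun φ : SF m => φ x) (f.g.tr v)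
  simp only [eM_trace, eM_mul, f.eN, Matrix.one_mul] at this
  rw [← f.ψ_eq, ← this, f.G_eq]; rfl

theorem Frame.tr2 (f : Frame s x) (v w : Euc m) :
    ∑ a, D w (D v (D (f.b a) (D (f.b a) s.u))) x = D w (D v s.ψ) x +
      ∑ a, ∑ c, D w (D (f.b a) (D (f.b c) s.u)) x * D v (D (f.b c) (D (f.b a) s.u)) x := by
  have := congrArg (fun φ : SF m => φ x) (f.g.tr2 v w)
  simp only [SF.add_apply, eM_trace, eM_mul, f.eN, Matrix.one_mul] at this
  rw [f.G_eq, f.ψ_eq] at this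
  exact this

theorem Frame.uab (f : Frame s x) (a c : Fin m) :
    D (f.b a) (D (f.b c) s.u) x = if a = c then 1 else 0 := by
  have := congrFun (congrFun f.eG a) c
  rw [f.G_eq, Matrix.one_apply] at this
  exact this

end CY
end

section
open scoped ContDiff
open scoped ContDiff
namespace CY
variable {m : ℕ}

theorem max_lemma {E : Set (Euc m)} (hE : IsCompact E) (w f : SF m)
    (hw : ∀ x ∈ frontier E, w x ≤ 0) (hf0 : ∀ x ∈ E, w x = 0 → f x ≤ 0)
    {y : Euc m} (hy : y ∈ E) (hwy : 0 ≤ w y) (hfy : 0 < f y) :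
    ∃ x ∈ E, 0 < w x ∧ f y ≤ f x ∧ IsLocalMax (f : Euc m → ℝ) x := by
  have hcl : IsClosed {x | 0 ≤ w x} := isClosed_le continuous_const w.cont
  have hS : IsCompact (E ∩ {x | 0 ≤ w x}) := hE.inter_right hcl
  obtain ⟨x, ⟨hxE, hxw⟩, hmax⟩ := hS.exists_isMaxOn ⟨y, hy, hwy⟩ f.cont.continuousOn
  have hyx : f y ≤ f x := hmax ⟨hy, hwy⟩
  have hwx : 0 < w x := by
    rcases lt_or_eq_of_le (show 0 ≤ w x from hxw) with h | h
    · exact h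
    · have := hf0 x hxE h.symm; linarith
  refine ⟨x, hxE, hwx, hyx, ?_⟩
  have hxin : x ∈ interior E := by
    by_contra hc
    have : x ∈ frontier E := ⟨subset_closure hxE, hc⟩
    have := hw x this
    linarith
  have hop : IsOpen {x | 0 < w x} := isOpen_lt continuous_const w.cont
  filter_upwards [isOpen_interior.mem_nhds hxin, hop.mem_nhds hwx] with z hz1 hz2
  exact hmax ⟨interior_subset hz1, le_of_lt hz2⟩

theorem sym_ineq {n : Type*} [Fintype n] (T : n → n → ℝ) (hT : ∀ a b, T a b = T b a)
    (c t : n → ℝ) (ht : ∀ a, t a = ∑ b, c b * T a b) {v : ℝ} (hv : v = ∑ a, c a ^ 2)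
    (hv0 : 0 < v) :
    2 * (∑ a, t a ^ 2) / v - (∑ a, c a * t a) ^ 2 / v ^ 2 ≤ ∑ a, ∑ b, T a b ^ 2 := by
  set κ := ∑ a, c a * t a with hκ
  set τ := ∑ a, t a ^ 2 with hτ
  have h0 : 0 ≤ ∑ a, ∑ b, (T a b - t a * c b / v - c a * t b / v + κ * c a * c b / v ^ 2) ^ 2 :=
    Finset.sum_nonneg fun a _ => Finset.sum_nonneg fun b _ => sq_nonneg _
  have hrow : ∀ a, ∑ b, (T a b - t a * c b / v - c a * t b / v + κ * c a * c b / v ^ 2) ^ 2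
      = ∑ b, T a b ^ 2 + (t a / v) ^ 2 * v + (c a / v) ^ 2 * τ + (κ * c a / v ^ 2) ^ 2 * v
        - 2 * (t a / v) * t a - 2 * (c a / v) * ∑ b, t b * T a b + 2 * (κ * c a / v ^ 2) * t a
        + 2 * (t a / v) * (c a / v) * κ - 2 * (t a / v) * (κ * c a / v ^ 2) * v
        - 2 * (c a / v) * (κ * c a / v ^ 2) * κ := by
    intro a
    have e1 : ∀ b, (T a b - t a * c b / v - c a * t b / v + κ * c a * c b / v ^ 2) ^ 2
      = T a b ^ 2 + (t a / v) ^ 2 * c b ^ 2 + (c a / v) ^ 2 * t b ^ 2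
        + (κ * c a / v ^ 2) ^ 2 * c b ^ 2
        - 2 * (t a / v) * (c b * T a b) - 2 * (c a / v) * (t b * T a b)
        + 2 * (κ * c a / v ^ 2) * (c b * T a b)
        + 2 * (t a / v) * (c a / v) * (c b * t b) - 2 * (t a / v) * (κ * c a / v ^ 2) * c b ^ 2
        - 2 * (c a / v) * (κ * c a / v ^ 2) * (c b * t b) := by
      intro b; ring
    simp only [e1, Finset.sum_add_distrib, Finset.sum_sub_distrib, ← Finset.mul_sum]
    rw [← hv, ← hτ, ← hκ, ← ht a]
  have hct : ∑ a, c a * ∑ b, t b * T a b = τ := by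
    simp only [Finset.mul_sum]
    rw [Finset.sum_comm, hτ]
    refine Finset.sum_congr rfl fun b _ => ?_
    rw [sq]
    conv_rhs => rw [ht b, Finset.mul_sum]
    refine Finset.sum_congr rfl fun a _ => ?_
    rw [hT b a, ← ht b]; ring
  have e2 : ∑ a, ∑ b, (T a b - t a * c b / v - c a * t b / v + κ * c a * c b / v ^ 2) ^ 2
      = ∑ a, ∑ b, T a b ^ 2 - 2 * τ / v + κ ^ 2 / v ^ 2 := by
    have e3 : ∀ a, ∑ b, (T a b - t a * c b / v - c a * t b / v + κ * c a * c b / v ^ 2) ^ 2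
      = ∑ b, T a b ^ 2 - (1 / v) * t a ^ 2 + (τ / v ^ 2 + κ ^ 2 / v ^ 3 - 2 * κ ^ 2 / v ^ 3) * c a ^ 2
        + (2 * κ / v ^ 2) * (c a * t a)
        - (2 / v) * (c a * ∑ b, t b * T a b) := by
      intro a
      rw [hrow a]
      field_simp
      ring
    simp only [e3, Finset.sum_add_distrib, Finset.sum_sub_distrib, ← Finset.mul_sum]
    rw [← hv, ← hτ, ← hκ, hct]
    field_simp
    ring
  rw [e2] at h0
  linarith

theorem pog_alg {n : Type*} [Fintype n] (T : n → n → ℝ) (hT : ∀ a b, T a b = T b a)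
    (c va wa waa vaa caa : n → ℝ) (v w ue M P R : ℝ) (hv : v = ∑ a, c a ^ 2) (hv0 : 0 < v)
    (hw : 0 < w) (hva : ∀ a, va a = ∑ b, c b * T a b)
    (h1 : ∀ a, wa a * v + w * va a + w * v * (ue * c a) = 0)
    (h2 : ∀ a, waa a * v + w * vaa a + w * v * (caa a + (ue * c a) ^ 2) + 2 * wa a * va a
      + 2 * wa a * v * (ue * c a) + 2 * w * va a * (ue * c a) ≤ 0)
    (hM : ∑ a, waa a = -M) (hP : ∑ a, vaa a = P + ∑ a, ∑ b, T a b ^ 2)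
    (hR : ∑ a, caa a = v + R) :
    (w * v) ^ 2 ≤ M * (w * v) - P * w ^ 2 + (∑ a, c a * wa a) ^ 2 - w * (w * v) * R := by
  have hs := sym_ineq T hT c va hva hv hv0
  set S := ∑ a, ∑ b, T a b ^ 2 with hS
  set κ := ∑ a, c a * va a with hκ
  set τ := ∑ a, va a ^ 2 with hτ
  set α := ∑ a, c a * wa a with hα
  set A := ∑ a, wa a ^ 2 with hA
  -- first order
  have hwa : ∀ a, wa a = - (w / v) * va a - w * ue * c a := by
    intro a
    have := h1 a
    field_simp
    linear_combination this
  have h3 : ∀ a, (v / w) * waa a + vaa a + v * caa a - (v / w ^ 2) * wa a ^ 2 - (1 / v) * va a ^ 2 ≤ 0 := by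
    intro a
    have h2a := h2 a
    have e1 : waa a * v + w * vaa a + w * v * (caa a + (ue * c a) ^ 2) + 2 * wa a * va a
      + 2 * wa a * v * (ue * c a) + 2 * w * va a * (ue * c a) = w * ((v / w) * waa a + vaa a + v * caa a - (v / w ^ 2) * wa a ^ 2 - (1 / v) * va a ^ 2) := by
      rw [hwa a]
      field_simp
      ring
    rw [e1] at h2a
    exact nonpos_of_mul_nonpos_right h2a hw
  have h4 : ∑ a, ((v / w) * waa a + vaa a + v * caa a - (v / w ^ 2) * wa a ^ 2 - (1 / v) * va a ^ 2) ≤ 0 :=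
    Finset.sum_nonpos fun a _ => h3 a
  simp only [Finset.sum_add_distrib, Finset.sum_sub_distrib, ← Finset.mul_sum] at h4
  rw [hM, hP, hR, ← hA, ← hτ] at h4
  have hαe : α = - (w / v) * κ - w * ue * v := by
    rw [hα, hκ, hv, Finset.mul_sum, Finset.mul_sum, ← Finset.sum_sub_distrib, ← hv]
    refine Finset.sum_congr rfl fun a _ => ?_
    rw [hwa a]; ring
  have hAe : A = (w / v) ^ 2 * τ + 2 * (w / v) * w * ue * κ + w ^ 2 * ue ^ 2 * v := by
    rw [hA, hκ, hτ, hv, Finset.mul_sum, Finset.mul_sum, Finset.mul_sum, ← Finset.sum_add_distrib,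
      ← Finset.sum_add_distrib, ← hv]
    refine Finset.sum_congr rfl fun a _ => ?_
    rw [hwa a]; ring
  have h5 : (v / w) * (-M) + P + v * (v + R) - α ^ 2 / w ^ 2 ≤ 0 := by
    have : (v / w ^ 2) * A + (1 / v) * τ - (2 * τ / v - κ ^ 2 / v ^ 2) = α ^ 2 / w ^ 2 := by
      rw [hAe, hαe]
      field_simp
      ring
    linarith
  have h6 : ((v / w) * (-M) + P + v * (v + R) - α ^ 2 / w ^ 2) * w ^ 2 ≤ 0 :=
    mul_nonpos_of_nonpos_of_nonneg h5 (by positivity)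
  have h7 : ((v / w) * (-M) + P + v * (v + R) - α ^ 2 / w ^ 2) * w ^ 2 =
    (w * v) ^ 2 - M * (w * v) + P * w ^ 2 - α ^ 2 + w * (w * v) * R := by
    field_simp
    ring
  linarith

theorem Frame.e_eq {s : Sol m} {x : Euc m} (f : Frame s x) (i : Fin m) :
    e i = ∑ a, f.F' a i • f.b a := by
  simp only [Frame.b, fr, Finset.smul_sum, smul_smul]
  rw [Finset.sum_comm]
  simp only [← Finset.sum_smul]
  have : ∀ j, ∑ a, f.F' a i * f.F j a = if j = i then 1 else 0 := by
    intro j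
    have := congrFun (congrFun f.h j) i
    rw [Matrix.mul_apply, Matrix.one_apply] at this
    rw [← this]
    exact Finset.sum_congr rfl fun a _ => mul_comm _ _
  simp [this]

theorem Frame.De {s : Sol m} {x : Euc m} (f : Frame s x) (i : Fin m) (φ : SF m) :
    D (e i) φ x = ∑ a, f.F' a i * D (f.b a) φ x := by
  rw [f.e_eq i, D_sum]; simp [D_smul]

theorem Frame.u_ea {s : Sol m} {x : Euc m} (f : Frame s x) (i a : Fin m) :
    D (f.b a) (D (e i) s.u) x = f.F' a i := by
  rw [D_comm, f.De]
  simp [f.uab]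

theorem Frame.u_ee {s : Sol m} {x : Euc m} (f : Frame s x) (i : Fin m) :
    D (e i) (D (e i) s.u) x = ∑ a, f.F' a i ^ 2 := by
  rw [f.De]
  simp [f.u_ea, sq]

theorem Sol.uee_pos (s : Sol m) (i : Fin m) (x : Euc m) : 0 < D (e i) (D (e i) s.u) x :=
  (s.pos x).diag_pos (i := i)

theorem pog_point (s : Sol m) (w : SF m) (x : Euc m) (i : Fin m)
    (hw : ∀ v v', D v (D v' w) = - D v (D v' s.u)) (hwx : 0 < w x)
    (hmax : IsLocalMax ((w * D (e i) (D (e i) s.u) *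
      SF.exp ((1/2 : ℝ) • (D (e i) s.u * D (e i) s.u)) : SF m) : Euc m → ℝ) x) :
    (w x * D (e i) (D (e i) s.u) x) ^ 2 ≤
      (m + w x * |D (e i) s.u x * D (e i) s.h x|) * (w x * D (e i) (D (e i) s.u) x)
      + |D (e i) (D (e i) s.h) x| * w x ^ 2 + D (e i) w x ^ 2 := by
  obtain ⟨f⟩ := s.exists_frame x
  set v : SF m := D (e i) (D (e i) s.u) with hv
  set q : SF m := D (e i) s.u with hq
  have hvx : 0 < v x := s.uee_pos i x
  have hsum : v x = ∑ a, f.F' a i ^ 2 := f.u_ee i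
  have hqa : ∀ a, D (f.b a) q x = f.F' a i := fun a => f.u_ea i a
  have hD1 : ∀ z, D z (w * v * SF.exp ((1/2 : ℝ) • (q * q))) =
      SF.exp ((1/2 : ℝ) • (q * q)) * (D z w * v + w * D z v + w * v * (q * D z q)) := by
    intro z
    ext y
    simp [D_exp, Derivation.leibniz]
    ring
  have hD2 : ∀ z, D z (D z (w * v * SF.exp ((1/2 : ℝ) • (q * q)))) =
      SF.exp ((1/2 : ℝ) • (q * q)) * (D z (D z w) * v + w * D z (D z v)
        + w * v * ((D z q * D z q + q * D z (D z q)) + (q * D z q) ^ 2)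
        + 2 * D z w * D z v + 2 * D z w * v * (q * D z q) + 2 * w * D z v * (q * D z q)) := by
    intro z
    rw [hD1]
    simp only [D_exp, Derivation.leibniz, map_add, Derivation.map_smul, smul_eq_mul]
    ext y
    have h2 : ((2 : SF m) : Euc m → ℝ) y = 2 := rfl
    simp [h2]
    ring
  have key := pog_alg (fun a b => D (e i) (D (f.b a) (D (f.b b) s.u)) x)
    (fun a b => by rw [D_comm (f.b a)]) (fun a => f.F' a i) (fun a => D (f.b a) v x)
    (fun a => D (f.b a) w x) (fun a => D (f.b a) (D (f.b a) w) x)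
    (fun a => D (f.b a) (D (f.b a) v) x)
    (fun a => D (f.b a) q x * D (f.b a) q x + q x * D (f.b a) (D (f.b a) q) x)
    (v x) (w x) (q x) m (D (e i) (D (e i) s.ψ) x) (q x * D (e i) s.ψ x) hsum hvx hwx
    (by
      intro a
      have h1 : D (f.b a) v = D (e i) (D (f.b a) (D (e i) s.u)) := by
        rw [hv, D_comm]
      have h2 : D (e i) (D (f.b a) (D (e i) s.u)) = D (e i) (D (e i) (D (f.b a) s.u)) := by
        rw [D_comm (f.b a)]
      rw [h1, h2]
      rw [f.De]
      refine Finset.sum_congr rfl fun b _ => ?_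
      congr 1
      rw [D_comm (f.b b), D_comm (f.b b)])
    (by
      intro a
      have h := (localMax_test hmax (f.b a)).1
      rw [hD1] at h
      simp only [SF.mul_apply, SF.add_apply, SF.exp_apply] at h
      have h' := (mul_eq_zero.1 h).resolve_left (Real.exp_pos _).ne'
      rw [hqa] at h'
      exact h')
    (by
      intro a
      have h := (localMax_test hmax (f.b a)).2
      rw [hD2] at h
      simp only [SF.mul_apply, SF.add_apply, SF.exp_apply, SF.pow_apply, SF.ofNat_apply] at h
      have h' := nonpos_of_mul_nonpos_right h (Real.exp_pos _)
      simp only [hqa] at h' ⊢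
      exact h')
    (by
      simp only [hw, SF.neg_apply, Finset.sum_neg_distrib, f.uab]
      simp)
    (by
      have h := f.tr2 (e i) (e i)
      have h1 : ∀ a, D (f.b a) (D (f.b a) v) = D (e i) (D (e i) (D (f.b a) (D (f.b a) s.u))) := by
        intro a
        rw [hv, D_comm (f.b a) (e i), D_comm (f.b a) (e i), D_comm (f.b a) (e i),
          D_comm (f.b a) (e i)]
      simp only [h1]
      rw [h]
      congr 1
      refine Finset.sum_congr rfl fun a _ => Finset.sum_congr rfl fun b _ => ?_
      rw [D_comm (f.b b) (f.b a), sq])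
    (by
      have h := f.tr1 (e i)
      have h1 : ∀ a, D (f.b a) (D (f.b a) q) = D (e i) (D (f.b a) (D (f.b a) s.u)) := by
        intro a
        rw [hq, D_comm (f.b a) (e i), D_comm (f.b a) (e i)]
      rw [Finset.sum_add_distrib, ← Finset.mul_sum]
      simp only [h1]
      rw [h]
      simp only [hqa, ← sq]
      rw [hsum])
  rw [← f.De i w] at key
  have e1 : D (e i) (D (e i) s.ψ) x = 2 * v x - D (e i) (D (e i) s.h) x := by
    simp [Sol.ψ, hv]; rfl
  have e2 : D (e i) s.ψ x = 2 * q x - D (e i) s.h x := by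
    simp [Sol.ψ, hq]
  rw [e1, e2] at key
  have hY : 0 ≤ w x * v x := by positivity
  have a1 := le_abs_self (q x * D (e i) s.h x)
  have a2 := le_abs_self (D (e i) (D (e i) s.h) x)
  have b1 : w x * (w x * v x) * (q x * D (e i) s.h x) ≤ w x * (w x * v x) * |q x * D (e i) s.h x| := by
    gcongr
  have b2 : D (e i) (D (e i) s.h) x * w x ^ 2 ≤ |D (e i) (D (e i) s.h) x| * w x ^ 2 := by
    gcongr
  have b3 : 0 ≤ v x * w x ^ 2 := by positivity
  have b4 : 0 ≤ w x * (w x * v x) * q x ^ 2 := by positivity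
  nlinarith

end CY
end

section
open scoped ContDiff
open scoped ContDiff
namespace CY
variable {m : ℕ} {ι : Type}

/-- uniformly bounded families -/
def Bd (S : ι → Set (Euc m)) : Subalgebra ℝ (ι → SF m) where
  carrier := {f | ∃ C : ℝ, ∀ i, ∀ x ∈ S i, |f i x| ≤ C}
  mul_mem' := by
    rintro f g ⟨C, hC⟩ ⟨C', hC'⟩
    refine ⟨|C| * |C'|, fun i x hx => ?_⟩
    change |f i x * g i x| ≤ _
    rw [abs_mul]
    have h1 := (hC i x hx).trans (le_abs_self _)
    have h2 := (hC' i x hx).trans (le_abs_self _)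
    gcongr
  add_mem' := by
    rintro f g ⟨C, hC⟩ ⟨C', hC'⟩
    refine ⟨C + C', fun i x hx => ?_⟩
    change |f i x + g i x| ≤ _
    exact (abs_add_le _ _).trans (add_le_add (hC i x hx) (hC' i x hx))
  algebraMap_mem' := fun r => ⟨|r|, fun i x _ => le_rfl⟩

theorem mem_Bd {S : ι → Set (Euc m)} {f : ι → SF m} :
    f ∈ Bd S ↔ ∃ C : ℝ, ∀ i, ∀ x ∈ S i, |f i x| ≤ C := Iff.rfl

theorem Bd_mono {S S' : ι → Set (Euc m)} (h : ∀ i, S i ⊆ S' i) {f : ι → SF m} (hf : f ∈ Bd S') :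
    f ∈ Bd S := by
  obtain ⟨C, hC⟩ := hf
  exact ⟨C, fun i x hx => hC i x (h i hx)⟩

theorem Bd_unif {S : ι → Set (Euc m)} {κ : Type*} [Finite κ] {f : κ → ι → SF m}
    (h : ∀ k, f k ∈ Bd S) : ∃ C : ℝ, 1 ≤ C ∧ ∀ k i, ∀ x ∈ S i, |f k i x| ≤ C := by
  choose C hC using h
  have := Fintype.ofFinite κ
  refine ⟨1 + ∑ k, |C k|, ?_, fun k i x hx => ?_⟩
  · have : 0 ≤ ∑ k, |C k| := Finset.sum_nonneg fun _ _ => abs_nonneg _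
    linarith
  · have h1 := (hC k i x hx).trans (le_abs_self _)
    have h2 : |C k| ≤ ∑ k, |C k| :=
      Finset.single_le_sum (f := fun k => |C k|) (fun _ _ => abs_nonneg _) (Finset.mem_univ k)
    linarith

/-- derivative of families -/
def Dp (v : Euc m) (f : ι → SF m) : ι → SF m := fun i => D v (f i)

/-- iterated derivatives -/
def dl (l : List (Fin m)) (f : SF m) : SF m := l.foldr (fun j g => D (e j) g) f

theorem dl_cons (j : Fin m) (l : List (Fin m)) (f : SF m) : dl (j :: l) f = D (e j) (dl l f) := rfl
theorem dl_nil (f : SF m) : dl [] f = f := rfl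
theorem dl_append (l l' : List (Fin m)) (f : SF m) : dl (l ++ l') f = dl l (dl l' f) := by
  simp [dl, List.foldr_append]

/-- the setting for the interior estimates -/
structure Fam (m : ℕ) (ι : Type) where
  E : Set (Euc m)
  hE : IsCompact E
  s : ι → Sol m
  w : ι → SF m
  hw : ∀ i v v', D v (D v' (w i)) = - D v (D v' (s i).u)
  hfr : ∀ i, ∀ x ∈ frontier E, w i x ≤ 0
  bu : (fun i => (s i).u) ∈ Bd (fun _ => E)
  bDu : ∀ j, (fun i => D (e j) (s i).u) ∈ Bd (fun _ => E)
  bw : w ∈ Bd (fun _ => E)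
  bDw : ∀ j, (fun i => D (e j) (w i)) ∈ Bd (fun _ => E)
  bh : ∀ l, (fun i => dl l (s i).h) ∈ Bd (fun _ => E)

/-- the good sets -/
def Fam.S (F : Fam m ι) (δ : ℝ) (i : ι) : Set (Euc m) := {x | x ∈ F.E ∧ δ ≤ F.w i x}

theorem quad_bound {a b Y : ℝ} (hb : 0 ≤ b) (ha : 0 ≤ a) (h : Y ^ 2 ≤ a * Y + b) :
    Y ≤ a + b + 1 := by
  by_contra hc
  push Not at hc
  nlinarith [mul_nonneg ha hb]

theorem Fam.pog (F : Fam m ι) (j : Fin m) : ∃ C, ∀ i, ∀ x ∈ F.E, 0 ≤ F.w i x →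
    F.w i x * D (e j) (D (e j) (F.s i).u) x ≤ C := by
  obtain ⟨Cw, hCw⟩ := F.bw
  obtain ⟨Cdw, hCdw⟩ := F.bDw j
  obtain ⟨Cu, hCu⟩ := F.bDu j
  obtain ⟨Ch, hCh⟩ := F.bh [j]
  obtain ⟨Chh, hChh⟩ := F.bh [j, j]
  set a : ℝ := m + |Cw| * (|Cu| * |Ch|) with ha
  set b : ℝ := |Chh| * |Cw| ^ 2 + |Cdw| ^ 2 with hb
  have ha0 : 0 ≤ a := by positivity
  have hb0 : 0 ≤ b := by positivity
  refine ⟨(a + b + 1) * Real.exp ((1/2) * |Cu| ^ 2), fun i y hy hwy => ?_⟩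
  set f : SF m := F.w i * D (e j) (D (e j) (F.s i).u) *
      SF.exp ((1/2 : ℝ) • (D (e j) (F.s i).u * D (e j) (F.s i).u)) with hf
  have hfa : ∀ x, f x = F.w i x * D (e j) (D (e j) (F.s i).u) x *
    Real.exp ((1/2) * (D (e j) (F.s i).u x) ^ 2) := by
    intro x; simp [hf, sq]
  have hyf : F.w i y * D (e j) (D (e j) (F.s i).u) y ≤ f y := by
    rw [hfa]
    have h1 : 0 ≤ F.w i y * D (e j) (D (e j) (F.s i).u) y :=
      mul_nonneg hwy ((F.s i).uee_pos j y).le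
    have h2 : 1 ≤ Real.exp ((1/2) * (D (e j) (F.s i).u y) ^ 2) :=
      Real.one_le_exp (by positivity)
    nlinarith
  rcases le_or_gt (f y) 0 with h0 | h0
  · have : 0 ≤ (a + b + 1) * Real.exp ((1/2) * |Cu| ^ 2) := by positivity
    linarith
  · obtain ⟨x, hxE, hwx, hyx, hmax⟩ := max_lemma F.hE (F.w i) f (F.hfr i) (by
      intro x _ h; rw [hfa, h]; simp) hy hwy h0
    have hp := pog_point (F.s i) (F.w i) x j (F.hw i) hwx hmax
    have hY : 0 ≤ F.w i x * D (e j) (D (e j) (F.s i).u) x :=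
      mul_nonneg hwx.le ((F.s i).uee_pos j x).le
    have b1 := (hCw i x hxE).trans (le_abs_self _)
    have b1' : F.w i x ≤ |Cw| := (le_abs_self _).trans b1
    have b2 : |D (e j) (F.w i) x| ≤ |Cdw| := (hCdw i x hxE).trans (le_abs_self _)
    have b3 : |D (e j) (F.s i).u x| ≤ |Cu| := (hCu i x hxE).trans (le_abs_self _)
    have b4 : |D (e j) (F.s i).h x| ≤ |Ch| := (hCh i x hxE).trans (le_abs_self _)
    have b5 : |D (e j) (D (e j) (F.s i).h) x| ≤ |Chh| := (hChh i x hxE).trans (le_abs_self _)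
    have hq := quad_bound (a := a) (b := b) hb0 ha0 (hp.trans (by
      rw [ha, hb, abs_mul, ← sq_abs (D (e j) (F.w i) x), ← add_assoc]
      gcongr))
    have he : Real.exp ((1/2) * (D (e j) (F.s i).u x) ^ 2) ≤ Real.exp ((1/2) * |Cu| ^ 2) := by
      rw [← sq_abs (D (e j) (F.s i).u x)]
      gcongr
    calc _ ≤ f x := hyf.trans hyx
      _ ≤ _ := by rw [hfa]; gcongr

theorem Fam.S_sub (F : Fam m ι) (δ : ℝ) (i : ι) : F.S δ i ⊆ F.E := fun _ h => h.1

theorem Fam.bdE (F : Fam m ι) (δ : ℝ) {f : ι → SF m} (h : f ∈ Bd (fun _ => F.E)) :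
    f ∈ Bd (F.S δ) := Bd_mono (fun i => F.S_sub δ i) h

theorem Frame.u_ij {s : Sol m} {x : Euc m} (f : Frame s x) (i j : Fin m) :
    D (e i) (D (e j) s.u) x = ∑ a, f.F' a i * f.F' a j := by
  rw [f.De]; simp [f.u_ea]

theorem Sol.uij_le (s : Sol m) (x : Euc m) (i j : Fin m) : |D (e i) (D (e j) s.u) x| ≤
    D (e i) (D (e i) s.u) x + D (e j) (D (e j) s.u) x := by
  obtain ⟨f⟩ := s.exists_frame x
  rw [f.u_ij, f.u_ee, f.u_ee, ← Finset.sum_add_distrib]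
  refine (Finset.abs_sum_le_sum_abs _ _).trans (Finset.sum_le_sum fun a _ => ?_)
  rw [abs_le]
  constructor <;> nlinarith [sq_nonneg (f.F' a i + f.F' a j), sq_nonneg (f.F' a i - f.F' a j), sq_nonneg (f.F' a i), sq_nonneg (f.F' a j)]

theorem Fam.bH (F : Fam m ι) {δ : ℝ} (hδ : 0 < δ) (a b : Fin m) :
    (fun i => D (e a) (D (e b) (F.s i).u)) ∈ Bd (F.S δ) := by
  obtain ⟨Ca, hCa⟩ := F.pog a
  obtain ⟨Cb, hCb⟩ := F.pog b
  refine ⟨(Ca + Cb) / δ, fun i x hx => ?_⟩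
  refine ((F.s i).uij_le x a b).trans ?_
  have h0 : 0 ≤ F.w i x := hδ.le.trans hx.2
  have h1 := hCa i x hx.1 h0
  have h2 := hCb i x hx.1 h0
  have h3 := (F.s i).uee_pos a x
  have h4 := (F.s i).uee_pos b x
  rw [le_div_iff₀ hδ]
  nlinarith [hx.2, mul_le_mul_of_nonneg_right hx.2 h3.le, mul_le_mul_of_nonneg_right hx.2 h4.le]

theorem exp_mem_Bd {S : ι → Set (Euc m)} {f : ι → SF m} (h : f ∈ Bd S) :
    (fun i => (f i).exp) ∈ Bd S := by
  obtain ⟨C, hC⟩ := h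
  refine ⟨Real.exp C, fun i x hx => ?_⟩
  simp only [SF.exp_apply, abs_of_pos (Real.exp_pos _)]
  exact Real.exp_le_exp.2 ((le_abs_self _).trans (hC i x hx))

theorem Fam.bψ (F : Fam m ι) : (fun i => (F.s i).ψ) ∈ Bd (fun _ => F.E) := by
  have h : (2:ℝ) • (fun i => (F.s i).u) - (fun i => (F.s i).h) ∈ Bd (fun _ => F.E) :=
    sub_mem (Subalgebra.smul_mem _ F.bu _) (F.bh [])
  exact h

theorem Fam.bN (F : Fam m ι) {δ : ℝ} (hδ : 0 < δ) (a b : Fin m) :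
    (fun i => (F.s i).gn.N a b) ∈ Bd (F.S δ) := by
  have h1 : (fun i => (-(F.s i).ψ).exp) ∈ Bd (F.S δ) :=
    exp_mem_Bd (F.bdE δ (neg_mem F.bψ))
  have h2 : (fun i => (Hf e (F.s i).u).adjugate a b) ∈ Bd (F.S δ) := by
    obtain ⟨C, hC1, hC⟩ := Bd_unif (κ := Fin m × Fin m)
      (f := fun k i => D (e k.1) (D (e k.2) (F.s i).u)) (fun k => F.bH hδ k.1 k.2)
    refine ⟨Nat.factorial m • C ^ m, fun i x hx => ?_⟩
    have h3 : (Hf e (F.s i).u).adjugate a b x =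
      ((eM x (Hf e (F.s i).u)).updateRow b (Pi.single a 1)).det := by
      rw [Matrix.adjugate_apply, eM_det]
      congr 1
      ext p q
      simp only [eM_apply, Matrix.updateRow_apply]
      split_ifs with hp
      · by_cases hq : q = a
        · subst hq; simp
        · simp [hq]
      · rfl
    rw [h3]
    have := Matrix.det_le (A := (eM x (Hf e (F.s i).u)).updateRow b (Pi.single a 1))
      (abv := IsAbsoluteValue.toAbsoluteValue (abs : ℝ → ℝ)) (x := C) (by
        intro p q
        change |_| ≤ C
        simp only [Matrix.updateRow_apply]
        split_ifs with hp
        · by_cases hq : q = a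
          · subst hq; simpa using hC1
          · simp [hq]; linarith
        · exact hC (p, q) i x hx)
    rw [Fintype.card_fin] at this
    exact this
  exact mul_mem h1 h2

/-- ellipticity -/
theorem Fam.ell (F : Fam m ι) {δ : ℝ} (hδ : 0 < δ) : ∃ Λ : ℝ, 1 ≤ Λ ∧ ∀ i, ∀ x ∈ F.S δ i,
    ∀ f : Frame (F.s i) x, (∀ a j, f.F' a j ^ 2 ≤ Λ) ∧ (∀ j a, f.F j a ^ 2 ≤ Λ) := by
  obtain ⟨C, hC1, hC⟩ := Bd_unif (κ := Fin m × Fin m)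
      (f := fun k i => D (e k.1) (D (e k.2) (F.s i).u)) (fun k => F.bH hδ k.1 k.2)
  obtain ⟨C', hC1', hC'⟩ := Bd_unif (κ := Fin m × Fin m)
      (f := fun k i => (F.s i).gn.N k.1 k.2) (fun k => F.bN hδ k.1 k.2)
  refine ⟨C + C', by linarith, fun i x hx f => ⟨fun a j => ?_, fun j a => ?_⟩⟩
  · have h1 := (le_abs_self _).trans (hC (j, j) i x hx)
    simp only at h1
    rw [f.u_ee] at h1
    have h2 : f.F' a j ^ 2 ≤ ∑ a, f.F' a j ^ 2 :=
      Finset.single_le_sum (f := fun a => f.F' a j ^ 2) (fun _ _ => sq_nonneg _) (Finset.mem_univ a)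
    linarith
  · have h1 := (le_abs_self _).trans (hC' (j, j) i x hx)
    have h3 : (F.s i).gn.N j j x = ∑ a, f.F j a ^ 2 := by
      have := congrFun (congrFun f.hN j) j
      rw [eM_apply, Matrix.mul_apply] at this
      rw [this]
      exact Finset.sum_congr rfl fun a _ => by rw [Matrix.transpose_apply, sq]
    simp only at h1
    rw [h3] at h1
    have h2 : f.F j a ^ 2 ≤ ∑ a, f.F j a ^ 2 :=
      Finset.single_le_sum (f := fun a => f.F j a ^ 2) (fun _ _ => sq_nonneg _) (Finset.mem_univ a)
    linarith

theorem Frame.Db {s : Sol m} {x : Euc m} (f : Frame s x) (a : Fin m) (φ : SF m) :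
    D (f.b a) φ = ∑ i, f.F i a • D (e i) φ := by
  rw [Frame.b, fr, D_sum]; simp [D_smul]

theorem lin_sq {Λ : ℝ} (c t : Fin m → ℝ) (hc : ∀ a, c a ^ 2 ≤ Λ) :
    (∑ a, c a * t a) ^ 2 ≤ m * Λ * ∑ a, t a ^ 2 := by
  refine (Finset.sum_mul_sq_le_sq_mul_sq _ c t).trans ?_
  have h0 : ∑ a, c a ^ 2 ≤ m * Λ := by
    calc _ ≤ ∑ _a : Fin m, Λ := Finset.sum_le_sum fun a _ => hc a
      _ = _ := by simp
  exact mul_le_mul_of_nonneg_right h0 (Finset.sum_nonneg fun _ _ => sq_nonneg _)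

/-- gradient in the frame -/
def Frame.gr {s : Sol m} {x : Euc m} (f : Frame s x) (φ ψ : SF m) : ℝ :=
  ∑ a, D (f.b a) φ x * D (f.b a) ψ x

theorem Frame.gr_le {s : Sol m} {x : Euc m} (f : Frame s x) {Λ : ℝ} (hΛ : ∀ j a, f.F j a ^ 2 ≤ Λ)
    (φ : SF m) : f.gr φ φ ≤ m * (m * Λ) * ∑ i, D (e i) φ x ^ 2 := by
  unfold Frame.gr
  calc _ ≤ ∑ _a : Fin m, m * Λ * ∑ i, D (e i) φ x ^ 2 := by
        refine Finset.sum_le_sum fun a _ => ?_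
        rw [f.Db, ← sq]
        simp only [SF.sum_apply, SF.smul_apply]
        exact lin_sq _ _ fun j => hΛ j a
    _ = _ := by simp; ring

theorem Frame.le_gr {s : Sol m} {x : Euc m} (f : Frame s x) {Λ : ℝ} (hΛ : ∀ a j, f.F' a j ^ 2 ≤ Λ)
    (φ : SF m) : ∑ i, D (e i) φ x ^ 2 ≤ m * (m * Λ) * f.gr φ φ := by
  unfold Frame.gr
  calc _ ≤ ∑ _i : Fin m, m * Λ * ∑ a, D (f.b a) φ x ^ 2 := by
        refine Finset.sum_le_sum fun i _ => ?_
        rw [f.De]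
        exact lin_sq _ _ fun a => hΛ a i
    _ = _ := by simp [sq]; ring

theorem Frame.L_mul {s : Sol m} {x : Euc m} (f : Frame s x) (φ ψ : SF m) :
    s.L (φ * ψ) x = φ x * s.L ψ x + ψ x * s.L φ x + 2 * f.gr φ ψ := by
  simp only [f.L_apply, Frame.gr, Finset.mul_sum, ← Finset.sum_add_distrib]
  refine Finset.sum_congr rfl fun a _ => ?_
  simp [Derivation.leibniz]
  ring

theorem Fam.Lw (F : Fam m ι) (i : ι) (x : Euc m) : (F.s i).L (F.w i) x = -m := by
  obtain ⟨f⟩ := (F.s i).exists_frame x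
  simp only [f.L_apply, F.hw, SF.neg_apply, f.uab]
  simp

theorem Fam.lemmaM' (F : Fam m ι) (Φ : ι → SF m) (h0 : ∀ i x, 0 ≤ Φ i x) {δ : ℝ} (hδ : 0 < δ)
    (hL : ∃ c > 0, ∃ C : ℝ, ∀ i, ∀ x ∈ F.S (δ / 2) i, c * Φ i x ^ 2 - C ≤ (F.s i).L (Φ i) x) :
    Φ ∈ Bd (F.S δ) := by
  have hδ2 : 0 < δ / 2 := by linarith
  obtain ⟨c, hc, C, hC⟩ := hL
  obtain ⟨Λ, hΛ1, hΛ⟩ := F.ell hδ2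
  obtain ⟨Cw, hCw⟩ := F.bw
  obtain ⟨Cg, hCg1, hCg⟩ := Bd_unif (fun j => F.bDw j)
  -- gradient bound
  set Gb : ℝ := m * (m * Λ) * (m * Cg ^ 2) with hGb
  have hGb0 : 0 ≤ Gb := by positivity
  set a : ℝ := (6 * Gb + 2 * |Cw| * m) / c with ha
  set b : ℝ := |C| * |Cw| ^ 4 / c with hb
  have ha0 : 0 ≤ a := by positivity
  have hb0 : 0 ≤ b := by positivity
  refine ⟨(a + b + 1) / (δ / 2) ^ 2, fun i y hy => ?_⟩
  rw [abs_of_nonneg (h0 i y), le_div_iff₀ (by positivity)]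
  set w : SF m := F.w i - algebraMap ℝ _ (δ / 2) with hw
  have hwa : ∀ x, w x = F.w i x - δ / 2 := fun x => by simp [hw]
  have hDw : ∀ v, D v w = D v (F.w i) := fun v => by simp [hw]
  have hwy : δ / 2 ≤ w y := by rw [hwa]; linarith [hy.2]
  have hle : Φ i y * (δ / 2) ^ 2 ≤ (w * w * Φ i) y := by
    simp only [SF.mul_apply]
    have : (δ / 2) ^ 2 ≤ w y * w y := by nlinarith
    nlinarith [h0 i y]
  rcases le_or_gt ((w * w * Φ i) y) 0 with hn | hn
  · linarith
  obtain ⟨x, hxE, hwx, hyx, hmax⟩ := max_lemma F.hE w (w * w * Φ i)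
    (by intro x hx; rw [hwa]; linarith [F.hfr i x hx])
    (by intro x _ h; simp [h]) hy.1 (hδ2.le.trans hwy) hn
  refine hle.trans (hyx.trans ?_)
  have hxS : x ∈ F.S (δ / 2) i := ⟨hxE, by rw [hwa] at hwx; linarith⟩
  obtain ⟨f⟩ := (F.s i).exists_frame x
  have hLn : (F.s i).L (w * w * Φ i) x ≤ 0 := by
    rw [f.L_apply]
    exact Finset.sum_nonpos fun a _ => (localMax_test hmax (f.b a)).2
  have hgr : f.gr (w * w) (Φ i) * w x = - 4 * Φ i x * f.gr w w * w x := by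
    have : ∀ a, D (f.b a) (w * w) x * D (f.b a) (Φ i) x * w x =
        - 4 * Φ i x * (D (f.b a) w x * D (f.b a) w x) * w x := by
      intro a
      have h := (localMax_test hmax (f.b a)).1
      simp only [Derivation.leibniz, smul_eq_mul, SF.add_apply, SF.mul_apply] at h ⊢
      have h2 : w x * (w x * D (f.b a) (Φ i) x + 2 * Φ i x * D (f.b a) w x) = 0 := by
        linear_combination h
      have h3 := (mul_eq_zero.1 h2).resolve_left hwx.ne'
      linear_combination (2 * w x * D (f.b a) w x) * h3
    unfold Frame.gr
    rw [Finset.sum_mul, Finset.mul_sum, Finset.sum_mul]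
    exact Finset.sum_congr rfl fun a _ => this a
  have hgr' : f.gr (w * w) (Φ i) = - 4 * Φ i x * f.gr w w := mul_right_cancel₀ hwx.ne' hgr
  have hLw : (F.s i).L w x = -m := by
    rw [← F.Lw i x, f.L_apply, f.L_apply]; simp only [hDw]
  rw [f.L_mul, f.L_mul, hgr', hLw, SF.mul_apply] at hLn
  have hgb : f.gr w w ≤ Gb := by
    refine (f.gr_le (hΛ i x hxS f).2 w).trans ?_
    rw [hGb]
    gcongr
    calc ∑ j, D (e j) w x ^ 2 ≤ ∑ _j : Fin m, Cg ^ 2 := by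
          refine Finset.sum_le_sum fun j _ => ?_
          rw [hDw]
          exact sq_le_sq.2 ((hCg j i x hxE).trans (le_abs_self _))
      _ = _ := by simp
  have hCx := hC i x hxS
  have hwC : w x ≤ |Cw| := by
    rw [hwa]
    have := (le_abs_self _).trans ((hCw i x hxE).trans (le_abs_self _))
    linarith
  have hΦ := h0 i x
  -- final quadratic inequality
  have h1 : w x * w x * (c * Φ i x ^ 2 - C) ≤ Φ i x * (6 * f.gr w w + 2 * w x * m) := by
    have : w x * w x * (c * Φ i x ^ 2 - C) ≤ w x * w x * (F.s i).L (Φ i) x := by gcongr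
    nlinarith
  have h2 : Φ i x * (6 * f.gr w w + 2 * w x * m) ≤ Φ i x * (6 * Gb + 2 * |Cw| * m) := by gcongr
  have h3 : (w x * w x) * (w x * w x * (c * Φ i x ^ 2 - C)) ≤
      (w x * w x) * (Φ i x * (6 * Gb + 2 * |Cw| * m)) :=
    mul_le_mul_of_nonneg_left (h1.trans h2) (by positivity)
  have h4 : w x ^ 4 * C ≤ |Cw| ^ 4 * |C| := by
    calc w x ^ 4 * C ≤ w x ^ 4 * |C| := by gcongr; exact le_abs_self _
      _ ≤ _ := by gcongr
  have := quad_bound (a := a) (b := b) (Y := (w * w * Φ i) x) hb0 ha0 (by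
    simp only [SF.mul_apply]
    rw [ha, hb, div_mul_eq_mul_div, ← add_div, le_div_iff₀ hc]
    nlinarith)
  exact this

theorem Fam.lemmaM (F : Fam m ι) (Φ : ι → SF m) (h0 : ∀ i x, 0 ≤ Φ i x)
    (hL : ∀ δ > 0, ∃ c > 0, ∃ C : ℝ, ∀ i, ∀ x ∈ F.S δ i, c * Φ i x ^ 2 - C ≤ (F.s i).L (Φ i) x)
    {δ : ℝ} (hδ : 0 < δ) : Φ ∈ Bd (F.S δ) := F.lemmaM' Φ h0 hδ (hL _ (by linarith))

end CY
end

section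
open scoped ContDiff
open scoped ContDiff
namespace CY
variable {m : ℕ}

section alg
variable (t : Fin m → Matrix (Fin m) (Fin m) ℝ) (q : Fin m → Fin m → Matrix (Fin m) (Fin m) ℝ)

/-- contractions -/
def cX (a b c d : Fin m) : ℝ := ∑ k, t k a b * t k c d
/-- contractions -/
def cB (i j : Fin m) : ℝ := ∑ a, ∑ b, t i a b * t j a b
/-- contractions -/
def cBB : ℝ := ∑ i, ∑ j, cB t i j ^ 2
/-- contractions -/
def cCC : ℝ := ∑ a, ∑ b, ∑ c, ∑ d, cX t a b c d * cX t a c b d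
/-- contractions -/
def cXQ : ℝ := ∑ a, ∑ b, ∑ c, ∑ d, cX t a b c d * q a b c d
/-- contractions -/
def cQQ : ℝ := ∑ a, ∑ b, ∑ c, ∑ d, q a b c d ^ 2
/-- contractions -/
def cS : ℝ := ∑ a, ∑ b, ∑ c, t a b c ^ 2

/-- sum over four indices -/
theorem sum4 (f : Fin m → Fin m → Fin m → Fin m → ℝ) : ∑ a, ∑ b, ∑ c, ∑ d, f a b c d =
    ∑ x : Fin m × Fin m × Fin m × Fin m, f x.1 x.2.1 x.2.2.1 x.2.2.2 := by
  simp only [Fintype.sum_prod_type]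

theorem sum5 (f : Fin m → Fin m → Fin m → Fin m → Fin m → ℝ) :
    ∑ a, ∑ b, ∑ c, ∑ d, ∑ k, f a b c d k =
    ∑ x : Fin m × Fin m × Fin m × Fin m × Fin m, f x.1 x.2.1 x.2.2.1 x.2.2.2.1 x.2.2.2.2 := by
  simp only [Fintype.sum_prod_type]

theorem sum6 (f : Fin m → Fin m → Fin m → Fin m → Fin m → Fin m → ℝ) :
    ∑ a, ∑ b, ∑ c, ∑ d, ∑ k, ∑ l, f a b c d k l =
    ∑ x : Fin m × Fin m × Fin m × Fin m × Fin m × Fin m,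
      f x.1 x.2.1 x.2.2.1 x.2.2.2.1 x.2.2.2.2.1 x.2.2.2.2.2 := by
  simp only [Fintype.sum_prod_type]

variable {t q}

theorem XX_eq : ∑ a, ∑ b, ∑ c, ∑ d, cX t a b c d ^ 2 = cBB t := by
  simp only [cBB, cB, cX, sq, Finset.sum_mul_sum]
  rw [sum6, sum6]
  refine Fintype.sum_equiv ⟨fun (a,b,c,d,k,l) => (k,l,a,c,b,d), fun (k,l,a,c,b,d) => (a,b,c,d,k,l),
    fun _ => rfl, fun _ => rfl⟩ _ _ fun ⟨a,b,c,d,k,l⟩ => ?_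
  simp only [Equiv.coe_fn_mk]
  ring

end alg

section alg2
variable {t : Fin m → Matrix (Fin m) (Fin m) ℝ} {q : Fin m → Fin m → Matrix (Fin m) (Fin m) ℝ}

theorem trB (t2 : ∀ a b c, t a b c = t a c b) (k n : Fin m) : (t k * t n).trace = cB t k n := by
  simp only [Matrix.trace, Matrix.diag_apply, Matrix.mul_apply, cB]
  exact Finset.sum_congr rfl fun a _ => Finset.sum_congr rfl fun b _ => by rw [t2 n b a]

theorem sqB (t1 : ∀ a b c, t a b c = t b a c) (t2 : ∀ a b c, t a b c = t a c b) (k n : Fin m) :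
    ∑ p, (t p * t p) k n = cB t k n := by
  simp only [Matrix.mul_apply, cB]
  exact Finset.sum_congr rfl fun a _ => Finset.sum_congr rfl fun b _ => by
    rw [t1 a k b, t2 a b n, t1 a n b]

theorem A3 (t1 : ∀ a b c, t a b c = t b a c) (t2 : ∀ a b c, t a b c = t a c b)
    (q1 : ∀ a b c d, q a b c d = q b a c d) (q2 : ∀ a b c d, q a b c d = q a c b d)
    (q3 : ∀ a b c d, q a b c d = q a b d c) :
    ∑ p, ∑ k, ∑ n, t p k n * (q p k * t n).trace = cXQ t q := by
  simp only [Matrix.trace, Matrix.diag_apply, Matrix.mul_apply, Finset.sum_mul, Finset.mul_sum, cXQ, cX]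
  rw [sum5, sum5]
  refine Fintype.sum_equiv ⟨fun (p,k,n,a,b) => (p,k,a,b,n), fun (p,k,a,b,n) => (p,k,n,a,b),
    fun _ => rfl, fun _ => rfl⟩ _ _ fun ⟨p,k,n,a,b⟩ => ?_
  simp only [Equiv.coe_fn_mk]
  simp only [t1, t2, q1, q2, q3]
  ring

theorem A6 (t1 : ∀ a b c, t a b c = t b a c) (t2 : ∀ a b c, t a b c = t a c b)
    (q1 : ∀ a b c d, q a b c d = q b a c d) (q2 : ∀ a b c d, q a b c d = q a c b d)
    (q3 : ∀ a b c d, q a b c d = q a b d c) :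
    ∑ p, ∑ k, (t p * q p k * t k).trace = cXQ t q := by
  simp only [Matrix.trace, Matrix.diag_apply, Matrix.mul_apply, Finset.sum_mul, Finset.mul_sum, cXQ, cX]
  rw [sum5, sum5]
  refine Fintype.sum_equiv ⟨fun (p,k,i,j,h) => (p,h,k,j,i), fun (p,h,k,j,i) => (p,k,i,j,h),
    fun _ => rfl, fun _ => rfl⟩ _ _ fun ⟨p,k,i,j,h⟩ => ?_
  simp only [Equiv.coe_fn_mk]
  simp only [t1, t2, q1, q2, q3]
  ring

theorem A9b (t1 : ∀ a b c, t a b c = t b a c) (t2 : ∀ a b c, t a b c = t a c b)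
    (q1 : ∀ a b c d, q a b c d = q b a c d) (q2 : ∀ a b c d, q a b c d = q a c b d)
    (q3 : ∀ a b c d, q a b c d = q a b d c) :
    ∑ p, ∑ k, (q p k * (t p * t k)).trace = cXQ t q := by
  simp only [Matrix.trace, Matrix.diag_apply, Matrix.mul_apply, Finset.sum_mul, Finset.mul_sum, cXQ, cX]
  rw [sum5, sum5]
  refine Fintype.sum_equiv ⟨fun (p,k,i,j,h) => (p,j,k,i,h), fun (p,j,k,i,h) => (p,k,i,j,h),
    fun _ => rfl, fun _ => rfl⟩ _ _ fun ⟨p,k,i,j,h⟩ => ?_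
  simp only [Equiv.coe_fn_mk]
  simp only [t1, t2, q1, q2, q3]
  ring

theorem A5a (t1 : ∀ a b c, t a b c = t b a c) (t2 : ∀ a b c, t a b c = t a c b)
    (q1 : ∀ a b c d, q a b c d = q b a c d) (q2 : ∀ a b c d, q a b c d = q a c b d)
    (q3 : ∀ a b c d, q a b c d = q a b d c) :
    ∑ k, ∑ a, ∑ b, (t k * q a b).trace * t k b a = cXQ t q := by
  simp only [Matrix.trace, Matrix.diag_apply, Matrix.mul_apply, Finset.sum_mul, Finset.mul_sum, cXQ, cX]
  rw [sum5, sum5]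
  refine Fintype.sum_equiv ⟨fun (k,a,b,c,d) => (a,b,c,d,k), fun (a,b,c,d,k) => (k,a,b,c,d),
    fun _ => rfl, fun _ => rfl⟩ _ _ fun ⟨k,a,b,c,d⟩ => ?_
  simp only [Equiv.coe_fn_mk]
  simp only [t1, t2, q1, q2, q3]
  ring

theorem A5b (t1 : ∀ a b c, t a b c = t b a c) (t2 : ∀ a b c, t a b c = t a c b)
    (q1 : ∀ a b c d, q a b c d = q b a c d) (q2 : ∀ a b c d, q a b c d = q a c b d)
    (q3 : ∀ a b c d, q a b c d = q a b d c) :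
    ∑ k, ∑ a, ∑ b, (q k a * t b).trace * t k b a = cXQ t q := by
  simp only [Matrix.trace, Matrix.diag_apply, Matrix.mul_apply, Finset.sum_mul, Finset.mul_sum, cXQ, cX]
  rw [sum5, sum5]
  refine Fintype.sum_equiv ⟨fun (k,a,b,c,d) => (k,a,c,d,b), fun (k,a,c,d,b) => (k,a,b,c,d),
    fun _ => rfl, fun _ => rfl⟩ _ _ fun ⟨k,a,b,c,d⟩ => ?_
  simp only [Equiv.coe_fn_mk]
  simp only [t1, t2, q1, q2, q3]
  ring

theorem A5c (t1 : ∀ a b c, t a b c = t b a c) (t2 : ∀ a b c, t a b c = t a c b)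
    (q1 : ∀ a b c d, q a b c d = q b a c d) (q2 : ∀ a b c d, q a b c d = q a c b d)
    (q3 : ∀ a b c d, q a b c d = q a b d c) :
    ∑ k, ∑ a, ∑ b, (t a * q k b).trace * t k b a = cXQ t q := by
  simp only [Matrix.trace, Matrix.diag_apply, Matrix.mul_apply, Finset.sum_mul, Finset.mul_sum, cXQ, cX]
  rw [sum5, sum5]
  refine Fintype.sum_equiv ⟨fun (k,a,b,c,d) => (k,b,c,d,a), fun (k,b,c,d,a) => (k,a,b,c,d),
    fun _ => rfl, fun _ => rfl⟩ _ _ fun ⟨k,a,b,c,d⟩ => ?_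
  simp only [Equiv.coe_fn_mk]
  simp only [t1, t2, q1, q2, q3]
  ring

theorem A4 (t1 : ∀ a b c, t a b c = t b a c) (t2 : ∀ a b c, t a b c = t a c b) :
    ∑ p, ∑ k, ∑ n, t p k n * (t p * t k * t n).trace = cCC t := by
  simp only [Matrix.trace, Matrix.diag_apply, Matrix.mul_apply, Finset.sum_mul, Finset.mul_sum, cCC, cX]
  rw [sum6, sum6]
  refine Fintype.sum_equiv ⟨fun (p,k,n,a,c,b) => (k,n,b,a,c,p), fun (k,n,b,a,c,p) => (p,k,n,a,c,b),
    fun _ => rfl, fun _ => rfl⟩ _ _ fun ⟨p,k,n,a,c,b⟩ => ?_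
  simp only [Equiv.coe_fn_mk]
  simp only [t1, t2]
  ring

theorem A9 (t1 : ∀ a b c, t a b c = t b a c) (t2 : ∀ a b c, t a b c = t a c b) :
    ∑ p, ∑ k, (t p * t k * (t p * t k)).trace = cCC t := by
  simp only [Matrix.trace, Matrix.diag_apply, Matrix.mul_apply, Finset.sum_mul, Finset.mul_sum, cCC, cX]
  rw [sum6, sum6]
  refine Fintype.sum_equiv ⟨fun (p,k,i,j,l,h) => (i,h,l,j,k,p), fun (i,h,l,j,k,p) => (p,k,i,j,l,h),
    fun _ => rfl, fun _ => rfl⟩ _ _ fun ⟨p,k,i,j,l,h⟩ => ?_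
  simp only [Equiv.coe_fn_mk]
  simp only [t1, t2]
  ring

theorem A5d (t1 : ∀ a b c, t a b c = t b a c) (t2 : ∀ a b c, t a b c = t a c b) :
    ∑ k, ∑ a, ∑ b, (t k * (t a * t b)).trace * t k b a = cCC t := by
  simp only [Matrix.trace, Matrix.diag_apply, Matrix.mul_apply, Finset.sum_mul, Finset.mul_sum, cCC, cX]
  rw [sum6, sum6]
  refine Fintype.sum_equiv ⟨fun (k,a,b,c,d,g) => (a,b,d,c,g,k), fun (a,b,d,c,g,k) => (k,a,b,c,d,g),
    fun _ => rfl, fun _ => rfl⟩ _ _ fun ⟨k,a,b,c,d,g⟩ => ?_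
  simp only [Equiv.coe_fn_mk]
  simp only [t1, t2]
  ring

theorem A5e (t1 : ∀ a b c, t a b c = t b a c) (t2 : ∀ a b c, t a b c = t a c b) :
    ∑ k, ∑ a, ∑ b, (t a * (t k * t b)).trace * t k b a = cCC t := by
  simp only [Matrix.trace, Matrix.diag_apply, Matrix.mul_apply, Finset.sum_mul, Finset.mul_sum, cCC, cX]
  rw [sum6, sum6]
  refine Fintype.sum_equiv ⟨fun (k,a,b,c,d,g) => (a,b,d,g,c,k), fun (a,b,d,g,c,k) => (k,a,b,c,d,g),
    fun _ => rfl, fun _ => rfl⟩ _ _ fun ⟨k,a,b,c,d,g⟩ => ?_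
  simp only [Equiv.coe_fn_mk]
  simp only [t1, t2]
  ring


theorem CC_le : cCC t ≤ cBB t := by
  have h : 0 ≤ ∑ a, ∑ b, ∑ c, ∑ d, (cX t a b c d - cX t a c b d) ^ 2 :=
    Finset.sum_nonneg fun a _ => Finset.sum_nonneg fun b _ => Finset.sum_nonneg fun c _ =>
      Finset.sum_nonneg fun d _ => sq_nonneg _
  have e1 : ∀ a b c d, (cX t a b c d - cX t a c b d) ^ 2 =
      cX t a b c d ^ 2 + cX t a c b d ^ 2 - 2 * (cX t a b c d * cX t a c b d) := by
    intros; ring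
  simp only [e1, Finset.sum_add_distrib, Finset.sum_sub_distrib, ← Finset.mul_sum] at h
  have e2 : ∑ a, ∑ b, ∑ c, ∑ d, cX t a c b d ^ 2 = cBB t := by
    rw [← XX_eq]
    exact Finset.sum_congr rfl fun a _ => Finset.sum_comm
  rw [e2, XX_eq] at h
  have : ∑ a, ∑ b, ∑ c, ∑ d, cX t a b c d * cX t a c b d = cCC t := rfl
  linarith

theorem QY_ineq (t1 : ∀ a b c, t a b c = t b a c) (t2 : ∀ a b c, t a b c = t a c b)
    (q1 : ∀ a b c d, q a b c d = q b a c d) (q2 : ∀ a b c d, q a b c d = q a c b d)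
    (q3 : ∀ a b c d, q a b c d = q a b d c) :
    0 ≤ 2 * cQQ q - 6 * cXQ t q + (3 * cBB t + 6 * cCC t) / 2 := by
  set X := cX t with hX
  have x2 : ∀ a b c d, X a b c d = X a b d c := by
    intro a b c d; simp only [hX, cX]
    exact Finset.sum_congr rfl fun k _ => by rw [t2 k c d]
  have h : 0 ≤ ∑ a, ∑ b, ∑ c, ∑ d, (2 * q a b c d - X a b c d - X a c b d - X a d b c) ^ 2 :=
    Finset.sum_nonneg fun a _ => Finset.sum_nonneg fun b _ => Finset.sum_nonneg fun c _ =>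
      Finset.sum_nonneg fun d _ => sq_nonneg _
  have e1 : ∀ a b c d, (2 * q a b c d - X a b c d - X a c b d - X a d b c) ^ 2 =
      4 * q a b c d ^ 2 + X a b c d ^ 2 + X a c b d ^ 2 + X a d b c ^ 2
      - 4 * (X a b c d * q a b c d) - 4 * (X a c b d * q a b c d) - 4 * (X a d b c * q a b c d)
      + 2 * (X a b c d * X a c b d) + 2 * (X a b c d * X a d b c) + 2 * (X a c b d * X a d b c) := by
    intros; ring
  simp only [e1, Finset.sum_add_distrib, Finset.sum_sub_distrib, ← Finset.mul_sum] at h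
  have hBB : ∑ a, ∑ b, ∑ c, ∑ d, X a b c d ^ 2 = cBB t := XX_eq
  have hCC : ∑ a, ∑ b, ∑ c, ∑ d, X a b c d * X a c b d = cCC t := rfl
  have hXQ : ∑ a, ∑ b, ∑ c, ∑ d, X a b c d * q a b c d = cXQ t q := rfl
  have hQQ : ∑ a, ∑ b, ∑ c, ∑ d, q a b c d ^ 2 = cQQ q := rfl
  have f1 : ∑ a, ∑ b, ∑ c, ∑ d, X a c b d ^ 2 = cBB t := by
    rw [← hBB]; exact Finset.sum_congr rfl fun a _ => Finset.sum_comm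
  have f2 : ∑ a, ∑ b, ∑ c, ∑ d, X a d b c ^ 2 = cBB t := by
    rw [← hBB, sum4, sum4]
    exact Fintype.sum_equiv ⟨fun (a,b,c,d) => (a,d,b,c), fun (a,d,b,c) => (a,b,c,d),
      fun _ => rfl, fun _ => rfl⟩ _ _ fun ⟨a,b,c,d⟩ => rfl
  have f3 : ∑ a, ∑ b, ∑ c, ∑ d, X a c b d * q a b c d = cXQ t q := by
    rw [← hXQ, sum4, sum4]
    exact Fintype.sum_equiv ⟨fun (a,b,c,d) => (a,c,b,d), fun (a,c,b,d) => (a,b,c,d),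
      fun _ => rfl, fun _ => rfl⟩ _ _ fun ⟨a,b,c,d⟩ => by
        simp only [Equiv.coe_fn_mk]; rw [q2 a b c d]
  have f4 : ∑ a, ∑ b, ∑ c, ∑ d, X a d b c * q a b c d = cXQ t q := by
    rw [← hXQ, sum4, sum4]
    exact Fintype.sum_equiv ⟨fun (a,b,c,d) => (a,d,b,c), fun (a,d,b,c) => (a,b,c,d),
      fun _ => rfl, fun _ => rfl⟩ _ _ fun ⟨a,b,c,d⟩ => by
        simp only [Equiv.coe_fn_mk]; rw [q3 a b c d, q2 a b d c]
  have f5 : ∑ a, ∑ b, ∑ c, ∑ d, X a b c d * X a d b c = cCC t := by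
    rw [← hCC, sum4, sum4]
    exact Fintype.sum_equiv ⟨fun (a,b,c,d) => (a,b,d,c), fun (a,b,d,c) => (a,b,c,d),
      fun _ => rfl, fun _ => rfl⟩ _ _ fun ⟨a,b,c,d⟩ => by
        simp only [Equiv.coe_fn_mk]; rw [x2 a b c d]
  have f6 : ∑ a, ∑ b, ∑ c, ∑ d, X a c b d * X a d b c = cCC t := by
    rw [← hCC, sum4, sum4]
    exact Fintype.sum_equiv ⟨fun (a,b,c,d) => (a,c,d,b), fun (a,c,d,b) => (a,b,c,d),
      fun _ => rfl, fun _ => rfl⟩ _ _ fun ⟨a,b,c,d⟩ => by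
        simp only [Equiv.coe_fn_mk]; rw [x2 a c b d, x2 a d b c]
  rw [hBB, hCC, hXQ, hQQ, f1, f2, f3, f4, f5, f6] at h
  linarith

theorem cal_alg (P : Fin m → Fin m → Matrix (Fin m) (Fin m) ℝ)
    (ψ2 : Fin m → Fin m → ℝ) (ψ3 : Fin m → Fin m → Fin m → ℝ)
    (t1 : ∀ a b c, t a b c = t b a c) (t2 : ∀ a b c, t a b c = t a c b)
    (q1 : ∀ a b c d, q a b c d = q b a c d) (q2 : ∀ a b c d, q a b c d = q a c b d)
    (q3 : ∀ a b c d, q a b c d = q a b d c)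
    (hQ : ∀ a b, ∑ p, q p p a b = ψ2 a b + (t a * t b).trace)
    (hP : ∀ k a b, ∑ p, P p k a b = ψ3 k a b + (t k * q a b).trace + (q k a * t b).trace
      + (t a * q k b).trace - (t k * (t a * t b)).trace - (t a * (t k * t b)).trace) :
    (cBB t) / 2 + 2 * (∑ k, ∑ a, ∑ b, ψ3 k a b * t k b a) - 3 * (∑ a, ∑ b, ψ2 a b * cB t a b) ≤
    ∑ p, (∑ k, ∑ n, (2 * (t p * t p) k n - q p p k n) * (t k * t n).trace
      - 4 * ∑ k, ∑ n, t p k n * ((q p k - t p * t k) * t n).trace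
      + 2 * ∑ k, ((P p k * t k).trace - 2 * (t p * q p k * t k).trace - (q p p * (t k * t k)).trace
        + 2 * (t p * t p * (t k * t k)).trace)
      + 2 * ∑ k, ((q p k - t p * t k) * (q p k - t p * t k)).trace) := by
  have hB := trB t2
  -- the pieces
  have p1 : ∑ p, ∑ k, ∑ n, (t p * t p) k n * (t k * t n).trace = cBB t := by
    rw [Finset.sum_comm]
    have : ∀ k, ∑ p, ∑ n, (t p * t p) k n * (t k * t n).trace = ∑ n, cB t k n ^ 2 := by
      intro k
      rw [Finset.sum_comm]
      refine Finset.sum_congr rfl fun n _ => ?_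
      rw [← Finset.sum_mul, sqB t1 t2, hB, sq]
    simp only [this]; rfl
  have p2 : ∑ p, ∑ k, ∑ n, q p p k n * (t k * t n).trace =
      ∑ a, ∑ b, ψ2 a b * cB t a b + cBB t := by
    rw [Finset.sum_comm, cBB, ← Finset.sum_add_distrib]
    refine Finset.sum_congr rfl fun k _ => ?_
    rw [Finset.sum_comm, ← Finset.sum_add_distrib]
    refine Finset.sum_congr rfl fun n _ => ?_
    rw [← Finset.sum_mul, hQ, hB]; ring
  have p7 : ∑ p, ∑ k, (q p p * (t k * t k)).trace = ∑ a, ∑ b, ψ2 a b * cB t a b + cBB t := by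
    have : ∑ p, ∑ k, (q p p * (t k * t k)).trace = ∑ a, ∑ b, (∑ p, q p p a b) * ∑ k, (t k * t k) b a := by
      simp only [Matrix.trace, Matrix.diag_apply]
      simp only [Matrix.mul_apply (M := q _ _)]
      simp only [Finset.sum_mul_sum]
      rw [sum4, sum4]
      exact Fintype.sum_equiv ⟨fun (p,k,a,b) => (a,b,p,k), fun (a,b,p,k) => (p,k,a,b),
        fun _ => rfl, fun _ => rfl⟩ _ _ fun ⟨a,b,c,d⟩ => rfl
    rw [this, cBB, ← Finset.sum_add_distrib]
    refine Finset.sum_congr rfl fun a _ => ?_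
    rw [← Finset.sum_add_distrib]
    refine Finset.sum_congr rfl fun b _ => ?_
    have hs : cB t b a = cB t a b := by
      rw [← hB, ← hB, Matrix.trace_mul_comm]
    rw [sqB t1 t2, hQ, hB, hs]; ring
  have p8 : ∑ p, ∑ k, (t p * t p * (t k * t k)).trace = cBB t := by
    have : ∑ p, ∑ k, (t p * t p * (t k * t k)).trace =
        ∑ a, ∑ b, (∑ p, (t p * t p) a b) * ∑ k, (t k * t k) b a := by
      have h : ∀ p k, (t p * t p * (t k * t k)).trace = ∑ a, ∑ b, (t p * t p) a b * (t k * t k) b a :=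
        fun p k => rfl
      simp only [h, Finset.sum_mul_sum]
      rw [sum4, sum4]
      exact Fintype.sum_equiv ⟨fun (p,k,a,b) => (a,b,p,k), fun (a,b,p,k) => (p,k,a,b),
        fun _ => rfl, fun _ => rfl⟩ _ _ fun ⟨a,b,c,d⟩ => rfl
    rw [this, cBB]
    refine Finset.sum_congr rfl fun a _ => Finset.sum_congr rfl fun b _ => ?_
    have hs : cB t b a = cB t a b := by
      rw [← hB, ← hB, Matrix.trace_mul_comm]
    rw [sqB t1 t2, sqB t1 t2, hs, sq]
  have p9 : ∑ p, ∑ k, (q p k * q p k).trace = cQQ q := by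
    simp only [Matrix.trace, Matrix.diag_apply, Matrix.mul_apply, cQQ]
    exact Finset.sum_congr rfl fun a _ => Finset.sum_congr rfl fun b _ =>
      Finset.sum_congr rfl fun c _ => Finset.sum_congr rfl fun d _ => by rw [q3 a b d c, sq]
  have p9c : ∑ p, ∑ k, (t p * t k * q p k).trace = cXQ t q := by
    rw [← A9b t1 t2 q1 q2 q3]
    exact Finset.sum_congr rfl fun a _ => Finset.sum_congr rfl fun b _ => Matrix.trace_mul_comm _ _
  have p5 : ∑ p, ∑ k, (P p k * t k).trace = ∑ k, ∑ a, ∑ b, ψ3 k a b * t k b a + 3 * cXQ t q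
      - 2 * cCC t := by
    have h1 : ∑ p, ∑ k, (P p k * t k).trace = ∑ k, ∑ a, ∑ b, (∑ p, P p k a b) * t k b a := by
      simp only [Matrix.trace, Matrix.diag_apply, Matrix.mul_apply, Finset.sum_mul]
      rw [sum4, sum4]
      exact Fintype.sum_equiv ⟨fun (p,k,a,b) => (k,a,b,p), fun (k,a,b,p) => (p,k,a,b),
        fun _ => rfl, fun _ => rfl⟩ _ _ fun ⟨a,b,c,d⟩ => rfl
    rw [h1]
    simp only [hP, add_mul, sub_mul, Finset.sum_add_distrib, Finset.sum_sub_distrib]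
    rw [A5a t1 t2 q1 q2 q3, A5b t1 t2 q1 q2 q3, A5c t1 t2 q1 q2 q3, A5d t1 t2, A5e t1 t2]
    ring
  have a3 := A3 t1 t2 q1 q2 q3
  have a6 := A6 t1 t2 q1 q2 q3
  have a9b := A9b t1 t2 q1 q2 q3
  have a4 := A4 t1 t2
  have a9 := A9 t1 t2
  have hy := QY_ineq t1 t2 q1 q2 q3
  have hc := CC_le (t := t)
  simp only [sub_mul, mul_sub, Matrix.trace_sub, Finset.sum_add_distrib, Finset.sum_sub_distrib,
    mul_add, mul_assoc (2 : ℝ), ← Finset.mul_sum] at *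
  linarith

theorem BB_ge : cS t ^ 2 ≤ m * cBB t := by
  have h1 : cS t = ∑ i, cB t i i := by
    simp only [cS, cB, sq]
  have h2 : (∑ i, cB t i i) ^ 2 ≤ m * ∑ i, cB t i i ^ 2 := by
    have := sq_sum_le_card_mul_sum_sq (s := Finset.univ) (f := fun i => cB t i i)
    simpa using this
  have h3 : ∑ i, cB t i i ^ 2 ≤ cBB t := by
    refine Finset.sum_le_sum fun i _ => ?_
    exact Finset.single_le_sum (f := fun j => cB t i j ^ 2) (fun _ _ => sq_nonneg _) (Finset.mem_univ i)
  rw [h1]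
  exact h2.trans (by gcongr)

end alg2
end CY
end

section
open scoped ContDiff
open scoped ContDiff
namespace CY
variable {m : ℕ} {ι : Type}

/-- mixed third derivative matrices -/
def GN.M (g : GN m) (v : Euc m) : Matrix (Fin m) (Fin m) (SF m) := g.N * dM v g.G

/-- Gram matrix of third derivatives -/
def GN.S (g : GN m) (b : Fin m → Euc m) : Matrix (Fin m) (Fin m) (SF m) :=
  fun k n => (g.M (b k) * g.M (b n)).trace

/-- Calabi's function -/
def GN.sig (g : GN m) (b : Fin m → Euc m) : SF m := (g.N * g.S b).trace

theorem GN.M_fr (g : GN m) (F F' : Matrix (Fin m) (Fin m) ℝ) (h : F * F' = 1) (h' : F' * F = 1)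
    (v : Euc m) : (g.fr F F' h h').M v = cM F' * g.M v * cM F := by
  unfold GN.M
  change (cM F' * g.N * (cM F').transpose) * dM v ((cM F).transpose * g.G * cM F) = _
  rw [dM_conj]
  calc _ = cM F' * (g.N * ((cM F').transpose * (cM F).transpose) * dM v g.G) * cM F := by
        simp only [Matrix.mul_assoc]
    _ = _ := by rw [cMFt h, Matrix.mul_one]

theorem GN.M_frv (g : GN m) (F : Matrix (Fin m) (Fin m) ℝ) (a : Fin m) :
    g.M (CY.fr F a) = ∑ i, F i a • g.M (e i) := by
  unfold GN.M
  rw [dM_fr, Matrix.mul_sum]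
  exact Finset.sum_congr rfl fun i _ => Matrix.mul_smul _ _ _

theorem GN.S_fr (g : GN m) (F F' : Matrix (Fin m) (Fin m) ℝ) (h : F * F' = 1) (h' : F' * F = 1) :
    (g.fr F F' h h').S (CY.fr F) = (cM F).transpose * g.S e * cM F := by
  ext1 a b
  have h1 : (g.fr F F' h h').S (CY.fr F) a b = (g.M (CY.fr F a) * g.M (CY.fr F b)).trace := by
    unfold GN.S
    rw [M_fr, M_fr]
    calc _ = (cM F' * (g.M (CY.fr F a) * (cM F * cM F') * g.M (CY.fr F b) * cM F)).trace := by
          simp only [Matrix.mul_assoc]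
      _ = (g.M (CY.fr F a) * g.M (CY.fr F b) * (cM F * cM F')).trace := by
          rw [cMF h, Matrix.mul_one, Matrix.trace_mul_comm]; simp only [Matrix.mul_assoc]; rw [cMF h]
      _ = _ := by rw [cMF h, Matrix.mul_one]
  rw [h1, M_frv, M_frv]
  simp only [Matrix.sum_mul, Matrix.mul_sum, Matrix.trace_sum, Matrix.smul_mul, Matrix.mul_smul,
    Matrix.trace_smul, Matrix.mul_apply, Matrix.transpose_apply, cM, Matrix.map_apply,
    Finset.sum_mul]
  rw [Finset.sum_comm]
  refine Finset.sum_congr rfl fun i _ => Finset.sum_congr rfl fun j _ => ?_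
  change F i b • F j a • g.S e j i = _
  ext x; simp; ring

theorem GN.sig_fr (g : GN m) (F F' : Matrix (Fin m) (Fin m) ℝ) (h : F * F' = 1) (h' : F' * F = 1) :
    (g.fr F F' h h').sig (CY.fr F) = g.sig e := by
  unfold GN.sig
  rw [S_fr]
  exact trace_cyc3 _ _ _ _ (cMF h)

/-- Calabi's function -/
def Sol.σ (s : Sol m) : SF m := s.gn.sig e

variable {s : Sol m} {x : Euc m}

theorem Frame.σ_eq (f : Frame s x) : s.σ = f.g.sig f.b := (s.gn.sig_fr f.F f.F' f.h f.h').symm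

/-- third derivatives -/
def Frame.t (f : Frame s x) (a : Fin m) : Matrix (Fin m) (Fin m) ℝ := eM x (dM (f.b a) f.g.G)
/-- fourth derivatives -/
def Frame.q (f : Frame s x) (a b : Fin m) : Matrix (Fin m) (Fin m) ℝ :=
  eM x (dM (f.b a) (dM (f.b b) f.g.G))
/-- fifth derivatives -/
def Frame.P (f : Frame s x) (a b : Fin m) : Matrix (Fin m) (Fin m) ℝ :=
  eM x (dM (f.b a) (dM (f.b a) (dM (f.b b) f.g.G)))

theorem Frame.t_apply (f : Frame s x) (a b c : Fin m) :
    f.t a b c = D (f.b a) (D (f.b b) (D (f.b c) s.u)) x := by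
  rw [Frame.t, f.G_eq]; rfl
theorem Frame.q_apply (f : Frame s x) (a b c d : Fin m) :
    f.q a b c d = D (f.b a) (D (f.b b) (D (f.b c) (D (f.b d) s.u))) x := by
  rw [Frame.q, f.G_eq]; rfl
theorem Frame.P_apply (f : Frame s x) (a b c d : Fin m) :
    f.P a b c d = D (f.b a) (D (f.b a) (D (f.b b) (D (f.b c) (D (f.b d) s.u)))) x := by
  rw [Frame.P, f.G_eq]; rfl

theorem Frame.t1 (f : Frame s x) (a b c : Fin m) : f.t a b c = f.t b a c := by
  simp only [f.t_apply]; rw [D_comm (f.b a)]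
theorem Frame.t2 (f : Frame s x) (a b c : Fin m) : f.t a b c = f.t a c b := by
  simp only [f.t_apply]; rw [D_comm (f.b b)]
theorem Frame.q1 (f : Frame s x) (a b c d : Fin m) : f.q a b c d = f.q b a c d := by
  simp only [f.q_apply]; rw [D_comm (f.b a)]
theorem Frame.q2 (f : Frame s x) (a b c d : Fin m) : f.q a b c d = f.q a c b d := by
  simp only [f.q_apply]; rw [D_comm (f.b b)]
theorem Frame.q3 (f : Frame s x) (a b c d : Fin m) : f.q a b c d = f.q a b d c := by
  simp only [f.q_apply]; rw [D_comm (f.b c)]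

theorem GN.dM_M (g : GN m) (v w : Euc m) : dM v (g.M w) = g.N * dM v (dM w g.G) - g.M v * g.M w := by
  unfold GN.M
  rw [dM_mul, g.dN]
  simp only [Matrix.neg_mul, Matrix.mul_assoc]
  abel

theorem GN.dN' (g : GN m) (v : Euc m) : dM v g.N = -(g.M v * g.N) := g.dN v

theorem Frame.eM_M (f : Frame s x) (a : Fin m) : eM x (f.g.M (f.b a)) = f.t a := by
  rw [GN.M, eM_mul, f.eN, Matrix.one_mul]; rfl

theorem Frame.eM_dM (f : Frame s x) (p k : Fin m) : eM x (dM (f.b p) (f.g.M (f.b k))) =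
    f.q p k - f.t p * f.t k := by
  rw [GN.dM_M, eM_sub, eM_mul, eM_mul, f.eN, f.eM_M, f.eM_M, Matrix.one_mul]; rfl

theorem Frame.eM_dN (f : Frame s x) (p : Fin m) : eM x (dM (f.b p) f.g.N) = - f.t p := by
  rw [GN.dN', eM_neg, eM_mul, f.eN, f.eM_M, Matrix.mul_one]

theorem Frame.eM_ddM (f : Frame s x) (p k : Fin m) :
    eM x (dM (f.b p) (dM (f.b p) (f.g.M (f.b k)))) =
    f.P p k - f.t p * f.q p k - f.t p * f.q p k - f.q p p * f.t k + f.t p * f.t p * f.t k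
      + f.t p * f.t p * f.t k := by
  rw [GN.dM_M, dM_sub, dM_mul, dM_mul, eM_sub, eM_add, eM_add, eM_mul, eM_mul, eM_mul, eM_mul,
    f.eN, f.eM_M, f.eM_M, f.eM_dM, f.eM_dM, f.eM_dN]
  change -f.t p * f.q p k + 1 * f.P p k - _ = _
  simp only [Matrix.one_mul, Matrix.neg_mul, Matrix.sub_mul, Matrix.mul_sub, Matrix.mul_assoc]
  abel

theorem Frame.eM_ddN (f : Frame s x) (p : Fin m) :
    eM x (dM (f.b p) (dM (f.b p) f.g.N)) = f.t p * f.t p + f.t p * f.t p - f.q p p := by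
  rw [GN.dN', dM_neg, dM_mul, eM_neg, eM_add, eM_mul, eM_mul, f.eN, f.eM_M, f.eM_dM, f.eM_dN]
  simp only [Matrix.mul_one, Matrix.mul_neg]
  abel

theorem Frame.S_x (f : Frame s x) (k n : Fin m) : f.g.S f.b k n x = (f.t k * f.t n).trace := by
  rw [GN.S, eM_trace, eM_mul, f.eM_M, f.eM_M]

theorem Frame.S_D (f : Frame s x) (p k n : Fin m) : D (f.b p) (f.g.S f.b k n) x =
    ((f.q p k - f.t p * f.t k) * f.t n).trace + (f.t k * (f.q p n - f.t p * f.t n)).trace := by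
  rw [GN.S, D_trace, dM_mul, eM_trace, eM_add, eM_mul, eM_mul, f.eM_M, f.eM_M, f.eM_dM, f.eM_dM,
    Matrix.trace_add]

theorem Frame.S_DD (f : Frame s x) (p k : Fin m) : D (f.b p) (D (f.b p) (f.g.S f.b k k)) x =
    2 * ((f.P p k - f.t p * f.q p k - f.t p * f.q p k - f.q p p * f.t k + f.t p * f.t p * f.t k
      + f.t p * f.t p * f.t k) * f.t k).trace +
    2 * ((f.q p k - f.t p * f.t k) * (f.q p k - f.t p * f.t k)).trace := by
  rw [GN.S, D_trace, dM_mul, D_trace, dM_add, dM_mul, dM_mul, eM_trace]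
  simp only [eM_add, eM_mul, f.eM_M, f.eM_dM, f.eM_ddM, Matrix.trace_add]
  rw [Matrix.trace_mul_comm (f.t k)]
  ring

theorem Frame.σ_DD (f : Frame s x) (p : Fin m) : D (f.b p) (D (f.b p) s.σ) x =
    ∑ k, ∑ n, (2 * (f.t p * f.t p) k n - f.q p p k n) * (f.t k * f.t n).trace
      - 4 * ∑ k, ∑ n, f.t p k n * ((f.q p k - f.t p * f.t k) * f.t n).trace
      + 2 * ∑ k, ((f.P p k * f.t k).trace - 2 * (f.t p * f.q p k * f.t k).trace
        - (f.q p p * (f.t k * f.t k)).trace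
        + 2 * (f.t p * f.t p * (f.t k * f.t k)).trace)
      + 2 * ∑ k, ((f.q p k - f.t p * f.t k) * (f.q p k - f.t p * f.t k)).trace := by
  rw [f.σ_eq, GN.sig, D_trace, dM_mul, D_trace, dM_add, dM_mul, dM_mul, eM_trace]
  simp only [eM_add, eM_mul, f.eN, f.eM_dN, f.eM_ddN, Matrix.trace_add, Matrix.one_mul,
    Matrix.neg_mul, Matrix.trace_neg]
  have h1 : ((f.t p * f.t p + f.t p * f.t p - f.q p p) * eM x (f.g.S f.b)).trace =
      ∑ k, ∑ n, (2 * (f.t p * f.t p) k n - f.q p p k n) * (f.t k * f.t n).trace := by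
    simp only [Matrix.trace, Matrix.diag_apply]
    refine Finset.sum_congr rfl fun k _ => ?_
    rw [Matrix.mul_apply]
    refine Finset.sum_congr rfl fun n _ => ?_
    rw [eM_apply, f.S_x, Matrix.trace_mul_comm]
    change _ * Matrix.trace _ = _ * Matrix.trace _
    congr 1
    simp only [Matrix.sub_apply, Matrix.add_apply]; ring
  have h2 : (f.t p * eM x (dM (f.b p) (f.g.S f.b))).trace =
      2 * ∑ k, ∑ n, f.t p k n * ((f.q p k - f.t p * f.t k) * f.t n).trace := by
    have : (f.t p * eM x (dM (f.b p) (f.g.S f.b))).trace =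
      ∑ k, ∑ n, (f.t p k n * ((f.q p n - f.t p * f.t n) * f.t k).trace
         + f.t p k n * ((f.q p k - f.t p * f.t k) * f.t n).trace) := by
      simp only [Matrix.trace, Matrix.diag_apply]
      refine Finset.sum_congr rfl fun k _ => ?_
      rw [Matrix.mul_apply]
      refine Finset.sum_congr rfl fun n _ => ?_
      rw [eM_apply, dM_apply, f.S_D, mul_add, Matrix.trace_mul_comm (f.t n)]
      rfl
    rw [this]
    simp only [Finset.sum_add_distrib]
    rw [two_mul]
    congr 1
    rw [Finset.sum_comm]
    refine Finset.sum_congr rfl fun k _ => Finset.sum_congr rfl fun n _ => ?_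
    rw [f.t2 p n k]
  have h3 : (eM x (dM (f.b p) (dM (f.b p) (f.g.S f.b)))).trace =
      2 * ∑ k, ((f.P p k * f.t k).trace - 2 * (f.t p * f.q p k * f.t k).trace
        - (f.q p p * (f.t k * f.t k)).trace
        + 2 * (f.t p * f.t p * (f.t k * f.t k)).trace)
      + 2 * ∑ k, ((f.q p k - f.t p * f.t k) * (f.q p k - f.t p * f.t k)).trace := by
    have : (eM x (dM (f.b p) (dM (f.b p) (f.g.S f.b)))).trace =
      ∑ k, D (f.b p) (D (f.b p) (f.g.S f.b k k)) x := rfl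
    rw [this, Finset.mul_sum, Finset.mul_sum, ← Finset.sum_add_distrib]
    refine Finset.sum_congr rfl fun k _ => ?_
    rw [f.S_DD]
    congr 1
    simp only [Matrix.add_mul, Matrix.sub_mul, Matrix.trace_add, Matrix.trace_sub, Matrix.mul_assoc]
    ring
  rw [h1, h2, h3]
  ring

theorem Frame.tr3 (f : Frame s x) (k a b : Fin m) : ∑ p, f.P p k a b =
    D (f.b k) (D (f.b a) (D (f.b b) s.ψ)) x + (f.t k * f.q a b).trace + (f.q k a * f.t b).trace
      + (f.t a * f.q k b).trace - (f.t k * (f.t a * f.t b)).trace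
      - (f.t a * (f.t k * f.t b)).trace := by
  have := congrArg (fun φ : SF m => φ x) (f.g.tr3 (f.b b) (f.b a) (f.b k))
  simp only [SF.add_apply, SF.sub_apply, eM_trace, eM_mul, f.eN, Matrix.one_mul] at this
  rw [f.ψ_eq] at this
  refine Eq.trans ?_ this
  rw [f.G_eq]
  simp only [Matrix.trace, Matrix.diag_apply]
  refine Finset.sum_congr rfl fun p _ => ?_
  rw [f.P_apply, eM_apply, dM_apply, dM_apply, dM_apply, Hf]
  congr 1
  rw [D_comm (f.b p) (f.b k), D_comm (f.b p) (f.b k), D_comm (f.b p) (f.b a), D_comm (f.b p) (f.b a),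
    D_comm (f.b p) (f.b b), D_comm (f.b p) (f.b b)]

theorem Frame.trQ (f : Frame s x) (a b : Fin m) : ∑ p, f.q p p a b =
    D (f.b a) (D (f.b b) s.ψ) x + (f.t a * f.t b).trace := by
  have := congrArg (fun φ : SF m => φ x) (f.g.tr2 (f.b b) (f.b a))
  simp only [SF.add_apply, SF.sub_apply, eM_trace, eM_mul, f.eN, Matrix.one_mul] at this
  rw [f.ψ_eq] at this
  refine Eq.trans ?_ this
  rw [f.G_eq]
  simp only [Matrix.trace, Matrix.diag_apply]
  refine Finset.sum_congr rfl fun p _ => ?_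
  rw [f.q_apply, eM_apply, dM_apply, dM_apply, Hf]
  congr 1
  rw [D_comm (f.b p) (f.b a), D_comm (f.b p) (f.b a), D_comm (f.b p) (f.b b), D_comm (f.b p) (f.b b)]

theorem Frame.Lσ (f : Frame s x) :
    (cBB f.t) / 2 + 2 * (∑ k, ∑ a, ∑ b, D (f.b k) (D (f.b a) (D (f.b b) s.ψ)) x * f.t k b a)
      - 3 * (∑ a, ∑ b, D (f.b a) (D (f.b b) s.ψ) x * cB f.t a b) ≤ s.L s.σ x := by
  rw [f.L_apply]
  simp only [f.σ_DD]
  exact cal_alg f.P (fun a b => D (f.b a) (D (f.b b) s.ψ) x)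
    (fun k a b => D (f.b k) (D (f.b a) (D (f.b b) s.ψ)) x) f.t1 f.t2 f.q1 f.q2 f.q3
    f.trQ f.tr3

theorem Frame.σ_x (f : Frame s x) : s.σ x = cS f.t := by
  rw [f.σ_eq, GN.sig, eM_trace, eM_mul, f.eN, Matrix.one_mul]
  simp only [Matrix.trace, Matrix.diag_apply, eM_apply, f.S_x, cS]
  refine Finset.sum_congr rfl fun a _ => ?_
  have := trB f.t2 a a
  rw [Matrix.trace] at this
  simp only [Matrix.diag_apply] at this
  rw [this, cB]
  simp only [sq]

end CY
end

section
open scoped ContDiff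
open scoped ContDiff
namespace CY
variable {m : ℕ} {ι : Type}
variable {s : Sol m} {x : Euc m}

theorem abs_le_of_sq' {c Λ : ℝ} (h1 : 1 ≤ Λ) (h : c ^ 2 ≤ Λ) : |c| ≤ Λ :=
  abs_le_of_sq_le_sq (by nlinarith) (by linarith)

theorem lin_abs {Λ C : ℝ} (h0 : 0 ≤ Λ) (c t : Fin m → ℝ) (hc : ∀ a, |c a| ≤ Λ) (ht : ∀ a, |t a| ≤ C) :
    |∑ a, c a * t a| ≤ m * Λ * C := by
  refine (Finset.abs_sum_le_sum_abs _ _).trans ?_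
  calc _ ≤ ∑ _a : Fin m, Λ * C := Finset.sum_le_sum fun a _ => by
        rw [abs_mul]
        exact mul_le_mul (hc a) (ht a) (abs_nonneg _) h0
    _ = _ := by simp [mul_assoc]

theorem Frame.Db_le (f : Frame s x) {Λ C : ℝ} (h0 : 0 ≤ Λ) (hΛ : ∀ j a, |f.F j a| ≤ Λ) (φ : SF m)
    (h : ∀ i, |D (e i) φ x| ≤ C) (a : Fin m) : |D (f.b a) φ x| ≤ m * Λ * C := by
  rw [f.Db]
  simp only [SF.sum_apply, SF.smul_apply]
  exact lin_abs h0 (fun i => f.F i a) _ (fun i => hΛ i a) h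

theorem Frame.De_le (f : Frame s x) {Λ C : ℝ} (h0 : 0 ≤ Λ) (hΛ : ∀ a j, |f.F' a j| ≤ Λ) (φ : SF m)
    (h : ∀ i, |D (f.b i) φ x| ≤ C) (j : Fin m) : |D (e j) φ x| ≤ m * Λ * C := by
  rw [f.De]
  exact lin_abs h0 (fun i => f.F' i j) _ (fun i => hΛ i j) h

theorem Frame.Db2_le (f : Frame s x) {Λ C : ℝ} (h0 : 0 ≤ Λ) (hΛ : ∀ j a, |f.F j a| ≤ Λ) (φ : SF m)
    (h : ∀ i j, |D (e i) (D (e j) φ) x| ≤ C) (a b : Fin m) :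
    |D (f.b a) (D (f.b b) φ) x| ≤ m * Λ * (m * Λ * C) := by
  refine f.Db_le h0 hΛ _ (fun i => ?_) a
  rw [D_comm]
  exact f.Db_le h0 hΛ _ (fun j => h j i) b

theorem Frame.Db3_le (f : Frame s x) {Λ C : ℝ} (h0 : 0 ≤ Λ) (hΛ : ∀ j a, |f.F j a| ≤ Λ) (φ : SF m)
    (h : ∀ i j k, |D (e i) (D (e j) (D (e k) φ)) x| ≤ C) (a b c : Fin m) :
    |D (f.b a) (D (f.b b) (D (f.b c) φ)) x| ≤ m * Λ * (m * Λ * (m * Λ * C)) := by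
  refine f.Db_le h0 hΛ _ (fun i => ?_) a
  rw [D_comm, D_comm (e i)]
  exact f.Db2_le h0 hΛ _ (fun j k => h j k i) b c

theorem Frame.De3_le (f : Frame s x) {Λ C : ℝ} (h0 : 0 ≤ Λ) (hΛ : ∀ a j, |f.F' a j| ≤ Λ) (φ : SF m)
    (h : ∀ i j k, |D (f.b i) (D (f.b j) (D (f.b k) φ)) x| ≤ C) (a b c : Fin m) :
    |D (e a) (D (e b) (D (e c) φ)) x| ≤ m * Λ * (m * Λ * (m * Λ * C)) := by
  refine f.De_le h0 hΛ _ (fun i => ?_) a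
  rw [D_comm, D_comm (f.b i)]
  refine f.De_le h0 hΛ _ (fun j => ?_) b
  rw [D_comm]
  exact f.De_le h0 hΛ _ (fun k => h k j i) c

theorem Frame.Lσ2 (f : Frame s x) {H2 H3 : ℝ}
    (h2 : ∀ a b, |D (f.b a) (D (f.b b) s.h) x| ≤ H2)
    (h3 : ∀ a b c, |D (f.b a) (D (f.b b) (D (f.b c) s.h)) x| ≤ H3) :
    (1 / (8 * (m + 1))) * s.σ x ^ 2 - (m * (m * (m * H3 ^ 2)) + 9 * (m * (m * H2 ^ 2)) + 32 * (m + 1))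
      ≤ s.L s.σ x := by
  refine le_trans ?_ f.Lσ
  rw [f.σ_x]
  have e2 : ∀ a b, D (f.b a) (D (f.b b) s.ψ) x = 2 * (if a = b then 1 else 0)
      - D (f.b a) (D (f.b b) s.h) x := by
    intro a b
    simp only [Sol.ψ, map_sub, Derivation.map_smul, SF.sub_apply, SF.smul_apply, f.uab]
  have e3 : ∀ a b c, D (f.b a) (D (f.b b) (D (f.b c) s.ψ)) x = 2 * f.t a b c
      - D (f.b a) (D (f.b b) (D (f.b c) s.h)) x := by
    intro a b c
    simp only [Sol.ψ, map_sub, Derivation.map_smul, SF.sub_apply, SF.smul_apply, f.t_apply]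
  have i3 : cS f.t - m * (m * (m * H3 ^ 2)) / 2 ≤
      ∑ k, ∑ a, ∑ b, D (f.b k) (D (f.b a) (D (f.b b) s.ψ)) x * f.t k b a := by
    have : cS f.t - m * (m * (m * H3 ^ 2)) / 2 = ∑ k, ∑ a, ∑ b, (f.t k a b ^ 2 - H3 ^ 2 / 2) := by
      simp only [Finset.sum_sub_distrib, cS]; simp; ring
    rw [this]
    refine Finset.sum_le_sum fun k _ => Finset.sum_le_sum fun a _ => Finset.sum_le_sum fun b _ => ?_
    rw [e3, f.t2 k b a]
    have := sq_abs (D (f.b k) (D (f.b a) (D (f.b b) s.h)) x)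
    have h' := h3 k a b
    have : (D (f.b k) (D (f.b a) (D (f.b b) s.h)) x) ^ 2 ≤ H3 ^ 2 := by
      rw [← this]; gcongr
    nlinarith [sq_nonneg (f.t k a b - D (f.b k) (D (f.b a) (D (f.b b) s.h)) x), sq_nonneg (f.t k a b)]
  have i2 : ∑ a, ∑ b, D (f.b a) (D (f.b b) s.ψ) x * cB f.t a b ≤
      2 * cS f.t + cBB f.t / 12 + 3 * (m * (m * H2 ^ 2)) := by
    have : 2 * cS f.t + cBB f.t / 12 + 3 * (m * (m * H2 ^ 2)) = ∑ a, ∑ b,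
        (2 * (if a = b then cB f.t a b else 0) + cB f.t a b ^ 2 / 12 + 3 * H2 ^ 2) := by
      simp only [Finset.sum_add_distrib, ← Finset.mul_sum, ← Finset.sum_div, cBB]
      simp [cS, cB, sq]
    rw [this]
    refine Finset.sum_le_sum fun a _ => Finset.sum_le_sum fun b _ => ?_
    rw [e2]
    have := sq_abs (D (f.b a) (D (f.b b) s.h) x)
    have h' := h2 a b
    have : (D (f.b a) (D (f.b b) s.h) x) ^ 2 ≤ H2 ^ 2 := by
      rw [← this]; gcongr
    split_ifs <;> nlinarith [sq_nonneg (cB f.t a b + 6 * D (f.b a) (D (f.b b) s.h) x)]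
  have iB := BB_ge (t := f.t)
  have hBB : 0 ≤ cBB f.t := Finset.sum_nonneg fun _ _ => Finset.sum_nonneg fun _ _ => sq_nonneg _
  have hm : (0:ℝ) < m + 1 := by positivity
  have iB' : cS f.t ^ 2 / (m + 1) ≤ cBB f.t := by
    rw [div_le_iff₀ hm]; nlinarith
  have i1 : 4 * cS f.t ≤ cS f.t ^ 2 / (m + 1) / 8 + 32 * (m + 1) := by
    rw [div_div, ← sub_nonneg]
    have : cS f.t ^ 2 / ((m + 1) * 8) + 32 * (m + 1) - 4 * cS f.t =
      (cS f.t - 16 * (m + 1)) ^ 2 / ((m + 1) * 8) := by field_simp; ring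
    rw [this]; positivity
  have i0 : (1 / (8 * ((m:ℝ) + 1))) * cS f.t ^ 2 = cS f.t ^ 2 / (m + 1) / 8 := by field_simp
  rw [i0]
  linarith

theorem Sol.σ_nonneg (s : Sol m) (x : Euc m) : 0 ≤ s.σ x := by
  obtain ⟨f⟩ := s.exists_frame x
  rw [f.σ_x]
  exact Finset.sum_nonneg fun _ _ => Finset.sum_nonneg fun _ _ => Finset.sum_nonneg fun _ _ => sq_nonneg _

theorem Fam.ell' (F : Fam m ι) {δ : ℝ} (hδ : 0 < δ) : ∃ Λ : ℝ, 1 ≤ Λ ∧ ∀ i, ∀ x ∈ F.S δ i,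
    ∀ f : Frame (F.s i) x, (∀ a j, |f.F' a j| ≤ Λ) ∧ (∀ j a, |f.F j a| ≤ Λ) := by
  obtain ⟨Λ, h1, h⟩ := F.ell hδ
  exact ⟨Λ, h1, fun i x hx f => ⟨fun a j => abs_le_of_sq' h1 ((h i x hx f).1 a j),
    fun a j => abs_le_of_sq' h1 ((h i x hx f).2 a j)⟩⟩

theorem Fam.bσ (F : Fam m ι) {δ : ℝ} (hδ : 0 < δ) : (fun i => (F.s i).σ) ∈ Bd (F.S δ) := by
  refine F.lemmaM _ (fun i x => (F.s i).σ_nonneg x) (fun δ hδ => ?_) hδ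
  obtain ⟨Λ, h1, h⟩ := F.ell' hδ
  obtain ⟨C2, -, hC2⟩ := Bd_unif (κ := Fin m × Fin m)
      (f := fun k i => D (e k.1) (D (e k.2) (F.s i).h)) (fun k => F.bh [k.1, k.2])
  obtain ⟨C3, -, hC3⟩ := Bd_unif (κ := Fin m × Fin m × Fin m)
      (f := fun k i => D (e k.1) (D (e k.2.1) (D (e k.2.2) (F.s i).h))) (fun k => F.bh [k.1, k.2.1, k.2.2])
  refine ⟨1 / (8 * (m + 1)), by positivity, m * (m * (m * (m * Λ * (m * Λ * (m * Λ * C3))) ^ 2)) + 9 * (m * (m * (m * Λ * (m * Λ * C2)) ^ 2)) + 32 * (m + 1), fun i x hx => ?_⟩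
  obtain ⟨f⟩ := (F.s i).exists_frame x
  obtain ⟨-, hf⟩ := h i x hx f
  exact f.Lσ2 (f.Db2_le (by linarith) hf _ fun a b => hC2 (a, b) i x hx.1)
    (f.Db3_le (by linarith) hf _ fun a b c => hC3 (a, b, c) i x hx.1)

theorem Fam.b3 (F : Fam m ι) {δ : ℝ} (hδ : 0 < δ) (a b c : Fin m) :
    (fun i => D (e a) (D (e b) (D (e c) (F.s i).u))) ∈ Bd (F.S δ) := by
  obtain ⟨C, hC⟩ := F.bσ hδ
  obtain ⟨Λ, h1, h⟩ := F.ell' hδ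
  refine ⟨m * Λ * (m * Λ * (m * Λ * (|C| + 1))), fun i x hx => ?_⟩
  obtain ⟨f⟩ := (F.s i).exists_frame x
  obtain ⟨hf, -⟩ := h i x hx f
  refine f.De3_le (by linarith) hf _ (C := |C| + 1) (fun p q r => ?_) a b c
  have h2 := hC i x hx
  rw [abs_of_nonneg ((F.s i).σ_nonneg x), f.σ_x] at h2
  rw [← f.t_apply]
  refine abs_le_of_sq' (by linarith [abs_nonneg C]) ?_
  have h3 : f.t p q r ^ 2 ≤ cS f.t := by
    unfold cS
    refine le_trans ?_ (Finset.single_le_sum (f := fun p => ∑ b, ∑ c, f.t p b c ^ 2) (fun _ _ => Finset.sum_nonneg fun _ _ => Finset.sum_nonneg fun _ _ => sq_nonneg _) (Finset.mem_univ p))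
    refine le_trans ?_ (Finset.single_le_sum (f := fun q => ∑ c, f.t p q c ^ 2) (fun _ _ => Finset.sum_nonneg fun _ _ => sq_nonneg _) (Finset.mem_univ q))
    exact Finset.single_le_sum (f := fun r => f.t p q r ^ 2) (fun _ _ => sq_nonneg _) (Finset.mem_univ r)
  linarith [le_abs_self C]

end CY
end

section
open scoped ContDiff
open scoped ContDiff
namespace CY
variable {m : ℕ} {ι : Type}

/-- families with a growth bound -/
def BdG (S : ι → Set (Euc m)) (G : ι → Euc m → ℝ) : AddSubgroup (ι → SF m) where
  carrier := {f | ∃ C : ℝ, 0 ≤ C ∧ ∀ i, ∀ x ∈ S i, (f i x) ^ 2 ≤ C * G i x}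
  zero_mem' := ⟨0, le_rfl, fun i x _ => by change (0:ℝ) ^ 2 ≤ _; simp⟩
  add_mem' := by
    rintro f g ⟨C, h0, hC⟩ ⟨C', h0', hC'⟩
    refine ⟨2 * C + 2 * C', by positivity, fun i x hx => ?_⟩
    change (f i x + g i x) ^ 2 ≤ _
    nlinarith [hC i x hx, hC' i x hx, sq_nonneg (f i x - g i x)]
  neg_mem' := by
    rintro f ⟨C, h0, hC⟩
    refine ⟨C, h0, fun i x hx => ?_⟩
    change (-f i x) ^ 2 ≤ _
    rw [neg_sq]; exact hC i x hx

theorem BdG_mul {S : ι → Set (Euc m)} {G G' G'' : ι → Euc m → ℝ} {f g : ι → SF m} (hf : f ∈ BdG S G)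
    (hg : g ∈ BdG S G') (K : ℝ) (hK : 0 ≤ K) (h : ∀ i x, G i x * G' i x ≤ K * G'' i x) :
    f * g ∈ BdG S G'' := by
  obtain ⟨C, h0, hC⟩ := hf
  obtain ⟨C', h0', hC'⟩ := hg
  refine ⟨C * C' * K, by positivity, fun i x hx => ?_⟩
  change (f i x * g i x) ^ 2 ≤ _
  rw [mul_pow]
  calc _ ≤ (C * G i x) * (C' * G' i x) :=
        mul_le_mul (hC i x hx) (hC' i x hx) (sq_nonneg _) ((sq_nonneg _).trans (hC i x hx))
    _ = C * C' * (G i x * G' i x) := by ring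
    _ ≤ C * C' * (K * G'' i x) := mul_le_mul_of_nonneg_left (h i x) (mul_nonneg h0 h0')
    _ = _ := by ring

theorem BdG_mono {S : ι → Set (Euc m)} {G G' : ι → Euc m → ℝ} {f : ι → SF m} (hf : f ∈ BdG S G)
    (h : ∀ i x, G i x ≤ G' i x) : f ∈ BdG S G' := by
  obtain ⟨C, h0, hC⟩ := hf
  exact ⟨C, h0, fun i x hx => (hC i x hx).trans (mul_le_mul_of_nonneg_left (h i x) h0)⟩

theorem BdG_of_Bd {S : ι → Set (Euc m)} {G : ι → Euc m → ℝ} {f : ι → SF m} (hf : f ∈ Bd S)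
    (h : ∀ i x, 1 ≤ G i x) : f ∈ BdG S G := by
  obtain ⟨C, hC⟩ := hf
  refine ⟨C ^ 2, sq_nonneg _, fun i x hx => ?_⟩
  calc (f i x) ^ 2 = |f i x| ^ 2 := (sq_abs _).symm
    _ ≤ C ^ 2 := by gcongr; exact hC i x hx
    _ ≤ _ := le_mul_of_one_le_right (sq_nonneg _) (h i x)

theorem Dp_mul (v : Euc m) (f g : ι → SF m) : Dp v (f * g) = f * Dp v g + g * Dp v f := by
  funext i; exact (D v).leibniz (f i) (g i)
theorem Dp_add (v : Euc m) (f g : ι → SF m) : Dp v (f + g) = Dp v f + Dp v g := by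
  funext i; exact map_add (D v) (f i) (g i)
theorem Dp_neg (v : Euc m) (f : ι → SF m) : Dp v (-f) = -Dp v f := by
  funext i; exact map_neg (D v) (f i)
theorem Dp_sub (v : Euc m) (f g : ι → SF m) : Dp v (f - g) = Dp v f - Dp v g := by
  funext i; exact map_sub (D v) (f i) (g i)
theorem Dp_smul (v : Euc m) (r : ℝ) (f : ι → SF m) : Dp v (r • f) = r • Dp v f := by
  funext i; exact (D v).map_smul r (f i)
theorem Dp_sum {κ : Type*} (t : Finset κ) (v : Euc m) (f : κ → ι → SF m) :
    Dp v (∑ k ∈ t, f k) = ∑ k ∈ t, Dp v (f k) := by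
  funext i; simp only [Dp, Finset.sum_apply, map_sum]
theorem Dp_algebraMap (v : Euc m) (r : ℝ) : Dp v (algebraMap ℝ (ι → SF m) r) = 0 := by
  funext i; exact (D v).map_algebraMap r
theorem Dp_comm (v w : Euc m) (f : ι → SF m) : Dp v (Dp w f) = Dp w (Dp v f) := by
  funext i; exact D_comm v w (f i)

/-- the three growth classes give an algebra -/
def PA (S : ι → Set (Euc m)) (Y Z : ι → Euc m → ℝ) (hY : ∀ i x, 0 ≤ Y i x) (hZ : ∀ i x, 0 ≤ Z i x) :
    Subalgebra ℝ (ι → SF m) where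
  carrier := {f | f ∈ Bd S ∧ (∀ j, Dp (e j) f ∈ BdG S (fun i x => 1 + Y i x)) ∧
    ∀ j k, Dp (e j) (Dp (e k) f) ∈ BdG S (fun i x => 1 + Y i x ^ 2 + Z i x)}
  mul_mem' := by
    rintro f g ⟨f0, f1, f2⟩ ⟨g0, g1, g2⟩
    have m01 : ∀ {a b : ι → SF m}, a ∈ Bd S → b ∈ BdG S (fun i x => 1 + Y i x) →
        a * b ∈ BdG S (fun i x => 1 + Y i x) := fun ha hb =>
      BdG_mul (BdG_of_Bd (G := fun _ _ => 1) ha (fun _ _ => le_rfl)) hb 1 zero_le_one (fun i x => by simp)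
    have m02 : ∀ {a b : ι → SF m}, a ∈ Bd S → b ∈ BdG S (fun i x => 1 + Y i x ^ 2 + Z i x) →
        a * b ∈ BdG S (fun i x => 1 + Y i x ^ 2 + Z i x) := fun ha hb =>
      BdG_mul (BdG_of_Bd (G := fun _ _ => 1) ha (fun _ _ => le_rfl)) hb 1 zero_le_one (fun i x => by simp)
    have m11 : ∀ {a b : ι → SF m}, a ∈ BdG S (fun i x => 1 + Y i x) →
        b ∈ BdG S (fun i x => 1 + Y i x) → a * b ∈ BdG S (fun i x => 1 + Y i x ^ 2 + Z i x) :=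
      fun ha hb => BdG_mul ha hb 2 zero_le_two (fun i x => by
        nlinarith [hZ i x, sq_nonneg (Y i x - 1)])
    refine ⟨mul_mem f0 g0, fun j => ?_, fun j k => ?_⟩
    · rw [Dp_mul]; exact add_mem (m01 f0 (g1 j)) (m01 g0 (f1 j))
    · rw [Dp_mul, Dp_add, Dp_mul, Dp_mul]
      exact add_mem (add_mem (m02 f0 (g2 j k)) (m11 (g1 k) (f1 j)))
        (add_mem (m02 g0 (f2 j k)) (m11 (f1 k) (g1 j)))
  add_mem' := by
    rintro f g ⟨f0, f1, f2⟩ ⟨g0, g1, g2⟩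
    refine ⟨add_mem f0 g0, fun j => ?_, fun j k => ?_⟩
    · rw [Dp_add]; exact add_mem (f1 j) (g1 j)
    · rw [Dp_add, Dp_add]; exact add_mem (f2 j k) (g2 j k)
  algebraMap_mem' := fun r => by
    refine ⟨Subalgebra.algebraMap_mem _ r, fun j => ?_, fun j k => ?_⟩
    · rw [Dp_algebraMap]; exact zero_mem _
    · rw [Dp_algebraMap]
      have : Dp (e j) (0 : ι → SF m) = 0 := by funext i; exact map_zero _
      rw [this]; exact zero_mem _

/-- inverse matrix family -/
def Fam.NF (F : Fam m ι) (a b : Fin m) : ι → SF m := fun i => (F.s i).gn.N a b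
/-- derivative family of u -/
def Fam.ul (F : Fam m ι) (l : List (Fin m)) : ι → SF m := fun i => dl l (F.s i).u
/-- derivative family of h -/
def Fam.hl (F : Fam m ι) (l : List (Fin m)) : ι → SF m := fun i => dl l (F.s i).h
/-- linearized operator on families -/
def Fam.LF (F : Fam m ι) (φ : ι → SF m) : ι → SF m := fun i => (F.s i).L (φ i)

theorem Fam.ul_cons (F : Fam m ι) (j : Fin m) (l) : F.ul (j :: l) = Dp (e j) (F.ul l) := rfl
theorem Fam.hl_cons (F : Fam m ι) (j : Fin m) (l) : F.hl (j :: l) = Dp (e j) (F.hl l) := rfl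

theorem Fam.LF_eq (F : Fam m ι) (φ : ι → SF m) :
    F.LF φ = ∑ a, ∑ b, F.NF a b * Dp (e b) (Dp (e a) φ) := by
  funext i
  simp only [Fam.LF, Sol.L, Matrix.trace, Matrix.diag_apply, Matrix.mul_apply, Finset.sum_apply]
  rfl

theorem Fam.LF_D (F : Fam m ι) (v : Euc m) (φ : ι → SF m) : F.LF (Dp v φ) = Dp v (F.LF φ) -
    ∑ a, ∑ b, Dp v (F.NF a b) * Dp (e b) (Dp (e a) φ) := by
  rw [F.LF_eq, F.LF_eq, Dp_sum, ← Finset.sum_sub_distrib]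
  refine Finset.sum_congr rfl fun a _ => ?_
  rw [Dp_sum, ← Finset.sum_sub_distrib]
  refine Finset.sum_congr rfl fun b _ => ?_
  rw [Dp_mul, Dp_comm (e a) v, Dp_comm (e b) v]
  ring

theorem Fam.DNF (F : Fam m ι) (v : Euc m) (a b : Fin m) : Dp v (F.NF a b) =
    -∑ d, ∑ c, F.NF a c * Dp v (F.ul [c, d]) * F.NF d b := by
  funext i
  have := congrFun (congrFun ((F.s i).gn.dN v) a) b
  rw [dM_apply] at this
  refine this.trans ?_
  simp only [Matrix.neg_apply, Matrix.mul_apply, Pi.neg_apply, Finset.sum_apply, Finset.sum_mul]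
  rfl

theorem Fam.LF_u (F : Fam m ι) (j : Fin m) :
    F.LF (F.ul [j]) = (2:ℝ) • F.ul [j] - F.hl [j] := by
  funext i
  ext x
  obtain ⟨f⟩ := (F.s i).exists_frame x
  have h := f.tr1 (e j)
  change (F.s i).L (D (e j) (F.s i).u) x = _
  rw [f.L_apply]
  simp only [D_comm _ (e j)]
  rw [h]
  simp only [Sol.ψ, map_sub, Derivation.map_smul, SF.sub_apply, SF.smul_apply]
  rfl

/-- differential polynomials of order at most `r` -/
def Fam.A (F : Fam m ι) (r : ℕ) : Subalgebra ℝ (ι → SF m) :=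
  Algebra.adjoin ℝ ({f | ∃ a b, f = F.NF a b} ∪ {f | ∃ l, f = F.hl l} ∪
    {f | ∃ l, l.length ≤ r ∧ f = F.ul l})

theorem Fam.A_N (F : Fam m ι) (r : ℕ) (a b : Fin m) : F.NF a b ∈ F.A r :=
  Algebra.subset_adjoin (Or.inl (Or.inl ⟨a, b, rfl⟩))
theorem Fam.A_h (F : Fam m ι) (r : ℕ) (l) : F.hl l ∈ F.A r :=
  Algebra.subset_adjoin (Or.inl (Or.inr ⟨l, rfl⟩))
theorem Fam.A_u (F : Fam m ι) (r : ℕ) (l) (h : l.length ≤ r) : F.ul l ∈ F.A r :=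
  Algebra.subset_adjoin (Or.inr ⟨l, h, rfl⟩)

theorem Fam.A_DN (F : Fam m ι) {r : ℕ} (hr : 3 ≤ r) (j a b : Fin m) : Dp (e j) (F.NF a b) ∈ F.A r := by
  rw [F.DNF]
  refine neg_mem (sum_mem fun d _ => sum_mem fun c _ => mul_mem (mul_mem (F.A_N _ _ _) ?_) (F.A_N _ _ _))
  exact F.A_u r [j, c, d] (by simpa using hr)

theorem Fam.A_mono (F : Fam m ι) {r r' : ℕ} (h : r ≤ r') : F.A r ≤ F.A r' := by
  refine Algebra.adjoin_mono (Set.union_subset_union_right _ ?_)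
  rintro _ ⟨l, hl, rfl⟩
  exact ⟨l, hl.trans h, rfl⟩

theorem Fam.A_D (F : Fam m ι) {r : ℕ} (hr : 2 ≤ r) (j : Fin m) {f : ι → SF m} (hf : f ∈ F.A r) :
    Dp (e j) f ∈ F.A (r + 1) := by
  unfold Fam.A at hf
  induction hf using Algebra.adjoin_induction with
  | mem x hx =>
    rcases hx with (⟨a, b, rfl⟩ | ⟨l, rfl⟩) | ⟨l, hl, rfl⟩
    · exact F.A_DN (by omega) j a b
    · exact F.A_h _ (j :: l)
    · exact F.A_u _ (j :: l) (by simpa using hl)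
  | algebraMap c => rw [Dp_algebraMap]; exact zero_mem _
  | add x y _ _ hx hy => rw [Dp_add]; exact add_mem hx hy
  | mul x y h1 h2 hx hy =>
    rw [Dp_mul]
    exact add_mem (mul_mem (F.A_mono (Nat.le_succ r) h1) hy) (mul_mem (F.A_mono (Nat.le_succ r) h2) hx)

theorem Fam.A_L (F : Fam m ι) (l : List (Fin m)) (hl : l ≠ []) : F.LF (F.ul l) ∈ F.A (l.length + 1) := by
  induction l with
  | nil => exact absurd rfl hl
  | cons j l ih =>
    rcases eq_or_ne l [] with rfl | h
    · rw [F.LF_u]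
      exact sub_mem (Subalgebra.smul_mem _ (F.A_u _ _ (by simp)) _) (F.A_h _ _)
    · have hl1 : 1 ≤ l.length := List.length_pos_iff.2 h
      rw [F.ul_cons, F.LF_D]
      refine sub_mem (F.A_D (by simp only [List.length_cons]; omega) j (ih h)) (sum_mem fun a _ => sum_mem fun b _ => mul_mem
        (F.A_DN (by simp; omega) _ _ _) ?_)
      exact F.A_u _ (b :: a :: l) (by simp)

end CY
end

section
open scoped ContDiff
open scoped ContDiff
namespace CY
variable {m : ℕ} {ι : Type}

theorem bern_arith {c1 K : ℝ} (hc : 0 < c1) (hK : 0 < K) : ∃ B0 > 0, ∃ c > 0, ∃ C : ℝ,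
    ∀ V Y Z LV LY X : ℝ, 0 ≤ V → V ≤ K → 0 ≤ Y → 0 ≤ Z → c1 * Y - K ≤ LV →
    (∀ t > 0, 2 * c1 * Z - t * Y - (K / t) * (1 + Y ^ 2 + Z) ≤ LY) → X ^ 2 ≤ K * Y ^ 2 * Z →
    c * ((B0 + V) * Y) ^ 2 - C ≤ (B0 + V) * LY + Y * LV + 2 * X := by
  obtain ⟨θ, hθ⟩ : ∃ θ, θ = 4 * K / c1 := ⟨_, rfl⟩
  have hθ0 : 0 < θ := by rw [hθ]; positivity
  have hθc : θ * c1 = 4 * K := by rw [hθ]; field_simp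
  obtain ⟨B0, hB⟩ : ∃ B, B = θ / c1 := ⟨_, rfl⟩
  have hB0 : 0 < B0 := by rw [hB]; positivity
  have hBc : B0 * c1 = θ := by rw [hB]; field_simp
  obtain ⟨M, hM⟩ : ∃ M, M = B0 + K := ⟨_, rfl⟩
  have hM0 : 0 < M := by rw [hM]; positivity
  obtain ⟨t, ht⟩ : ∃ t, t = K / c1 + 4 * M * K / c1 := ⟨_, rfl⟩
  have ht0 : 0 < t := by rw [ht]; positivity
  obtain ⟨r, hr⟩ : ∃ r, r = K / t := ⟨_, rfl⟩
  have hr0 : 0 < r := by rw [hr]; positivity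
  have htc : t * c1 = K + 4 * M * K := by rw [ht]; field_simp
  have hrt : r * t = K := by rw [hr]; field_simp
  have hMK : 0 < M * K := by positivity
  have hr1 : r ≤ c1 := by
    rw [hr, div_le_iff₀ ht0]; nlinarith
  have hr2 : M * r ≤ c1 / 4 := by
    rw [hr, ← mul_div_assoc, div_le_iff₀ ht0]; nlinarith
  obtain ⟨q, hq⟩ : ∃ q, q = M * t + K := ⟨_, rfl⟩
  refine ⟨B0, hB0, c1 / (4 * M ^ 2), by positivity, q ^ 2 / c1 + M * r, ?_⟩
  intro V Y Z LV LY X hV hVK hY hZ hLV hLY hX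
  have hLY := hLY t ht0
  rw [← hr] at hLY
  have hBV : B0 + V ≤ M := by linarith
  have hBV0 : 0 ≤ B0 + V := by linarith
  have h1 : (B0 + V) * c1 * Z - M * t * Y - M * r - c1 / 4 * Y ^ 2 ≤ (B0 + V) * LY := by
    refine le_trans ?_ (mul_le_mul_of_nonneg_left hLY hBV0)
    have a1 : (B0 + V) * (r * Z) ≤ (B0 + V) * (c1 * Z) := by gcongr
    have a2 : (B0 + V) * (t * Y) ≤ M * (t * Y) := by gcongr
    have a3 : (B0 + V) * r ≤ M * r := by gcongr
    have a4 : (B0 + V) * r * Y ^ 2 ≤ c1 / 4 * Y ^ 2 := by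
      gcongr; linarith
    nlinarith
  have h2 : θ * Z ≤ (B0 + V) * c1 * Z := by
    rw [← hBc]; gcongr; linarith
  have h3 : -(c1 / 4 * Y ^ 2 + θ * Z) ≤ 2 * X := by
    have : |2 * X| ≤ c1 / 4 * Y ^ 2 + θ * Z := by
      refine abs_le_of_sq_le_sq ?_ (by positivity)
      have : (c1 / 4 * Y ^ 2 + θ * Z) ^ 2 = (c1 / 4 * Y ^ 2 - θ * Z) ^ 2 + (θ * c1) * Y ^ 2 * Z := by ring
      rw [this, hθc]
      nlinarith [sq_nonneg (c1 / 4 * Y ^ 2 - θ * Z)]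
    exact (abs_le.1 this).1
  have h4 : c1 * Y ^ 2 - K * Y ≤ Y * LV := by nlinarith
  have h5 : q * Y ≤ c1 / 4 * Y ^ 2 + q ^ 2 / c1 := by
    have : c1 / 4 * Y ^ 2 + q ^ 2 / c1 - q * Y = (c1 / 2 * Y - q) ^ 2 / c1 := by field_simp; ring
    have : 0 ≤ (c1 / 2 * Y - q) ^ 2 / c1 := by positivity
    linarith
  have h6 : c1 / (4 * M ^ 2) * ((B0 + V) * Y) ^ 2 ≤ c1 / 4 * Y ^ 2 := by
    calc _ ≤ c1 / (4 * M ^ 2) * (M * Y) ^ 2 := by gcongr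
      _ = _ := by field_simp
  have h7 : q * Y = M * t * Y + K * Y := by rw [hq]; ring
  linarith

variable {s : Sol m} {x : Euc m} {κ : Type} [Fintype κ]

/-- sum of squares -/
def sqs (φ : κ → SF m) : SF m := ∑ a, φ a * φ a
/-- sum of squares of gradients -/
def gs (φ : κ → SF m) (x : Euc m) : ℝ := ∑ a, ∑ i, (D (e i) (φ a) x) ^ 2

theorem sqs_apply (φ : κ → SF m) (x : Euc m) : sqs φ x = ∑ a, (φ a x) ^ 2 := by
  simp [sqs, sq]
theorem sqs_nonneg (φ : κ → SF m) (x : Euc m) : 0 ≤ sqs φ x := by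
  rw [sqs_apply]; positivity
theorem gs_nonneg (φ : κ → SF m) (x : Euc m) : 0 ≤ gs φ x := by
  unfold gs; positivity

theorem Frame.L_sqs (f : Frame s x) (φ : κ → SF m) :
    s.L (sqs φ) x = ∑ a, (2 * (φ a x * s.L (φ a) x) + 2 * f.gr (φ a) (φ a)) := by
  have : s.L (sqs φ) x = ∑ a, s.L (φ a * φ a) x := by
    simp only [f.L_apply, sqs, map_sum, SF.sum_apply]
    rw [Finset.sum_comm]
  rw [this]
  refine Finset.sum_congr rfl fun a _ => ?_
  rw [f.L_mul]; ring

theorem Frame.gs_le (f : Frame s x) {Λ : ℝ} (hΛ0 : 0 ≤ Λ) (hΛ : ∀ a j, f.F' a j ^ 2 ≤ Λ) (φ : κ → SF m) :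
    (1 / (m * (m * Λ) + 1)) * gs φ x ≤ ∑ a, f.gr (φ a) (φ a) := by
  have h0 : 0 < m * (m * Λ) + 1 := by positivity
  rw [gs, Finset.mul_sum]
  refine Finset.sum_le_sum fun a _ => ?_
  rw [one_div, inv_mul_le_iff₀ h0]
  have := f.le_gr hΛ (φ a)
  have h1 : 0 ≤ f.gr (φ a) (φ a) := Finset.sum_nonneg fun _ _ => mul_self_nonneg _
  linarith

theorem Frame.sqs_lower (f : Frame s x) {Λ Q t : ℝ} (hΛ0 : 0 ≤ Λ) (hΛ : ∀ a j, f.F' a j ^ 2 ≤ Λ)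
    (φ : κ → SF m) (ht : 0 < t) (hQ : ∀ a, (s.L (φ a) x) ^ 2 ≤ Q) :
    2 * (1 / (m * (m * Λ) + 1)) * gs φ x - t * sqs φ x - Fintype.card κ * Q / t ≤ s.L (sqs φ) x := by
  rw [f.L_sqs, Finset.sum_add_distrib, ← Finset.mul_sum, ← Finset.mul_sum]
  have h1 := f.gs_le hΛ0 hΛ φ
  have h2 : - t * sqs φ x - Fintype.card κ * Q / t ≤ 2 * ∑ a, φ a x * s.L (φ a) x := by
    have : - t * sqs φ x - Fintype.card κ * Q / t = ∑ a, (- t * φ a x ^ 2 - Q / t) := by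
      rw [sqs_apply, Finset.sum_sub_distrib, ← Finset.mul_sum]; simp; ring
    rw [this, Finset.mul_sum]
    refine Finset.sum_le_sum fun a _ => ?_
    have h3 : (s.L (φ a) x) ^ 2 / t ≤ Q / t := by gcongr; exact hQ a
    have h4 : 0 ≤ (t * φ a x + s.L (φ a) x) ^ 2 / t := by positivity
    have h5 : (t * φ a x + s.L (φ a) x) ^ 2 / t = t * φ a x ^ 2 + 2 * (φ a x * s.L (φ a) x) +
      (s.L (φ a) x) ^ 2 / t := by field_simp; ring
    linarith
  linarith

theorem Frame.gr_sqs (f : Frame s x) {Λ : ℝ} (hΛ0 : 0 ≤ Λ) (hΛ : ∀ j a, f.F j a ^ 2 ≤ Λ) (φ : κ → SF m) :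
    f.gr (sqs φ) (sqs φ) ≤ m * (m * Λ) * (4 * (sqs φ x * gs φ x)) := by
  refine (f.gr_le hΛ _).trans (mul_le_mul_of_nonneg_left ?_ (by positivity))
  have : ∀ i, D (e i) (sqs φ) x ^ 2 ≤ 4 * (sqs φ x * ∑ a, (D (e i) (φ a) x) ^ 2) := by
    intro i
    have h1 : D (e i) (sqs φ) x = 2 * ∑ a, φ a x * D (e i) (φ a) x := by
      simp only [sqs, map_sum, SF.sum_apply, Finset.mul_sum]
      refine Finset.sum_congr rfl fun a _ => ?_
      simp [Derivation.leibniz]; ring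
    rw [h1, mul_pow, sqs_apply]
    have := Finset.sum_mul_sq_le_sq_mul_sq Finset.univ (fun a => φ a x) (fun a => D (e i) (φ a) x)
    linarith
  refine (Finset.sum_le_sum fun i _ => this i).trans (le_of_eq ?_)
  rw [← Finset.mul_sum, ← Finset.mul_sum, gs, Finset.sum_comm]

theorem Frame.gr_cs (f : Frame s x) (φ ψ : SF m) : f.gr φ ψ ^ 2 ≤ f.gr φ φ * f.gr ψ ψ := by
  unfold Frame.gr
  have := Finset.sum_mul_sq_le_sq_mul_sq Finset.univ (fun a => D (f.b a) φ x) (fun a => D (f.b a) ψ x)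
  simpa only [sq] using this

/-- gradient family -/
def gf (φ : κ → SF m) (p : κ × Fin m) : SF m := D (e p.2) (φ p.1)

theorem sqs_gf (φ : κ → SF m) : sqs (gf φ) x = gs φ x := by
  rw [sqs_apply, gs, Fintype.sum_prod_type]; rfl

/-- Bernstein argument at finitely many functions -/
theorem bern_point {Λ CW K1 K2 : ℝ} (hΛ1 : 1 ≤ Λ) (hCW : 0 ≤ CW) (hK1 : 0 ≤ K1) (hK2 : 0 ≤ K2) :
    ∃ B0 > 0, ∃ c > 0, ∃ C : ℝ, ∀ (s : Sol m) (x : Euc m) (f : Frame s x) (W : κ → SF m),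
    (∀ a j, f.F' a j ^ 2 ≤ Λ) → (∀ j a, f.F j a ^ 2 ≤ Λ) → (∀ a, |W a x| ≤ CW) →
    (∀ a, (s.L (W a) x) ^ 2 ≤ K1 * (1 + gs W x)) →
    (∀ p, (s.L (gf W p) x) ^ 2 ≤ K2 * (1 + gs W x ^ 2 + gs (gf W) x)) →
    c * ((B0 + sqs W x) * gs W x) ^ 2 - C ≤ s.L ((algebraMap ℝ (SF m) B0 + sqs W) * sqs (gf W)) x := by
  set c1 : ℝ := 1 / (m * (m * Λ) + 1) with hc1
  have hc0 : 0 < c1 := by positivity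
  set n : ℝ := (Fintype.card κ : ℝ) with hn
  set n' : ℝ := (Fintype.card (κ × Fin m) : ℝ) with hn'
  set CV : ℝ := n * CW ^ 2 with hCV
  set t0 : ℝ := n * K1 / c1 + 1 with ht0
  have ht00 : 0 < t0 := by positivity
  set K : ℝ := CV + (t0 * CV + c1) + n' * K2 + 16 * (m * (m * Λ)) ^ 2 * CV + 1 with hK
  have p1 : 0 ≤ CV := by positivity
  have p2 : 0 ≤ t0 * CV + c1 := by positivity
  have p3 : 0 ≤ n' * K2 := by positivity
  have p4 : 0 ≤ 16 * (m * (m * Λ)) ^ 2 * CV := by positivity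
  obtain ⟨B0, hB0, c, hc, C, h⟩ := bern_arith (c1 := c1) (K := K) hc0 (by linarith)
  refine ⟨B0, hB0, c, hc, C, fun s x f W hF' hF hW hL1 hL2 => ?_⟩
  have hΛ0 : 0 ≤ Λ := by linarith
  have hV0 := sqs_nonneg W x
  have hY0 := gs_nonneg W x
  have hZ0 := gs_nonneg (gf W) x
  have hV : sqs W x ≤ CV := by
    rw [sqs_apply]
    calc _ ≤ ∑ _a : κ, CW ^ 2 := Finset.sum_le_sum fun a _ => by
          rw [← sq_abs]; gcongr; exact hW a
      _ = _ := by simp [hCV, hn]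
  have key := h (sqs W x) (gs W x) (gs (gf W) x) (s.L (sqs W) x) (s.L (sqs (gf W)) x)
    (f.gr (sqs W) (sqs (gf W))) hV0 (by linarith) hY0 hZ0 ?_ ?_ ?_
  · refine key.trans (le_of_eq ?_)
    have e1 : s.L ((algebraMap ℝ (SF m) B0 + sqs W) * sqs (gf W)) x =
        s.L (B0 • sqs (gf W)) x + s.L (sqs W * sqs (gf W)) x := by
      rw [add_mul, ← Algebra.smul_def]
      simp only [f.L_apply, map_add, SF.add_apply, Finset.sum_add_distrib]
    have e2 : s.L (B0 • sqs (gf W)) x = B0 * s.L (sqs (gf W)) x := by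
      simp only [f.L_apply, Derivation.map_smul, SF.smul_apply, Finset.mul_sum]
    rw [e1, e2, f.L_mul, sqs_gf]
    ring
  · refine le_trans ?_ (f.sqs_lower hΛ0 hF' W ht00 hL1)
    rw [← hc1]
    have h1 : n * (K1 * (1 + gs W x)) / t0 ≤ c1 * (1 + gs W x) := by
      rw [div_le_iff₀ ht00, ht0]
      have : c1 * (1 + gs W x) * (n * K1 / c1 + 1) = n * (K1 * (1 + gs W x)) + c1 * (1 + gs W x) := by
        field_simp
      rw [this]
      have : 0 ≤ c1 * (1 + gs W x) := by positivity
      linarith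
    have h2 : t0 * sqs W x ≤ t0 * CV := by gcongr
    linarith
  · intro t ht
    refine le_trans ?_ (f.sqs_lower hΛ0 hF' (gf W) ht hL2)
    rw [← hc1, sqs_gf]
    have h1 : n' * (K2 * (1 + gs W x ^ 2 + gs (gf W) x)) / t ≤ K / t * (1 + gs W x ^ 2 + gs (gf W) x) := by
      rw [← mul_assoc, mul_div_right_comm]
      gcongr
      linarith
    linarith
  · refine (f.gr_cs _ _).trans ?_
    have h1 := f.gr_sqs hΛ0 hF W
    have h2 := f.gr_sqs hΛ0 hF (gf W)
    rw [sqs_gf] at h2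
    have h3 : 0 ≤ f.gr (sqs (gf W)) (sqs (gf W)) := Finset.sum_nonneg fun _ _ => mul_self_nonneg _
    calc _ ≤ (m * (m * Λ) * (4 * (sqs W x * gs W x))) * (m * (m * Λ) * (4 * (gs W x * gs (gf W) x))) :=
          mul_le_mul h1 h2 h3 (by positivity)
      _ = 16 * (m * (m * Λ)) ^ 2 * sqs W x * (gs W x ^ 2 * gs (gf W) x) := by ring
      _ ≤ 16 * (m * (m * Λ)) ^ 2 * CV * (gs W x ^ 2 * gs (gf W) x) := by gcongr
      _ ≤ K * (gs W x ^ 2 * gs (gf W) x) := by gcongr; linarith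
      _ = _ := by ring

end CY
end

section
open scoped ContDiff
open scoped ContDiff
namespace CY
variable {m : ℕ} {ι : Type}

theorem Fam.bern_step (F : Fam m ι) {k : ℕ} (hk : 3 ≤ k) {δ : ℝ} (hδ : 0 < δ)
    (ih : ∀ δ > 0, ∀ l, l.length ≤ k → F.ul l ∈ Bd (F.S δ)) (l : List (Fin m)) (hl : l.length = k + 1) :
    F.ul l ∈ Bd (F.S δ) := by
  have hδ2 : 0 < δ / 2 := by linarith
  set S := F.S (δ / 2) with hS
  set W : ι → List.Vector (Fin m) k → SF m := fun i a => F.ul a.1 i with hW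
  set Y : ι → Euc m → ℝ := fun i x => gs (W i) x with hYd
  set Z : ι → Euc m → ℝ := fun i x => gs (gf (W i)) x with hZd
  have hY : ∀ i x, 0 ≤ Y i x := fun i x => gs_nonneg _ _
  have hZ : ∀ i x, 0 ≤ Z i x := fun i x => gs_nonneg _ _
  set G1 : ι → Euc m → ℝ := fun i x => 1 + Y i x with hG1
  set G2 : ι → Euc m → ℝ := fun i x => 1 + Y i x ^ 2 + Z i x with hG2
  have one1 : ∀ i x, 1 ≤ G1 i x := fun i x => by simp [hG1, hY]
  have one2 : ∀ i x, 1 ≤ G2 i x := fun i x => by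
    have := hZ i x; have := sq_nonneg (Y i x); simp only [hG2]; linarith
  have m01 : ∀ {a b : ι → SF m}, a ∈ Bd S → b ∈ BdG S G1 → a * b ∈ BdG S G1 := fun ha hb =>
      BdG_mul (BdG_of_Bd (G := fun _ _ => 1) ha (fun _ _ => le_rfl)) hb 1 zero_le_one (fun i x => by simp)
  have m02 : ∀ {a b : ι → SF m}, a ∈ Bd S → b ∈ BdG S G2 → a * b ∈ BdG S G2 := fun ha hb =>
      BdG_mul (BdG_of_Bd (G := fun _ _ => 1) ha (fun _ _ => le_rfl)) hb 1 zero_le_one (fun i x => by simp)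
  have m11 : ∀ {a b : ι → SF m}, a ∈ BdG S G1 → b ∈ BdG S G1 → a * b ∈ BdG S G2 :=
      fun ha hb => BdG_mul ha hb 2 zero_le_two (fun i x => by
        simp only [hG1, hG2]
        nlinarith [hZ i x, sq_nonneg (Y i x - 1)])
  have m12 : ∀ {a : ι → SF m}, a ∈ BdG S G1 → a ∈ BdG S G2 := by
    intro a ha
    have := m11 (BdG_of_Bd (one_mem (Bd S)) one1) ha
    rwa [one_mul] at this
  have u0 : ∀ l, l.length ≤ k → F.ul l ∈ Bd S := ih _ hδ2
  have u1 : ∀ l, l.length ≤ k + 1 → F.ul l ∈ BdG S G1 := by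
    intro l hl
    rcases Nat.lt_or_ge k l.length with h | h
    · cases l with
      | nil => simp at h
      | cons j l =>
        have hlk : l.length = k := by simp at h hl; omega
        refine ⟨1, zero_le_one, fun i x _ => ?_⟩
        have h1 : (D (e j) (W i ⟨l, hlk⟩) x) ^ 2 ≤ Y i x := by
          refine le_trans ?_ (Finset.single_le_sum (f := fun a => ∑ j, (D (e j) (W i a) x) ^ 2) (fun _ _ => by positivity) (Finset.mem_univ ⟨l, hlk⟩))
          exact Finset.single_le_sum (f := fun j => (D (e j) (W i ⟨l, hlk⟩) x) ^ 2) (fun _ _ => by positivity) (Finset.mem_univ j)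
        rw [one_mul]
        exact h1.trans (by simp [hG1])
    · exact BdG_of_Bd (u0 l h) one1
  have u2 : ∀ l, l.length ≤ k + 2 → F.ul l ∈ BdG S G2 := by
    intro l hl
    rcases Nat.lt_or_ge (k + 1) l.length with h | h
    · cases l with
      | nil => simp at h
      | cons j' l => cases l with
        | nil => simp at h
        | cons j l =>
          have hlk : l.length = k := by simp at h hl; omega
          refine ⟨1, zero_le_one, fun i x _ => ?_⟩
          have h1 : (D (e j') (D (e j) (W i ⟨l, hlk⟩)) x) ^ 2 ≤ Z i x := by
            refine le_trans ?_ (Finset.single_le_sum (f := fun p => ∑ j, (D (e j) (gf (W i) p) x) ^ 2) (fun _ _ => by positivity) (Finset.mem_univ (⟨l, hlk⟩, j)))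
            exact Finset.single_le_sum (f := fun j' => (D (e j') (gf (W i) (⟨l, hlk⟩, j)) x) ^ 2) (fun _ _ => by positivity) (Finset.mem_univ j')
          rw [one_mul]
          exact h1.trans (by have := sq_nonneg (Y i x); simp only [hG2]; linarith)
    · exact m12 (u1 l h)
  have n0 : ∀ a b, F.NF a b ∈ Bd S := fun a b => F.bN hδ2 a b
  have n1 : ∀ j a b, Dp (e j) (F.NF a b) ∈ Bd S := by
    intro j a b
    rw [F.DNF]
    exact neg_mem (sum_mem fun d _ => sum_mem fun c _ => mul_mem (mul_mem (n0 _ _)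
      (u0 [j, c, d] (by simpa using hk))) (n0 _ _))
  have n2 : ∀ i j a b, Dp (e i) (Dp (e j) (F.NF a b)) ∈ BdG S G1 := by
    intro i j a b
    rw [F.DNF, Dp_neg, Dp_sum]
    refine neg_mem (sum_mem fun d _ => ?_)
    rw [Dp_sum]
    refine sum_mem fun c _ => ?_
    rw [Dp_mul, Dp_mul]
    have hu : Dp (e j) (F.ul [c, d]) ∈ Bd S := u0 [j, c, d] (by simpa using hk)
    refine add_mem (BdG_of_Bd (mul_mem (mul_mem (n0 _ _) hu) (n1 _ _ _)) one1) (m01 (n0 _ _)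
      (add_mem (m01 (n0 _ _) ?_) (BdG_of_Bd (mul_mem hu (n1 _ _ _)) one1)))
    exact u1 [i, j, c, d] (by simp; omega)
  have hA : F.A k ≤ PA S Y Z hY hZ := by
    refine Algebra.adjoin_le ?_
    rintro _ ((⟨a, b, rfl⟩ | ⟨l, rfl⟩) | ⟨l, hl, rfl⟩)
    · exact ⟨n0 a b, fun j => BdG_of_Bd (n1 j a b) one1, fun i j => m12 (n2 i j a b)⟩
    · exact ⟨F.bdE _ (F.bh l), fun j => BdG_of_Bd (F.bdE _ (F.bh (j :: l))) one1,
        fun i j => BdG_of_Bd (F.bdE _ (F.bh (i :: j :: l))) one2⟩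
    · exact ⟨u0 l hl, fun j => u1 (j :: l) (by simpa using hl),
        fun i j => u2 (i :: j :: l) (by simpa using hl)⟩
  have L1 : ∀ l, l.length = k → F.LF (F.ul l) ∈ BdG S G1 := by
    intro l hl
    cases l with
    | nil => simp at hl; omega
    | cons j l =>
      simp at hl
      have hne : l ≠ [] := by rintro rfl; simp at hl; omega
      have hP := hA (by have := F.A_L l hne; rwa [hl] at this)
      rw [F.ul_cons, F.LF_D]
      refine sub_mem (hP.2.1 j) (sum_mem fun a _ => sum_mem fun b _ => m01 (n1 _ _ _) ?_)
      exact u1 (b :: a :: l) (by simp; omega)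
  have L2 : ∀ l j', l.length = k → F.LF (Dp (e j') (F.ul l)) ∈ BdG S G2 := by
    intro l j' hl
    cases l with
    | nil => simp at hl; omega
    | cons j l =>
      simp at hl
      have hne : l ≠ [] := by rintro rfl; simp at hl; omega
      have hP := hA (by have := F.A_L l hne; rwa [hl] at this)
      rw [F.LF_D, F.ul_cons, F.LF_D, Dp_sub, Dp_sum]
      refine sub_mem (sub_mem (hP.2.2 j' j) (sum_mem fun a _ => ?_)) (sum_mem fun a _ => sum_mem fun b _ => m02 (n1 _ _ _) ?_)
      · rw [Dp_sum]
        refine sum_mem fun b _ => ?_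
        rw [Dp_mul]
        exact add_mem (m02 (n1 _ _ _) (u2 (j' :: b :: a :: l) (by simp; omega)))
          (m11 (u1 (b :: a :: l) (by simp; omega)) (n2 _ _ _ _))
      · exact u2 (b :: a :: j :: l) (by simp; omega)
  -- constants
  obtain ⟨Λ, hΛ1, hΛ⟩ := F.ell hδ2
  obtain ⟨CW, hCW1, hCW⟩ := Bd_unif (κ := List.Vector (Fin m) k) (f := fun a => F.ul a.1)
    (fun a => u0 a.1 a.2.le)
  choose K1 hK10 hK1 using fun a : List.Vector (Fin m) k => L1 a.1 a.2
  choose K2 hK20 hK2 using fun p : List.Vector (Fin m) k × Fin m => L2 p.1.1 p.2 p.1.2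
  obtain ⟨B0, hB0, c, hc, C, hb⟩ := bern_point (m := m) (κ := List.Vector (Fin m) k) (Λ := Λ) (CW := CW)
    (K1 := ∑ a, K1 a) (K2 := ∑ p, K2 p) hΛ1 (by linarith) (Finset.sum_nonneg fun a _ => hK10 a)
    (Finset.sum_nonneg fun a _ => hK20 a)
  set Φ : ι → SF m := fun i => (algebraMap ℝ (SF m) B0 + sqs (W i)) * sqs (gf (W i)) with hΦ
  have hΦa : ∀ i x, Φ i x = (B0 + sqs (W i) x) * Y i x := by
    intro i x
    simp only [hΦ, SF.mul_apply, SF.add_apply, SF.algebraMap_apply, sqs_gf]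
    rfl
  have hbd : Φ ∈ Bd (F.S δ) := by
    refine F.lemmaM' Φ (fun i x => ?_) hδ ⟨c, hc, C, fun i x hx => ?_⟩
    · rw [hΦa]
      exact mul_nonneg (add_nonneg hB0.le (sqs_nonneg _ _)) (hY i x)
    · rw [hΦa]
      obtain ⟨f⟩ := (F.s i).exists_frame x
      refine hb (F.s i) x f (W i) (hΛ i x hx f).1 (hΛ i x hx f).2 (fun a => hCW a i x hx)
        (fun a => ?_) (fun p => ?_)
      · refine (hK1 a i x hx).trans (mul_le_mul_of_nonneg_right ?_ (by have := hY i x; positivity))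
        exact Finset.single_le_sum (f := K1) (fun a _ => hK10 a) (Finset.mem_univ a)
      · refine (hK2 p i x hx).trans (mul_le_mul_of_nonneg_right ?_ (by have := one2 i x; linarith))
        exact Finset.single_le_sum (f := K2) (fun a _ => hK20 a) (Finset.mem_univ p)
  obtain ⟨CΦ, hCΦ⟩ := hbd
  cases l with
  | nil => simp at hl
  | cons j l =>
    simp at hl
    refine ⟨CΦ / B0 + 1, fun i x hx => ?_⟩
    have h1 : (D (e j) (W i ⟨l, hl⟩) x) ^ 2 ≤ Y i x := by
      refine le_trans ?_ (Finset.single_le_sum (f := fun a => ∑ j, (D (e j) (W i a) x) ^ 2) (fun _ _ => by positivity) (Finset.mem_univ ⟨l, hl⟩))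
      exact Finset.single_le_sum (f := fun j => (D (e j) (W i ⟨l, hl⟩) x) ^ 2) (fun _ _ => by positivity) (Finset.mem_univ j)
    have h2 := (le_abs_self _).trans (hCΦ i x hx)
    rw [hΦa] at h2
    have h3 : Y i x ≤ CΦ / B0 := by
      rw [le_div_iff₀ hB0]
      nlinarith [sqs_nonneg (W i) x, hY i x, mul_nonneg (sqs_nonneg (W i) x) (hY i x)]
    refine abs_le_of_sq' ?_ ((h1.trans h3).trans (by linarith))
    linarith [hY i x]

/-- all derivatives are bounded on the good sets -/
theorem Fam.all (F : Fam m ι) {δ : ℝ} (hδ : 0 < δ) (l : List (Fin m)) :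
    (fun i => dl l (F.s i).u) ∈ Bd (F.S δ) := by
  have : ∀ k, ∀ δ > 0, ∀ l, l.length ≤ k + 3 → F.ul l ∈ Bd (F.S δ) := by
    intro k
    induction k with
    | zero =>
      intro δ hδ l hl
      match l with
      | [] => exact F.bdE _ F.bu
      | [a] => exact F.bdE _ (F.bDu a)
      | [a, b] => exact F.bH hδ a b
      | [a, b, c] => exact F.b3 hδ a b c
      | _ :: _ :: _ :: _ :: _ => simp at hl; omega
    | succ k ih =>
      intro δ hδ l hl
      rcases Nat.lt_or_ge (k + 3) l.length with h | h
      · exact F.bern_step (by omega) hδ ih l (by omega)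
      · exact ih δ hδ l h
  exact this l.length δ hδ l (by omega)

end CY
end

section
open scoped ContDiff
open scoped ContDiff
namespace CY
variable {m : ℕ}

/-- The frequency lattice. -/
abbrev Zm (m : ℕ) := Fin m → ℤ

/-- The Wiener algebra as absolutely summable Fourier coefficients. -/
def WA (m : ℕ) : Type := lp (fun _ : Zm m => ℂ) 1

namespace WA

instance : NormedAddCommGroup (WA m) := inferInstanceAs (NormedAddCommGroup (lp (fun _ : Zm m => ℂ) 1))
instance : NormedSpace ℂ (WA m) := inferInstanceAs (NormedSpace ℂ (lp (fun _ : Zm m => ℂ) 1))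
instance : CompleteSpace (WA m) := inferInstanceAs (CompleteSpace (lp (fun _ : Zm m => ℂ) 1))

/-- coefficients -/
def cf (c : WA m) : Zm m → ℂ := (show lp (fun _ : Zm m => ℂ) 1 from c).1

instance : CoeFun (WA m) (fun _ => Zm m → ℂ) := ⟨cf⟩

theorem ext' {c d : WA m} (h : ∀ ξ, c ξ = d ξ) : c = d :=
  Subtype.ext (funext h)

@[simp] theorem add_apply (c d : WA m) (ξ : Zm m) : (c + d) ξ = c ξ + d ξ := rfl
@[simp] theorem sub_apply (c d : WA m) (ξ : Zm m) : (c - d) ξ = c ξ - d ξ := rfl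
@[simp] theorem neg_apply (c : WA m) (ξ : Zm m) : (-c) ξ = - c ξ := rfl
@[simp] theorem zero_apply (ξ : Zm m) : (0 : WA m) ξ = 0 := rfl
@[simp] theorem smul_apply (a : ℂ) (c : WA m) (ξ : Zm m) : (a • c) ξ = a * c ξ := rfl

theorem summ (c : WA m) : Summable (fun ξ => ‖c ξ‖) := by
  have := lp.memℓp (show lp (fun _ : Zm m => ℂ) 1 from c)
  have := this.summable (by norm_num)
  simp at this
  exact this

theorem norm_eq (c : WA m) : ‖c‖ = ∑' ξ, ‖c ξ‖ := by
  have := lp.norm_eq_tsum_rpow (p := 1) (by norm_num) (show lp (fun _ : Zm m => ℂ) 1 from c)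
  refine this.trans ?_
  simp
  rfl

/-- build an element -/
def ofS (f : Zm m → ℂ) (h : Summable (fun ξ => ‖f ξ‖)) : WA m :=
  (⟨f, memℓp_gen (by simpa using h)⟩ : lp (fun _ : Zm m => ℂ) 1)

@[simp] theorem ofS_apply (f : Zm m → ℂ) (h) (ξ : Zm m) : ofS f h ξ = f ξ := rfl

theorem norm_apply_le (c : WA m) (ξ : Zm m) : ‖c ξ‖ ≤ ‖c‖ := by
  rw [norm_eq]
  exact (summ c).le_tsum ξ (fun _ _ => norm_nonneg _)

/-- basis vectors -/
def sg (ξ : Zm m) : WA m := (lp.single 1 ξ (1 : ℂ) : lp (fun _ : Zm m => ℂ) 1)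

theorem sg_apply (ξ η : Zm m) : sg ξ η = if η = ξ then 1 else 0 := by
  have := lp.single_apply (E := fun _ : Zm m => ℂ) 1 ξ (1:ℂ) η
  refine this.trans ?_
  rw [Pi.single_apply]

@[simp] theorem norm_sg (ξ : Zm m) : ‖sg ξ‖ = 1 := by
  have := lp.norm_single (p := 1) (E := fun _ : Zm m => ℂ) (by norm_num) ξ (1:ℂ)
  refine this.trans ?_
  simp

theorem hasSum_sg (c : WA m) : HasSum (fun ξ => c ξ • sg ξ) c := by
  have := lp.hasSum_single (p := 1) (by simp) (show lp (fun _ : Zm m => ℂ) 1 from c)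
  refine Eq.subst (motive := fun f => HasSum f c) (funext fun ξ => ?_) this
  refine Subtype.ext (funext fun η => ?_)
  have h1 := lp.single_apply (E := fun _ : Zm m => ℂ) 1 ξ (c ξ) η
  refine h1.trans ?_
  change _ = (c ξ • sg ξ) η
  rw [smul_apply, sg_apply, Pi.single_apply]
  split_ifs <;> simp

variable {X : Type*} [NormedAddCommGroup X] [NormedSpace ℂ X]

theorem ext_clm {f g : WA m →L[ℂ] X} (h : ∀ ξ, f (sg ξ) = g (sg ξ)) : f = g := by
  ext c
  have h1 := (hasSum_sg c).map f f.continuous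
  have h2 := (hasSum_sg c).map g g.continuous
  refine h1.unique ?_
  convert h2 using 1
  ext ξ
  simp [h ξ]

variable [CompleteSpace X]

theorem lift_summable (v : Zm m → X) (C : ℝ) (hv : ∀ ξ, ‖v ξ‖ ≤ C) (c : WA m) :
    Summable (fun ξ => ‖c ξ • v ξ‖) := by
  refine Summable.of_nonneg_of_le (fun _ => norm_nonneg _) (fun ξ => ?_) ((summ c).mul_right C)
  rw [norm_smul]
  exact mul_le_mul_of_nonneg_left (hv ξ) (norm_nonneg _)

/-- universal property of l1 -/
def lift (v : Zm m → X) (C : ℝ) (hv : ∀ ξ, ‖v ξ‖ ≤ C) : WA m →L[ℂ] X :=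
  LinearMap.mkContinuous
    { toFun := fun c => ∑' ξ, c ξ • v ξ
      map_add' := fun c d => by
        simp only [add_apply, add_smul]
        exact (lift_summable v C hv c).of_norm.tsum_add (lift_summable v C hv d).of_norm
      map_smul' := fun a c => by
        simp only [smul_apply, mul_smul, RingHom.id_apply]
        exact (lift_summable v C hv c).of_norm.tsum_const_smul a } C
    (fun c => by
      change ‖∑' ξ, c ξ • v ξ‖ ≤ _
      refine (norm_tsum_le_tsum_norm (lift_summable v C hv c)).trans ?_
      rw [norm_eq, mul_comm, ← tsum_mul_right]
      refine (lift_summable v C hv c).tsum_le_tsum (fun ξ => ?_) ((summ c).mul_right C)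
      rw [norm_smul]
      exact mul_le_mul_of_nonneg_left (hv ξ) (norm_nonneg _))

theorem lift_apply (v : Zm m → X) (C : ℝ) (hv : ∀ ξ, ‖v ξ‖ ≤ C) (c : WA m) :
    lift v C hv c = ∑' ξ, c ξ • v ξ := rfl

theorem lift_hasSum (v : Zm m → X) (C : ℝ) (hv : ∀ ξ, ‖v ξ‖ ≤ C) (c : WA m) :
    HasSum (fun ξ => c ξ • v ξ) (lift v C hv c) := (lift_summable v C hv c).of_norm.hasSum

@[simp] theorem lift_sg (v : Zm m → X) (C : ℝ) (hv : ∀ ξ, ‖v ξ‖ ≤ C) (ξ : Zm m) :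
    lift v C hv (sg ξ) = v ξ := by
  rw [lift_apply, tsum_eq_single ξ]
  · simp [sg_apply]
  · intro η h; simp [sg_apply, h]

theorem lift_norm (v : Zm m → X) (C : ℝ) (hC : 0 ≤ C) (hv : ∀ ξ, ‖v ξ‖ ≤ C) :
    ‖lift v C hv‖ ≤ C := LinearMap.mkContinuous_norm_le _ hC _

theorem norm_clm_le {Y : Type*} [NormedAddCommGroup Y] [NormedSpace ℂ Y] [CompleteSpace Y] (f : WA m →L[ℂ] Y) (C : ℝ) (hC : 0 ≤ C) (h : ∀ ξ, ‖f (sg ξ)‖ ≤ C) : ‖f‖ ≤ C := by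
  have : f = lift (fun ξ => f (sg ξ)) C h := ext_clm (fun ξ => by simp)
  rw [this]
  exact lift_norm _ C hC _

/-- coordinate functional -/
def coord (ξ : Zm m) : WA m →L[ℂ] ℂ :=
  LinearMap.mkContinuous { toFun := fun c => c ξ, map_add' := fun _ _ => rfl, map_smul' := fun _ _ => rfl } 1
    (fun c => by rw [one_mul]; exact norm_apply_le c ξ)

@[simp] theorem coord_apply (ξ : Zm m) (c : WA m) : coord ξ c = c ξ := rfl

/-! multiplication -/
def shift (ξ : Zm m) : WA m →L[ℂ] WA m := lift (fun η => sg (ξ + η)) 1 (fun η => (norm_sg _).le)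

def mulB : WA m →L[ℂ] WA m →L[ℂ] WA m := lift shift 1 (fun ξ => lift_norm _ 1 zero_le_one _)

@[simp] theorem mulB_sg (ξ η : Zm m) : mulB (sg ξ) (sg η) = sg (ξ + η) := by
  have h : mulB (sg ξ) = shift ξ := lift_sg _ _ _ ξ
  rw [h]
  exact lift_sg _ _ _ η

theorem mulB_comm (c d : WA m) : mulB c d = mulB d c := by
  have : mulB (m := m) = mulB.flip := by
    refine ext_clm fun ξ => ext_clm fun η => ?_
    simp [add_comm]
  exact congrArg (fun f => f c d) this

theorem mulB_assoc (c d e : WA m) : mulB (mulB c d) e = mulB c (mulB d e) := by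
  have h1 : ∀ ξ η (e : WA m), mulB (mulB (sg ξ) (sg η)) e = mulB (sg ξ) (mulB (sg η) e) := by
    intro ξ η e
    have : mulB (mulB (sg ξ) (sg η)) = (mulB (sg ξ)).comp (mulB (sg η)) :=
      ext_clm fun ζ => by simp [add_assoc]
    exact congrArg (fun f => f e) this
  have h2 : ∀ ξ (d e : WA m), mulB (mulB (sg ξ) d) e = mulB (sg ξ) (mulB d e) := by
    intro ξ d e
    have : (mulB.flip e).comp (mulB (sg ξ)) = (mulB (sg ξ)).comp (mulB.flip e) :=
      ext_clm fun η => by simpa using h1 ξ η e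
    exact congrArg (fun f => f d) this
  have : (mulB.flip e).comp (mulB.flip d) = mulB.flip (mulB d e) :=
    ext_clm fun ξ => by simpa using h2 ξ d e
  exact congrArg (fun f => f c) this

theorem mulB_one (c : WA m) : mulB (sg 0) c = c := by
  have : mulB (sg (0 : Zm m)) = ContinuousLinearMap.id ℂ _ := ext_clm fun ξ => by simp
  exact congrArg (fun f => f c) this

theorem mulB_norm (c d : WA m) : ‖mulB c d‖ ≤ ‖c‖ * ‖d‖ := by
  refine ((mulB c).le_opNorm d).trans (mul_le_mul_of_nonneg_right ?_ (norm_nonneg _))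
  refine (mulB.le_opNorm c).trans ?_
  refine (mul_le_mul_of_nonneg_right (lift_norm _ 1 zero_le_one _) (norm_nonneg _)).trans ?_
  simp

instance : Mul (WA m) := ⟨fun c d => mulB c d⟩
instance : One (WA m) := ⟨sg 0⟩
theorem mul_def (c d : WA m) : c * d = mulB c d := rfl
theorem one_def : (1 : WA m) = sg 0 := rfl

instance : NormedCommRing (WA m) :=
  { (inferInstance : NormedAddCommGroup (WA m)) with
    mul := (· * ·)
    one := 1
    left_distrib := fun a b c => (mulB a).map_add b c
    right_distrib := fun a b c => by simp only [mul_def, map_add]; rfl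
    zero_mul := fun a => by simp only [mul_def, map_zero]; rfl
    mul_zero := fun a => by simp only [mul_def, map_zero]
    mul_assoc := mulB_assoc
    one_mul := mulB_one
    mul_one := fun a => (mulB_comm a (sg 0)).trans (mulB_one a)
    mul_comm := mulB_comm
    norm_mul_le := mulB_norm }

instance : Algebra ℂ (WA m) := Algebra.ofModule
  (fun r c d => by simp only [mul_def, map_smul]; rfl)
  (fun r c d => by simp only [mul_def, map_smul])

instance : NormedAlgebra ℂ (WA m) := { (inferInstance : Algebra ℂ (WA m)) with
  norm_smul_le := fun r c => (norm_smul_le r c) }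

instance : NormOneClass (WA m) := ⟨norm_sg 0⟩

@[simp] theorem sg_mul (ξ η : Zm m) : sg ξ * sg η = sg (ξ + η) := mulB_sg ξ η

/-- multiplication as a CLM -/
abbrev mulL (c : WA m) : WA m →L[ℂ] WA m := mulB c
@[simp] theorem mulL_apply (c d : WA m) : mulL c d = c * d := rfl

end WA
end CY
end

section
open scoped ContDiff
open scoped ContDiff
namespace CY
variable {m : ℕ}
attribute [local instance] instMeasureSpaceUnitAddCircle
attribute [local instance] instIsAddHaarMeasureUnitAddCircleVolume
attribute [local instance] instIsProbabilityMeasureUnitAddCircleVolume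
namespace WA

/-- pairing of frequency and vector -/
def pr (ξ : Zm m) (x : Euc m) : ℝ := ∑ j, (ξ j : ℝ) * x j

theorem pr_add_left (ξ η : Zm m) (x : Euc m) : pr (ξ + η) x = pr ξ x + pr η x := by
  simp [pr, add_mul, Finset.sum_add_distrib]
theorem pr_add (ξ : Zm m) (x y : Euc m) : pr ξ (x + y) = pr ξ x + pr ξ y := by
  simp [pr, mul_add, Finset.sum_add_distrib]
theorem pr_smul (ξ : Zm m) (t : ℝ) (y : Euc m) : pr ξ (t • y) = t * pr ξ y := by
  simp only [pr, Finset.mul_sum, PiLp.smul_apply, smul_eq_mul]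
  exact Finset.sum_congr rfl fun i _ => by ring
@[simp] theorem pr_zero (ξ : Zm m) : pr ξ (0 : Euc m) = 0 := by simp [pr]
@[simp] theorem pr_zero_left (x : Euc m) : pr (0 : Zm m) x = 0 := by simp [pr]
theorem pr_neg_left (ξ : Zm m) (x : Euc m) : pr (-ξ) x = - pr ξ x := by
  simp [pr, Finset.sum_neg_distrib]
@[simp] theorem pr_e (ξ : Zm m) (i : Fin m) : pr ξ (e i) = ξ i := by
  simp [pr, e, Pi.single_apply]

/-- characters -/
def ch (ξ : Zm m) (x : Euc m) : ℂ := Complex.exp ((2 * Real.pi * pr ξ x : ℝ) * Complex.I)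

@[simp] theorem norm_ch (ξ : Zm m) (x : Euc m) : ‖ch ξ x‖ = 1 := Complex.norm_exp_ofReal_mul_I _
theorem ch_add_left (ξ η : Zm m) (x : Euc m) : ch (ξ + η) x = ch ξ x * ch η x := by
  rw [ch, ch, ch, ← Complex.exp_add, pr_add_left]; push_cast; ring_nf
theorem ch_add (ξ : Zm m) (x y : Euc m) : ch ξ (x + y) = ch ξ x * ch ξ y := by
  rw [ch, ch, ch, ← Complex.exp_add, pr_add]; push_cast; ring_nf
@[simp] theorem ch_zero (ξ : Zm m) : ch ξ (0 : Euc m) = 1 := by simp [ch]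
@[simp] theorem ch_zero_left (x : Euc m) : ch (0 : Zm m) x = 1 := by simp [ch]
theorem ch_neg (ξ : Zm m) (x : Euc m) : ch (-ξ) x = starRingEnd ℂ (ch ξ x) := by
  rw [ch, ch, ← Complex.exp_conj, pr_neg_left, map_mul, Complex.conj_ofReal, Complex.conj_I]; push_cast; ring_nf

/-- integer vectors -/
def toE (k : Zm m) : Euc m := WithLp.toLp 2 (fun i => (k i : ℝ))
@[simp] theorem toE_apply (k : Zm m) (i : Fin m) : toE k i = k i := rfl
theorem ch_toE (ξ k : Zm m) : ch ξ (toE k) = 1 := by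
  have : pr ξ (toE k) = ((∑ j, ξ j * k j : ℤ) : ℝ) := by simp [pr]
  rw [ch, this, Complex.exp_eq_one_iff]
  exact ⟨∑ j, ξ j * k j, by push_cast; ring⟩

theorem cont_ch (ξ : Zm m) : Continuous (ch ξ) := by
  unfold ch pr; fun_prop

/-- evaluation functional -/
def evx (x : Euc m) : WA m →L[ℂ] ℂ := lift (fun ξ => ch ξ x) 1 (fun ξ => (norm_ch _ _).le)

@[simp] theorem evx_sg (x : Euc m) (ξ : Zm m) : evx x (sg ξ) = ch ξ x := lift_sg _ _ _ _

theorem evx_mul (x : Euc m) (c d : WA m) : evx x (c * d) = evx x c * evx x d := by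
  have h1 : ∀ ξ (d : WA m), evx x (sg ξ * d) = ch ξ x * evx x d := by
    intro ξ d
    have : (evx x).comp (mulL (sg ξ)) = ch ξ x • evx x := ext_clm fun η => by
      simp [ch_add_left]
    exact congrArg (fun f => f d) this
  have : (evx x).comp (mulL d) = evx x d • evx x := ext_clm fun ξ => by
    rw [ContinuousLinearMap.comp_apply, mulL_apply, mul_comm d, h1, ContinuousLinearMap.smul_apply, evx_sg, smul_eq_mul, mul_comm]
  have := congrArg (fun f => f c) this
  simpa [mul_comm] using this

theorem evx_one (x : Euc m) : evx x (1 : WA m) = 1 := by rw [one_def, evx_sg, ch_zero_left]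

/-- evaluation as algebra hom -/
def evA (x : Euc m) : WA m →ₐ[ℂ] ℂ := AlgHom.ofLinearMap (evx x).toLinearMap (evx_one x) (evx_mul x)

theorem evA_apply (x : Euc m) (c : WA m) : evA x c = evx x c := rfl

theorem evx_per (k : Zm m) (x : Euc m) (c : WA m) : evx (x + toE k) c = evx x c := by
  have : evx (x + toE k) = evx x := ext_clm fun ξ => by simp [ch_add, ch_toE]
  rw [this]

theorem evx_exp (x : Euc m) (c : WA m) : evx x (NormedSpace.exp c) = Complex.exp (evx x c) := by
  rw [Complex.exp_eq_exp_ℂ]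
  exact NormedSpace.map_exp_of_mem_ball (𝕂 := ℂ) (evA x) (evx x).continuous c
    ((NormedSpace.expSeries_radius_eq_top ℂ (WA m)).symm ▸ edist_lt_top _ _)

theorem evx_norm (x : Euc m) (c : WA m) : ‖evx x c‖ ≤ ‖c‖ := by
  have := (evx x).le_opNorm c
  refine this.trans ?_
  have h2 : ‖evx x‖ ≤ 1 := lift_norm _ 1 zero_le_one _
  nlinarith [norm_nonneg c]

theorem evx_cont (c : WA m) : Continuous (fun x => evx x c) := by
  have : (fun x => evx x c) = fun x => ∑' ξ, c ξ • ch ξ x := rfl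
  rw [this]
  refine continuous_tsum (fun ξ => by have := cont_ch ξ; fun_prop) (summ c) (fun ξ x => ?_)
  rw [norm_smul, norm_ch, mul_one]

theorem evx_hasDerivAt (c c' : WA m) (v : Euc m) (h : ∀ ξ, c' ξ = (2 * Real.pi * pr ξ v : ℝ) * Complex.I * c ξ)
    (x : Euc m) (t : ℝ) : HasDerivAt (fun t : ℝ => evx (x + t • v) c) (evx (x + t • v) c') t := by
  have : ∀ t : ℝ, evx (x + t • v) c' = ∑' ξ, c' ξ • ch ξ (x + t • v) := fun _ => rfl
  rw [this t]
  change HasDerivAt (fun t : ℝ => ∑' ξ, c ξ • ch ξ (x + t • v)) _ t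
  refine hasDerivAt_tsum (g := fun ξ (t : ℝ) => c ξ • ch ξ (x + t • v)) (g' := fun ξ (t:ℝ) => c' ξ • ch ξ (x + t • v)) (u := fun ξ => ‖c' ξ‖) (y₀ := 0) (summ c') (fun ξ s => ?_) (fun ξ s => ?_) ?_ t
  · have h1 : HasDerivAt (fun t : ℝ => (2 * Real.pi * pr ξ (x + t • v) : ℝ)) (2 * Real.pi * pr ξ v) s := by
      simp only [pr_add, pr_smul]
      have := ((((hasDerivAt_id s).mul_const (pr ξ v)).const_add (pr ξ x)).const_mul (2 * Real.pi))
      simpa using this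
    have h2 := ((h1.ofReal_comp.mul_const Complex.I).cexp).const_mul (c ξ)
    have h3 : c' ξ • ch ξ (x + s • v) = c ξ * (Complex.exp (↑(2 * Real.pi * pr ξ (x + s • v)) * Complex.I) * (↑(2 * Real.pi * pr ξ v) * Complex.I)) := by
      rw [h ξ, ch]
      simp only [smul_eq_mul]
      ring
    rw [h3]
    exact h2
  · rw [norm_smul, norm_ch, mul_one]
  · exact (lift_summable (fun ξ => ch ξ (x + (0:ℝ) • v)) 1 (fun ξ => (norm_ch _ _).le) c).of_norm

/-! Fourier uniqueness -/
open UnitAddTorus in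
/-- projection to the torus -/
def prj (x : Euc m) : UnitAddTorus (Fin m) := fun i => ((x i : ℝ) : UnitAddCircle)

theorem prj_surj : Function.Surjective (prj (m := m)) := by
  intro t
  choose f hf using fun i => QuotientAddGroup.mk_surjective (t i)
  exact ⟨WithLp.toLp 2 f, funext fun i => hf i⟩

theorem mF_prj (ξ : Zm m) (x : Euc m) : UnitAddTorus.mFourier ξ (prj x) = ch ξ x := by
  simp only [UnitAddTorus.mFourier, prj, ContinuousMap.coe_mk, fourier_coe_apply]
  rw [← Complex.exp_sum, ch, pr]
  congr 1
  push_cast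
  rw [Finset.mul_sum, Finset.sum_mul]
  exact Finset.sum_congr rfl fun i _ => by simp; ring

def toC : WA m →L[ℂ] C(UnitAddTorus (Fin m), ℂ) :=
  lift UnitAddTorus.mFourier 1 (fun ξ => UnitAddTorus.mFourier_norm.le)

@[simp] theorem toC_sg (ξ : Zm m) : toC (sg ξ) = UnitAddTorus.mFourier ξ := lift_sg _ _ _ _

theorem toC_prj (c : WA m) (x : Euc m) : toC c (prj x) = evx x c := by
  have : (ContinuousMap.evalCLM ℂ (prj x)).comp toC = evx x := ext_clm fun ξ => by
    simp [mF_prj]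
  exact congrArg (fun f => f c) this

theorem toC_coeff (c : WA m) (ξ : Zm m) : UnitAddTorus.mFourierCoeff (toC c) ξ = c ξ := by
  have h : ((innerSL ℂ (UnitAddTorus.mFourierLp (d := Fin m) 2 ξ)).comp
      ((ContinuousMap.toLp (E := ℂ) 2 MeasureTheory.volume ℂ).comp toC)) = coord ξ := ext_clm fun η => by
    simp only [ContinuousLinearMap.comp_apply, toC_sg, coord_apply, sg_apply]
    have := orthonormal_iff_ite.1 (UnitAddTorus.orthonormal_mFourier (d := Fin m)) ξ η
    exact this
  have h2 := congrArg (fun f => f c) h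
  rw [coord_apply] at h2
  rw [← h2, ← UnitAddTorus.mFourierCoeff_toLp, ← UnitAddTorus.mFourierBasis_repr,
    UnitAddTorus.mFourierBasis.repr_apply_apply, UnitAddTorus.coe_mFourierBasis]
  rfl

theorem uniq {c d : WA m} (h : ∀ x, evx x c = evx x d) : c = d := by
  have : toC c = toC d := by
    ext t
    obtain ⟨x, rfl⟩ := prj_surj t
    rw [toC_prj, toC_prj, h]
  refine ext' fun ξ => ?_
  rw [← toC_coeff, ← toC_coeff, this]

/-! multipliers -/
def mlt (k : Zm m → ℂ) (C : ℝ) (hk : ∀ ξ, ‖k ξ‖ ≤ C) : WA m →L[ℂ] WA m :=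
  lift (fun ξ => k ξ • sg ξ) C (fun ξ => by rw [norm_smul, norm_sg, mul_one]; exact hk ξ)

@[simp] theorem mlt_sg (k : Zm m → ℂ) (C : ℝ) (hk) (ξ : Zm m) : mlt k C hk (sg ξ) = k ξ • sg ξ :=
  lift_sg _ _ _ _

@[simp] theorem mlt_apply (k : Zm m → ℂ) (C : ℝ) (hk) (c : WA m) (ξ : Zm m) : mlt k C hk c ξ = k ξ * c ξ := by
  have : (coord ξ).comp (mlt k C hk) = k ξ • coord ξ := ext_clm fun η => by
    simp [sg_apply]
    split_ifs with h
    · rw [h]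
    · rfl
  exact congrArg (fun f => f c) this

/-- translation -/
def tau (s : Euc m) : WA m →L[ℂ] WA m := mlt (fun ξ => ch ξ s) 1 (fun ξ => (norm_ch _ _).le)

@[simp] theorem tau_apply (s : Euc m) (c : WA m) (ξ : Zm m) : tau s c ξ = ch ξ s * c ξ := mlt_apply _ _ _ _ _

theorem evx_tau (s x : Euc m) (c : WA m) : evx x (tau s c) = evx (x + s) c := by
  have : (evx x).comp (tau s) = evx (x + s) := ext_clm fun η => by
    simp [tau, ch_add, mul_comm]
  exact congrArg (fun f => f c) this

theorem tau_cont (c : WA m) : Continuous (fun s => tau s c) := by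
  have : (fun s => tau s c) = fun s => ∑' ξ, c ξ • (ch ξ s • sg ξ) := rfl
  rw [this]
  refine continuous_tsum (fun ξ => by have := cont_ch ξ; fun_prop) (summ c) (fun ξ x => ?_)
  rw [norm_smul, norm_smul, norm_ch, norm_sg, mul_one, mul_one]

@[simp] theorem tau_zero (c : WA m) : tau 0 c = c := ext' fun ξ => by simp

/-- conjugation -/
def st (c : WA m) : WA m := ofS (fun ξ => starRingEnd ℂ (c (-ξ))) (by
  simp only [RCLike.norm_conj]
  exact (Equiv.neg (Zm m)).summable_iff.2 (summ c))

@[simp] theorem st_apply (c : WA m) (ξ : Zm m) : st c ξ = starRingEnd ℂ (c (-ξ)) := rfl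

theorem norm_st (c : WA m) : ‖st c‖ = ‖c‖ := by
  rw [norm_eq, norm_eq]
  simp only [st_apply, RCLike.norm_conj]
  exact (Equiv.neg (Zm m)).tsum_eq (fun ξ => ‖c ξ‖)

theorem st_sub (c d : WA m) : st (c - d) = st c - st d := ext' fun ξ => by simp

theorem evx_st (x : Euc m) (c : WA m) : evx x (st c) = starRingEnd ℂ (evx x c) := by
  have h : ∀ c : WA m, evx x c = ∑' ξ, c ξ • ch ξ x := fun _ => rfl
  rw [h, h, Complex.conj_tsum, ← (Equiv.neg (Zm m)).tsum_eq]
  refine tsum_congr fun ξ => ?_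
  have : (Equiv.neg (Zm m)) ξ = -ξ := rfl
  rw [this, st_apply, neg_neg, ch_neg, smul_eq_mul, smul_eq_mul, map_mul]

end WA
end CY
end

section
open scoped ContDiff
open scoped ContDiff
namespace CY
variable {m : ℕ}
attribute [local instance] instMeasureSpaceUnitAddCircle
attribute [local instance] instIsAddHaarMeasureUnitAddCircleVolume
attribute [local instance] instIsProbabilityMeasureUnitAddCircleVolume
namespace WA
open MeasureTheory

/-- one-periodicity -/
def Per {α : Type*} (g : Euc m → α) : Prop := ∀ (k : Zm m) (x : Euc m), g (x + toE k) = g x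

theorem prj_eq {x y : Euc m} (h : prj x = prj y) : ∃ k, y = x + toE k := by
  have : ∀ i, ∃ n : ℤ, y i = x i + n := by
    intro i
    have hi : ((y i : ℝ) : UnitAddCircle) = ((x i : ℝ) : UnitAddCircle) := (congrFun h i).symm
    have h0 : (((y i - x i : ℝ)) : UnitAddCircle) = 0 := by
      rw [AddCircle.coe_sub, hi, sub_self]
    obtain ⟨n, hn⟩ := (AddCircle.coe_eq_zero_iff (1:ℝ)).1 h0
    exact ⟨n, by simp at hn; linarith⟩
  choose k hk using this
  exact ⟨k, PiLp.ext fun i => by simpa using hk i⟩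

theorem prj_quot : IsOpenQuotientMap (prj (m := m)) := by
  have h1 : IsOpenQuotientMap (Pi.map (fun (_ : Fin m) (x : ℝ) => (x : UnitAddCircle))) :=
    IsOpenQuotientMap.piMap fun _ => QuotientAddGroup.isOpenQuotientMap_mk
  exact h1.comp (PiLp.homeomorph 2 (fun _ : Fin m => ℝ)).isOpenQuotientMap

theorem Per.prj' {α : Type*} {g : Euc m → α} (hg : Per g) {x y : Euc m} (h : WA.prj x = WA.prj y) : g x = g y := by
  obtain ⟨k, rfl⟩ := prj_eq h
  exact (hg k x).symm

/-- descend a periodic function to the torus -/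
def tor (g : Euc m → ℝ) (hc : Continuous g) (hp : Per g) : C(UnitAddTorus (Fin m), ℂ) where
  toFun t := (g (Function.surjInv prj_surj t) : ℂ)
  continuous_toFun := by
    rw [prj_quot.isQuotientMap.continuous_iff]
    have : (fun t => (g (Function.surjInv prj_surj t) : ℂ)) ∘ prj = fun x => (g x : ℂ) := by
      funext x
      simp only [Function.comp]
      rw [hp.prj' (Function.surjInv_eq prj_surj (WA.prj x))]
    rw [this]
    fun_prop

theorem tor_prj (g : Euc m → ℝ) (hc : Continuous g) (hp : Per g) (x : Euc m) : tor g hc hp (prj x) = g x := by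
  change ((g (Function.surjInv prj_surj (prj x)) : ℝ) : ℂ) = g x
  rw [hp.prj' (Function.surjInv_eq prj_surj (WA.prj x))]

theorem Per.bdd {g : Euc m → ℝ} (hc : Continuous g) (hp : Per g) : ∃ B, 0 ≤ B ∧ ∀ x, |g x| ≤ B := by
  refine ⟨‖tor g hc hp‖, norm_nonneg _, fun x => ?_⟩
  have := (tor g hc hp).norm_coe_le_norm (prj x)
  rwa [tor_prj, Complex.norm_real] at this

theorem Per.max {g : Euc m → ℝ} (hc : Continuous g) (hp : Per g) : ∃ x0, ∀ x, g x ≤ g x0 := by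
  have hc2 : Continuous fun t => (tor g hc hp t).re := Complex.continuous_re.comp (tor g hc hp).continuous
  obtain ⟨t, -, ht⟩ := isCompact_univ.exists_isMaxOn ⟨WA.prj 0, Set.mem_univ _⟩ hc2.continuousOn
  obtain ⟨x0, rfl⟩ := prj_surj t
  refine ⟨x0, fun x => ?_⟩
  have := ht (Set.mem_univ (WA.prj x))
  simpa [tor_prj] using this

theorem Per.D {g : SF m} (hg : Per (g : Euc m → ℝ)) (v : Euc m) : Per (CY.D v g : Euc m → ℝ) := by
  intro k x
  rw [D_apply, D_apply]
  have : (fun y => g (y + toE k)) = (g : Euc m → ℝ) := funext fun y => hg k y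
  conv_rhs => rw [← this]
  rw [fderiv_comp_add_right]

/-- Fourier coefficients -/
def co (g : Euc m → ℝ) (hc : Continuous g) (hp : Per g) (ξ : Zm m) : ℂ := UnitAddTorus.mFourierCoeff (tor g hc hp) ξ

theorem co_bound {g : Euc m → ℝ} (hc : Continuous g) (hp : Per g) {B : ℝ} (hB : ∀ x, |g x| ≤ B) (ξ : Zm m) :
    ‖co g hc hp ξ‖ ≤ B := by
  rw [co, UnitAddTorus.mFourierCoeff]
  have := norm_integral_le_of_norm_le_const (μ := (volume : Measure (UnitAddTorus (Fin m)))) (C := B)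
    (f := fun t => UnitAddTorus.mFourier (-ξ) t • tor g hc hp t) (Filter.Eventually.of_forall fun t => ?_)
  · simpa using this
  · obtain ⟨x, rfl⟩ := prj_surj t
    rw [tor_prj, mF_prj, norm_smul, norm_ch, one_mul, Complex.norm_real]
    exact hB x

theorem intble (G : C(UnitAddTorus (Fin m), ℂ)) : Integrable G (volume : Measure (UnitAddTorus (Fin m))) :=
  G.continuous.integrable_of_hasCompactSupport (HasCompactSupport.of_compactSpace _)

theorem co_shift {g : Euc m → ℝ} (hc : Continuous g) (hp : Per g) (s : Euc m) (hc' : Continuous fun x => g (x + s))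
    (hp' : Per fun x => g (x + s)) (ξ : Zm m) : co _ hc' hp' ξ = ch ξ s * co g hc hp ξ := by
  rw [co, co, UnitAddTorus.mFourierCoeff, UnitAddTorus.mFourierCoeff]
  have := integral_add_right_eq_self (μ := (volume : Measure (UnitAddTorus (Fin m))))
    (fun t => UnitAddTorus.mFourier (-ξ) t • tor g hc hp t) (prj s)
  rw [← this, ← integral_const_mul]
  congr 1
  funext t
  obtain ⟨x, rfl⟩ := prj_surj t
  have h1 : prj x + prj s = prj (x + s) := by funext i; simp [prj]
  rw [h1, tor_prj, tor_prj, mF_prj, mF_prj, ch_add]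
  have h2 : ch ξ s * ch (-ξ) s = 1 := by rw [← ch_add_left]; simp
  simp only [smul_eq_mul]
  linear_combination (-(ch (-ξ) x * (g (x + s) : ℂ))) * h2

theorem co_D {g : SF m} (hp : Per (g : Euc m → ℝ)) (v : Euc m) (ξ : Zm m) :
    co (D v g) (D v g).cont (hp.D v) ξ = (2 * Real.pi * pr ξ v : ℝ) * Complex.I * co g g.cont hp ξ := by
  obtain ⟨B, hB0, hB⟩ := Per.bdd (D v g).cont (hp.D v)
  have hcs : ∀ (f : SF m) (t : ℝ), Continuous fun x => f (x + t • v) := fun f t => by have := f.cont; fun_prop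
  have hps : ∀ (f : SF m) (hf : Per (f : Euc m → ℝ)) (t : ℝ), Per fun x => f (x + t • v) := fun f hf t k x => by
    simp only []
    rw [add_right_comm, hf]
  let F : ℝ → UnitAddTorus (Fin m) → ℂ := fun t y => UnitAddTorus.mFourier (-ξ) y • tor _ (hcs g t) (hps g hp t) y
  let F' : ℝ → UnitAddTorus (Fin m) → ℂ := fun t y => UnitAddTorus.mFourier (-ξ) y • tor _ (hcs (D v g) t) (hps _ (hp.D v) t) y
  have hF : ∀ t, Continuous (F t) := fun t => by fun_prop
  have hF' : ∀ t, Continuous (F' t) := fun t => by fun_prop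
  have key := (hasDerivAt_integral_of_dominated_loc_of_deriv_le (μ := (volume : Measure (UnitAddTorus (Fin m))))
    (F := F) (F' := F') (x₀ := (0:ℝ)) (s := Set.univ) (bound := fun _ => B) Filter.univ_mem
    (Filter.Eventually.of_forall fun t => (hF t).aestronglyMeasurable)
    ((hF 0).integrable_of_hasCompactSupport (HasCompactSupport.of_compactSpace _))
    (hF' 0).aestronglyMeasurable
    (Filter.Eventually.of_forall fun y t _ => ?_) (integrable_const _)
    (Filter.Eventually.of_forall fun y t _ => ?_)).2
  · have e1 : ∀ t, ∫ y, F t y = ch ξ (t • v) * co g g.cont hp ξ := fun t =>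
      co_shift g.cont hp (t • v) (hcs g t) (hps g hp t) ξ
    have e2 : ∫ y, F' 0 y = co (D v g) (D v g).cont (hp.D v) ξ := by
      refine (co_shift (D v g).cont (hp.D v) ((0:ℝ) • v) (hcs _ 0) (hps _ (hp.D v) 0) ξ).trans ?_
      simp
    simp only [e1] at key
    rw [e2] at key
    refine key.unique ?_
    have h1 : HasDerivAt (fun t : ℝ => (2 * Real.pi * pr ξ (t • v) : ℝ)) (2 * Real.pi * pr ξ v) 0 := by
      simp only [pr_smul]
      have := (((hasDerivAt_id (0:ℝ)).mul_const (pr ξ v)).const_mul (2 * Real.pi))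
      simpa using this
    have h2 := ((h1.ofReal_comp.mul_const Complex.I).cexp).mul_const (co g g.cont hp ξ)
    simpa [ch] using h2
  · obtain ⟨x, rfl⟩ := prj_surj y
    simp only [F']
    rw [tor_prj, mF_prj, norm_smul, norm_ch, one_mul, Complex.norm_real]
    exact hB _
  · obtain ⟨x, rfl⟩ := prj_surj y
    simp only [F, F', tor_prj, smul_eq_mul]
    exact (hasDerivAt_line g x v t).ofReal_comp.const_mul _

/-- `1 - ∂_j²` -/
def lam (j : Fin m) (g : SF m) : SF m := g - D (e j) (D (e j) g)

theorem Per.lam {g : SF m} (hp : Per (g : Euc m → ℝ)) (j : Fin m) : Per (lam j g : Euc m → ℝ) := by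
  intro k x
  simp only [WA.lam, SF.sub_apply]
  rw [hp, (hp.D _).D _ k x]

theorem co_sub {g h : Euc m → ℝ} (hc : Continuous g) (hp : Per g) (hc1 : Continuous h) (hp1 : Per h)
    (hc2 : Continuous (fun x => g x - h x)) (hp2 : Per (fun x => g x - h x)) (ξ : Zm m) :
    co _ hc2 hp2 ξ = co g hc hp ξ - co h hc1 hp1 ξ := by
  rw [co, co, co, UnitAddTorus.mFourierCoeff, UnitAddTorus.mFourierCoeff, UnitAddTorus.mFourierCoeff]
  rw [← integral_sub]
  · congr 1
    funext t
    obtain ⟨x, rfl⟩ := prj_surj t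
    simp only [tor_prj, smul_eq_mul]
    push_cast; ring
  · exact intble (UnitAddTorus.mFourier (-ξ) * tor g hc hp)
  · exact intble (UnitAddTorus.mFourier (-ξ) * tor h hc1 hp1)

theorem co_lam {g : SF m} (hp : Per (g : Euc m → ℝ)) (j : Fin m) (ξ : Zm m) :
    co (lam j g) (lam j g).cont (hp.lam j) ξ = ((1 + (2 * Real.pi * ξ j) ^ 2 : ℝ) : ℂ) * co g g.cont hp ξ := by
  have h1 := co_sub g.cont hp (D (e j) (D (e j) g)).cont ((hp.D _).D _) (lam j g).cont (hp.lam j) ξ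
  refine h1.trans ?_
  rw [co_D (hp.D _), co_D hp, pr_e]
  push_cast
  linear_combination (-((2 * Real.pi * ξ j : ℂ)^2 * co g g.cont hp ξ)) * Complex.I_sq

theorem co_lams (l : List (Fin m)) {g : SF m} (hp : Per (g : Euc m → ℝ)) : ∃ B, ∀ ξ : Zm m,
    (l.map fun j => (1 + (2 * Real.pi * ξ j) ^ 2 : ℝ)).prod * ‖co g g.cont hp ξ‖ ≤ B := by
  induction l generalizing g with
  | nil =>
    obtain ⟨B, hB0, hB⟩ := Per.bdd g.cont hp
    exact ⟨B, fun ξ => by simpa using co_bound g.cont hp hB ξ⟩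
  | cons j l ih =>
    obtain ⟨B, hB⟩ := ih (hp.lam j)
    refine ⟨B, fun ξ => ?_⟩
    have := hB ξ
    rw [co_lam hp j, norm_mul, Complex.norm_real, Real.norm_of_nonneg (by positivity)] at this
    rw [List.map_cons, List.prod_cons]
    linarith

theorem summable_prodZ (f : ℤ → ℝ) (h0 : ∀ n, 0 ≤ f n) (hf : Summable f) (n : ℕ) :
    Summable (fun ξ : Fin n → ℤ => ∏ j, f (ξ j)) := by
  induction n with
  | zero => exact Summable.of_finite
  | succ n ih =>
    rw [← (Fin.consEquiv (fun _ : Fin (n+1) => ℤ)).summable_iff]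
    have := hf.mul_of_nonneg ih h0 (fun ξ => Finset.prod_nonneg fun j _ => h0 _)
    refine this.congr fun p => ?_
    simp [Fin.prod_univ_succ, Fin.consEquiv]

theorem summable_inv1 : Summable (fun n : ℤ => (1 + (2 * Real.pi * n) ^ 2 : ℝ)⁻¹) := by
  have h : Summable (fun n : ℤ => ((n : ℝ) ^ 2)⁻¹) := by
    have := Real.summable_one_div_int_pow (p := 2)
    simpa using this.2 (by norm_num)
  refine Summable.of_norm_bounded_eventually h ?_
  have : ∀ᶠ n : ℤ in Filter.cofinite, n ≠ 0 := by
    have := (Set.finite_singleton (0:ℤ)).compl_mem_cofinite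
    exact this
  filter_upwards [this] with n hn
  have hn' : (0:ℝ) < (n:ℝ)^2 := by positivity
  rw [Real.norm_of_nonneg (by positivity)]
  refine inv_anti₀ hn' ?_
  have h3 := Real.pi_gt_three
  have h4 : (n:ℝ)^2 * 1 ≤ (n:ℝ)^2 * (2 * Real.pi)^2 := mul_le_mul_of_nonneg_left (by nlinarith) hn'.le
  nlinarith

theorem co_summable {g : SF m} (hp : Per (g : Euc m → ℝ)) : Summable (fun ξ => ‖co g g.cont hp ξ‖) := by
  obtain ⟨B, hB⟩ := co_lams (List.finRange m) hp
  refine Summable.of_nonneg_of_le (fun _ => norm_nonneg _) (fun ξ => ?_)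
    ((summable_prodZ _ (fun n => by positivity) summable_inv1 m).mul_left B)
  have h1 := hB ξ
  rw [← List.ofFn_eq_map, List.prod_ofFn] at h1
  rw [Finset.prod_inv_distrib, ← div_eq_mul_inv, le_div_iff₀ (Finset.prod_pos fun j _ => by positivity)]
  linarith

/-- Fourier coefficients of a smooth periodic function in the Wiener algebra -/
def hat (g : SF m) (hp : Per (g : Euc m → ℝ)) : WA m := ofS (co g g.cont hp) (co_summable hp)

theorem evx_hat (g : SF m) (hp : Per (g : Euc m → ℝ)) (x : Euc m) : evx x (hat g hp) = g x := by
  have h1 := UnitAddTorus.hasSum_mFourier_series_apply_of_summable (f := tor g g.cont hp)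
    (co_summable hp).of_norm (prj x)
  rw [tor_prj] at h1
  simp only [mF_prj] at h1
  exact (lift_hasSum (fun ξ => ch ξ x) 1 (fun ξ => (norm_ch _ _).le) (hat g hp)).unique h1

theorem hat_D (g : SF m) (hp : Per (g : Euc m → ℝ)) (v : Euc m) (ξ : Zm m) :
    hat (D v g) (hp.D v) ξ = (2 * Real.pi * pr ξ v : ℝ) * Complex.I * hat g hp ξ := co_D hp v ξ

/-! smoothness of translates -/

theorem tau_hasFDerivAt (c : WA m) (c' : Fin m → WA m)
    (h : ∀ j ξ, c' j ξ = (2 * Real.pi * ξ j : ℝ) * Complex.I * c ξ) (s : Euc m) :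
    HasFDerivAt (fun s => tau s c) (∑ j, (EuclideanSpace.proj j : Euc m →L[ℝ] ℝ).smulRight (tau s (c' j))) s := by
  have hch : ∀ ξ (s : Euc m), HasFDerivAt (ch ξ)
      (∑ j, (EuclideanSpace.proj j : Euc m →L[ℝ] ℝ).smulRight ((2 * Real.pi * ξ j : ℝ) * Complex.I * ch ξ s)) s := by
    intro ξ s
    have h1 : HasFDerivAt (pr ξ) (∑ j, (ξ j : ℝ) • (EuclideanSpace.proj j : Euc m →L[ℝ] ℝ)) s := by
      unfold pr
      exact HasFDerivAt.fun_sum fun j _ => (EuclideanSpace.proj j : Euc m →L[ℝ] ℝ).hasFDerivAt.const_mul _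
    have h3 : HasDerivAt (fun t : ℝ => Complex.exp ((2 * Real.pi * t : ℝ) * Complex.I))
        ((2 * Real.pi : ℝ) * Complex.I * ch ξ s) (pr ξ s) := by
      have h1 : HasDerivAt (fun t : ℝ => (2 * Real.pi * t : ℝ)) (2 * Real.pi) (pr ξ s) := by
        simpa using (hasDerivAt_id (pr ξ s)).const_mul (2 * Real.pi)
      have h2 := ((h1.ofReal_comp.mul_const Complex.I).cexp)
      have h5 : (2 * Real.pi : ℝ) * Complex.I * ch ξ s = Complex.exp ((2 * Real.pi * pr ξ s : ℝ) * Complex.I) * ((2 * Real.pi : ℝ) * Complex.I) := by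
        rw [ch]; ring
      rw [h5]; exact h2
    have h2 := h3.hasFDerivAt.comp s h1
    refine h2.congr_fderiv ?_
    ext v
    simp [ContinuousLinearMap.sum_apply, Finset.sum_mul]
    refine Finset.sum_congr rfl fun j _ => ?_
    ring
  let f : Zm m → Euc m → WA m := fun ξ s => c ξ • (ch ξ s • sg ξ)
  let f' : Zm m → Euc m → Euc m →L[ℝ] WA m := fun ξ s =>
    ∑ j, (EuclideanSpace.proj j : Euc m →L[ℝ] ℝ).smulRight (c' j ξ • (ch ξ s • sg ξ))
  have hf : ∀ ξ s, HasFDerivAt (f ξ) (f' ξ s) s := by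
    intro ξ s
    have h1 := ((hch ξ s).smul_const (sg ξ)).const_smul (c ξ)
    refine h1.congr_fderiv ?_
    ext1 v
    simp only [f', ContinuousLinearMap.sum_apply, ContinuousLinearMap.smulRight_apply, ContinuousLinearMap.smul_apply,
      Finset.sum_smul, Finset.smul_sum]
    refine Finset.sum_congr rfl fun j _ => ?_
    rw [h j ξ, smul_assoc, smul_smul _ (ch ξ s), smul_comm (c ξ), smul_smul (c ξ)]
    congr 2
    ring
  have hp : ∀ j : Fin m, ‖(EuclideanSpace.proj j : Euc m →L[ℝ] ℝ)‖ ≤ 1 := fun j =>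
    ContinuousLinearMap.opNorm_le_bound _ zero_le_one fun v => by
      rw [one_mul]; exact PiLp.norm_apply_le v j
  have hb : ∀ ξ s, ‖f' ξ s‖ ≤ ∑ j, ‖c' j ξ‖ := by
    intro ξ s
    refine (norm_sum_le _ _).trans (Finset.sum_le_sum fun j _ => ?_)
    rw [ContinuousLinearMap.norm_smulRight_apply, norm_smul, norm_smul, norm_ch, norm_sg, mul_one, mul_one]
    exact mul_le_of_le_one_left (norm_nonneg _) (hp j)
  have key := hasFDerivAt_tsum (u := fun ξ => ∑ j, ‖c' j ξ‖) (summable_sum fun j _ => summ (c' j)) hf hb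
    (x₀ := 0) (lift_summable (fun ξ => ch ξ 0 • sg ξ) 1 (fun ξ => by simp) c).of_norm s
  refine key.congr_fderiv ?_
  have hs : HasSum (fun ξ => f' ξ s) (∑ j, (EuclideanSpace.proj j : Euc m →L[ℝ] ℝ).smulRight (tau s (c' j))) := by
    refine hasSum_sum fun j _ => ?_
    have h1 := lift_hasSum (fun ξ => ch ξ s • sg ξ) 1 (fun ξ => by simp [norm_smul]) (c' j)
    exact h1.mapL (ContinuousLinearMap.smulRightL ℝ (Euc m) (WA m) (EuclideanSpace.proj j))
  exact hs.tsum_eq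

theorem tau_hat_contDiff (g : SF m) (hp : Per (g : Euc m → ℝ)) : ContDiff ℝ ∞ (fun s => tau s (hat g hp)) := by
  rw [contDiff_infty]
  intro n
  induction n generalizing g with
  | zero => exact contDiff_zero.2 (tau_cont _)
  | succ n ih =>
    have hd := tau_hasFDerivAt (hat g hp) (fun j => hat (D (e j) g) (hp.D _)) (fun j ξ => by rw [hat_D, pr_e])
    have : ContDiff ℝ ((n : WithTop ℕ∞) + 1) (fun s => tau s (hat g hp)) := by
      rw [contDiff_succ_iff_fderiv]
      refine ⟨fun s => (hd s).differentiableAt, by simp, ?_⟩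
      have h2 : fderiv ℝ (fun s => tau s (hat g hp)) = fun s => ∑ j, (EuclideanSpace.proj j : Euc m →L[ℝ] ℝ).smulRight (tau s (hat (D (e j) g) (hp.D _))) :=
        funext fun s => (hd s).fderiv
      rw [h2]
      refine ContDiff.sum fun j _ => ?_
      exact (ContinuousLinearMap.smulRightL ℝ (Euc m) (WA m) (EuclideanSpace.proj j)).contDiff.comp (ih _ _)
    exact_mod_cast this

end WA
end CY
end

section
open scoped ContDiff
open scoped ContDiff
namespace CY
variable {m : ℕ}
namespace WA

/-- squared length of a frequency -/
def n2 (ξ : Zm m) : ℝ := ‖toE ξ‖ ^ 2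

theorem n2_nonneg (ξ : Zm m) : 0 ≤ n2 ξ := sq_nonneg _

theorem toE_add (ξ η : Zm m) : toE (ξ + η) = toE ξ + toE η := by ext i; simp

theorem abs_le_toE (ξ : Zm m) (i : Fin m) : |(ξ i : ℝ)| ≤ ‖toE ξ‖ := by
  simpa using PiLp.norm_apply_le (toE ξ) i

theorem abs_mul_le (ξ : Zm m) (i j : Fin m) : |(ξ i : ℝ) * ξ j| ≤ n2 ξ := by
  rw [abs_mul, n2, sq]
  exact mul_le_mul (abs_le_toE ξ i) (abs_le_toE ξ j) (abs_nonneg _) (norm_nonneg _)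

/-- `(1-Δ)⁻¹` -/
def J : WA m →L[ℂ] WA m := mlt (fun ξ => ((1 + n2 ξ)⁻¹ : ℝ)) 1 (fun ξ => by
  have := n2_nonneg ξ
  rw [Complex.norm_real, Real.norm_of_nonneg (by positivity)]
  exact inv_le_one_of_one_le₀ (by linarith))

@[simp] theorem J_apply (c : WA m) (ξ : Zm m) : J c ξ = ((1 + n2 ξ)⁻¹ : ℝ) * c ξ := mlt_apply _ _ _ _ _

theorem J_inj {c : WA m} (h : J c = 0) : c = 0 := ext' fun ξ => by
  have := congrArg (fun d : WA m => d ξ) h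
  simp only [J_apply, zero_apply, mul_eq_zero] at this
  rcases this with h1 | h1
  · have := n2_nonneg ξ
    have h2 : ((1 + n2 ξ)⁻¹ : ℝ) ≠ 0 := by positivity
    exact absurd (by exact_mod_cast h1) h2
  · simpa using h1

/-- `∂_i ∂_j (1-Δ)⁻¹` -/
def Dm (i j : Fin m) : WA m →L[ℂ] WA m :=
  mlt (fun ξ => ((-(2 * Real.pi * ξ i) * (2 * Real.pi * ξ j)) * (1 + n2 ξ)⁻¹ : ℝ)) ((2 * Real.pi) ^ 2) (fun ξ => by
    have h0 := n2_nonneg ξ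
    have h1 := abs_mul_le ξ i j
    rw [Complex.norm_real, Real.norm_eq_abs, abs_mul, abs_of_nonneg (a := (1 + n2 ξ)⁻¹) (by positivity)]
    have h2 : -(2 * Real.pi * ξ i) * (2 * Real.pi * ξ j) = - ((2 * Real.pi)^2 * (ξ i * ξ j)) := by ring
    rw [h2, abs_neg, abs_mul, abs_of_nonneg (a := (2 * Real.pi)^2) (by positivity), mul_assoc]
    refine mul_le_of_le_one_right (by positivity) ?_
    rw [← div_eq_mul_inv, div_le_one (by positivity)]
    linarith)

@[simp] theorem Dm_apply (i j : Fin m) (c : WA m) (ξ : Zm m) :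
    Dm i j c ξ = ((-(2 * Real.pi * ξ i) * (2 * Real.pi * ξ j)) * (1 + n2 ξ)⁻¹ : ℝ) * c ξ := mlt_apply _ _ _ _ _

/-- `∂_i (1-Δ)⁻¹` -/
def Pm (i : Fin m) : WA m →L[ℂ] WA m :=
  mlt (fun ξ => ((2 * Real.pi * ξ i) * (1 + n2 ξ)⁻¹ : ℝ) * Complex.I) (2 * Real.pi) (fun ξ => by
    have h0 := n2_nonneg ξ
    have h1 := abs_le_toE ξ i
    rw [norm_mul, Complex.norm_I, mul_one, Complex.norm_real, Real.norm_eq_abs, abs_mul, abs_mul, abs_of_nonneg (a := (1 + n2 ξ)⁻¹) (by positivity),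
      abs_of_nonneg (a := 2 * Real.pi) (by positivity), mul_assoc]
    refine mul_le_of_le_one_right (by positivity) ?_
    rw [← div_eq_mul_inv, div_le_one (by positivity)]
    rw [n2]
    nlinarith [sq_nonneg (‖toE ξ‖ - 1)])

@[simp] theorem Pm_apply (i : Fin m) (c : WA m) (ξ : Zm m) :
    Pm i c ξ = ((2 * Real.pi * ξ i) * (1 + n2 ξ)⁻¹ : ℝ) * Complex.I * c ξ := mlt_apply _ _ _ _ _

theorem sum_apply {α : Type*} (s : Finset α) (f : α → WA m) (ξ : Zm m) : (∑ a ∈ s, f a) ξ = ∑ a ∈ s, f a ξ := by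
  exact map_sum (coord ξ) f s

theorem J_deriv (c : WA m) (v x : Euc m) (t : ℝ) :
    HasDerivAt (fun t : ℝ => evx (x + t • v) (J c)) (evx (x + t • v) (∑ i, (v i : ℂ) • Pm i c)) t := by
  refine evx_hasDerivAt _ _ v (fun ξ => ?_) x t
  rw [sum_apply, pr]
  simp only [smul_apply, Pm_apply, J_apply]
  push_cast
  simp only [Finset.mul_sum, Finset.sum_mul]
  exact Finset.sum_congr rfl fun i _ => by ring

theorem P_deriv (c : WA m) (i : Fin m) (v x : Euc m) (t : ℝ) :
    HasDerivAt (fun t : ℝ => evx (x + t • v) (Pm i c)) (evx (x + t • v) (∑ j, (v j : ℂ) • Dm i j c)) t := by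
  refine evx_hasDerivAt _ _ v (fun ξ => ?_) x t
  rw [sum_apply, pr]
  simp only [smul_apply, Pm_apply, Dm_apply]
  generalize (1 + n2 ξ)⁻¹ = r
  push_cast
  simp only [Finset.mul_sum, Finset.sum_mul]
  refine Finset.sum_congr rfl fun j _ => ?_
  linear_combination (- (v j) * ((2 * Real.pi * ξ i) * (2 * Real.pi * ξ j)) * r * c ξ : ℂ) * Complex.I_sq

/-- coefficients -/
structure Coef (m : ℕ) where
  a : Fin m → Fin m → SF m
  pa : ∀ i j, Per (a i j : Euc m → ℝ)
  pd : ∀ x, (Matrix.of fun i j => a i j x).PosDef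
  b : SF m
  pb : Per (b : Euc m → ℝ)
  bpos : ∀ x, 0 < b x

/-- general operator -/
def Top (A : Fin m → Fin m → WA m) (b : WA m) : WA m →L[ℂ] WA m :=
  ∑ i, ∑ j, (mulL (A i j)).comp (Dm i j) - (mulL b).comp J

theorem Top_apply (A : Fin m → Fin m → WA m) (b c : WA m) : Top A b c = ∑ i, ∑ j, A i j * Dm i j c - b * J c := by
  simp [Top, ContinuousLinearMap.sum_apply]

def Coef.A (K : Coef m) (i j : Fin m) : WA m := hat (K.a i j) (K.pa i j)

theorem Coef.re_nonpos (K : Coef m) {B : WA m} {β : Euc m → ℝ} (hB : ∀ x, evx x B = β x) (hβ : ∀ x, 0 < β x)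
    {c : WA m} (h : Top K.A B c = 0) (x : Euc m) :
    (evx x (J c)).re ≤ 0 := by
  have hcont : Continuous (fun x => (evx x (J c)).re) := Complex.continuous_re.comp (evx_cont _)
  obtain ⟨x0, hx0⟩ := Per.max hcont (fun k x => by simp only [evx_per])
  refine (hx0 x).trans ?_
  have hS : ∀ v : Euc m, ∑ i, ∑ j, v i * v j * (evx x0 (Dm i j c)).re ≤ 0 := by
    intro v
    have hre : ∀ (f : ℝ → ℂ) (f' : ℂ) (t : ℝ), HasDerivAt f f' t → HasDerivAt (fun t => (f t).re) f'.re t :=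
      fun f f' t hf => Complex.reCLM.hasFDerivAt.comp_hasDerivAt t hf
    have h1 := fun t => hre _ _ t (J_deriv c v x0 t)
    have h2 : HasDerivAt (fun t : ℝ => (evx (x0 + t • v) (∑ i, (v i : ℂ) • Pm i c)).re)
        (∑ i, ∑ j, v i * v j * (evx x0 (Dm i j c)).re) 0 := by
      have h3 : HasDerivAt (fun t : ℝ => ∑ i, (v i : ℂ) * evx (x0 + t • v) (Pm i c))
          (∑ i, (v i : ℂ) * evx (x0 + (0:ℝ) • v) (∑ j, (v j : ℂ) • Dm i j c)) 0 :=
        HasDerivAt.fun_sum fun i _ => (P_deriv c i v x0 0).const_mul _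
      have h4 := hre _ _ _ h3
      simp only [map_sum, map_smul, smul_eq_mul] at h4 ⊢
      convert h4 using 1
      simp only [zero_smul, add_zero, Complex.re_sum, Finset.mul_sum]
      refine Finset.sum_congr rfl fun i _ => Finset.sum_congr rfl fun j _ => ?_
      rw [Complex.re_ofReal_mul, Complex.re_ofReal_mul]
      ring
    refine (snd_deriv_test h1 h2 ?_).2
    refine Filter.Eventually.of_forall fun t => ?_
    simpa using hx0 (x0 + t • v)
  obtain ⟨F, hF⟩ := psd_factor (K.pd x0).posSemidef
  have hA : ∀ i j, K.a i j x0 = ∑ k, F k i * F k j := by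
    intro i j
    have := congrFun (congrFun hF i) j
    simpa [Matrix.mul_apply] using this
  have h5 : ∑ i, ∑ j, K.a i j x0 * (evx x0 (Dm i j c)).re = β x0 * (evx x0 (J c)).re := by
    have h6 := congrArg (fun d => (evx x0 d).re) h
    simp only [Top_apply, map_sub, map_sum, evx_mul, map_zero, Complex.zero_re, hB, Coef.A, evx_hat, Complex.sub_re,
      Complex.re_sum, Complex.re_ofReal_mul] at h6
    linarith
  have h7 : ∑ i, ∑ j, K.a i j x0 * (evx x0 (Dm i j c)).re ≤ 0 := by
    have : ∑ i, ∑ j, K.a i j x0 * (evx x0 (Dm i j c)).re = ∑ k, ∑ i, ∑ j, F k i * F k j * (evx x0 (Dm i j c)).re := by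
      simp only [hA, Finset.sum_mul]
      rw [Finset.sum_comm (t := (Finset.univ : Finset (Fin m))) (f := fun k i => ∑ j, F k i * F k j * (evx x0 (Dm i j c)).re)]
      exact Finset.sum_congr rfl fun i _ => Finset.sum_comm
    rw [this]
    refine Finset.sum_nonpos fun k _ => ?_
    exact hS (WithLp.toLp 2 (F k))
  rw [h5] at h7
  by_contra hcon
  push Not at hcon
  exact absurd h7 (not_le.2 (mul_pos (hβ x0) hcon))

theorem Coef.inj (K : Coef m) {B : WA m} {β : Euc m → ℝ} (hB : ∀ x, evx x B = β x) (hβ : ∀ x, 0 < β x) :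
    Function.Injective (Top K.A B) := by
  rw [injective_iff_map_eq_zero]
  intro c h
  refine J_inj (uniq fun x => ?_)
  rw [map_zero]
  have h1 := K.re_nonpos hB hβ h x
  have h2 := K.re_nonpos hB hβ (c := -c) (by rw [map_neg, h, neg_zero]) x
  have h3 := K.re_nonpos hB hβ (c := Complex.I • c) (by rw [map_smul, h, smul_zero]) x
  have h4 := K.re_nonpos hB hβ (c := (-Complex.I) • c) (by rw [map_smul, h, smul_zero]) x
  simp only [map_neg, map_smul, smul_eq_mul, Complex.neg_re, Complex.mul_re, Complex.neg_im, Complex.I_re, Complex.I_im] at h2 h3 h4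
  apply Complex.ext
  · simp; linarith
  · simp; linarith

end WA
end CY
end

section
open scoped ContDiff
open scoped ContDiff
namespace CY
variable {m : ℕ}
namespace WA

theorem Dm_sg (i j : Fin m) (ξ : Zm m) : Dm i j (sg ξ) = ((-(2 * Real.pi * ξ i) * (2 * Real.pi * ξ j)) * (1 + n2 ξ)⁻¹ : ℝ) • sg ξ :=
  mlt_sg _ _ _ _
theorem J_sg (ξ : Zm m) : J (sg ξ) = ((1 + n2 ξ)⁻¹ : ℝ) • sg ξ := mlt_sg _ _ _ _

/-- symbol -/
def Pp (A : Fin m → Fin m → WA m) (p : Euc m) (r : ℝ) : WA m := ∑ i, ∑ j, (p i * p j) • A i j + (r ^ 2) • (1 : WA m)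

theorem Pp_smul (A : Fin m → Fin m → WA m) (p : Euc m) (r k : ℝ) : Pp A (k • p) (k * r) = (k ^ 2) • Pp A p r := by
  simp only [Pp, smul_add, Finset.smul_sum, smul_smul, PiLp.smul_apply, smul_eq_mul]
  congr 1
  · exact Finset.sum_congr rfl fun i _ => Finset.sum_congr rfl fun j _ => by congr 1; ring
  · congr 1; ring

theorem Pp_cont (A : Fin m → Fin m → WA m) : Continuous (fun θ : Euc m × ℝ => Pp A θ.1 θ.2) := by
  unfold Pp
  fun_prop

theorem Top_sg (A : Fin m → Fin m → WA m) (r : ℝ) (ξ : Zm m) :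
    Top A ((r ^ 2) • (1 : WA m)) (sg ξ) = -((1 + n2 ξ)⁻¹ • (Pp A ((2 * Real.pi) • toE ξ) r * sg ξ)) := by
  rw [Top_apply, Pp, J_sg]
  simp only [Dm_sg, add_mul, Finset.sum_mul, smul_add, Finset.smul_sum, neg_add, smul_mul_assoc, mul_smul_comm, smul_smul,
    PiLp.smul_apply, smul_eq_mul, toE_apply, ← Finset.sum_neg_distrib, ← neg_smul, sub_eq_add_neg]
  congr 1
  exact Finset.sum_congr rfl fun i _ => Finset.sum_congr rfl fun j _ => by congr 1; ring

theorem Coef.Pp_inv (K : Coef m) (p : Euc m) (r : ℝ) (h : ‖p‖ ^ 2 + r ^ 2 = 1) : ∃ z : WA m, z * Pp K.A p r = 1 := by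
  let q : SF m := ∑ i, ∑ j, (p i * p j) • K.a i j + (r ^ 2) • (1 : SF m)
  have hq : ∀ x, q x = ∑ i, ∑ j, (p i * p j) * K.a i j x + r ^ 2 := fun x => by
    simp [q, SF.sum_apply]
  have hpos : ∀ x, 0 < q x := by
    intro x
    rw [hq]
    by_cases hp : p = 0
    · subst hp
      simp at h ⊢
      rcases h with h | h <;> rw [h] <;> norm_num
    · have : (p : Fin m → ℝ) ≠ 0 := fun h0 => hp (by ext i; exact congrFun h0 i)
      have h1 := PosDef.pos (K.pd x) this
      have h2 : ∑ i, ∑ j, (p i * p j) * K.a i j x = (p : Fin m → ℝ) ⬝ᵥ (Matrix.of fun i j => K.a i j x).mulVec p := by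
        simp only [dotProduct, Matrix.mulVec, Finset.mul_sum, Matrix.of_apply]
        exact Finset.sum_congr rfl fun i _ => Finset.sum_congr rfl fun j _ => by ring
      rw [h2]
      have := sq_nonneg r
      linarith
  have hper : Per (q.inv (fun x => (hpos x).ne') : Euc m → ℝ) := fun k x => by
    simp only [SF.inv_apply, hq, (K.pa _ _) k x]
  refine ⟨hat _ hper, uniq fun x => ?_⟩
  rw [evx_mul, evx_hat, evx_one, Pp]
  have h3 : evx x (∑ i, ∑ j, (p i * p j) • K.A i j + (r ^ 2) • (1 : WA m)) = (q x : ℂ) := by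
    rw [hq]
    have hs : ∀ (a : ℝ) (c : WA m), evx x (a • c) = a * evx x c := fun a c => by
      have : a • c = (a : ℂ) • c := (Complex.coe_smul a c).symm
      rw [this, map_smul, smul_eq_mul]
    simp only [map_add, map_sum, hs, evx_one, Coef.A, evx_hat]
    push_cast
    ring
  rw [h3, SF.inv_apply]
  have := (hpos x).ne'
  push_cast
  exact inv_mul_cancel₀ (by exact_mod_cast this)

theorem Coef.par1 (K : Coef m) : ∃ C0 : ℝ, ∀ θ ∈ {θ : Euc m × ℝ | ‖θ.1‖ ^ 2 + θ.2 ^ 2 = 1}, ∃ (F : Finset (Zm m)) (z : Zm m → ℂ),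
    ∑ η ∈ F, ‖z η‖ * (1 + n2 η) ≤ C0 ∧ ‖(∑ η ∈ F, z η • sg η) * Pp K.A θ.1 θ.2 - 1‖ ≤ 1 / 4 := by
  have hcomp : IsCompact {θ : Euc m × ℝ | ‖θ.1‖ ^ 2 + θ.2 ^ 2 = 1} := by
    refine Metric.isCompact_of_isClosed_isBounded ?_ ?_
    · exact isClosed_eq (by fun_prop) continuous_const
    · refine (Metric.isBounded_closedBall (x := (0 : Euc m × ℝ)) (r := 1)).subset fun θ hθ => ?_
      simp only [Set.mem_setOf_eq] at hθ
      rw [mem_closedBall_zero_iff, Prod.norm_def]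
      refine max_le ?_ ?_
      · nlinarith [norm_nonneg θ.1, sq_nonneg θ.2]
      · rw [Real.norm_eq_abs]
        refine abs_le_one_iff_mul_self_le_one.2 ?_
        nlinarith [norm_nonneg θ.1, sq_nonneg θ.2, sq_nonneg ‖θ.1‖]
  refine hcomp.induction_on (p := fun s => ∃ C0 : ℝ, ∀ θ ∈ s, ∃ (F : Finset (Zm m)) (z : Zm m → ℂ),
    ∑ η ∈ F, ‖z η‖ * (1 + n2 η) ≤ C0 ∧ ‖(∑ η ∈ F, z η • sg η) * Pp K.A θ.1 θ.2 - 1‖ ≤ 1 / 4) ?_ ?_ ?_ ?_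
  · exact ⟨0, fun θ h => absurd h (Set.notMem_empty _)⟩
  · rintro s t hst ⟨C, hC⟩
    exact ⟨C, fun θ h => hC θ (hst h)⟩
  · rintro s t ⟨C, hC⟩ ⟨C', hC'⟩
    refine ⟨max C C', ?_⟩
    rintro θ (h | h)
    · obtain ⟨F, z, h1, h2⟩ := hC θ h
      exact ⟨F, z, h1.trans (le_max_left _ _), h2⟩
    · obtain ⟨F, z, h1, h2⟩ := hC' θ h
      exact ⟨F, z, h1.trans (le_max_right _ _), h2⟩
  · intro θ hθ
    obtain ⟨I, hI⟩ := K.Pp_inv θ.1 θ.2 hθ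
    have h1 : Filter.Tendsto (fun F : Finset (Zm m) => ‖(∑ η ∈ F, I η • sg η) * Pp K.A θ.1 θ.2 - 1‖) Filter.atTop (nhds 0) := by
      have := ((hasSum_sg I).mul_const (Pp K.A θ.1 θ.2))
      have h2 : Filter.Tendsto (fun F : Finset (Zm m) => (∑ η ∈ F, I η • sg η)) Filter.atTop (nhds I) := hasSum_sg I
      have h3 := ((h2.mul_const (Pp K.A θ.1 θ.2)).sub_const 1).norm
      rwa [hI, sub_self, norm_zero] at h3
    obtain ⟨F, hF⟩ := (h1.eventually (gt_mem_nhds (show (0:ℝ) < 1/4 by norm_num))).exists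
    have hc : Continuous fun θ : Euc m × ℝ => ‖(∑ η ∈ F, I η • sg η) * Pp K.A θ.1 θ.2 - 1‖ :=
      ((continuous_const.mul (Pp_cont K.A)).sub continuous_const).norm
    have hev := hc.continuousAt.eventually (gt_mem_nhds hF)
    refine ⟨{θ | ‖(∑ η ∈ F, I η • sg η) * Pp K.A θ.1 θ.2 - 1‖ < 1/4}, mem_nhdsWithin_of_mem_nhds hev, _, fun θ h => ⟨F, I, le_rfl, le_of_lt h⟩⟩

theorem Pp_diff (A : Fin m → Fin m → WA m) (p q : Euc m) (r : ℝ) :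
    ‖Pp A (p + q) r - Pp A p r‖ ≤ (∑ i, ∑ j, ‖A i j‖) * (2 * ‖p‖ * ‖q‖ + ‖q‖ ^ 2) := by
  rw [Pp, Pp, add_sub_add_right_eq_sub, ← Finset.sum_sub_distrib, Finset.sum_mul]
  refine (norm_sum_le _ _).trans (Finset.sum_le_sum fun i _ => ?_)
  rw [← Finset.sum_sub_distrib, Finset.sum_mul]
  refine (norm_sum_le _ _).trans (Finset.sum_le_sum fun j _ => ?_)
  rw [← sub_smul, norm_smul, mul_comm]
  refine mul_le_mul_of_nonneg_left ?_ (norm_nonneg _)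
  have hi : ∀ (v : Euc m) i, |v i| ≤ ‖v‖ := fun v i => by simpa using PiLp.norm_apply_le v i
  have h1 : (p + q) i * (p + q) j - p i * p j = p i * q j + q i * p j + q i * q j := by
    simp; ring
  rw [h1, Real.norm_eq_abs]
  refine (abs_add_le _ _).trans ((add_le_add_left (abs_add_le _ _) _).trans ?_)
  rw [abs_mul, abs_mul, abs_mul]
  have := mul_le_mul (hi p i) (hi q j) (abs_nonneg _) (norm_nonneg _)
  have := mul_le_mul (hi q i) (hi p j) (abs_nonneg _) (norm_nonneg _)
  have := mul_le_mul (hi q i) (hi q j) (abs_nonneg _) (norm_nonneg _)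
  nlinarith

theorem par_aux {a y p ρ : ℝ} (ha : 1 ≤ a) (hy : 0 ≤ y) (hp : 0 ≤ p) (hpρ : p ≤ ρ) (hρ1 : 1 ≤ ρ) :
    2 * p * (a * y) + (a * y) ^ 2 ≤ 2 * a ^ 2 * ρ * (1 + y ^ 2) := by
  have i1 : 2 * p * (a * y) ≤ ρ * a ^ 2 * (1 + y ^ 2) := by
    have : 2 * y ≤ 1 + y ^ 2 := by nlinarith [sq_nonneg (y - 1)]
    have a1 : p * a ≤ ρ * a ^ 2 := by
      rw [sq]
      exact mul_le_mul hpρ (by nlinarith) (by linarith) (by linarith)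
    have := mul_le_mul a1 this (by positivity) (by positivity)
    linarith
  have i2 : (a * y) ^ 2 ≤ ρ * a ^ 2 * (1 + y ^ 2) := by
    have : a ^ 2 ≤ ρ * a ^ 2 := le_mul_of_one_le_left (by positivity) hρ1
    have := mul_le_mul this (show y ^ 2 ≤ 1 + y ^ 2 by linarith) (by positivity) (by positivity)
    linarith [mul_pow a y 2]
  linarith

set_option maxHeartbeats 1000000 in
theorem Coef.par2 (K : Coef m) : ∃ (r C : ℝ), 1 ≤ r ∧ ∀ ξ : Zm m, ∃ v : WA m, ‖v‖ ≤ C ∧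
    ‖Top K.A ((r ^ 2) • (1 : WA m)) v - sg ξ‖ ≤ 1 / 2 := by
  obtain ⟨C0, hC0⟩ := K.par1
  set S := ∑ i, ∑ j, ‖K.A i j‖ with hS
  have hS0 : 0 ≤ S := Finset.sum_nonneg fun i _ => Finset.sum_nonneg fun j _ => norm_nonneg _
  set r : ℝ := 1 + 4 * (2 * S * (2 * Real.pi) ^ 2 * |C0|) with hr
  have hr1 : 1 ≤ r := by rw [hr]; have := abs_nonneg C0; linarith [show 0 ≤ 4 * (2 * S * (2 * Real.pi) ^ 2 * |C0|) by positivity]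
  refine ⟨r, 2 * |C0|, hr1, fun ξ => ?_⟩
  set p : Euc m := (2 * Real.pi) • toE ξ with hp
  have hpi : 1 ≤ 2 * Real.pi := by linarith [Real.pi_gt_three]
  have hpn : ‖p‖ = 2 * Real.pi * ‖toE ξ‖ := by rw [hp, norm_smul, Real.norm_of_nonneg (by linarith)]
  have hpx : ‖toE ξ‖ ≤ ‖p‖ := by rw [hpn]; exact le_mul_of_one_le_left (norm_nonneg _) hpi
  set ρ : ℝ := Real.sqrt (‖p‖ ^ 2 + r ^ 2) with hρ
  have hρ2 : ρ ^ 2 = ‖p‖ ^ 2 + r ^ 2 := Real.sq_sqrt (by positivity)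
  have hρ0 : 0 < ρ := Real.sqrt_pos.2 (by positivity)
  have hpρ : ‖p‖ ≤ ρ := Real.le_sqrt_of_sq_le (by nlinarith [sq_nonneg r])
  have hrρ : r ≤ ρ := Real.le_sqrt_of_sq_le (by nlinarith [sq_nonneg ‖p‖])
  obtain ⟨F, z, hz1, hz2⟩ := hC0 (ρ⁻¹ • p, ρ⁻¹ * r) (by
    simp only [Set.mem_setOf_eq, norm_smul, mul_pow, Real.norm_eq_abs, sq_abs]
    rw [← mul_add, ← hρ2, ← mul_pow, inv_mul_cancel₀ hρ0.ne', one_pow])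
  have hz1' : ∑ η ∈ F, ‖z η‖ * (1 + n2 η) ≤ |C0| := hz1.trans (le_abs_self _)
  simp only [Pp_smul] at hz2
  set k : ℝ := (ρ⁻¹) ^ 2 with hk
  have hk0 : 0 ≤ k := sq_nonneg _
  have hkρ : k * ρ ^ 2 = 1 := by rw [hk, ← mul_pow, inv_mul_cancel₀ hρ0.ne', one_pow]
  refine ⟨- ∑ η ∈ F, (k * (1 + n2 (ξ + η))) • (z η • sg (ξ + η)), ?_, ?_⟩
  · rw [norm_neg]
    refine (norm_sum_le _ _).trans ?_
    have hb : 2 * ∑ η ∈ F, ‖z η‖ * (1 + n2 η) ≤ 2 * |C0| := by linarith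
    refine le_trans ?_ hb
    rw [Finset.mul_sum]
    refine Finset.sum_le_sum fun η _ => ?_
    rw [norm_smul, norm_smul, norm_sg, mul_one, Real.norm_of_nonneg (mul_nonneg hk0 (by linarith [n2_nonneg (ξ + η)]))]
    have h1 : k * (1 + n2 (ξ + η)) ≤ 2 * (1 + n2 η) := by
      have h2 : n2 (ξ + η) ≤ 2 * n2 ξ + 2 * n2 η := by
        rw [n2, n2, n2, toE_add]
        nlinarith [norm_add_le (toE ξ) (toE η), norm_nonneg (toE ξ + toE η), sq_nonneg (‖toE ξ‖ - ‖toE η‖)]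
      have h3 : 1 + n2 ξ ≤ ρ ^ 2 := by
        rw [hρ2, n2]
        nlinarith [norm_nonneg (toE ξ)]
      have h4 : 1 + n2 (ξ + η) ≤ ρ ^ 2 * (2 * (1 + n2 η)) := by
        nlinarith [n2_nonneg η, n2_nonneg ξ]
      calc k * (1 + n2 (ξ + η)) ≤ k * (ρ ^ 2 * (2 * (1 + n2 η))) := mul_le_mul_of_nonneg_left h4 hk0
        _ = (k * ρ ^ 2) * (2 * (1 + n2 η)) := by ring
        _ = _ := by rw [hkρ, one_mul]
    calc k * (1 + n2 (ξ + η)) * ‖z η‖ ≤ 2 * (1 + n2 η) * ‖z η‖ := mul_le_mul_of_nonneg_right h1 (norm_nonneg _)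
      _ = _ := by ring
  · have hT : Top K.A ((r ^ 2) • (1 : WA m)) (- ∑ η ∈ F, (k * (1 + n2 (ξ + η))) • (z η • sg (ξ + η))) - sg ξ
        = sg ξ * (((∑ η ∈ F, z η • sg η) * (k • Pp K.A p r) - 1) +
          ∑ η ∈ F, z η • (sg η * (k • (Pp K.A (p + (2 * Real.pi) • toE η) r - Pp K.A p r)))) := by
      have hc : ∀ η, Top K.A ((r ^ 2) • (1 : WA m)) ((k * (1 + n2 (ξ + η))) • (z η • sg (ξ + η)))
          = - (z η • (k • (Pp K.A (p + (2 * Real.pi) • toE η) r * (sg ξ * sg η)))) := by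
        intro η
        have hs : ∀ (a : ℝ) (c : WA m), a • c = (a : ℂ) • c := fun a c => (Complex.coe_smul a c).symm
        rw [hs (k * (1 + n2 (ξ + η))), map_smul, map_smul, Top_sg, toE_add, smul_add, ← hp, ← sg_mul, hs (1 + n2 (ξ + η))⁻¹, hs k]
        simp only [smul_neg, smul_smul]
        congr 2
        have : (1 + n2 (ξ + η)) ≠ 0 := by linarith [n2_nonneg (ξ + η)]
        have h' : (1 + (n2 (ξ + η) : ℂ)) ≠ 0 := by exact_mod_cast this
        push_cast
        field_simp
      rw [map_neg, map_sum, Finset.sum_congr rfl fun η _ => hc η]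
      simp only [mul_add, mul_sub, mul_one, Finset.sum_neg_distrib, neg_neg, smul_sub, Finset.sum_mul, Finset.mul_sum, Finset.sum_sub_distrib]
      have e1 : ∀ η, sg ξ * (z η • sg η * k • Pp K.A p r) = sg ξ * z η • (sg η * k • Pp K.A p r) := fun η => by
        rw [smul_mul_assoc]
      have e2 : ∀ η, z η • k • (Pp K.A (p + (2 * Real.pi) • toE η) r * (sg ξ * sg η)) =
          sg ξ * z η • (sg η * k • Pp K.A (p + (2 * Real.pi) • toE η) r) := fun η => by
        simp only [mul_smul_comm]
        congr 2
        ring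
      simp only [e1, e2]
      abel
    rw [hT]
    refine (norm_mul_le _ _).trans ?_
    rw [norm_sg, one_mul]
    refine (norm_add_le _ _).trans ?_
    have : ‖∑ η ∈ F, z η • (sg η * (k • (Pp K.A (p + (2 * Real.pi) • toE η) r - Pp K.A p r)))‖ ≤ 1 / 4 := by
      have hb : ∀ η, ‖z η • (sg η * (k • (Pp K.A (p + (2 * Real.pi) • toE η) r - Pp K.A p r)))‖ ≤
          (2 * S * (2 * Real.pi) ^ 2 * ρ⁻¹) * (‖z η‖ * (1 + n2 η)) := by
        intro η
        rw [norm_smul]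
        have h1 : ‖sg η * (k • (Pp K.A (p + (2 * Real.pi) • toE η) r - Pp K.A p r))‖ ≤
            k * (S * (2 * ‖p‖ * ‖(2 * Real.pi) • toE η‖ + ‖(2 * Real.pi) • toE η‖ ^ 2)) := by
          refine (norm_mul_le _ _).trans ?_
          rw [norm_sg, one_mul, norm_smul, Real.norm_of_nonneg hk0]
          exact mul_le_mul_of_nonneg_left (Pp_diff _ _ _ _) hk0
        have h2 : 2 * ‖p‖ * ‖(2 * Real.pi) • toE η‖ + ‖(2 * Real.pi) • toE η‖ ^ 2 ≤ 2 * (2 * Real.pi) ^ 2 * ρ * (1 + n2 η) := by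
          rw [norm_smul (2 * Real.pi) (toE η), Real.norm_of_nonneg (by linarith), n2]
          exact par_aux hpi (norm_nonneg (toE η)) (norm_nonneg p) hpρ (hr1.trans hrρ)
        have h3 : k * ρ = ρ⁻¹ := by rw [hk]; field_simp
        calc _ ≤ ‖z η‖ * (k * (S * (2 * (2 * Real.pi) ^ 2 * ρ * (1 + n2 η)))) :=
              mul_le_mul_of_nonneg_left (h1.trans (mul_le_mul_of_nonneg_left (mul_le_mul_of_nonneg_left h2 hS0) hk0)) (norm_nonneg _)
          _ = (2 * S * (2 * Real.pi) ^ 2 * (k * ρ)) * (‖z η‖ * (1 + n2 η)) := by ring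
          _ = _ := by rw [h3]
      refine (norm_sum_le _ _).trans ((Finset.sum_le_sum fun η _ => hb η).trans ?_)
      rw [← Finset.mul_sum]
      calc _ ≤ (2 * S * (2 * Real.pi) ^ 2 * ρ⁻¹) * |C0| := mul_le_mul_of_nonneg_left hz1' (by positivity)
        _ = (2 * S * (2 * Real.pi) ^ 2 * |C0|) * ρ⁻¹ := by ring
        _ ≤ 1 / 4 := by
          rw [← div_eq_mul_inv, div_le_iff₀ hρ0]
          linarith
    linarith

theorem Coef.surj (K : Coef m) : ∃ r : ℝ, 1 ≤ r ∧ Function.Surjective (Top K.A ((r ^ 2) • (1 : WA m))) := by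
  obtain ⟨r, C, hr, h⟩ := K.par2
  choose v hv1 hv2 using h
  refine ⟨r, hr, ?_⟩
  set T := Top K.A ((r ^ 2) • (1 : WA m))
  set R := lift v C hv1
  have h1 : ‖(1 : WA m →L[ℂ] WA m) - T.comp R‖ ≤ 1 / 2 := by
    refine norm_clm_le _ _ (by norm_num) fun ξ => ?_
    have : ((1 : WA m →L[ℂ] WA m) - T.comp R) (sg ξ) = sg ξ - T (v ξ) := by simp [R]
    rw [this, norm_sub_rev]
    exact hv2 ξ
  have h2 : IsUnit (T.comp R) := by
    have := isUnit_one_sub_of_norm_lt_one (x := (1 : WA m →L[ℂ] WA m) - T.comp R) (lt_of_le_of_lt h1 (by norm_num))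
    simpa using this
  obtain ⟨U, hU⟩ := h2
  intro y
  refine ⟨R ((↑U⁻¹ : WA m →L[ℂ] WA m) y), ?_⟩
  have h3 : (T.comp R) * (↑U⁻¹ : WA m →L[ℂ] WA m) = 1 := by rw [← hU]; exact U.mul_inv
  exact congrArg (fun f : WA m →L[ℂ] WA m => f y) h3

end WA
end CY
end

section
open scoped ContDiff
open scoped ContDiff
namespace CY
variable {m : ℕ}
namespace WA

theorem fin_low (N : ℕ) : {ξ : Zm m | n2 ξ ≤ N}.Finite := by
  have h : (Set.univ.pi fun _ : Fin m => Set.Icc (-(N:ℤ)) N).Finite := Set.Finite.pi fun _ => Set.finite_Icc _ _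
  refine h.subset fun ξ hξ => ?_
  intro i _
  have h1 : (ξ i : ℝ) ^ 2 ≤ N := by
    have := abs_mul_le ξ i i
    rw [abs_mul_self] at this
    rw [sq]
    exact this.trans hξ
  have h2 : (ξ i) ^ 2 ≤ (N : ℤ) := by exact_mod_cast h1
  have h3 : |ξ i| ≤ N := by
    rw [← sq_abs] at h2
    rcases eq_or_ne (ξ i) 0 with h | h
    · rw [h]; simp
    · have : 1 ≤ |ξ i| := Int.one_le_abs h
      nlinarith
  exact abs_le.1 h3

theorem J_compact : IsCompactOperator (J : WA m →L[ℂ] WA m) := by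
  classical
  let F : ℕ → (WA m →L[ℂ] WA m) := fun N => ∑ ξ ∈ (fin_low (m := m) N).toFinset,
    (coord ξ).smulRight (((1 + n2 ξ)⁻¹ : ℝ) • sg ξ)
  have hF : ∀ N, IsCompactOperator (F N) := by
    intro N
    have : ∀ s : Finset (Zm m), IsCompactOperator
        (∑ ξ ∈ s, (coord ξ).smulRight (((1 + n2 ξ)⁻¹ : ℝ) • sg ξ) : WA m →L[ℂ] WA m) := by
      intro s
      induction s using Finset.induction_on with
      | empty => simpa using isCompactOperator_zero
      | insert a s ha ih =>
        rw [Finset.sum_insert ha]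
        refine IsCompactOperator.add ?_ ih
        have h1 : IsCompactOperator (coord a : WA m →L[ℂ] ℂ) := isCompactOperator_of_locallyCompactSpace_dom _
        exact h1.clm_comp (ContinuousLinearMap.toSpanSingleton ℂ (((1 + n2 a)⁻¹ : ℝ) • sg a))
    exact this _
  refine isCompactOperator_of_tendsto (l := Filter.atTop) (F := F) ?_ (Filter.Eventually.of_forall hF)
  rw [tendsto_iff_norm_sub_tendsto_zero]
  have hb : ∀ N, ‖F N - J‖ ≤ 1 / ((N : ℝ) + 1) := by
    intro N
    refine norm_clm_le _ _ (by positivity) fun η => ?_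
    have h1 : F N (sg η) = if n2 η ≤ N then J (sg η) else 0 := by
      simp only [F, ContinuousLinearMap.sum_apply, ContinuousLinearMap.smulRight_apply, coord_apply, sg_apply, ite_smul, one_smul, zero_smul, J_sg]
      rw [Finset.sum_ite_eq']
      simp
    rw [ContinuousLinearMap.sub_apply, h1]
    split_ifs with h
    · simp; positivity
    · rw [zero_sub, norm_neg, J_sg, norm_smul, norm_sg, mul_one, Real.norm_of_nonneg (by have := n2_nonneg η; positivity), one_div]
      push Not at h
      exact inv_anti₀ (by positivity) (by linarith)
  exact squeeze_zero (fun _ => norm_nonneg _) hb tendsto_one_div_add_atTop_nhds_zero_nat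

theorem Coef.bij (K : Coef m) : Function.Bijective (Top K.A (hat K.b K.pb)) := by
  have hinj : Function.Injective (Top K.A (hat K.b K.pb)) := K.inj (evx_hat _ _) K.bpos
  refine ⟨hinj, ?_⟩
  obtain ⟨r, hr, hs⟩ := K.surj
  have hs' : ∀ x : Euc m, evx x ((r ^ 2) • (1 : WA m)) = ((r ^ 2 : ℝ) : ℂ) := fun x => by
    have : (r ^ 2) • (1 : WA m) = ((r ^ 2 : ℝ) : ℂ) • 1 := (Complex.coe_smul _ _).symm
    rw [this, map_smul, evx_one, smul_eq_mul, mul_one]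
  have hi := K.inj hs' (fun x => by positivity)
  set T := Top K.A ((r ^ 2) • (1 : WA m)) with hT
  set T' := Top K.A (hat K.b K.pb) with hT'
  let E := ContinuousLinearEquiv.ofBijective T (LinearMap.ker_eq_bot.2 hi) (LinearMap.range_eq_top.2 hs)
  have hE : ∀ c, E c = T c := fun c => rfl
  let G : WA m →L[ℂ] WA m := (E.symm : WA m →L[ℂ] WA m).comp ((mulL ((r ^ 2) • (1 : WA m) - hat K.b K.pb)).comp J)
  have hG : IsCompactOperator G :=
    (J_compact.clm_comp (mulL ((r ^ 2) • (1 : WA m) - hat K.b K.pb))).clm_comp (E.symm : WA m →L[ℂ] WA m)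
  have key : ∀ c, T' c = T (c + G c) := by
    intro c
    have h1 : T (G c) = ((r ^ 2) • (1 : WA m) - hat K.b K.pb) * J c := by
      rw [← hE]; exact E.apply_symm_apply _
    rw [map_add, h1, hT, hT', Top_apply, Top_apply]
    ring
  rcases hG.hasEigenvalue_or_mem_resolventSet (μ := (-1 : ℂ)) (by norm_num) with h | h
  · exfalso
    obtain ⟨v, hv⟩ := h.exists_hasEigenvector
    have h1 : G v = (-1 : ℂ) • v := hv.apply_eq_smul
    refine hv.2 (hinj ?_)
    rw [key, h1, map_zero]
    simp
  · rw [spectrum.mem_resolventSet_iff] at h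
    obtain ⟨U, hU⟩ := h
    intro y
    obtain ⟨d, hd⟩ := hs y
    refine ⟨- (↑U⁻¹ : WA m →L[ℂ] WA m) d, ?_⟩
    have h3 : (algebraMap ℂ (WA m →L[ℂ] WA m) (-1) - G) * (↑U⁻¹ : WA m →L[ℂ] WA m) = 1 := by rw [← hU]; exact U.mul_inv
    have h4 := congrArg (fun f : WA m →L[ℂ] WA m => f d) h3
    simp [Algebra.algebraMap_eq_smul_one] at h4
    rw [key, ← hd]
    congr 1
    rw [map_neg]
    refine Eq.trans ?_ h4
    abel

end WA
end CY
end

section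
open scoped ContDiff
open scoped ContDiff
namespace CY
variable {m : ℕ}
namespace WA

/-- the matrix `K + D²(Jc)` -/
def MM (K : ℝ) (c : WA m) : Matrix (Fin m) (Fin m) (WA m) := Matrix.of fun i j => (if i = j then (K : ℂ) • 1 else 0) + Dm i j c

/-- nonlinear operator -/
def NN (K : ℝ) (c : WA m) : WA m := (MM K c).det * NormedSpace.exp (-(2 : ℂ) • J c)

theorem exp_contDiff : ContDiff ℂ ω (NormedSpace.exp : WA m → WA m) :=
  contDiff_omega_iff_analyticOnNhd.2 fun x _ => NormedSpace.exp_analytic (𝕂 := ℂ) x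

theorem NN_contDiff (K : ℝ) : ContDiff ℂ ω (NN (m := m) K) := by
  unfold NN
  refine ContDiff.mul ?_ (exp_contDiff.comp (by fun_prop))
  simp only [Matrix.det_apply]
  refine ContDiff.sum fun s _ => ?_
  have : ContDiff ℂ ω fun c : WA m => ∏ i, MM K c (s i) i := contDiff_prod fun i _ => by
    simp only [MM, Matrix.of_apply]
    fun_prop
  rcases Int.units_eq_one_or (Equiv.Perm.sign s) with h | h
  · simpa [h] using this
  · simpa [h] using this.neg

theorem MM_hasFDerivAt (K : ℝ) (c : WA m) (i j : Fin m) : HasFDerivAt (fun c => MM K c i j) (Dm i j) c := by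
  simp only [MM, Matrix.of_apply]
  exact (Dm i j).hasFDerivAt.const_add _

theorem NN_fderiv (K : ℝ) (c d : WA m) : fderiv ℂ (NN K) c d =
    NormedSpace.exp (-(2 : ℂ) • J c) * (∑ i, ∑ j, (MM K c).adjugate j i * Dm i j d - (2 : ℂ) • ((MM K c).det * J d)) := by
  have h1 : HasFDerivAt (fun c : WA m => (MM K c).det)
      (∑ s : Equiv.Perm (Fin m), (Equiv.Perm.sign s : ℤ) • ∑ i, (∏ j ∈ Finset.univ.erase i, MM K c (s j) j) • Dm (s i) i) c := by
    have : ∀ c : WA m, (MM K c).det = ∑ s : Equiv.Perm (Fin m), (Equiv.Perm.sign s : ℤ) • ∏ i, MM K c (s i) i := fun c => by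
      rw [Matrix.det_apply]; rfl
    simp only [this]
    refine HasFDerivAt.fun_sum fun s _ => ?_
    have h2 : HasFDerivAt (fun c : WA m => ∏ i, MM K c (s i) i) (∑ i, (∏ j ∈ Finset.univ.erase i, MM K c (s j) j) • Dm (s i) i) c :=
      HasFDerivAt.finset_prod fun i _ => MM_hasFDerivAt K c (s i) i
    rcases Int.units_eq_one_or (Equiv.Perm.sign s) with h | h
    · simpa [h] using h2
    · simpa [h] using h2.fun_neg
  have h2 : HasFDerivAt (fun c : WA m => NormedSpace.exp (-(2 : ℂ) • J c))
      ((NormedSpace.exp (-(2 : ℂ) • J c) • (1 : WA m →L[ℂ] WA m)).comp (-(2 : ℂ) • J)) c :=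
    (hasFDerivAt_exp (𝕂 := ℂ)).comp c (J.hasFDerivAt.const_smul (-(2:ℂ)))
  have h3 := h1.fun_mul h2
  have h4 : NN K = fun c : WA m => (MM K c).det * NormedSpace.exp (-(2 : ℂ) • J c) := rfl
  rw [h4, h3.fderiv]
  have h5 : (∑ s : Equiv.Perm (Fin m), (Equiv.Perm.sign s : ℤ) • ∑ i, (∏ j ∈ Finset.univ.erase i, MM K c (s j) j) • Dm (s i) i) d
      = ∑ i, ∑ j, (MM K c).adjugate j i * Dm i j d := by
    have h6 := det_deriv_alg (MM K c) (Matrix.of fun i j => Dm i j d)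
    have h7 : ((MM K c).adjugate * Matrix.of fun i j => Dm i j d).trace = ∑ i, ∑ j, (MM K c).adjugate j i * Dm i j d := by
      simp only [Matrix.trace, Matrix.diag_apply, Matrix.mul_apply, Matrix.of_apply]
      exact Finset.sum_comm
    rw [← h7, ← h6, ContinuousLinearMap.sum_apply]
    refine Finset.sum_congr rfl fun s _ => ?_
    rw [ContinuousLinearMap.smul_apply, ContinuousLinearMap.sum_apply]
    have : ∀ x : WA m, Equiv.Perm.sign s • x = (Equiv.Perm.sign s : ℤ) • x := fun _ => rfl
    rw [this]
    congr 1
    refine Finset.sum_congr rfl fun i _ => ?_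
    rw [ContinuousLinearMap.smul_apply, smul_eq_mul, mul_comm]
    rfl
  simp only [ContinuousLinearMap.add_apply, ContinuousLinearMap.smul_apply, ContinuousLinearMap.comp_apply, h5, smul_eq_mul,
    ContinuousLinearMap.one_apply]
  simp only [mul_sub, neg_smul, mul_neg, mul_smul_comm]
  rw [add_comm, sub_eq_add_neg]
  congr 2
  ring_nf

end WA
end CY
end

section
open scoped ContDiff
open scoped ContDiff
namespace CY
variable {m : ℕ}
namespace WA

/-- matrix `K + D²φ` of smooth functions -/
def tM (K : ℝ) (φ : SF m) : Matrix (Fin m) (Fin m) (SF m) :=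
  Matrix.of fun i j => (if i = j then K • (1 : SF m) else 0) + D (e i) (D (e j) φ)

/-- real matrix -/
def rM (K : ℝ) (φ : SF m) (x : Euc m) : Matrix (Fin m) (Fin m) ℝ :=
  Matrix.of fun i j => (if i = j then K else 0) + D (e i) (D (e j) φ) x

theorem tM_rM (K : ℝ) (φ : SF m) (x : Euc m) : (ev x).mapMatrix (tM K φ) = rM K φ x := by
  ext i j
  simp only [RingHom.mapMatrix_apply, Matrix.map_apply, tM, rM, Matrix.of_apply]
  change ((if i = j then K • (1 : SF m) else 0) + D (e i) (D (e j) φ)) x = _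
  rw [SF.add_apply]
  split_ifs <;> simp

theorem tM_det (K : ℝ) (φ : SF m) (x : Euc m) : (tM K φ).det x = (rM K φ x).det := by
  rw [← tM_rM, ← AlgHom.map_det]; rfl

theorem tM_adj (K : ℝ) (φ : SF m) (x : Euc m) (i j : Fin m) : (tM K φ).adjugate i j x = (rM K φ x).adjugate i j := by
  rw [← tM_rM, ← AlgHom.map_adjugate]; rfl

theorem rM_symm (K : ℝ) (φ : SF m) (x : Euc m) : (rM K φ x).transpose = rM K φ x := by
  ext i j
  simp only [rM, Matrix.transpose_apply, Matrix.of_apply, D_comm (e i) (e j), eq_comm]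

/-- torus solution -/
structure TS (K : ℝ) (f φ : SF m) : Prop where
  per : Per (φ : Euc m → ℝ)
  pd : ∀ x, (rM K φ x).PosDef
  eq : ∀ x, (rM K φ x).det = Real.exp (2 * φ x + f x)

theorem n2_eq (ξ : Zm m) : n2 ξ = ∑ j, (ξ j : ℝ) ^ 2 := by
  rw [n2, EuclideanSpace.norm_sq_eq]
  simp

/-- `(1-Δ)φ` -/
def cOf (φ : SF m) (hp : Per (φ : Euc m → ℝ)) : WA m :=
  hat φ hp - ∑ j, (((2 * Real.pi) ^ 2)⁻¹ : ℝ) • hat (D (e j) (D (e j) φ)) ((hp.D _).D _)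

theorem hat_DD (φ : SF m) (hp : Per (φ : Euc m → ℝ)) (i j : Fin m) (ξ : Zm m) :
    hat (D (e i) (D (e j) φ)) ((hp.D _).D _) ξ = ((-(2 * Real.pi * ξ i) * (2 * Real.pi * ξ j) : ℝ) : ℂ) * hat φ hp ξ := by
  rw [hat_D (D (e j) φ) (hp.D _) (e i), hat_D φ hp (e j), pr_e, pr_e]
  push_cast
  linear_combination (2 * Real.pi * ξ i * (2 * Real.pi * ξ j) * hat φ hp ξ : ℂ) * Complex.I_sq

theorem cOf_apply (φ : SF m) (hp : Per (φ : Euc m → ℝ)) (ξ : Zm m) : cOf φ hp ξ = ((1 + n2 ξ : ℝ) : ℂ) * hat φ hp ξ := by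
  have hs : ∀ (a : ℝ) (c : WA m), (a • c) ξ = (a : ℂ) * c ξ := fun a c => rfl
  rw [cOf, sub_apply, sum_apply]
  simp only [hs]
  rw [n2_eq]
  have h2 : ∀ j : Fin m, (((2 * Real.pi) ^ 2)⁻¹ : ℝ) * hat (D (e j) (D (e j) φ)) ((hp.D _).D _) ξ
      = - (((ξ j : ℝ) ^ 2 : ℝ) : ℂ) * hat φ hp ξ := by
    intro j
    rw [hat_DD φ hp j j ξ, ← mul_assoc, ← Complex.ofReal_mul, ← Complex.ofReal_neg]
    congr 2
    have := Real.pi_pos.ne'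
    field_simp
  rw [Finset.sum_congr rfl fun j _ => h2 j]
  push_cast
  simp only [neg_mul, Finset.sum_neg_distrib, ← Finset.sum_mul]
  ring

theorem J_cOf (φ : SF m) (hp : Per (φ : Euc m → ℝ)) : J (cOf φ hp) = hat φ hp := ext' fun ξ => by
  have : (1 + n2 ξ) ≠ 0 := by linarith [n2_nonneg ξ]
  rw [J_apply, cOf_apply, ← mul_assoc, ← Complex.ofReal_mul, inv_mul_cancel₀ this, Complex.ofReal_one, one_mul]

theorem Dm_cOf (φ : SF m) (hp : Per (φ : Euc m → ℝ)) (i j : Fin m) :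
    Dm i j (cOf φ hp) = hat (D (e i) (D (e j) φ)) ((hp.D _).D _) := ext' fun ξ => by
  have : (1 + n2 ξ) ≠ 0 := by linarith [n2_nonneg ξ]
  rw [Dm_apply, cOf_apply, hat_DD, ← mul_assoc, ← Complex.ofReal_mul, mul_assoc, inv_mul_cancel₀ this, mul_one]

theorem evx_det (x : Euc m) (M : Matrix (Fin m) (Fin m) (WA m)) : evx x M.det = (M.map (evx x)).det :=
  (evA x).toRingHom.map_det M

theorem evx_adj (x : Euc m) (M : Matrix (Fin m) (Fin m) (WA m)) (i j : Fin m) : evx x (M.adjugate i j) = (M.map (evx x)).adjugate i j :=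
  congrFun (congrFun ((evA x).toRingHom.map_adjugate M) i) j

theorem evx_MM (K : ℝ) (c : WA m) (x : Euc m) :
    (MM K c).map (evx x) = Matrix.of fun i j => (if i = j then (K : ℂ) else 0) + evx x (Dm i j c) := by
  ext i j
  simp only [MM, Matrix.map_apply, Matrix.of_apply, map_add]
  split_ifs <;> simp [evx_one]

theorem evx_NN (K : ℝ) (c : WA m) (x : Euc m) : evx x (NN K c) =
    (Matrix.of fun i j => (if i = j then (K : ℂ) else 0) + evx x (Dm i j c)).det * Complex.exp (-2 * evx x (J c)) := by
  rw [NN, evx_mul, evx_exp, evx_det, evx_MM, map_smul, smul_eq_mul]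

/-- complexification -/
def toCM (M : Matrix (Fin m) (Fin m) ℝ) : Matrix (Fin m) (Fin m) ℂ := Complex.ofRealHom.mapMatrix M

theorem toCM_det (M : Matrix (Fin m) (Fin m) ℝ) : (toCM M).det = (M.det : ℂ) := (Complex.ofRealHom.map_det M).symm
theorem toCM_adj (M : Matrix (Fin m) (Fin m) ℝ) (i j : Fin m) : (toCM M).adjugate i j = (M.adjugate i j : ℂ) :=
  (congrFun (congrFun (Complex.ofRealHom.map_adjugate M) i) j).symm

theorem MM_cOf (K : ℝ) (φ : SF m) (hp : Per (φ : Euc m → ℝ)) (x : Euc m) : (MM K (cOf φ hp)).map (evx x) = toCM (rM K φ x) := by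
  rw [evx_MM]
  ext i j
  simp only [Matrix.of_apply, Dm_cOf, evx_hat, toCM, rM, RingHom.mapMatrix_apply, Matrix.map_apply, map_add]
  congr 1
  split_ifs <;> simp

/-- linearized coefficients -/
def TS.coef {K : ℝ} {f φ : SF m} (h : TS K f φ) : Coef m where
  a i j := SF.exp (-(2 : ℝ) • φ) * (tM K φ).adjugate j i
  pa i j := by
    have hM : ∀ x, (tM K φ).adjugate j i x = (rM K φ x).adjugate j i := fun x => by
      exact tM_adj K φ x j i
    intro k x
    simp only [SF.mul_apply, SF.exp_apply, SF.smul_apply, hM, h.per k x]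
    have : rM K φ (x + toE k) = rM K φ x := by
      ext i j
      simp only [rM, Matrix.of_apply, ((h.per.D (e j)).D (e i)) k x]
    rw [this]
  pd x := by
    have hM : ∀ i j, (tM K φ).adjugate j i x = (rM K φ x).adjugate j i := fun i j => by
      exact tM_adj K φ x j i
    have hd := (h.pd x).det_pos
    have h1 : (Matrix.of fun i j => (SF.exp (-(2 : ℝ) • φ) * (tM K φ).adjugate j i) x) =
        (Real.exp (-2 * φ x) * (rM K φ x).det) • (rM K φ x)⁻¹.transpose := by
      ext i j
      simp only [Matrix.of_apply, SF.mul_apply, SF.exp_apply, SF.smul_apply, hM, Matrix.smul_apply, Matrix.transpose_apply, smul_eq_mul]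
      rw [Matrix.inv_def, Ring.inverse_eq_inv', Matrix.smul_apply, smul_eq_mul, mul_assoc, ← mul_assoc (rM K φ x).det,
        mul_inv_cancel₀ hd.ne', one_mul]
    rw [h1]
    exact (h.pd x).inv.transpose.smul (mul_pos (Real.exp_pos _) hd)
  b := (2 : ℝ) • (SF.exp (-(2 : ℝ) • φ) * (tM K φ).det)
  pb := by
    have hM : ∀ x, (tM K φ).det x = (rM K φ x).det := fun x => by
      exact tM_det K φ x
    intro k x
    simp only [SF.mul_apply, SF.exp_apply, SF.smul_apply, hM, h.per k x]
    have : rM K φ (x + toE k) = rM K φ x := by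
      ext i j
      simp only [rM, Matrix.of_apply, ((h.per.D (e j)).D (e i)) k x]
    rw [this]
  bpos x := by
    have hM : ∀ x, (tM K φ).det x = (rM K φ x).det := fun x => by
      exact tM_det K φ x
    have hd := (h.pd x).det_pos
    simp only [SF.mul_apply, SF.exp_apply, SF.smul_apply, hM, smul_eq_mul]
    positivity

theorem TS.fderiv_eq {K : ℝ} {f φ : SF m} (h : TS K f φ) :
    fderiv ℂ (NN K) (cOf φ h.per) = Top h.coef.A (hat h.coef.b h.coef.pb) := by
  have hM : ∀ x, (tM K φ).det x = (rM K φ x).det := fun x => by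
    exact tM_det K φ x
  have hM' : ∀ x i j, (tM K φ).adjugate j i x = (rM K φ x).adjugate j i := fun x i j => by
    exact tM_adj K φ x j i
  ext1 d
  rw [NN_fderiv, Top_apply]
  refine uniq fun x => ?_
  simp only [evx_mul, evx_exp, map_sub, map_sum, map_smul, evx_adj, evx_det, MM_cOf, J_cOf, evx_hat, toCM_adj, toCM_det, Coef.A]
  have e1 : ∀ i j, h.coef.a i j x = Real.exp (-2 * φ x) * (rM K φ x).adjugate j i := fun i j => by
    simp only [TS.coef, SF.mul_apply, SF.exp_apply, SF.smul_apply, hM', smul_eq_mul]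
  have e2 : h.coef.b x = 2 * (Real.exp (-2 * φ x) * (rM K φ x).det) := by
    simp only [TS.coef, SF.mul_apply, SF.exp_apply, SF.smul_apply, hM, smul_eq_mul]
  simp only [e1, e2, smul_eq_mul]
  push_cast
  simp only [mul_sub, Finset.mul_sum]
  congr 1
  · exact Finset.sum_congr rfl fun i _ => Finset.sum_congr rfl fun j _ => by ring
  · ring

end WA
end CY
end

section
open scoped ContDiff
open scoped ContDiff Topology
namespace CY
variable {m : ℕ}
namespace WA

theorem n2_neg (ξ : Zm m) : n2 (-ξ) = n2 ξ := by simp [n2_eq]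

theorem J_st (c : WA m) : J (st c) = st (J c) := ext' fun ξ => by
  rw [J_apply, st_apply, st_apply, J_apply, n2_neg, map_mul, Complex.conj_ofReal]

theorem Dm_st (i j : Fin m) (c : WA m) : Dm i j (st c) = st (Dm i j c) := ext' fun ξ => by
  rw [Dm_apply, st_apply, st_apply, Dm_apply, n2_neg, map_mul, Complex.conj_ofReal]
  simp

theorem J_tau (s : Euc m) (c : WA m) : J (tau s c) = tau s (J c) := ext' fun ξ => by
  rw [J_apply, tau_apply, tau_apply, J_apply]; ring

theorem Dm_tau (i j : Fin m) (s : Euc m) (c : WA m) : Dm i j (tau s c) = tau s (Dm i j c) := ext' fun ξ => by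
  rw [Dm_apply, tau_apply, tau_apply, Dm_apply]; ring

theorem Dm_comm (i j : Fin m) (c : WA m) : Dm i j c = Dm j i c := ext' fun ξ => by
  rw [Dm_apply, Dm_apply]
  congr 2; ring

theorem NN_st (K : ℝ) (c : WA m) : NN K (st c) = st (NN K c) := uniq fun x => by
  rw [evx_st, evx_NN, evx_NN, map_mul, ← Complex.exp_conj, RingHom.map_det]
  congr 1
  · congr 1
    ext i j
    simp only [Matrix.of_apply, Dm_st, evx_st, RingHom.mapMatrix_apply, Matrix.map_apply, map_add]
    congr 1
    split_ifs <;> simp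
  · rw [J_st, evx_st, map_mul, map_neg, Complex.conj_ofNat]

theorem NN_tau (K : ℝ) (s : Euc m) (c : WA m) : NN K (tau s c) = tau s (NN K c) := uniq fun x => by
  rw [evx_tau, evx_NN, evx_NN, J_tau, evx_tau]
  simp only [Dm_tau, evx_tau]

theorem exp_tau (s : Euc m) (c : WA m) : tau s (NormedSpace.exp c) = NormedSpace.exp (tau s c) := uniq fun x => by
  rw [evx_tau, evx_exp, evx_exp, evx_tau]

theorem evx_J_contDiff {c : WA m} (h : ContDiffAt ℝ ∞ (fun s => tau s c) 0) : ContDiff ℝ ∞ (fun x => (evx x (J c)).re) := by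
  rw [contDiff_iff_contDiffAt]
  intro x
  have h1 : (fun y => (evx y (J c)).re) = fun y => (Complex.reCLM ((evx x (J (tau (y - x) c))))) := by
    funext y
    rw [J_tau, evx_tau, add_sub_cancel]; rfl
  rw [h1]
  have h2 : ContDiffAt ℝ ∞ (fun y : Euc m => tau (y - x) c) x := by
    have h3 : ContDiffAt ℝ ∞ (fun s => tau s c) (x - x) := by rwa [sub_self]
    exact ContDiffAt.comp (f := fun y : Euc m => y - x) x h3 (by fun_prop)
  have h4 : ContDiff ℝ ∞ (fun d : WA m => Complex.reCLM (evx x (J d))) :=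
    Complex.reCLM.contDiff.comp (((evx x).comp J).restrictScalars ℝ).contDiff
  exact h4.contDiffAt.comp x h2

/-- the real function of a real element -/
def phi (c : WA m) (h : ContDiffAt ℝ ∞ (fun s => tau s c) 0) : SF m := ⟨fun x => (evx x (J c)).re, evx_J_contDiff h⟩

theorem phi_apply (c : WA m) (h : ContDiffAt ℝ ∞ (fun s => tau s c) 0) (x : Euc m) : phi c h x = (evx x (J c)).re := rfl

theorem hasDerivAt_re {g : ℝ → ℂ} {g' : ℂ} {t : ℝ} (h : HasDerivAt g g' t) : HasDerivAt (fun t => (g t).re) g'.re t :=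
  Complex.reCLM.hasFDerivAt.comp_hasDerivAt t h

theorem phi_D (c : WA m) (h) (i : Fin m) (x : Euc m) : D (e i) (phi c h) x = (evx x (Pm i c)).re := by
  have h1 := hasDerivAt_line (phi c h) x (e i) 0
  have h2 := hasDerivAt_re (J_deriv c (e i) x 0)
  have h3 := h1.unique h2
  rw [zero_smul, add_zero] at h3
  rw [h3]
  congr 2
  rw [Finset.sum_eq_single i]
  · simp [e]
  · intro j _ hj; simp [e, hj]
  · simp

theorem phi_DD (c : WA m) (h) (i j : Fin m) (x : Euc m) : D (e i) (D (e j) (phi c h)) x = (evx x (Dm i j c)).re := by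
  have h1 := hasDerivAt_line (D (e j) (phi c h)) x (e i) 0
  have h2 := hasDerivAt_re (P_deriv c j (e i) x 0)
  simp only [← phi_D c h] at h2
  have h3 := h1.unique h2
  rw [zero_smul, add_zero] at h3
  rw [h3, Dm_comm i j]
  congr 2
  rw [Finset.sum_eq_single i]
  · simp [e]
  · intro j _ hj; simp [e, hj]
  · simp

theorem phi_per (c : WA m) (h) : Per (phi c h : Euc m → ℝ) := fun k x => by
  rw [phi_apply, phi_apply, evx_per]

theorem re_of_st {c : WA m} (h : st c = c) (x : Euc m) : ((evx x c).re : ℂ) = evx x c := by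
  have := evx_st x c
  rw [h] at this
  exact Complex.conj_eq_iff_re.1 this.symm

theorem evx_NN_phi (K : ℝ) (c : WA m) (h) (hs : st c = c) (x : Euc m) :
    evx x (NN K c) = (((rM K (phi c h) x).det * Real.exp (-2 * phi c h x) : ℝ) : ℂ) := by
  rw [evx_NN]
  push_cast
  rw [← toCM_det, phi_apply, re_of_st (by rw [← J_st, hs])]
  congr 2
  ext i j
  simp only [toCM, rM, Matrix.of_apply, RingHom.mapMatrix_apply, Matrix.map_apply, map_add, phi_DD]
  congr 1
  · split_ifs <;> simp
  · exact (re_of_st (by rw [← Dm_st, hs]) x).symm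

/-- uniform ellipticity -/
theorem TS.lam {K : ℝ} {f φ : SF m} (h : TS K f φ) : ∃ l > 0, ∀ x (v : Euc m), ‖v‖ = 1 →
    l ≤ ∑ i, ∑ j, rM K φ x i j * v i * v j := by
  let q : UnitAddTorus (Fin m) × Euc m → ℝ := fun p => ∑ i, ∑ j,
    ((if i = j then K else 0) + (tor (D (e i) (D (e j) φ)) (SF.cont _) ((h.per.D _).D _) p.1).re) * p.2 i * p.2 j
  have hq : ∀ x v, q (prj x, v) = ∑ i, ∑ j, rM K φ x i j * v i * v j := fun x v => by
    simp only [q, tor_prj, Complex.ofReal_re, rM, Matrix.of_apply]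
  have hc : Continuous q := by
    refine continuous_finset_sum _ fun i _ => continuous_finset_sum _ fun j _ => ?_
    have h1 : Continuous fun p : UnitAddTorus (Fin m) × Euc m => (tor (D (e i) (D (e j) φ)) (SF.cont _) ((h.per.D _).D _) p.1).re :=
      Complex.continuous_re.comp ((tor _ _ _).continuous.comp continuous_fst)
    have h2 : ∀ i, Continuous fun p : UnitAddTorus (Fin m) × Euc m => p.2 i := fun i =>
      (EuclideanSpace.proj i : Euc m →L[ℝ] ℝ).continuous.comp continuous_snd
    exact ((continuous_const.add h1).mul (h2 i)).mul (h2 j)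
  have hpos : ∀ x (v : Euc m), ‖v‖ = 1 → 0 < q (prj x, v) := fun x v hv => by
    rw [hq]
    have hv0 : (v : Fin m → ℝ) ≠ 0 := by
      intro h0
      have : v = 0 := by ext i; exact congrFun h0 i
      rw [this, norm_zero] at hv
      exact zero_ne_one hv
    have := PosDef.pos (h.pd x) hv0
    simp only [dotProduct, Matrix.mulVec, Finset.mul_sum] at this
    refine this.trans_eq (Finset.sum_congr rfl fun i _ => Finset.sum_congr rfl fun j _ => by ring)
  have hcomp : IsCompact ((Set.univ : Set (UnitAddTorus (Fin m))) ×ˢ Metric.sphere (0 : Euc m) 1) :=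
    isCompact_univ.prod (isCompact_sphere _ _)
  by_cases hne : (Metric.sphere (0 : Euc m) 1).Nonempty
  · obtain ⟨⟨t, v⟩, hp, hmin⟩ := hcomp.exists_isMinOn (Set.univ_nonempty.prod hne) hc.continuousOn
    obtain ⟨x0, rfl⟩ := prj_surj t
    have hv : ‖v‖ = 1 := by simpa using hp.2
    refine ⟨q (prj x0, v), hpos x0 v hv, fun x w hw => ?_⟩
    rw [← hq]
    exact hmin (a := (prj x, w)) ⟨Set.mem_univ _, by simpa using hw⟩
  · refine ⟨1, one_pos, fun x v hv => absurd ⟨v, by simpa using hv⟩ hne⟩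

theorem pd_of_close {K l ε : ℝ} {A B : Matrix (Fin m) (Fin m) ℝ} (hl : ∀ v : Euc m, ‖v‖ = 1 → l ≤ ∑ i, ∑ j, A i j * v i * v j)
    (hB : B.transpose = B) (hAB : ∀ i j, |A i j - B i j| ≤ ε) (hε : (m : ℝ) ^ 2 * ε < l) : B.PosDef := by
  refine posDef_of hB fun v hv => ?_
  have key : ∀ v : Euc m, ‖v‖ = 1 → 0 < ∑ i, ∑ j, B i j * v i * v j := fun v hv => by
    have h1 : ∑ i, ∑ j, A i j * v i * v j - ∑ i, ∑ j, B i j * v i * v j ≤ ∑ i : Fin m, ∑ j : Fin m, ε := by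
      rw [← Finset.sum_sub_distrib]
      refine Finset.sum_le_sum fun i _ => ?_
      rw [← Finset.sum_sub_distrib]
      refine Finset.sum_le_sum fun j _ => ?_
      have hi : |v i| ≤ 1 := hv ▸ (PiLp.norm_apply_le v i)
      have hj : |v j| ≤ 1 := hv ▸ (PiLp.norm_apply_le v j)
      calc A i j * v i * v j - B i j * v i * v j = (A i j - B i j) * (v i * v j) := by ring
        _ ≤ |(A i j - B i j) * (v i * v j)| := le_abs_self _
        _ = |A i j - B i j| * (|v i| * |v j|) := by rw [abs_mul, abs_mul]
        _ ≤ |A i j - B i j| * 1 := mul_le_mul_of_nonneg_left (mul_le_one₀ hi (abs_nonneg _) hj) (abs_nonneg _)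
        _ ≤ ε := by rw [mul_one]; exact hAB i j
    have h2 : ∑ i : Fin m, ∑ j : Fin m, ε = (m : ℝ) ^ 2 * ε := by simp; ring
    have := hl v hv
    linarith
  have hw : (WithLp.toLp 2 v : Euc m) ≠ 0 := fun h0 => hv (by
    funext i; exact congrArg (fun w : Euc m => w i) h0)
  set w : Euc m := WithLp.toLp 2 v
  have hn : 0 < ‖w‖ := norm_pos_iff.2 hw
  have h3 := key (‖w‖⁻¹ • w) (by rw [norm_smul, norm_inv, norm_norm, inv_mul_cancel₀ hn.ne'])
  have h4 : ∑ i, ∑ j, B i j * (‖w‖⁻¹ • w) i * (‖w‖⁻¹ • w) j = (‖w‖⁻¹ ^ 2) * (v ⬝ᵥ B.mulVec v) := by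
    simp only [dotProduct, Matrix.mulVec, Finset.mul_sum, PiLp.smul_apply, smul_eq_mul]
    refine Finset.sum_congr rfl fun i _ => Finset.sum_congr rfl fun j _ => ?_
    change B i j * (‖w‖⁻¹ * v i) * (‖w‖⁻¹ * v j) = _
    ring
  rw [h4] at h3
  exact pos_of_mul_pos_right h3 (by positivity)

theorem st_hat (φ : SF m) (hp) : st (hat φ hp) = hat φ hp := uniq fun x => by
  rw [evx_st, evx_hat, Complex.conj_ofReal]

theorem TS.open {K : ℝ} {f φ : SF m} (h : TS K f φ) (hf : Per (f : Euc m → ℝ)) (g : SF m) (hg : Per (g : Euc m → ℝ)) :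
    ∀ᶠ s : ℝ in 𝓝 0, ∃ ψ : SF m, TS K (f + s • g) ψ := by
  classical
  set c0 := cOf φ h.per with hc0
  have hbij := h.coef.bij
  let E := ContinuousLinearEquiv.ofBijective (Top h.coef.A (hat h.coef.b h.coef.pb)) (LinearMap.ker_eq_bot.2 hbij.1)
    (LinearMap.range_eq_top.2 hbij.2)
  have hd : HasFDerivAt (NN K) (E : WA m →L[ℂ] WA m) c0 := by
    have h1 := ((NN_contDiff (m := m) K).differentiable (by simp) c0).hasFDerivAt
    rw [h.fderiv_eq] at h1
    exact h1
  have hcd : ContDiffAt ℂ ω (NN K) c0 := (NN_contDiff K).contDiffAt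
  have hω : (ω : WithTop ℕ∞) ≠ 0 := by simp
  let P := hcd.toOpenPartialHomeomorph (NN K) hd hω
  have hPc : ∀ c, P c = NN K c := fun c => rfl
  have hsrc : c0 ∈ P.source := hcd.mem_toOpenPartialHomeomorph_source hd hω
  have htgt : NN K c0 ∈ P.target := hcd.image_mem_toOpenPartialHomeomorph_target hd hω
  have hΨ : ContDiffAt ℂ ω P.symm (NN K c0) := hcd.to_localInverse hd hω
  have hΨ0 : P.symm (NN K c0) = c0 := P.left_inv hsrc
  -- the right hand side
  let y : ℝ → WA m := fun s => NormedSpace.exp (hat f hf + (s : ℂ) • hat g hg)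
  have hyev : ∀ s x, evx x (y s) = ((Real.exp (f x + s * g x) : ℝ) : ℂ) := fun s x => by
    simp only [y, evx_exp, map_add, map_smul, evx_hat, smul_eq_mul]
    push_cast; rfl
  have hst0 : st c0 = c0 := ext' fun ξ => by
    have := congrArg (fun d : WA m => d ξ) (st_hat φ h.per)
    simp only [st_apply] at this
    rw [st_apply, hc0, cOf_apply, cOf_apply, n2_neg, map_mul, Complex.conj_ofReal, this]
  have hy0 : y 0 = NN K c0 := uniq fun x => by
    rw [hyev, NN, evx_mul, evx_exp, evx_det, MM_cOf, toCM_det, h.eq x, map_smul, J_cOf, evx_hat, smul_eq_mul]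
    rw [← Complex.ofReal_ofNat, ← Complex.ofReal_neg, ← Complex.ofReal_mul, ← Complex.ofReal_exp, ← Complex.ofReal_mul, ← Real.exp_add]
    congr 2; ring
  have hyc : Continuous y := by
    have h1 : Continuous (NormedSpace.exp : WA m → WA m) := exp_contDiff.continuous
    exact h1.comp (by fun_prop)
  have hyst : ∀ s, st (y s) = y s := fun s => uniq fun x => by
    rw [evx_st, hyev, Complex.conj_ofReal]
  obtain ⟨l, hl0, hl⟩ := h.lam
  obtain ⟨ε, hε0, hε⟩ : ∃ ε > 0, (m : ℝ) ^ 2 * ((2 * Real.pi) ^ 2 * ε) < l := by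
    refine ⟨l / ((m : ℝ) ^ 2 * (2 * Real.pi) ^ 2 + 1), by positivity, ?_⟩
    rw [← mul_assoc, mul_div_assoc', div_lt_iff₀ (by positivity)]
    nlinarith
  obtain ⟨r, hr0, hr⟩ := Metric.isOpen_iff.1 P.open_source c0 hsrc
  have hcs : Filter.Tendsto (fun s => P.symm (y s)) (𝓝 0) (𝓝 c0) := by
    have h1 : ContinuousAt P.symm (y 0) := by rw [hy0]; exact hΨ.continuousAt
    have h2 : ContinuousAt (fun s => P.symm (y s)) 0 := ContinuousAt.comp (f := y) h1 hyc.continuousAt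
    have h3 : P.symm (y 0) = c0 := by rw [hy0, hΨ0]
    have h4 : Filter.Tendsto (fun s => P.symm (y s)) (𝓝 0) (𝓝 (P.symm (y 0))) := h2
    rwa [h3] at h4
  have ev1 : ∀ᶠ s in 𝓝 (0 : ℝ), P.symm (y s) ∈ Metric.ball c0 (min r ε) := hcs (Metric.ball_mem_nhds _ (lt_min hr0 hε0))
  have ev2 : ∀ᶠ s in 𝓝 (0 : ℝ), y s ∈ P.target := hyc.continuousAt.eventually (by rw [hy0]; exact P.open_target.mem_nhds htgt)
  have ev3 : ∀ᶠ s in 𝓝 (0 : ℝ), ContDiffAt ℂ ω P.symm (y s) := hyc.continuousAt.eventually (by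
    rw [hy0]; exact hΨ.eventually (by simp))
  filter_upwards [ev1, ev2, ev3] with s hs1 hs2 hs3
  set c := P.symm (y s) with hc
  have hNc : NN K c = y s := P.right_inv hs2
  rw [Metric.mem_ball, dist_eq_norm] at hs1
  have hcsrc : c ∈ P.source := hr (by rw [Metric.mem_ball, dist_eq_norm]; exact hs1.trans_le (min_le_left _ _))
  have hstc : st c = c := by
    have h1 : st c ∈ P.source := hr (by
      rw [Metric.mem_ball, dist_eq_norm, ← hst0, ← st_sub, norm_st]; exact hs1.trans_le (min_le_left _ _))
    refine P.injOn h1 hcsrc ?_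
    rw [hPc, hPc, NN_st, hNc, hyst]
  have hsm : ContDiffAt ℝ ∞ (fun v => tau v c) 0 := by
    have h1 : ∀ᶠ v in 𝓝 (0 : Euc m), tau v c ∈ P.source :=
      (tau_cont c).continuousAt.eventually (by
        change P.source ∈ 𝓝 (tau 0 c)
        rw [tau_zero]; exact P.open_source.mem_nhds hcsrc)
    have h2 : (fun v => tau v c) =ᶠ[𝓝 0] fun v => P.symm (tau v (y s)) := by
      filter_upwards [h1] with v hv
      rw [← hNc, ← NN_tau, ← hPc, P.left_inv hv]
    refine ContDiffAt.congr_of_eventuallyEq ?_ h2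
    have h3 : ContDiff ℝ ∞ (fun v => tau v (y s)) := by
      simp only [y, exp_tau, map_add, map_smul]
      have h4 : ContDiff ℝ ∞ (NormedSpace.exp : WA m → WA m) := (exp_contDiff.restrict_scalars ℝ).of_le le_top
      exact h4.comp ((tau_hat_contDiff f hf).add ((tau_hat_contDiff g hg).const_smul (s : ℂ)))
    have h5 : ContDiffAt ℝ ∞ P.symm (tau 0 (y s)) := by
      rw [tau_zero]; exact (hs3.restrict_scalars ℝ).of_le le_top
    exact ContDiffAt.comp 0 h5 h3.contDiffAt
  refine ⟨phi c hsm, phi_per c hsm, fun x => ?_, fun x => ?_⟩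
  · refine pd_of_close (K := K) (l := l) (ε := (2 * Real.pi) ^ 2 * ε) (hl x) (rM_symm _ _ _) (fun i j => ?_) hε
    simp only [rM, Matrix.of_apply, phi_DD, add_sub_add_left_eq_sub]
    have h1 : D (e i) (D (e j) φ) x = (evx x (Dm i j c0)).re := by
      rw [hc0, Dm_cOf, evx_hat, Complex.ofReal_re]
    rw [h1, ← Complex.sub_re, ← map_sub, ← map_sub]
    refine (Complex.abs_re_le_norm _).trans ((evx_norm _ _).trans (((Dm i j).le_opNorm _).trans ?_))
    have h2 : ‖Dm (m := m) i j‖ ≤ (2 * Real.pi) ^ 2 := by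
      unfold Dm mlt; exact lift_norm _ _ (by positivity) _
    rw [norm_sub_rev]
    exact mul_le_mul h2 (hs1.trans_le (min_le_right _ _)).le (norm_nonneg _) (by positivity)
  · have h1 := evx_NN_phi K c hsm hstc x
    rw [hNc, hyev] at h1
    have h2 : Real.exp (f x + s * g x) = (rM K (phi c hsm) x).det * Real.exp (-2 * phi c hsm x) := by exact_mod_cast h1
    have h3 : (rM K (phi c hsm) x).det = Real.exp (f x + s * g x) * Real.exp (2 * phi c hsm x) := by
      rw [h2, mul_assoc, ← Real.exp_add]; simp
    rw [h3, ← Real.exp_add, SF.add_apply, SF.smul_apply]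
    congr 1; ring

end WA
end CY
end

section
open scoped ContDiff
open scoped ContDiff Topology
namespace CY
variable {m : ℕ}

theorem taylor2 (f : SF m) (x v : Euc m) {M : ℝ} (h : ∀ t ∈ Set.Icc (0:ℝ) 1, |D v (D v f) (x + t • v)| ≤ M) :
    |f (x + v) - f x - D v f x| ≤ M := by
  have hM : 0 ≤ M := (abs_nonneg _).trans (h 0 ⟨le_rfl, zero_le_one⟩)
  have h1 : ∀ t ∈ Set.Icc (0:ℝ) 1, |D v f (x + t • v) - D v f x| ≤ M := fun t ht => by
    have := norm_image_sub_le_of_norm_deriv_le_segment' (f := fun t : ℝ => D v f (x + t • v)) (a := 0) (b := 1) (C := M)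
      (f' := fun t => D v (D v f) (x + t • v)) (fun s _ => (hasDerivAt_line (D v f) x v s).hasDerivWithinAt)
      (fun s hs => h s ⟨hs.1, hs.2.le⟩) t ht
    simp only [zero_smul, add_zero, sub_zero, Real.norm_eq_abs] at this
    exact this.trans (mul_le_of_le_one_right hM ht.2)
  have := norm_image_sub_le_of_norm_deriv_le_segment_01' (f := fun t : ℝ => f (x + t • v) - t * D v f x) (C := M)
      (f' := fun t => D v f (x + t • v) - 1 * D v f x)
      (fun s _ => ((hasDerivAt_line f x v s).sub ((hasDerivAt_id s).mul_const _)).hasDerivWithinAt)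
      (fun s hs => by rw [one_mul]; exact h1 s ⟨hs.1, hs.2.le⟩)
  simp only [one_smul, zero_smul, add_zero, one_mul, zero_mul, sub_zero, Real.norm_eq_abs] at this
  convert this using 2; ring

theorem DD_le (f : SF m) (v y : Euc m) {C : ℝ} (h : ∀ a b, |D (e a) (D (e b) f) y| ≤ C) :
    |D v (D v f) y| ≤ (m : ℝ) ^ 2 * C * ‖v‖ ^ 2 := by
  have h1 : D v (D v f) y = ∑ a, ∑ b, v a * (v b * D (e a) (D (e b) f) y) := by
    rw [D_eq_sum v, SF.sum_apply]
    refine Finset.sum_congr rfl fun a _ => ?_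
    rw [SF.smul_apply, D_eq_sum v f, map_sum, SF.sum_apply, Finset.mul_sum]
    refine Finset.sum_congr rfl fun b _ => ?_
    rw [Derivation.map_smul, SF.smul_apply]
  rw [h1]
  have hi : ∀ i, |v i| ≤ ‖v‖ := fun i => PiLp.norm_apply_le v i
  calc |∑ a, ∑ b, v a * (v b * D (e a) (D (e b) f) y)| ≤ ∑ a : Fin m, ∑ b : Fin m, C * ‖v‖ ^ 2 := by
        refine (Finset.abs_sum_le_sum_abs _ _).trans (Finset.sum_le_sum fun a _ => ?_)
        refine (Finset.abs_sum_le_sum_abs _ _).trans (Finset.sum_le_sum fun b _ => ?_)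
        rw [abs_mul, abs_mul]
        have hC := h a b
        have h0 := (abs_nonneg _).trans hC
        calc |v a| * (|v b| * |D (e a) (D (e b) f) y|) ≤ ‖v‖ * (‖v‖ * C) := by
              gcongr
              · exact hi a
              · exact hi b
          _ = C * ‖v‖ ^ 2 := by ring
    _ = _ := by simp; ring

/-- local boundedness of all derivatives along a filter -/
def LB {ι : Type*} (U : Filter ι) (g : ι → SF m) (Ω : Set (Euc m)) : Prop :=
  ∀ x ∈ Ω, ∀ l, ∃ r > 0, ∃ C : ℝ, ∀ᶠ i in U, ∀ y ∈ Metric.ball x r, |dl l (g i) y| ≤ C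

theorem ultra_lim {ι : Type*} (U : Ultrafilter ι) (f : ι → ℝ) {C : ℝ} (h : ∀ᶠ i in U, |f i| ≤ C) :
    ∃ a, Filter.Tendsto f U (𝓝 a) := by
  obtain ⟨a, -, ha⟩ := (isCompact_Icc (a := -C) (b := C)).ultrafilter_le_nhds' (U.map f) (by
    change ∀ᶠ i in (U : Filter ι), f i ∈ Set.Icc (-C) C
    filter_upwards [h] with i hi using abs_le.1 hi)
  exact ⟨a, ha⟩

theorem exists_limit {ι : Type*} (U : Ultrafilter ι) (g : ι → SF m) {Ω : Set (Euc m)} (hΩ : IsOpen Ω) (h : LB (U : Filter ι) g Ω) :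
    ∃ F : Euc m → ℝ, ContDiffOn ℝ ∞ F Ω ∧ (∀ x ∈ Ω, Filter.Tendsto (fun i => g i x) U (𝓝 (F x))) ∧
      ∀ x ∈ Ω, ∀ a b, Filter.Tendsto (fun i => Hf e (g i) a b x) U (𝓝 (hessMatrix F x a b)) := by
  have hex : ∀ l x, ∃ a, x ∈ Ω → Filter.Tendsto (fun i => dl l (g i) x) U (𝓝 a) := fun l x => by
    by_cases hx : x ∈ Ω
    · obtain ⟨r, hr, C, hC⟩ := h x hx l
      obtain ⟨a, ha⟩ := ultra_lim U (fun i => dl l (g i) x) (C := C) (by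
        filter_upwards [hC] with i hi using hi x (Metric.mem_ball_self hr))
      exact ⟨a, fun _ => ha⟩
    · exact ⟨0, fun h => absurd h hx⟩
  choose G hG using hex
  let G' : List (Fin m) → Euc m → (Euc m →L[ℝ] ℝ) := fun l x => ∑ j, G (j :: l) x • (EuclideanSpace.proj j : Euc m →L[ℝ] ℝ)
  have hder : ∀ l, ∀ x ∈ Ω, HasFDerivAt (G l) (G' l x) x := fun l x hx => by
    obtain ⟨r0, hr0, hball⟩ := Metric.isOpen_iff.1 hΩ x hx
    choose r hr C hC using fun a b => h x hx (a :: b :: l)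
    obtain ⟨ρ, hρ0, hρ⟩ : ∃ ρ > 0, ∀ a b, ρ ≤ r a b := by
      have h1 : ∀ᶠ ρ in 𝓝[>] (0:ℝ), ∀ a b, ρ ∈ Set.Ioc 0 (r a b) :=
        Filter.eventually_all.2 fun a => Filter.eventually_all.2 fun b => Ioc_mem_nhdsGT (hr a b)
      obtain ⟨ρ, h2, h3⟩ := (h1.and self_mem_nhdsWithin).exists
      exact ⟨ρ, h3, fun a b => (h2 a b).2⟩
    obtain ⟨B, hB⟩ : ∃ B, ∀ a b, C a b ≤ B := by
      obtain ⟨B, hB⟩ := (Set.finite_range (fun p : Fin m × Fin m => C p.1 p.2)).bddAbove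
      exact ⟨B, fun a b => hB ⟨(a, b), rfl⟩⟩
    have hev : ∀ᶠ i in (U : Filter ι), ∀ a b, ∀ y ∈ Metric.ball x ρ, |dl (a :: b :: l) (g i) y| ≤ B := by
      rw [Filter.eventually_all]; intro a
      rw [Filter.eventually_all]; intro b
      filter_upwards [hC a b] with i hi y hy
      exact (hi y (Metric.ball_subset_ball (hρ a b) hy)).trans (hB a b)
    have key : ∀ v : Euc m, ‖v‖ < min ρ r0 → |G l (x + v) - G l x - G' l x v| ≤ (m : ℝ) ^ 2 * B * ‖v‖ ^ 2 := fun v hv => by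
      have hxv : x + v ∈ Ω := hball (by rw [Metric.mem_ball, dist_eq_norm, add_sub_cancel_left]; exact hv.trans_le (min_le_right _ _))
      have t1 := hG l (x + v) hxv
      have t2 := hG l x hx
      have t3 : Filter.Tendsto (fun i => D v (dl l (g i)) x) U (𝓝 (G' l x v)) := by
        have : ∀ i, D v (dl l (g i)) x = ∑ j, dl (j :: l) (g i) x * v j := fun i => by
          rw [D_eq_sum v, SF.sum_apply]
          exact Finset.sum_congr rfl fun j _ => by rw [SF.smul_apply, dl_cons, mul_comm]
        simp only [this]
        have h2 : G' l x v = ∑ j, G (j :: l) x * v j := by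
          simp only [G', ContinuousLinearMap.sum_apply, ContinuousLinearMap.smul_apply, smul_eq_mul]; rfl
        rw [h2]
        exact tendsto_finset_sum _ fun j _ => (hG (j :: l) x hx).mul_const _
      refine le_of_tendsto ((t1.sub t2).sub t3).abs ?_
      filter_upwards [hev] with i hi
      refine taylor2 _ x v fun t ht => DD_le _ v _ fun a b => hi a b _ ?_
      rw [Metric.mem_ball, dist_eq_norm, add_sub_cancel_left, norm_smul, Real.norm_of_nonneg ht.1]
      exact (mul_le_of_le_one_left (norm_nonneg _) ht.2).trans_lt (hv.trans_le (min_le_left _ _))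
    rw [hasFDerivAt_iff_isLittleO_nhds_zero]
    have hO : (fun v => G l (x + v) - G l x - G' l x v) =O[𝓝 0] fun v : Euc m => ‖v‖ ^ 2 := by
      refine Asymptotics.IsBigO.of_bound ((m : ℝ) ^ 2 * B) ?_
      filter_upwards [Metric.ball_mem_nhds (0 : Euc m) (lt_min hρ0 hr0)] with v hv
      rw [Real.norm_eq_abs, norm_pow, norm_norm]
      exact key v (by simpa using hv)
    exact hO.trans_isLittleO (Asymptotics.isLittleO_norm_pow_id one_lt_two)
  have hsm : ∀ n : ℕ, ∀ l, ContDiffOn ℝ n (G l) Ω := by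
    intro n
    induction n with
    | zero => exact fun l => contDiffOn_zero.2 fun x hx => (hder l x hx).continuousAt.continuousWithinAt
    | succ n ih =>
      intro l
      have : ((n + 1 : ℕ) : WithTop ℕ∞) = n + 1 := by norm_cast
      rw [this, contDiffOn_succ_iff_fderiv_of_isOpen hΩ]
      refine ⟨fun x hx => (hder l x hx).differentiableAt.differentiableWithinAt, by simp, ?_⟩
      refine ContDiffOn.congr (f := G' l) ?_ fun x hx => (hder l x hx).fderiv
      exact ContDiffOn.sum fun j _ => (ih (j :: l)).smul contDiffOn_const
  refine ⟨G [], contDiffOn_infty.2 fun n => hsm n [], fun x hx => hG [] x hx, fun x hx a b => ?_⟩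
  have h1 : hessMatrix (G []) x a b = G [a, b] x := by
    rw [hessMatrix, iteratedFDeriv_two_apply]
    have h2 : fderiv ℝ (G []) =ᶠ[𝓝 x] G' [] := by
      filter_upwards [hΩ.mem_nhds hx] with y hy using (hder [] y hy).fderiv
    have h3 : HasFDerivAt (G' []) (∑ j, (G' [j] x).smulRight (EuclideanSpace.proj j : Euc m →L[ℝ] ℝ)) x :=
      HasFDerivAt.fun_sum fun j _ => (hder [j] x hx).smul_const (EuclideanSpace.proj j : Euc m →L[ℝ] ℝ)
    rw [h2.fderiv_eq, h3.fderiv]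
    simp [G', ContinuousLinearMap.sum_apply, Finset.sum_apply, Pi.single_apply]
  rw [h1]
  exact hG [a, b] x hx

end CY
end

section
open scoped ContDiff
open scoped ContDiff Topology
namespace CY
variable {m : ℕ}

/-- affine functions -/
def lin (a : Euc m) (b : ℝ) : SF m := ⟨fun x => ⟪a, x⟫ + b,
  show ContDiff ℝ ∞ (fun x : Euc m => ⟪a, x⟫ + b) from (contDiff_const.inner ℝ contDiff_id).add contDiff_const⟩
theorem lin_apply (a : Euc m) (b : ℝ) (x : Euc m) : lin a b x = ⟪a, x⟫ + b := rfl
theorem D_lin (a v : Euc m) (b : ℝ) : D v (lin a b) = ⟪a, v⟫ • (1 : SF m) := SF.ext' fun x => by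
  have h1 := hasDerivAt_line (lin a b) x v 0
  have h2 : HasDerivAt (fun t : ℝ => lin a b (x + t • v)) ⟪a, v⟫ 0 := by
    have h3 : (fun t : ℝ => lin a b (x + t • v)) = fun t => ⟪a, x⟫ + b + t * ⟪a, v⟫ := by
      funext t
      rw [lin_apply, inner_add_right, inner_smul_right]; ring
    rw [h3]
    simpa using ((hasDerivAt_id (0:ℝ)).mul_const ⟪a, v⟫).const_add (⟪a, x⟫ + b)
  have := h1.unique h2
  rw [zero_smul, add_zero] at this
  rw [this]; simp

/-- half the squared norm -/
def qd (m : ℕ) : SF m := ⟨fun x => ‖x‖ ^ 2 / 2,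
  show ContDiff ℝ ∞ (fun x : Euc m => ‖x‖ ^ 2 / 2) from (contDiff_norm_sq ℝ).div_const 2⟩
theorem qd_apply (x : Euc m) : qd m x = ‖x‖ ^ 2 / 2 := rfl
theorem D_qd (v : Euc m) : D v (qd m) = lin v 0 := SF.ext' fun x => by
  have h1 := hasDerivAt_line (qd m) x v 0
  have h2 : HasDerivAt (fun t : ℝ => qd m (x + t • v)) ⟪v, x⟫ 0 := by
    have h3 : (fun t : ℝ => qd m (x + t • v)) = fun t => ‖x‖ ^ 2 / 2 + (t * ⟪v, x⟫ + t ^ 2 * (‖v‖ ^ 2 / 2)) := by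
      funext t
      rw [qd_apply, norm_add_sq_real, inner_smul_right, real_inner_comm, norm_smul, mul_pow, Real.norm_eq_abs, sq_abs]; ring
    rw [h3]
    have := (((hasDerivAt_id (0:ℝ)).mul_const ⟪v, x⟫).add (((hasDerivAt_id (0:ℝ)).pow 2).mul_const (‖v‖ ^ 2 / 2))).const_add (‖x‖ ^ 2 / 2)
    simpa using this
  have := h1.unique h2
  rw [zero_smul, add_zero] at this
  rw [this, lin_apply, add_zero]
theorem DD_qd (v w : Euc m) : D w (D v (qd m)) = ⟪v, w⟫ • (1 : SF m) := by rw [D_qd, D_lin]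
theorem D_one (v : Euc m) : D v (1 : SF m) = 0 := (D v).map_one_eq_zero
theorem DD_lin (a v w : Euc m) (b : ℝ) : D w (D v (lin a b)) = 0 := by rw [D_lin, Derivation.map_smul, D_one, smul_zero]

theorem inner_e (i j : Fin m) : ⟪(e i : Euc m), e j⟫ = if i = j then 1 else 0 := by
  simp [e, EuclideanSpace.inner_single_left, Pi.single_apply]

theorem quad_form (u : SF m) (x : Euc m) (a : Fin m → ℝ) :
    a ⬝ᵥ (eM x (Hf e u)).mulVec a = D (WithLp.toLp 2 a) (D (WithLp.toLp 2 a) u) x := by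
  set v : Euc m := WithLp.toLp 2 a with hv
  have h1 : D v (D v u) x = ∑ i, ∑ j, v i * (v j * D (e i) (D (e j) u) x) := by
    rw [D_eq_sum v, SF.sum_apply]
    refine Finset.sum_congr rfl fun a _ => ?_
    rw [SF.smul_apply, D_eq_sum v u, map_sum, SF.sum_apply, Finset.mul_sum]
    refine Finset.sum_congr rfl fun b _ => ?_
    rw [Derivation.map_smul, SF.smul_apply]
  rw [h1]
  simp only [dotProduct, Matrix.mulVec, Finset.mul_sum, eM_apply, Hf]
  exact Finset.sum_congr rfl fun i _ => Finset.sum_congr rfl fun j _ => by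
    change a i * (_ * a j) = a i * (a j * _); ring

theorem eM_Hf_symm (u : SF m) (x : Euc m) : (eM x (Hf e u)).transpose = eM x (Hf e u) := by
  rw [← eM_transpose, Hf_symm]

theorem det_le_of_max {u v : SF m} {x : Euc m} (hu : (eM x (Hf e u)).PosDef) (h : IsLocalMax (fun y => u y - v y) x) :
    (eM x (Hf e u)).det ≤ (eM x (Hf e v)).det := by
  refine det_mono hu (eM_Hf_symm v x) fun a => ?_
  rw [quad_form, quad_form]
  have := (localMax_test (f := u - v) h (WithLp.toLp 2 a)).2
  rw [map_sub, map_sub, SF.sub_apply] at this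
  linarith

theorem Sol.DD_nonneg (s : Sol m) (v x : Euc m) : 0 ≤ D v (D v s.u) x := by
  have h : D v (D v s.u) x = v.ofLp ⬝ᵥ (eM x (Hf e s.u)).mulVec v.ofLp := (quad_form s.u x v.ofLp).symm
  rw [h]
  by_cases hv : v.ofLp = 0
  · rw [hv]; simp
  · exact (PosDef.pos (s.pos x) hv).le

theorem convex_line (f : SF m) (x v : Euc m) (h : ∀ y, 0 ≤ D v (D v f) y) : f x + D v f x ≤ f (x + v) := by
  have hmono : Monotone fun t : ℝ => D v f (x + t • v) :=
    monotone_of_hasDerivAt_nonneg (fun t => hasDerivAt_line (D v f) x v t) fun t => h _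
  have := (convex_Icc (0:ℝ) 1).mul_sub_le_image_sub_of_le_deriv (f := fun t : ℝ => f (x + t • v)) (C := D v f x)
    (fun t _ => (hasDerivAt_line f x v t).continuousAt.continuousWithinAt)
    (fun t _ => (hasDerivAt_line f x v t).differentiableAt.differentiableWithinAt)
    (fun t ht => by
      rw [(hasDerivAt_line f x v t).deriv]
      rw [interior_Icc] at ht
      have := hmono ht.1.le
      simpa using this) 0 ⟨le_rfl, zero_le_one⟩ 1 ⟨zero_le_one, le_rfl⟩ zero_le_one
  simp only [one_smul, zero_smul, add_zero, sub_zero, mul_one] at this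
  linarith

theorem Sol.convex (s : Sol m) (x v : Euc m) : s.u x + D v s.u x ≤ s.u (x + v) :=
  convex_line s.u x v fun y => s.DD_nonneg v y

theorem cont_bdd (f : SF m) {E : Set (Euc m)} (hE : IsCompact E) : ∃ C, ∀ x ∈ E, |f x| ≤ C := by
  obtain ⟨C, hC⟩ := hE.exists_bound_of_continuousOn f.cont.continuousOn
  exact ⟨C, fun x hx => hC x hx⟩

theorem est {ι : Type} (s : ι → Sol m) {E : Set (Euc m)} (hE : IsCompact E) {r C : ℝ} (hr : 0 < r)
    (hu : ∀ i, ∀ x ∈ E, ∀ v : Euc m, ‖v‖ ≤ r → |(s i).u (x + v)| ≤ C) (a : Euc m) (M : ℝ)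
    (hfr : ∀ i, ∀ x ∈ frontier E, M - ⟪a, x⟫ ≤ (s i).u x) (bh : ∀ l, (fun i => dl l (s i).h) ∈ Bd (fun _ => E))
    {δ : ℝ} (hδ : 0 < δ) (l : List (Fin m)) :
    ∃ B, ∀ i, ∀ x ∈ E, (s i).u x + δ ≤ M - ⟪a, x⟫ → |dl l (s i).u x| ≤ B := by
  have bu : (fun i => (s i).u) ∈ Bd (fun _ : ι => E) := ⟨C, fun i x hx => by
    have := hu i x hx 0 (by simpa using hr.le)
    rwa [add_zero] at this⟩
  have bDu : ∀ j, (fun i => D (e j) (s i).u) ∈ Bd (fun _ : ι => E) := fun j => ⟨2 * C / r, fun i x hx => by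
    have h0 := hu i x hx 0 (by simpa using hr.le)
    rw [add_zero] at h0
    have hn : ‖(r • e j : Euc m)‖ ≤ r := by
      rw [norm_smul, Real.norm_of_nonneg hr.le]; simp [e]
    have h1 := hu i x hx (r • e j) hn
    have h2 := hu i x hx (-(r • e j)) (by rwa [norm_neg])
    have h3 := (s i).convex x (r • e j)
    have h4 := (s i).convex x (-(r • e j))
    rw [← neg_smul] at h4 h2
    rw [D_smul, SF.smul_apply] at h3 h4
    rw [abs_le] at h0 h1 h2 ⊢
    constructor
    · rw [← neg_div, div_le_iff₀ hr]; linarith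
    · rw [le_div_iff₀ hr]; linarith⟩
  let w : ι → SF m := fun i => lin (-a) M - (s i).u
  have hwa : ∀ i x, w i x = M - ⟪a, x⟫ - (s i).u x := fun i x => by
    simp only [w, SF.sub_apply, lin_apply, inner_neg_left]; ring
  have bl : (fun _ : ι => lin (-a) M) ∈ Bd (fun _ : ι => E) := by
    obtain ⟨C, hC⟩ := cont_bdd (lin (-a) M) hE
    exact ⟨C, fun i x hx => hC x hx⟩
  have bl' : ∀ j, (fun _ : ι => D (e j) (lin (-a) M)) ∈ Bd (fun _ : ι => E) := fun j => by
    obtain ⟨C, hC⟩ := cont_bdd (D (e j) (lin (-a) M)) hE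
    exact ⟨C, fun i x hx => hC x hx⟩
  let F : Fam m ι :=
    { E := E, hE := hE, s := s, w := w
      hw := fun i v v' => by simp only [w, map_sub, DD_lin, zero_sub]
      hfr := fun i x hx => by rw [hwa]; linarith [hfr i x hx]
      bu := bu, bDu := bDu
      bw := sub_mem bl bu
      bDw := fun j => by
        have : (fun i => D (e j) (w i)) = (fun _ : ι => D (e j) (lin (-a) M)) - fun i => D (e j) (s i).u := by
          funext i; simp only [w, map_sub, Pi.sub_apply]
        rw [this]
        exact sub_mem (bl' j) (bDu j)
      bh := bh }
  obtain ⟨B, hB⟩ := F.all hδ l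
  refine ⟨B, fun i x hx hw => hB i x ⟨hx, ?_⟩⟩
  change δ ≤ w i x
  rw [hwa]; linarith

theorem sol_limit {ι : Type*} (U : Ultrafilter ι) (s : ι → Sol m) {Ω : Set (Euc m)} (hΩ : IsOpen Ω)
    (h : LB (U : Filter ι) (fun i => (s i).u) Ω) (H : Euc m → ℝ)
    (hH : ∀ x ∈ Ω, Filter.Tendsto (fun i => (s i).h x) U (𝓝 (H x))) :
    ∃ F : Euc m → ℝ, ContDiffOn ℝ ∞ F Ω ∧ (∀ x ∈ Ω, Filter.Tendsto (fun i => (s i).u x) U (𝓝 (F x))) ∧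
      (∀ x ∈ Ω, (hessMatrix F x).PosDef) ∧ ∀ x ∈ Ω, (hessMatrix F x).det = Real.exp (2 * F x - H x) := by
  obtain ⟨F, h1, h2, h3⟩ := exists_limit U (fun i => (s i).u) hΩ h
  have h4 : ∀ x ∈ Ω, Filter.Tendsto (fun i => eM x (Hf e (s i).u)) U (𝓝 (hessMatrix F x)) := fun x hx => by
    exact tendsto_pi_nhds.2 fun a => tendsto_pi_nhds.2 fun b => h3 x hx a b
  have hdet : ∀ x ∈ Ω, (hessMatrix F x).det = Real.exp (2 * F x - H x) := fun x hx => by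
    have t1 : Filter.Tendsto (fun i => (eM x (Hf e (s i).u)).det) U (𝓝 (hessMatrix F x).det) :=
      ((continuous_id.matrix_det (R := ℝ) (n := Fin m)).tendsto _).comp (h4 x hx)
    have t2 : Filter.Tendsto (fun i => Real.exp (2 * (s i).u x - (s i).h x)) U (𝓝 (Real.exp (2 * F x - H x))) :=
      (Real.continuous_exp.tendsto _).comp (((h2 x hx).const_mul 2).sub (hH x hx))
    simp only [(s _).pde] at t1
    exact tendsto_nhds_unique t1 t2
  refine ⟨F, h1, h2, fun x hx => ?_, hdet⟩
  have hs : (hessMatrix F x).transpose = hessMatrix F x := by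
    refine tendsto_nhds_unique ?_ (h4 x hx)
    have := ((continuous_id.matrix_transpose (R := ℝ) (n := Fin m) (m := Fin m)).tendsto _).comp (h4 x hx)
    refine this.congr fun i => ?_
    exact eM_Hf_symm _ _
  have hpsd : (hessMatrix F x).PosSemidef := by
    refine psd_of hs fun a => ?_
    have hc : Continuous fun A : Matrix (Fin m) (Fin m) ℝ => a ⬝ᵥ A.mulVec a := by
      simp only [dotProduct, Matrix.mulVec]; fun_prop
    refine ge_of_tendsto ((hc.tendsto _).comp (h4 x hx)) (Filter.Eventually.of_forall fun i => ?_)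
    change 0 ≤ a ⬝ᵥ (eM x (Hf e (s i).u)).mulVec a
    rw [quad_form]
    exact (s i).DD_nonneg _ _
  rw [hpsd.posDef_iff_isUnit, Matrix.isUnit_iff_isUnit_det, hdet x hx]
  exact (Real.exp_pos _).ne'.isUnit

end CY
end

section
open scoped ContDiff
open scoped ContDiff Topology
namespace CY
variable {m : ℕ}

theorem dl_add (l : List (Fin m)) (f g : SF m) : dl l (f + g) = dl l f + dl l g := by
  induction l with
  | nil => rfl
  | cons j l ih => rw [dl_cons, dl_cons, dl_cons, ih, map_add]
theorem dl_smul (l : List (Fin m)) (c : ℝ) (f : SF m) : dl l (c • f) = c • dl l f := by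
  induction l with
  | nil => rfl
  | cons j l ih => rw [dl_cons, dl_cons, ih, Derivation.map_smul]
theorem dl_sub (l : List (Fin m)) (f g : SF m) : dl l (f - g) = dl l f - dl l g := by
  induction l with
  | nil => rfl
  | cons j l ih => rw [dl_cons, dl_cons, dl_cons, ih, map_sub]

namespace WA

theorem eM_rM (K : ℝ) (φ : SF m) (x : Euc m) : eM x (Hf e (K • qd m + φ)) = rM K φ x := by
  ext i j
  rw [eM_apply]
  change D (e i) (D (e j) (K • qd m + φ)) x = (if i = j then K else 0) + D (e i) (D (e j) φ) x
  rw [map_add, map_add, Derivation.map_smul, Derivation.map_smul, DD_qd, inner_e]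
  by_cases h : i = j
  · simp [h]
  · simp [h, Ne.symm h]

theorem eM_K (K : ℝ) (x : Euc m) : eM x (Hf e (K • qd m)) = K • (1 : Matrix (Fin m) (Fin m) ℝ) := by
  have := eM_rM K (0 : SF m) x
  rw [add_zero] at this
  rw [this]
  ext i j
  change (if i = j then K else 0) + D (e i) (D (e j) (0 : SF m)) x = _
  rw [map_zero, map_zero]
  simp [Matrix.one_apply]

theorem eM_K_det (K : ℝ) (x : Euc m) : (eM x (Hf e (K • qd m))).det = K ^ m := by
  rw [eM_K, Matrix.det_smul]; simp

theorem eM_K_pos {K : ℝ} (hK : 0 < K) (x : Euc m) : (eM x (Hf e (K • qd m))).PosDef := by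
  rw [eM_K]; exact Matrix.PosDef.one.smul hK

theorem TS.max {K : ℝ} (hK : 0 < K) {f φ : SF m} (h : TS K f φ) {x : Euc m} (hx : ∀ y, φ y ≤ φ x) :
    2 * φ x + f x ≤ m * Real.log K := by
  have h1 := det_le_of_max (u := K • qd m + φ) (v := K • qd m) (x := x) (by rw [eM_rM]; exact h.pd x)
    (Filter.Eventually.of_forall fun y => by simpa using hx y)
  rw [eM_rM, h.eq, eM_K_det] at h1
  have := Real.log_le_log (Real.exp_pos _) h1
  rwa [Real.log_exp, Real.log_pow] at this

theorem TS.min {K : ℝ} (hK : 0 < K) {f φ : SF m} (h : TS K f φ) {x : Euc m} (hx : ∀ y, φ x ≤ φ y) :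
    m * Real.log K ≤ 2 * φ x + f x := by
  have h1 := det_le_of_max (u := K • qd m) (v := K • qd m + φ) (x := x) (eM_K_pos hK x)
    (Filter.Eventually.of_forall fun y => by simpa using hx y)
  rw [eM_rM, h.eq, eM_K_det] at h1
  have := Real.log_le_log (by positivity) h1
  rwa [Real.log_exp, Real.log_pow] at this

theorem TS.bound {K : ℝ} (hK : 0 < K) {f φ : SF m} (h : TS K f φ) {A : ℝ} (hA : ∀ x, |f x| ≤ A) (x : Euc m) :
    |φ x| ≤ (|m * Real.log K| + A) / 2 := by
  obtain ⟨x0, h0⟩ := h.per.max φ.cont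
  obtain ⟨x1, h1⟩ := Per.max (g := fun x => - φ x) φ.cont.neg (fun k x => congrArg Neg.neg (h.per k x))
  have h2 := h.max hK h0
  have h3 := h.min hK (x := x1) (fun y => by linarith [h1 y])
  have h4 := abs_le.1 (hA x0)
  have h5 := abs_le.1 (hA x1)
  have h6 := le_abs_self (m * Real.log K)
  have h7 := neg_abs_le (m * Real.log K)
  rw [abs_le]
  constructor
  · linarith [h1 x]
  · linarith [h0 x]

/-- the solution on `ℝ^m` attached to a torus solution -/
def TS.sol {K : ℝ} {f φ : SF m} (h : TS K f φ) : Sol m where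
  u := K • qd m + φ
  h := (2 * K) • qd m - f
  pos x := by rw [eM_rM]; exact h.pd x
  pde x := by
    rw [eM_rM, h.eq]
    simp only [SF.add_apply, SF.sub_apply, SF.smul_apply]
    congr 1; ring

theorem closedness {K : ℝ} (hK : 0 < K) {f g : SF m} (hf : Per (f : Euc m → ℝ)) (hg : Per (g : Euc m → ℝ)) (t : ℕ → ℝ)
    (ht : ∀ n, |t n| ≤ 1) {t0 : ℝ} (htt : Filter.Tendsto t Filter.atTop (𝓝 t0)) (φ : ℕ → SF m)
    (h : ∀ n, TS K (f + t n • g) (φ n)) : ∃ ψ, TS K (f + t0 • g) ψ := by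
  obtain ⟨A, hA0, hA⟩ := hf.bdd f.cont
  obtain ⟨B, hB0, hB⟩ := hg.bdd g.cont
  have hfg : ∀ n x, |(f + t n • g) x| ≤ A + B := fun n x => by
    rw [SF.add_apply, SF.smul_apply]
    refine (abs_add_le _ _).trans (add_le_add (hA x) ?_)
    rw [abs_mul]
    calc |t n| * |g x| ≤ 1 * B := mul_le_mul (ht n) (hB x) (abs_nonneg _) zero_le_one
      _ = B := one_mul B
  obtain ⟨Q, hQ⟩ : ∃ Q : ℝ, ∀ n x, |φ n x| ≤ Q := ⟨_, fun n x => (h n).bound hK (hfg n) x⟩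
  have hQ0 : 0 ≤ Q := (abs_nonneg _).trans (hQ 0 0)
  let s : ℕ → Sol m := fun n => (h n).sol
  have hsu : ∀ n x, (s n).u x = K * (‖x‖ ^ 2 / 2) + φ n x := fun n x => rfl
  let U : Ultrafilter ℕ := Filter.hyperfilter ℕ
  have hU : (U : Filter ℕ) ≤ Filter.atTop := Nat.hyperfilter_le_atTop
  have hLB : LB (U : Filter ℕ) (fun n => (s n).u) Set.univ := by
    intro x _ l
    set ρ := ‖x‖ + 1 with hρ
    have hρ0 : 0 < ρ := by positivity
    obtain ⟨R, hR0, hRρ, hR⟩ : ∃ R : ℝ, 0 < R ∧ ρ ≤ R ∧ K * (ρ ^ 2 / 2) + 2 * Q + 1 ≤ K * (R ^ 2 / 2) := by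
      have hlim : Filter.Tendsto (fun R : ℝ => K * (R ^ 2 / 2)) Filter.atTop Filter.atTop :=
        Filter.Tendsto.const_mul_atTop hK ((Filter.tendsto_pow_atTop two_ne_zero).atTop_div_const two_pos)
      obtain ⟨R, h1, h2, h3⟩ := ((Filter.eventually_gt_atTop (0:ℝ)).and ((Filter.eventually_ge_atTop ρ).and
        (hlim.eventually_ge_atTop (K * (ρ ^ 2 / 2) + 2 * Q + 1)))).exists
      exact ⟨R, h1, h2, h3⟩
    have hE : IsCompact (Metric.closedBall (0 : Euc m) R) := isCompact_closedBall _ _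
    obtain ⟨B, hB⟩ := est s hE (r := 1) (C := K * ((R + 1) ^ 2 / 2) + Q) one_pos (by
        intro n y hy v hv
        rw [hsu]
        have hn : ‖y + v‖ ≤ R + 1 := (norm_add_le _ _).trans (add_le_add (by simpa using hy) hv)
        refine (abs_add_le _ _).trans (add_le_add ?_ (hQ n _))
        rw [abs_of_nonneg (by positivity)]
        gcongr) 0 (K * (R ^ 2 / 2) - Q) (by
        intro n y hy
        rw [frontier_closedBall _ hR0.ne'] at hy
        have : ‖y‖ = R := by simpa using hy
        rw [hsu, this, inner_zero_left]
        have := abs_le.1 (hQ n y)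
        linarith) (by
        intro l
        obtain ⟨C1, hC1⟩ := cont_bdd (dl l ((2 * K) • qd m - f)) hE
        obtain ⟨C2, hC2⟩ := cont_bdd (dl l g) hE
        refine ⟨C1 + C2, fun n y hy => ?_⟩
        have : dl l (s n).h = dl l ((2 * K) • qd m - f) - t n • dl l g := by
          rw [← dl_smul, ← dl_sub]
          change dl l ((2 * K) • qd m - (f + t n • g)) = _
          rw [sub_add_eq_sub_sub]
        change |dl l (s n).h y| ≤ _
        rw [this, SF.sub_apply, SF.smul_apply]
        refine (abs_sub _ _).trans (add_le_add (hC1 y hy) ?_)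
        rw [abs_mul]
        calc |t n| * |dl l g y| ≤ 1 * C2 := mul_le_mul (ht n) (hC2 y hy) (abs_nonneg _) zero_le_one
          _ = C2 := one_mul _) one_pos l
    refine ⟨1, one_pos, B, Filter.Eventually.of_forall fun n y hy => hB n y ?_ ?_⟩
    all_goals
      have hy1 : ‖y‖ ≤ ρ := by
        rw [Metric.mem_ball, dist_eq_norm] at hy
        have := norm_add_le x (y - x)
        rw [add_sub_cancel] at this
        linarith
    · simpa using hy1.trans hRρ
    · rw [hsu, inner_zero_left]
      have h1 := abs_le.1 (hQ n y)
      have h2 : K * (‖y‖ ^ 2 / 2) ≤ K * (ρ ^ 2 / 2) := by gcongr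
      linarith
  have hhs : ∀ n x, (s n).h x = 2 * K * (‖x‖ ^ 2 / 2) - (f x + t n * g x) := fun n x => rfl
  obtain ⟨F, hF1, hF2, hF3, hF4⟩ := sol_limit U s isOpen_univ hLB (fun x => 2 * K * (‖x‖ ^ 2 / 2) - (f x + t0 * g x))
    (fun x _ => by
      simp only [hhs]
      exact tendsto_const_nhds.sub (tendsto_const_nhds.add ((htt.mono_left hU).mul_const _)))
  let F' : SF m := ⟨F, contDiffOn_univ.1 hF1⟩
  have hrw : ∀ x, rM K (F' - K • qd m) x = hessMatrix F x := fun x => by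
    rw [← eM_rM, add_sub_cancel]
    ext i j
    exact (hess_eq F' x i j).symm
  refine ⟨F' - K • qd m, ?_, fun x => ?_, fun x => ?_⟩
  · intro k x
    have hl : ∀ x, Filter.Tendsto (fun n => φ n x) U (𝓝 ((F' - K • qd m) x)) := fun x => by
      have h1 := (hF2 x trivial).sub_const (K * (‖x‖ ^ 2 / 2))
      refine h1.congr fun n => ?_
      rw [hsu]; ring
    refine tendsto_nhds_unique (hl _) ((hl x).congr fun n => ?_)
    exact ((h n).per k x).symm
  · rw [hrw]; exact hF3 x trivial
  · rw [hrw, hF4 x trivial]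
    simp only [SF.add_apply, SF.sub_apply, SF.smul_apply]
    congr 1
    change _ = 2 * (F x - K * (‖x‖ ^ 2 / 2)) + _
    ring

theorem torus {K : ℝ} (hK : 0 < K) {f : SF m} (hf : Per (f : Euc m → ℝ)) : ∃ φ, TS K f φ := by
  set c : ℝ := m * Real.log K with hc
  let f0 : SF m := c • 1
  have hf0 : Per (f0 : Euc m → ℝ) := fun k x => rfl
  have hg : Per (f - f0 : SF m) := fun k x => by rw [SF.sub_apply, SF.sub_apply, hf k x, hf0 k x]
  let S : Set ℝ := {t | ∃ φ, TS K (f0 + t • (f - f0)) φ}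
  have hper : ∀ t : ℝ, Per (f0 + t • (f - f0) : SF m) := fun t k x => by
    have h1 := hg k x
    have h2 := hf0 k x
    change f0 _ + t * (f - f0) _ = f0 _ + t * (f - f0) _
    rw [h1, h2]
  have key : Set.Icc (0:ℝ) 1 ⊆ S := by
    refine IsClosed.Icc_subset_of_forall_exists_gt ?_ ?_ ?_
    · rw [← isSeqClosed_iff_isClosed]
      intro t t0 ht htt
      have h0 : t0 ∈ Set.Icc (0:ℝ) 1 := isClosed_Icc.isSeqClosed (fun n => (ht n).2) htt
      refine ⟨?_, h0⟩
      choose φ hφ using fun n => (ht n).1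
      refine closedness hK hf0 hg t (fun n => ?_) htt φ hφ
      rw [abs_of_nonneg (ht n).2.1]; exact (ht n).2.2
    · refine ⟨0, fun k x => rfl, fun x => ?_, fun x => ?_⟩
      · rw [← eM_rM, add_zero]; exact eM_K_pos hK x
      · rw [← eM_rM, add_zero, eM_K_det, zero_smul, add_zero]
        change _ = Real.exp (2 * 0 + c * 1)
        rw [mul_zero, zero_add, mul_one, hc, mul_comm, ← Real.rpow_def_of_pos hK, Real.rpow_natCast]
    · rintro t ⟨⟨φ, hφ⟩, _⟩ y hy
      have h1 := hφ.open (hper t) (f - f0) hg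
      obtain ⟨ε, hε, h2⟩ := Metric.eventually_nhds_iff.1 h1
      have hyt : 0 < y - t := sub_pos.2 hy
      have hs0 : 0 < min (ε / 2) (y - t) := lt_min (by linarith) hyt
      obtain ⟨ψ, hψ⟩ := @h2 (min (ε / 2) (y - t)) (by
        rw [Real.dist_eq, sub_zero, abs_of_pos hs0]
        exact (min_le_left _ _).trans_lt (by linarith))
      refine ⟨t + min (ε / 2) (y - t), ⟨ψ, ?_⟩, by linarith, ?_⟩
      · rw [add_smul, ← add_assoc]; exact hψ
      · linarith [min_le_right (ε / 2) (y - t)]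
  obtain ⟨φ, hφ⟩ := key ⟨zero_le_one, le_rfl⟩
  rw [one_smul, add_sub_cancel] at hφ
  exact ⟨φ, hφ⟩

end WA
end CY
end

section
open scoped ContDiff
open scoped ContDiff Topology
namespace CY
variable {m : ℕ}

theorem coord_le (x : Euc m) (i : Fin m) : |x i| ≤ ‖x‖ := by
  have := PiLp.norm_apply_le x i
  rwa [Real.norm_eq_abs] at this

/-- coordinatewise rounding -/
def rnd (x : Euc m) : Zm m := fun i => round (x i)

theorem rnd_eq {x : Euc m} {k : Zm m} (h : ‖x - WA.toE k‖ < 1 / 2) : rnd x = k := by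
  funext i
  have h1 := (coord_le (x - WA.toE k) i).trans_lt h
  have h2 : (x - WA.toE k) i = x i - k i := rfl
  rw [h2, abs_lt] at h1
  exact round_eq_iff.2 ⟨by linarith [h1.1], by linarith [h1.2]⟩

/-- periodization of a function which is constant outside of a small ball -/
theorem periodize (f0 : SF m) (c : ℝ) (h0 : ∀ y : Euc m, 1 / 4 ≤ ‖y‖ → f0 y = c) :
    ∃ f : SF m, WA.Per (f : Euc m → ℝ) ∧ ∀ x, f x = f0 (x - WA.toE (rnd x)) := by
  have hs : ContDiff ℝ ∞ (fun x : Euc m => f0 (x - WA.toE (rnd x))) := by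
    rw [contDiff_iff_contDiffAt]
    intro x
    by_cases hx : ‖x - WA.toE (rnd x)‖ < 3 / 8
    · have h1 : ContDiffAt ℝ ∞ (fun y : Euc m => f0 (y - WA.toE (rnd x))) x :=
        (f0.cd.comp (contDiff_id.sub contDiff_const)).contDiffAt
      refine h1.congr_of_eventuallyEq ?_
      filter_upwards [Metric.ball_mem_nhds x (by norm_num : (0:ℝ) < 1 / 8)] with y hy
      rw [Metric.mem_ball, dist_eq_norm] at hy
      have : rnd y = rnd x := rnd_eq (by
        have := norm_add_le (y - x) (x - WA.toE (rnd x))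
        rw [sub_add_sub_cancel] at this
        linarith)
      rw [this]
    · refine (contDiffAt_const (c := c)).congr_of_eventuallyEq ?_
      filter_upwards [Metric.ball_mem_nhds x (by norm_num : (0:ℝ) < 1 / 8)] with y hy
      rw [Metric.mem_ball, dist_eq_norm] at hy
      refine h0 _ ?_
      by_contra hlt
      push Not at hlt
      have h1 : ‖x - WA.toE (rnd y)‖ < 3 / 8 := by
        have := norm_add_le (x - y) (y - WA.toE (rnd y))
        rw [sub_add_sub_cancel, norm_sub_rev x y] at this
        linarith
      have h2 : rnd x = rnd y := rnd_eq (by linarith)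
      rw [h2] at hx
      exact hx h1
  refine ⟨⟨_, hs⟩, fun k x => ?_, fun x => rfl⟩
  change f0 (x + WA.toE k - WA.toE (rnd (x + WA.toE k))) = f0 (x - WA.toE (rnd x))
  congr 1
  have : rnd (x + WA.toE k) = rnd x + k := by
    funext i
    exact round_add_intCast _ _
  rw [this]
  have h2 : WA.toE (rnd x + k) = WA.toE (rnd x) + WA.toE k := by
    ext i
    simp
  rw [h2, add_sub_add_right_eq_sub]

theorem cutoff {S T : Set (Euc m)} (hS : IsClosed S) (hT : IsClosed T) (h : Disjoint S T) :
    ∃ χ : SF m, (∀ x ∈ S, χ x = 0) ∧ (∀ x ∈ T, χ x = 1) ∧ ∀ x, 0 ≤ χ x ∧ χ x ≤ 1 := by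
  obtain ⟨f, h1, h2, h3⟩ := exists_contMDiffMap_zero_one_of_isClosed (n := (⊤ : ℕ∞)) (modelWithCornersSelf ℝ (Euc m)) hS hT h
  exact ⟨⟨f, contMDiff_iff_contDiff.1 f.contMDiff⟩, h1, h2, h3⟩

theorem support {Ω : Set (Euc m)} (ho : IsOpen Ω) (hc : Convex ℝ Ω) (hne : Ω.Nonempty) {z : Euc m} (hz : z ∉ Ω) :
    ∃ n : Euc m, ‖n‖ = 1 ∧ ∀ x ∈ Ω, 0 < ⟪n, x - z⟫ := by
  obtain ⟨f, hf⟩ := geometric_hahn_banach_open_point hc ho hz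
  set w : Euc m := (InnerProductSpace.toDual ℝ (Euc m)).symm f with hw
  have hwf : ∀ x, ⟪w, x⟫ = f x := fun x => InnerProductSpace.toDual_symm_apply
  have hw0 : w ≠ 0 := by
    rintro h0
    obtain ⟨x, hx⟩ := hne
    have := hf x hx
    rw [← hwf, ← hwf, h0, inner_zero_left, inner_zero_left] at this
    exact lt_irrefl _ this
  have hn : 0 < ‖w‖ := norm_pos_iff.2 hw0
  refine ⟨(-‖w‖⁻¹) • w, ?_, fun x hx => ?_⟩
  · rw [norm_smul, norm_neg, norm_inv, norm_norm, inv_mul_cancel₀ hn.ne']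
  · rw [real_inner_smul_left, inner_sub_right, hwf, hwf]
    have := hf x hx
    have h2 : 0 < ‖w‖⁻¹ := inv_pos.2 hn
    nlinarith

/-- the boundary barrier -/
def vB (B : ℝ) (n z : Euc m) : SF m :=
  qd m + (B / 2) • ((lin n (-⟪n, z⟫)) ^ 2 - (2:ℝ) • lin n (-⟪n, z⟫)) + (Real.log (1 + B) / 2 - 1) • 1

theorem vB_apply (B : ℝ) (n z x : Euc m) : vB B n z x =
    ‖x‖ ^ 2 / 2 + B / 2 * (⟪n, x - z⟫ ^ 2 - 2 * ⟪n, x - z⟫) + (Real.log (1 + B) / 2 - 1) := by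
  simp only [vB, SF.add_apply, SF.smul_apply, SF.sub_apply, SF.pow_apply, SF.one_apply, lin_apply, qd_apply, inner_sub_right]
  ring

theorem vB_hess (B : ℝ) (n z x : Euc m) : eM x (Hf e (vB B n z)) =
    1 + Matrix.replicateCol Unit (B • n.ofLp) * Matrix.replicateRow Unit n.ofLp := by
  ext i j
  rw [eM_apply]
  change D (e i) (D (e j) (vB B n z)) x = _
  have h1 : D (e i) (D (e j) ((lin n (-⟪n, z⟫)) ^ 2)) = (2 * ⟪n, e i⟫ * ⟪n, e j⟫) • (1 : SF m) := by
    rw [pow_two, Derivation.leibniz, map_add, smul_eq_mul, D_lin, Derivation.leibniz, Derivation.map_smul, D_one, D_lin]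
    ext y
    simp
    ring
  have hn : ∀ k : Fin m, ⟪n, e k⟫ = n k := fun k => by
    simp [e, EuclideanSpace.inner_single_right]
  rw [vB, map_add, map_add, map_add, map_add, Derivation.map_smul, Derivation.map_smul, map_sub, map_sub, h1, DD_qd,
    Derivation.map_smul, Derivation.map_smul, DD_lin, Derivation.map_smul, D_one, smul_zero, smul_zero, map_zero, inner_e, hn, hn]
  rw [Matrix.add_apply, Matrix.mul_apply, Matrix.one_apply]
  by_cases hij : i = j
  · simp [hij]; ring
  · simp [hij, Ne.symm hij]; ring

theorem vB_det {B : ℝ} {n : Euc m} (hn : ‖n‖ = 1) (z x : Euc m) : (eM x (Hf e (vB B n z))).det = 1 + B := by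
  rw [vB_hess, Matrix.det_one_add_replicateCol_mul_replicateRow, dotProduct_smul]
  have : n.ofLp ⬝ᵥ n.ofLp = ‖n‖ ^ 2 := by
    rw [EuclideanSpace.norm_sq_eq]
    simp [dotProduct, pow_two]
  rw [this, hn]; simp

theorem vB_pos {B : ℝ} (hB : 0 ≤ B) (n z x : Euc m) : (eM x (Hf e (vB B n z))).PosDef := by
  refine posDef_of (eM_Hf_symm _ _) fun a ha => ?_
  have h1 : a ⬝ᵥ (eM x (Hf e (vB B n z))).mulVec a = a ⬝ᵥ a + B * (n.ofLp ⬝ᵥ a) ^ 2 := by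
    rw [vB_hess, Matrix.add_mulVec, Matrix.one_mulVec, dotProduct_add, ← Matrix.mulVec_mulVec]
    congr 1
    simp only [dotProduct, Matrix.mulVec, Matrix.replicateCol_apply, Matrix.replicateRow_apply, Finset.univ_unique, Finset.sum_singleton, Pi.smul_apply,
      smul_eq_mul]
    rw [pow_two, ← mul_assoc, Finset.mul_sum]
    refine Finset.sum_congr rfl fun i _ => ?_
    ring
  rw [h1]
  have h2 : 0 < a ⬝ᵥ a := by
    have := Matrix.dotProduct_star_self_pos_iff.2 ha
    simpa using this
  positivity

theorem prop1small {Ω : Set (Euc m)} (ho : IsOpen Ω) (hc : Convex ℝ Ω) (hne : Ω.Nonempty) (hb : ∀ x ∈ Ω, ‖x‖ < 1 / 8) (j : ℝ) :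
    ∃ s : Sol m, (∀ x ∈ Ω, s.h x = 0) ∧ ∀ z ∈ frontier Ω, j ≤ s.u z := by
  set B : ℝ := Real.exp (2 * (j + 1)) with hB
  have hB0 : 0 < B := Real.exp_pos _
  set ε : ℝ := 1 / (8 * (1 + B)) with hε
  have hε0 : 0 < ε := by positivity
  have hεB : ε * B ≤ 1 / 8 := by
    rw [hε, div_mul_eq_mul_div, one_mul, div_le_div_iff₀ (by positivity) (by norm_num)]; linarith
  have hε1 : ε ≤ 1 / 8 := by
    rw [hε, div_le_div_iff₀ (by positivity) (by norm_num)]; linarith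
  set K : ℝ := 16 * (4 * B + 1) with hK
  have hK0 : 0 < K := by positivity
  obtain ⟨χ, hχ0, hχ1, hχ⟩ := cutoff (S := (Metric.thickening ε Ω)ᶜ) (T := closure Ω) Metric.isOpen_thickening.isClosed_compl
    isClosed_closure (by
      rw [Set.disjoint_compl_left_iff_subset]
      exact Metric.closure_subset_thickening hε0 Ω)
  have hthick : ∀ x ∈ Metric.thickening ε Ω, ∃ y ∈ Ω, ‖x - y‖ < ε := fun x hx => by
    obtain ⟨y, hy, h⟩ := Metric.mem_thickening_iff.1 hx
    exact ⟨y, hy, by rwa [dist_eq_norm] at h⟩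
  have hthn : ∀ x ∈ Metric.thickening ε Ω, ‖x‖ < 1 / 4 := fun x hx => by
    obtain ⟨y, hy, h⟩ := hthick x hx
    have := norm_add_le (x - y) y
    rw [sub_add_cancel] at this
    linarith [hb y hy]
  have hχ4 : ∀ x : Euc m, 1 / 4 ≤ ‖x‖ → χ x = 0 := fun x hx => hχ0 x fun h => absurd (hthn x h) (not_lt.2 hx)
  let f0 : SF m := χ * ((2 * K) • qd m + K • 1) - K • 1
  have hf0 : ∀ x, f0 x = χ x * (K * ‖x‖ ^ 2 + K) - K := fun x => by
    simp only [f0, SF.sub_apply, SF.mul_apply, SF.add_apply, SF.smul_apply, SF.one_apply, qd_apply]; ring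
  obtain ⟨f, hfp, hf⟩ := periodize f0 (-K) (fun y hy => by rw [hf0, hχ4 y hy]; ring)
  obtain ⟨φ, hφ⟩ := WA.torus hK0 hfp
  have hsu : ∀ x, hφ.sol.u x = K * (‖x‖ ^ 2 / 2) + φ x := fun x => rfl
  have hsh : ∀ x, hφ.sol.h x = 2 * K * (‖x‖ ^ 2 / 2) - f x := fun x => rfl
  have hin : ∀ x : Euc m, ‖x‖ < 1 / 2 → hφ.sol.h x = (1 - χ x) * (K * ‖x‖ ^ 2 + K) := fun x hx => by
    have h0 : WA.toE (0 : Zm m) = 0 := by ext i; simp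
    have : rnd x = 0 := rnd_eq (by rw [h0, sub_zero]; exact hx)
    rw [hsh, hf, this, h0, sub_zero, hf0]; ring
  have hout : ∀ x : Euc m, 1 / 2 ≤ ‖x‖ → 3 / 4 * K * ‖x‖ ^ 2 ≤ hφ.sol.h x := fun x hx => by
    rw [hsh, hf, hf0]
    set y := x - WA.toE (rnd x)
    have hx2 : (1:ℝ) / 4 ≤ ‖x‖ ^ 2 := by nlinarith
    rcases lt_or_ge ‖y‖ (1 / 4) with hy | hy
    · have hy2 : ‖y‖ ^ 2 ≤ 1 / 16 := by nlinarith [norm_nonneg y]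
      have h1 := hχ y
      have h2 : χ y * (K * ‖y‖ ^ 2 + K) ≤ 1 * (K * ‖y‖ ^ 2 + K) := mul_le_mul_of_nonneg_right h1.2 (by positivity)
      nlinarith
    · rw [hχ4 y hy]; nlinarith
  refine ⟨hφ.sol, fun x hx => ?_, fun z hz => ?_⟩
  · rw [hin x (by linarith [hb x hx]), hχ1 x (subset_closure hx)]; ring
  have hzn : ‖z‖ ≤ 1 / 8 := by
    have h1 : closure Ω ⊆ Metric.closedBall 0 (1 / 8) := closure_minimal (fun x hx => by simpa using (hb x hx).le) Metric.isClosed_closedBall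
    simpa using h1 hz.1
  obtain ⟨n, hn, hnΩ⟩ := support ho hc hne (z := z) (by rw [ho.frontier_eq] at hz; exact hz.2)
  have hlx : ∀ x : Euc m, |⟪n, x - z⟫| ≤ ‖x‖ + 1 := fun x => by
    have h1 := abs_real_inner_le_norm n (x - z)
    rw [hn, one_mul] at h1
    linarith [norm_sub_le x z]
  have hb2 : ∀ x : Euc m, ‖x‖ ^ 2 / 2 + B / 2 * (⟪n, x - z⟫ ^ 2 - 2 * ⟪n, x - z⟫) - 1 ≤ (4 * B + 1) * (‖x‖ ^ 2 + 1) := fun x => by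
    have h1 := abs_le.1 (hlx x)
    have h2 : ⟪n, x - z⟫ ^ 2 ≤ (‖x‖ + 1) ^ 2 := by
      rw [← sq_abs]; exact pow_le_pow_left₀ (abs_nonneg _) (hlx x) 2
    have h3 : ⟪n, x - z⟫ ^ 2 - 2 * ⟪n, x - z⟫ ≤ 8 * (‖x‖ ^ 2 + 1) := by nlinarith [sq_nonneg (‖x‖ - 1)]
    nlinarith [sq_nonneg ‖x‖]
  have hkey : ∀ x : Euc m, ‖x‖ ^ 2 / 2 + B / 2 * (⟪n, x - z⟫ ^ 2 - 2 * ⟪n, x - z⟫) - 1 ≤ hφ.sol.h x / 2 := fun x => by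
    rcases lt_or_ge ‖x‖ (1 / 2) with hx | hx
    · by_cases hxt : x ∈ Metric.thickening ε Ω
      · have h0 : 0 ≤ hφ.sol.h x := by
          rw [hin x hx]
          exact mul_nonneg (by linarith [(hχ x).2]) (by positivity)
        obtain ⟨y, hy, hxy⟩ := hthick x hxt
        have h1 := hnΩ y hy
        have h2 := abs_le.1 (abs_real_inner_le_norm n (x - y))
        rw [hn, one_mul] at h2
        have h3 : ⟪n, x - z⟫ = ⟪n, x - y⟫ + ⟪n, y - z⟫ := by rw [← inner_add_right, sub_add_sub_cancel]
        have h4 : -ε ≤ ⟪n, x - z⟫ := by linarith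
        have h5 := abs_le.1 (hlx x)
        have h6 : ⟪n, x - z⟫ ^ 2 - 2 * ⟪n, x - z⟫ ≤ 3 * ε := by
          rcases le_or_gt 0 ⟪n, x - z⟫ with h7 | h7
          · nlinarith
          · nlinarith
        have h8 := hthn x hxt
        nlinarith [norm_nonneg x]
      · rw [hin x hx, hχ0 x hxt]
        have := hb2 x
        have h9 : 0 ≤ (4 * B + 1) * (‖x‖ ^ 2 + 1) := by positivity
        rw [hK]; linarith
    · have h1 := hout x hx
      have hx2 : (1:ℝ) / 4 ≤ ‖x‖ ^ 2 := by nlinarith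
      have h2 := hb2 x
      have h3 : 3 / 4 * K * ‖x‖ ^ 2 = 12 * ((4 * B + 1) * ‖x‖ ^ 2) := by rw [hK]; ring
      have h4 : 0 ≤ (4 * B + 1) * (‖x‖ ^ 2 - 1 / 4) := mul_nonneg (by positivity) (by linarith)
      linarith
  -- global minimum of u - v
  have huv : ∀ x, vB B n z x ≤ hφ.sol.u x := by
    obtain ⟨Q, hQ0, hQ⟩ := hφ.per.bdd φ.cont
    have hlow : ∀ x : Euc m, ‖x‖ ^ 2 - (Q + (4 * B + 1) + |Real.log (1 + B) / 2|) ≤ hφ.sol.u x - vB B n z x := fun x => by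
      have h1 := hb2 x
      have h2 := abs_le.1 (hQ x)
      have h3 := le_abs_self (Real.log (1 + B) / 2)
      rw [hsu, vB_apply, hK]
      nlinarith [sq_nonneg ‖x‖, mul_nonneg hB0.le (sq_nonneg ‖x‖)]
    have hcoer : Filter.Tendsto (fun x => hφ.sol.u x - vB B n z x) (Filter.cocompact (Euc m)) Filter.atTop := by
      refine Filter.tendsto_atTop_mono hlow ?_
      refine Filter.tendsto_atTop_add_const_right _ _ ?_
      exact (Filter.tendsto_pow_atTop two_ne_zero).comp (tendsto_norm_cocompact_atTop)
    obtain ⟨x0, hx0⟩ := (hφ.sol.u.cont.sub (vB B n z).cont).exists_forall_le hcoer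
    have hdet := det_le_of_max (u := vB B n z) (v := hφ.sol.u) (x := x0) (vB_pos hB0.le n z x0)
      (Filter.Eventually.of_forall fun y => by
        have := hx0 y
        change hφ.sol.u x0 - vB B n z x0 ≤ hφ.sol.u y - vB B n z y at this
        change vB B n z y - hφ.sol.u y ≤ vB B n z x0 - hφ.sol.u x0
        linarith)
    rw [vB_det hn, hφ.sol.pde] at hdet
    have h1 := Real.log_le_log (by linarith) hdet
    rw [Real.log_exp] at h1
    have h2 := hkey x0
    intro x
    have h3 : hφ.sol.u x0 - vB B n z x0 ≤ hφ.sol.u x - vB B n z x := hx0 x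
    have h4 := vB_apply B n z x0
    linarith
  have h1 := huv z
  rw [vB_apply, sub_self, inner_zero_right] at h1
  have h2 : 2 * (j + 1) ≤ Real.log (1 + B) := by
    rw [Real.le_log_iff_exp_le (by linarith)]; linarith
  nlinarith [sq_nonneg ‖z‖]

end CY
end

section
open scoped ContDiff
open scoped ContDiff Topology
namespace CY
variable {m : ℕ}

/-- scaling of the argument -/
def scl (c : ℝ) (f : SF m) : SF m := ⟨fun x => f (c • x),
  show ContDiff ℝ ∞ (fun x : Euc m => f (c • x)) from f.cd.comp (contDiff_const_smul c)⟩
theorem scl_apply (c : ℝ) (f : SF m) (x : Euc m) : scl c f x = f (c • x) := rfl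

theorem D_scl (c : ℝ) (f : SF m) (v : Euc m) : D v (scl c f) = c • scl c (D v f) := SF.ext' fun x => by
  have h1 := hasDerivAt_line (scl c f) x v 0
  have h2 := hasDerivAt_line f (c • x) (c • v) 0
  have h3 : (fun t : ℝ => scl c f (x + t • v)) = fun t : ℝ => f (c • x + t • c • v) := by
    funext t
    rw [scl_apply, smul_add, smul_comm]
  rw [h3] at h1
  have := h1.unique h2
  rw [zero_smul, add_zero, zero_smul, add_zero, D_smul] at this
  exact this

theorem eM_scl (c : ℝ) (u : SF m) (x : Euc m) : eM x (Hf e (scl c u)) = c ^ 2 • eM (c • x) (Hf e u) := by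
  ext i j
  rw [Matrix.smul_apply, eM_apply, eM_apply]
  change D (e i) (D (e j) (scl c u)) x = c ^ 2 • D (e i) (D (e j) u) (c • x)
  rw [D_scl, Derivation.map_smul, D_scl, SF.smul_apply, SF.smul_apply, scl_apply, smul_eq_mul]
  ring

/-- scaling of solutions -/
def Sol.scale (s : Sol m) (P : ℝ) (hP : 0 < P) : Sol m where
  u := scl P⁻¹ s.u - (m * Real.log P) • 1
  h := scl P⁻¹ s.h
  pos x := by
    have h1 : Hf e (scl P⁻¹ s.u - (m * Real.log P) • 1) = Hf e (scl P⁻¹ s.u) := by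
      ext1 i j
      change D (e i) (D (e j) _) = D (e i) (D (e j) _)
      rw [map_sub, Derivation.map_smul, D_one, smul_zero, sub_zero]
    rw [h1, eM_scl]
    exact (s.pos _).smul (by positivity)
  pde x := by
    have h1 : Hf e (scl P⁻¹ s.u - (m * Real.log P) • 1) = Hf e (scl P⁻¹ s.u) := by
      ext1 i j
      change D (e i) (D (e j) _) = D (e i) (D (e j) _)
      rw [map_sub, Derivation.map_smul, D_one, smul_zero, sub_zero]
    rw [h1, eM_scl, Matrix.det_smul, s.pde, Fintype.card_fin]
    have h2 : (P⁻¹ ^ 2) ^ m = Real.exp (-(2 * (m * Real.log P))) := by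
      rw [Real.exp_neg, ← pow_mul, inv_pow]
      congr 1
      rw [show 2 * (m * Real.log P) = ((2 * m : ℕ) : ℝ) * Real.log P by push_cast; ring, ← Real.log_pow,
        Real.exp_log (by positivity)]
    rw [h2, ← Real.exp_add]
    congr 1
    simp only [SF.sub_apply, SF.smul_apply, SF.one_apply, scl_apply]
    ring

theorem prop1 {Ω : Set (Euc m)} (ho : IsOpen Ω) (hc : Convex ℝ Ω) (hne : Ω.Nonempty) {ρ : ℝ} (hb : ∀ x ∈ Ω, ‖x‖ < ρ) (j : ℝ) :
    ∃ s : Sol m, (∀ x ∈ Ω, s.h x = 0) ∧ ∀ z ∈ frontier Ω, j ≤ s.u z := by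
  have hρ : 0 < ρ := by
    obtain ⟨x, hx⟩ := hne
    exact (norm_nonneg x).trans_lt (hb x hx)
  set P : ℝ := 8 * ρ with hP
  have hP0 : 0 < P := by positivity
  let φ : Euc m ≃ₜ Euc m := Homeomorph.smulOfNeZero P hP0.ne'
  have hφ : ∀ x, φ x = P • x := fun x => rfl
  obtain ⟨s, h1, h2⟩ := prop1small (Ω := φ ⁻¹' Ω) (ho.preimage φ.continuous)
    (hc.linear_preimage (LinearMap.lsmul ℝ (Euc m) P))
    (by
      obtain ⟨x, hx⟩ := hne
      exact ⟨P⁻¹ • x, by rw [Set.mem_preimage, hφ, smul_inv_smul₀ hP0.ne']; exact hx⟩)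
    (fun x hx => by
      have := hb _ hx
      rw [hφ, norm_smul, Real.norm_of_nonneg hP0.le, hP] at this
      nlinarith) (j + m * Real.log P)
  refine ⟨s.scale P hP0, fun x hx => h1 _ ?_, fun z hz => ?_⟩
  · rw [Set.mem_preimage, hφ, smul_inv_smul₀ hP0.ne']; exact hx
  · have := h2 (P⁻¹ • z) (by
      rw [← φ.preimage_frontier, Set.mem_preimage, hφ, smul_inv_smul₀ hP0.ne']; exact hz)
    change j ≤ s.u (P⁻¹ • z) - m * Real.log P * 1
    linarith

theorem deriv_smooth {g : ℝ → ℝ} (hg : ContDiff ℝ ∞ g) : ContDiff ℝ ∞ (deriv g) := (contDiff_infty_iff_deriv.1 hg).2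

theorem D_comp (v : Euc m) (g : ℝ → ℝ) (hg : ContDiff ℝ ∞ g) (f : SF m) :
    D v (SF.comp g hg f) = SF.comp (deriv g) (deriv_smooth hg) f * D v f := SF.ext' fun x => by
  have h1 := hasDerivAt_line (SF.comp g hg f) x v 0
  have h2 := hasDerivAt_line f x v 0
  rw [zero_smul, add_zero] at h1 h2
  have h3 : HasDerivAt g (deriv g (f x)) (f (x + (0:ℝ) • v)) := by
    rw [zero_smul, add_zero]
    exact ((hg.differentiable (by simp)) (f x)).hasDerivAt
  exact h1.unique (h3.comp (0:ℝ) h2)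

theorem exists_slog {ε : ℝ} (hε : 0 < ε) : ∃ g : ℝ → ℝ, ContDiff ℝ ∞ g ∧ ∀ t, ε ≤ t → g t = Real.log t := by
  refine ⟨fun t => Real.smoothTransition (2 * t / ε - 1) * Real.log t, ?_, fun t ht => ?_⟩
  · rw [contDiff_iff_contDiffAt]
    intro t
    rcases lt_or_ge t (ε / 2) with h | h
    · refine (contDiffAt_const (c := (0:ℝ))).congr_of_eventuallyEq ?_
      filter_upwards [gt_mem_nhds h] with s hs
      rw [Real.smoothTransition.zero_of_nonpos, zero_mul]
      rw [sub_nonpos, div_le_one hε]; linarith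
    · refine ContDiffAt.mul ?_ (Real.contDiffAt_log.2 (by linarith))
      refine Real.smoothTransition.contDiffAt.comp t ?_
      fun_prop
  · have : Real.smoothTransition (2 * t / ε - 1) = 1 := by
      refine Real.smoothTransition.one_of_one_le ?_
      rw [le_sub_iff_add_le, le_div_iff₀ hε]; linarith
    simp only [this, one_mul]

theorem slog_deriv {ε : ℝ} {g : ℝ → ℝ} (h : ∀ t, ε ≤ t → g t = Real.log t) {t : ℝ} (h0 : 0 < ε) (ht : ε < t) :
    deriv (deriv g) t = - (t⁻¹) ^ 2 := by
  have h1 : ∀ s, ε < s → deriv g s = s⁻¹ := fun s hs => by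
    have : g =ᶠ[𝓝 s] Real.log := by
      filter_upwards [lt_mem_nhds hs] with r hr using h r hr.le
    rw [this.deriv_eq, Real.deriv_log]
  have h2 : deriv g =ᶠ[𝓝 t] fun s => s⁻¹ := by
    filter_upwards [lt_mem_nhds ht] with r hr using h1 r hr
  rw [h2.deriv_eq, deriv_inv, inv_pow]

/-- the matrix of the linear parts of a simplicial cone -/
def nM (n : Fin m → Euc m) : Matrix (Fin m) (Fin m) ℝ := Matrix.of fun k i => n k i

/-- lower barrier coming from a simplicial cone -/
def gC (n : Fin m → Euc m) (c : Fin m → ℝ) (δ : ℝ) (x : Euc m) : ℝ :=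
  Real.log |(nM n).det| - ∑ k, Real.log (⟪n k, x⟫ + c k + δ)

theorem cone_lower {n : Fin m → Euc m} {c : Fin m → ℝ} (hn : (nM n).det ≠ 0) {Ω : Set (Euc m)} (ho : IsOpen Ω) {ρ : ℝ}
    (hb : ∀ x ∈ Ω, ‖x‖ < ρ) (hpos : ∀ x ∈ Ω, ∀ k, 0 ≤ ⟪n k, x⟫ + c k) {δ : ℝ} (hδ : 0 < δ) (s : Sol m)
    (h0 : ∀ x ∈ Ω, s.h x = 0) {J : ℝ} (hJ : Real.log |(nM n).det| - m * Real.log δ ≤ J) (hu : ∀ z ∈ frontier Ω, J ≤ s.u z) :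
    ∀ x ∈ Ω, gC n c δ x ≤ s.u x := by
  obtain ⟨g, hg, hgl⟩ := exists_slog (half_pos hδ)
  let p : Fin m → SF m := fun k => lin (n k) (c k + δ)
  have hp : ∀ k x, p k x = ⟪n k, x⟫ + c k + δ := fun k x => by simp only [p, lin_apply]; ring
  let G : SF m := (Real.log |(nM n).det|) • 1 - ∑ k, SF.comp g hg (p k)
  have hcl : ∀ x ∈ closure Ω, ∀ k, δ ≤ p k x := fun x hx k => by
    have hcl : IsClosed {x | δ ≤ p k x} := isClosed_le continuous_const (p k).cont
    exact closure_minimal (fun y hy => by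
      have := hpos y hy k
      change δ ≤ p k y
      rw [hp]; linarith) hcl hx
  have hG : ∀ x ∈ closure Ω, G x = gC n c δ x := fun x hx => by
    have h1 : G x = Real.log |(nM n).det| * 1 - ∑ k, g (p k x) := by
      simp only [G, SF.sub_apply, SF.smul_apply, SF.one_apply, SF.sum_apply]; rfl
    rw [h1, gC, mul_one]
    congr 1
    refine Finset.sum_congr rfl fun k _ => ?_
    rw [hgl _ (by linarith [hcl x hx k]), hp]
  have hle : ∀ x ∈ closure Ω, G x ≤ Real.log |(nM n).det| - m * Real.log δ := fun x hx => by
    rw [hG x hx, gC]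
    have : ∑ _k : Fin m, Real.log δ ≤ ∑ k, Real.log (⟪n k, x⟫ + c k + δ) := Finset.sum_le_sum fun k _ => by
      rw [← hp]; exact Real.log_le_log hδ (hcl x hx k)
    simp at this
    linarith
  have hH : ∀ x ∈ closure Ω, eM x (Hf e G) = (Matrix.diagonal (fun k => (p k x)⁻¹) * nM n).transpose * (Matrix.diagonal (fun k => (p k x)⁻¹) * nM n) :=
    fun x hx => by
    ext i j
    rw [eM_apply]
    change D (e i) (D (e j) G) x = _
    have h1 : ∀ k, D (e i) (D (e j) (SF.comp g hg (p k))) x = - ((p k x)⁻¹ * n k i * ((p k x)⁻¹ * n k j)) := fun k => by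
      have hn : ∀ l : Fin m, ⟪n k, e l⟫ = n k l := fun l => by simp [e, EuclideanSpace.inner_single_right]
      rw [D_comp, Derivation.leibniz, D_comp]
      simp only [p, D_lin, Derivation.map_smul, D_one, smul_zero, smul_eq_mul, mul_zero, zero_add, SF.mul_apply, SF.smul_apply, SF.one_apply, mul_one, hn]
      have h2 := slog_deriv hgl (half_pos hδ) (t := p k x) (by linarith [hcl x hx k])
      change n k j * (deriv (deriv g) (p k x) * n k i) = _
      rw [h2]
      change n k j * (-((p k x)⁻¹) ^ 2 * n k i) = - ((p k x)⁻¹ * n k i * ((p k x)⁻¹ * n k j))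
      ring
    have h2 : D (e i) (D (e j) G) x = ∑ k, (p k x)⁻¹ * n k i * ((p k x)⁻¹ * n k j) := by
      simp only [G, map_sub, map_sum, Derivation.map_smul, D_one, smul_zero, map_zero, SF.sub_apply, SF.sum_apply, h1, SF.zero_apply,
        Finset.sum_neg_distrib]
      ring
    rw [h2, Matrix.mul_apply]
    refine Finset.sum_congr rfl fun k _ => ?_
    rw [Matrix.transpose_apply, Matrix.diagonal_mul, Matrix.diagonal_mul]
    rfl
  have hdet : ∀ x ∈ closure Ω, (eM x (Hf e G)).det = Real.exp (2 * G x) := fun x hx => by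
    rw [hH x hx, Matrix.det_mul, Matrix.det_transpose, Matrix.det_mul, Matrix.det_diagonal, hG x hx, gC]
    have h1 : ∏ k, (p k x)⁻¹ = Real.exp (- ∑ k, Real.log (⟪n k, x⟫ + c k + δ)) := by
      rw [← Finset.sum_neg_distrib, Real.exp_sum]
      refine Finset.prod_congr rfl fun k _ => ?_
      rw [← hp, Real.exp_neg, Real.exp_log (by linarith [hcl x hx k])]
    rw [h1, two_mul, Real.exp_add, sub_eq_add_neg, Real.exp_add, Real.exp_log (abs_pos.2 hn)]
    have h2 : (nM n).det * (nM n).det = |(nM n).det| * |(nM n).det| := (abs_mul_abs_self _).symm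
    linear_combination (Real.exp (- ∑ k, Real.log (⟪n k, x⟫ + c k + δ))) ^ 2 * h2
  have hpd : ∀ x ∈ closure Ω, (eM x (Hf e G)).PosDef := fun x hx => by
    have h1 : (eM x (Hf e G)).PosSemidef := by
      rw [hH x hx]
      have := Matrix.posSemidef_conjTranspose_mul_self (Matrix.diagonal (fun k => (p k x)⁻¹) * nM n)
      rwa [Matrix.conjTranspose_eq_transpose_of_trivial] at this
    rw [h1.posDef_iff_isUnit, Matrix.isUnit_iff_isUnit_det, hdet x hx]
    exact (Real.exp_pos _).ne'.isUnit
  have hcomp : IsCompact (closure Ω) := by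
    refine Metric.isCompact_of_isClosed_isBounded isClosed_closure ?_
    refine Bornology.IsBounded.closure ?_
    exact (Metric.isBounded_ball (x := (0 : Euc m)) (r := ρ)).subset fun x hx => by simpa using hb x hx
  intro x hx
  obtain ⟨x0, hx0, hmax⟩ := hcomp.exists_isMaxOn ⟨x, subset_closure hx⟩ (G.cont.sub s.u.cont).continuousOn
  have hx1 : G x - s.u x ≤ G x0 - s.u x0 := hmax (subset_closure hx)
  rw [← hG x (subset_closure hx)]
  suffices G x0 ≤ s.u x0 by linarith
  by_cases hin : x0 ∈ Ω
  · have h1 := det_le_of_max (u := G) (v := s.u) (hpd x0 hx0) (by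
      filter_upwards [ho.mem_nhds hin] with y hy
      exact hmax (subset_closure hy))
    rw [hdet x0 hx0, s.pde, h0 x0 hin, sub_zero, Real.exp_le_exp] at h1
    linarith
  · have h1 := hu x0 (by rw [ho.frontier_eq]; exact ⟨hx0, hin⟩)
    linarith [hle x0 hx0]

end CY
end

section
open scoped ContDiff
open scoped ContDiff Topology
namespace CY
variable {m : ℕ}

/-- upper barrier on balls -/
theorem upper (hm : 0 < m) {ρ : ℝ} (hρ : 0 < ρ) : ∃ C : ℝ, ∀ (s : Sol m) (x0 : Euc m),
    (∀ x ∈ Metric.ball x0 ρ, s.h x = 0) → ∀ y ∈ Metric.ball x0 (ρ / 2), s.u y ≤ C := by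
  have hm' : (0:ℝ) < m := by exact_mod_cast hm
  refine ⟨Real.log ((6 * m * ρ ^ 2) ^ m / (3 / 4 * ρ ^ 2) ^ (2 * m)) / 2, fun s x0 h0 y hy => ?_⟩
  set k : ℝ := (m : ℝ)⁻¹ with hk
  let q : SF m := lin ((2:ℝ) • x0) (ρ ^ 2 - ‖x0‖ ^ 2) - (2:ℝ) • qd m
  have hq : ∀ x, q x = ρ ^ 2 - ‖x - x0‖ ^ 2 := fun x => by
    change lin ((2:ℝ) • x0) (ρ ^ 2 - ‖x0‖ ^ 2) x - (2:ℝ) * qd m x = _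
    rw [lin_apply, qd_apply, norm_sub_sq_real, inner_smul_left, real_inner_comm]
    simp only [conj_trivial]; ring
  have hqv : ∀ v, D v q = lin ((-2:ℝ) • v) (2 * ⟪x0, v⟫) := fun v => by
    refine SF.ext' fun x => ?_
    change D v (lin ((2:ℝ) • x0) (ρ ^ 2 - ‖x0‖ ^ 2) - (2:ℝ) • qd m) x = _
    rw [map_sub, Derivation.map_smul, D_lin, D_qd]
    simp only [SF.sub_apply, SF.smul_apply, lin_apply, inner_smul_left, conj_trivial, SF.one_apply]; ring
  have hqvv : ∀ v x, D v (D v q) x = -2 * ‖v‖ ^ 2 := fun v x => by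
    rw [hqv, D_lin, SF.smul_apply, SF.one_apply, inner_smul_left, real_inner_self_eq_norm_sq]
    simp
  let E : SF m := (k • s.u).exp
  have hE : ∀ x, E x = Real.exp (k * s.u x) := fun x => by
    change (k • s.u).exp x = _
    rw [SF.exp_apply, SF.smul_apply]
  have hEv : ∀ v, D v E = E * (k • D v s.u) := fun v => by
    change D v (k • s.u).exp = _
    rw [D_exp, Derivation.map_smul]
  let f : SF m := q * E
  have hf : ∀ x, f x = q x * E x := fun x => SF.mul_apply _ _ _
  have hEpos : ∀ x, 0 < E x := fun x => by rw [hE]; exact Real.exp_pos _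
  obtain ⟨x, hx, hmax⟩ := (isCompact_closedBall x0 ρ).exists_isMaxOn ⟨x0, Metric.mem_closedBall_self hρ.le⟩ f.cont.continuousOn
  have hf0 : 0 < f x := by
    refine lt_of_lt_of_le ?_ (hmax (Metric.mem_closedBall_self hρ.le))
    rw [hf, hq, sub_self, norm_zero]
    exact mul_pos (by nlinarith) (hEpos x0)
  have hqx : 0 < q x := by
    rw [hf] at hf0
    exact (pos_iff_pos_of_mul_pos hf0).2 (hEpos x)
  have hxb : ‖x - x0‖ < ρ := by
    rw [hq] at hqx
    exact lt_of_pow_lt_pow_left₀ 2 hρ.le (by linarith)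
  have hxB : x ∈ Metric.ball x0 ρ := by rwa [Metric.mem_ball, dist_eq_norm]
  have hlm : IsLocalMax f x := Filter.mem_of_superset (Metric.isOpen_ball.mem_nhds hxB)
    fun y hy => hmax (Metric.ball_subset_closedBall hy)
  have hvv : ∀ v, D v (D v s.u) x ≤ 6 * m * ρ ^ 2 / q x ^ 2 * ‖v‖ ^ 2 := fun v => by
    obtain ⟨h1, h2⟩ := localMax_test hlm v
    have e1 : D v f = E * (D v q + q * (k • D v s.u)) := by
      change D v (q * E) = _
      rw [Derivation.leibniz, hEv, smul_eq_mul, smul_eq_mul]; ring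
    rw [e1, SF.mul_apply] at h1
    have h1' := (mul_eq_zero.1 h1).resolve_left (hEpos x).ne'
    rw [e1, Derivation.leibniz, smul_eq_mul, smul_eq_mul, SF.add_apply, SF.mul_apply, SF.mul_apply, h1', zero_mul, add_zero] at h2
    have h2' := nonpos_of_mul_nonpos_right h2 (hEpos x)
    rw [map_add, Derivation.leibniz, Derivation.map_smul, smul_eq_mul, smul_eq_mul] at h2'
    simp only [SF.add_apply, SF.mul_apply, SF.smul_apply] at h1' h2'
    rw [hqvv] at h2'
    have hb : (D v q x) ^ 2 ≤ 4 * ρ ^ 2 * ‖v‖ ^ 2 := by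
      have h3 : D v q x = -2 * ⟪v, x - x0⟫ := by
        rw [hqv, lin_apply, inner_smul_left, inner_sub_right, real_inner_comm x0 v]; simp; ring
      have h4 : |⟪v, x - x0⟫| ≤ ‖v‖ * ρ := (abs_real_inner_le_norm _ _).trans (by gcongr)
      have h5 := sq_le_sq' (by linarith [(abs_le.1 h4).1]) (abs_le.1 h4).2
      rw [h3]; nlinarith
    set A := D v q x
    set B := D v s.u x
    set G := D v (D v s.u) x
    set Q := q x
    have hQ : Q ≤ ρ ^ 2 := by rw [show Q = _ from hq x]; nlinarith [sq_nonneg ‖x - x0‖]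
    have hA : k * B * Q = -A := by linarith
    have h6 : k * G * Q ^ 2 ≤ 6 * ρ ^ 2 * ‖v‖ ^ 2 := by
      have : Q * (-2 * ‖v‖ ^ 2 + (Q * (k * G) + k * B * A)) ≤ 0 := mul_nonpos_of_nonneg_of_nonpos hqx.le h2'
      have h7 : Q * (k * B * A) = - A ^ 2 := by
        rw [show Q * (k * B * A) = k * B * Q * A by ring, hA]; ring
      have h8 : Q * ‖v‖ ^ 2 ≤ ρ ^ 2 * ‖v‖ ^ 2 := by gcongr
      nlinarith
    rw [div_mul_eq_mul_div, le_div_iff₀ (by positivity)]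
    have h9 : (m : ℝ) * k = 1 := mul_inv_cancel₀ hm'.ne'
    calc G * Q ^ 2 = m * (k * G * Q ^ 2) := by rw [show (m : ℝ) * (k * G * Q ^ 2) = (m * k) * (G * Q ^ 2) by ring, h9, one_mul]
      _ ≤ m * (6 * ρ ^ 2 * ‖v‖ ^ 2) := by gcongr
      _ = _ := by ring
  set c : ℝ := 6 * m * ρ ^ 2 / q x ^ 2 with hc
  have hdet : Real.exp (2 * s.u x) ≤ c ^ m := by
    have h1 := s.pde x
    rw [h0 x hxB, sub_zero] at h1
    rw [← h1]
    have h2 : (c • (1 : Matrix (Fin m) (Fin m) ℝ)).det = c ^ m := by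
      rw [Matrix.det_smul, Matrix.det_one, mul_one, Fintype.card_fin]
    rw [← h2]
    refine det_mono (s.pos x) (by simp) fun a => ?_
    rw [quad_form]
    refine (hvv _).trans_eq ?_
    rw [EuclideanSpace.norm_sq_eq, Matrix.smul_mulVec, Matrix.one_mulVec, dotProduct_smul, smul_eq_mul]
    simp [dotProduct, pow_two, hc]
  have hpw : ∀ x, E x ^ (2 * m) = Real.exp (2 * s.u x) := fun x => by
    rw [hE, ← Real.exp_nat_mul]; congr 1; push_cast
    rw [hk]; field_simp
  have hK : f x ^ (2 * m) ≤ (6 * m * ρ ^ 2) ^ m := by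
    rw [hf, mul_pow, hpw, pow_mul (q x)]
    calc (q x ^ 2) ^ m * Real.exp (2 * s.u x) ≤ (q x ^ 2) ^ m * c ^ m := by gcongr
      _ = _ := by rw [← mul_pow, hc, mul_div_cancel₀]; positivity
  have hqy : 3 / 4 * ρ ^ 2 ≤ q y := by
    rw [hq]
    rw [Metric.mem_ball, dist_eq_norm] at hy
    nlinarith [norm_nonneg (y - x0)]
  have hyf : f y ≤ f x := hmax (Metric.ball_subset_closedBall (Metric.ball_subset_ball (by linarith) hy))
  have hfin : (3 / 4 * ρ ^ 2) ^ (2 * m) * Real.exp (2 * s.u y) ≤ (6 * m * ρ ^ 2) ^ m := by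
    refine le_trans ?_ hK
    rw [← hpw, ← mul_pow]
    have := hEpos y
    refine pow_le_pow_left₀ (by positivity) (le_trans ?_ hyf) _
    rw [hf]; gcongr
  rw [mul_comm, ← le_div_iff₀ (by positivity)] at hfin
  have := (Real.le_log_iff_exp_le (by positivity)).2 hfin
  linarith
end CY
end

section
open scoped ContDiff
open scoped ContDiff Topology
namespace CY
variable {m : ℕ}

theorem span_normals {Ω : Set (Euc m)} (hc : Convex ℝ Ω) (hne : Ω.Nonempty)
    (hp : ¬ ∃ p v : Euc m, v ≠ 0 ∧ ∀ t : ℝ, p + t • v ∈ closure Ω) :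
    Submodule.span ℝ {n : Euc m | ∃ c : ℝ, ∀ x ∈ Ω, 0 ≤ ⟪n, x⟫ + c} = ⊤ := by
  set W := {n : Euc m | ∃ c : ℝ, ∀ x ∈ Ω, 0 ≤ ⟪n, x⟫ + c} with hW
  rw [← Submodule.orthogonal_eq_bot_iff]
  by_contra hb
  obtain ⟨v, hv, hv0⟩ := Submodule.exists_mem_ne_zero_of_ne_bot hb
  obtain ⟨p, hpΩ⟩ := hne
  refine hp ⟨p, v, hv0, fun t => ?_⟩
  by_contra hnot
  obtain ⟨f, u, h1, h2⟩ := geometric_hahn_banach_point_closed hc.closure isClosed_closure hnot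
  set w : Euc m := (InnerProductSpace.toDual ℝ (Euc m)).symm f with hw
  have hwf : ∀ x, ⟪w, x⟫ = f x := fun x => InnerProductSpace.toDual_symm_apply
  have hwW : w ∈ W := ⟨-u, fun x hx => by
    have := h2 x (subset_closure hx)
    rw [hwf]; linarith⟩
  have h3 : ⟪w, v⟫ = 0 := (Submodule.mem_orthogonal _ _).1 hv w (Submodule.subset_span hwW)
  rw [hwf] at h3
  have h4 := h2 p (subset_closure hpΩ)
  rw [map_add, map_smul, h3, smul_zero, add_zero] at h1
  linarith

theorem cone_data {Ω : Set (Euc m)} (hc : Convex ℝ Ω) (hne : Ω.Nonempty)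
    (hp : ¬ ∃ p v : Euc m, v ≠ 0 ∧ ∀ t : ℝ, p + t • v ∈ closure Ω) {v0 : Euc m} (hv0 : v0 ≠ 0) {c0 : ℝ}
    (h0 : ∀ x ∈ Ω, 0 ≤ ⟪v0, x⟫ + c0) :
    ∃ (n : Fin m → Euc m) (c : Fin m → ℝ), (nM n).det ≠ 0 ∧ (∀ x ∈ Ω, ∀ k, 0 ≤ ⟪n k, x⟫ + c k) ∧ ∃ k, n k = v0 ∧ c k = c0 := by
  classical
  set W := {n : Euc m | ∃ c : ℝ, ∀ x ∈ Ω, 0 ≤ ⟪n, x⟫ + c} with hW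
  have hs : LinearIndepOn ℝ id ({v0} : Set (Euc m)) := LinearIndepOn.singleton hv0
  obtain ⟨b, hbW, hvb, hsp, hli⟩ := exists_linearIndepOn_extension hs
    (show ({v0} : Set (Euc m)) ⊆ W from Set.singleton_subset_iff.2 ⟨c0, h0⟩)
  rw [Set.image_id, Set.image_id] at hsp
  have htop : ⊤ ≤ Submodule.span ℝ (Set.range (fun x : b => (x : Euc m))) := by
    rw [Subtype.range_coe, ← span_normals hc hne hp]
    exact Submodule.span_le.2 hsp
  let B : Module.Basis b ℝ (Euc m) := Module.Basis.mk (v := fun x : b => (x : Euc m)) hli htop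
  have : Fintype b := FiniteDimensional.fintypeBasisIndex B
  have hcard : Fintype.card b = m := by
    rw [← Module.finrank_eq_card_basis B, finrank_euclideanSpace_fin]
  let eq : b ≃ Fin m := Fintype.equivFinOfCardEq hcard
  let n : Fin m → Euc m := fun k => (eq.symm k : Euc m)
  have hnW : ∀ k, n k ∈ W := fun k => hbW (eq.symm k).2
  choose c' hc' using hnW
  refine ⟨n, fun k => if n k = v0 then c0 else c' k, ?_, fun x hx k => ?_, eq ⟨v0, hvb rfl⟩, ?_, ?_⟩
  · have h1 : LinearIndependent ℝ n := LinearIndependent.comp (v := fun x : b => (x : Euc m)) hli eq.symm eq.symm.injective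
    have h2 : LinearIndependent ℝ (nM n).row :=
      h1.map' (WithLp.linearEquiv 2 ℝ (Fin m → ℝ)).toLinearMap (LinearEquiv.ker _)
    exact ((Matrix.isUnit_iff_isUnit_det _).1 (Matrix.linearIndependent_rows_iff_isUnit.1 h2)).ne_zero
  · dsimp only
    split_ifs with h
    · rw [h]; exact h0 x hx
    · exact hc' k x hx
  · simp [n]
  · simp [n]

theorem coerc {n : Fin m → Euc m} (hn : (nM n).det ≠ 0) (c : Fin m → ℝ) :
    ∃ (a : Euc m) (κ K : ℝ), 0 < κ ∧ ∀ x, (∀ k, 0 ≤ ⟪n k, x⟫ + c k) → κ * ‖x‖ - K ≤ gC n c 1 x + ⟪a, x⟫ := by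
  let A : Euc m →ₗ[ℝ] (Fin m → ℝ) := LinearMap.pi fun k => (innerSL ℝ (n k)).toLinearMap
  have hA : ∀ x k, A x k = ⟪n k, x⟫ := fun x k => rfl
  have hinj : Function.Injective A := by
    rw [← LinearMap.ker_eq_bot, LinearMap.ker_eq_bot']
    intro x hx
    have h1 : (nM n).mulVec x.ofLp = 0 := by
      funext k
      have := congrFun hx k
      rw [hA] at this
      refine Eq.trans ?_ this
      change (n k).ofLp ⬝ᵥ x.ofLp = _
      rw [EuclideanSpace.inner_eq_star_dotProduct]
      simp [dotProduct_comm]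
    have h2 := Matrix.eq_zero_of_mulVec_eq_zero hn h1
    ext i
    exact congrFun h2 i
  obtain ⟨K, hK0, hK⟩ := (LinearMap.injective_iff_antilipschitz A).1 hinj
  have hb : ∀ x, ‖x‖ ≤ K * ‖A x‖ := fun x => by
    have := hK.le_mul_dist x 0
    rwa [dist_zero_right, map_zero, dist_zero_right] at this
  have hK0' : (0:ℝ) < K := hK0
  refine ⟨∑ k, n k, 1 / (2 * K), - (Real.log |(nM n).det| - ∑ k, c k - m - (∑ k, |c k|) / 2), by positivity, fun x hx => ?_⟩
  have h1 : ‖A x‖ ≤ ∑ k, (⟪n k, x⟫ + c k) + ∑ k, |c k| := by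
    have h0 : 0 ≤ ∑ k, (⟪n k, x⟫ + c k) + ∑ k, |c k| :=
      add_nonneg (Finset.sum_nonneg fun k _ => hx k) (Finset.sum_nonneg fun k _ => abs_nonneg _)
    refine (pi_norm_le_iff_of_nonneg h0).2 fun k => ?_
    have e1 := Finset.single_le_sum (f := fun k => ⟪n k, x⟫ + c k) (fun k _ => hx k) (Finset.mem_univ k)
    have e2 := Finset.single_le_sum (f := fun k => |c k|) (fun k _ => abs_nonneg _) (Finset.mem_univ k)
    have e3 : ‖A x k‖ ≤ (⟪n k, x⟫ + c k) + |c k| := by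
      rw [hA, Real.norm_eq_abs, abs_le]
      constructor <;> linarith [hx k, neg_abs_le (c k), le_abs_self (c k)]
    linarith
  have h2 : ∑ k, Real.log (⟪n k, x⟫ + c k + 1) ≤ ∑ k, ((⟪n k, x⟫ + c k) / 2 + 1) := by
    refine Finset.sum_le_sum fun k _ => ?_
    have hpos : 0 < (⟪n k, x⟫ + c k + 1) / 2 := by linarith [hx k]
    have e1 := Real.log_le_sub_one_of_pos hpos
    have e2 : Real.log (⟪n k, x⟫ + c k + 1) = Real.log ((⟪n k, x⟫ + c k + 1) / 2) + Real.log 2 := by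
      rw [← Real.log_mul hpos.ne' two_ne_zero, div_mul_cancel₀ _ two_ne_zero]
    have := Real.log_two_lt_d9
    linarith
  rw [Finset.sum_add_distrib, ← Finset.sum_div] at h2
  simp only [Finset.sum_const, Finset.card_univ, Fintype.card_fin, nsmul_eq_mul, mul_one] at h2
  have h3 : ⟪∑ k, n k, x⟫ = ∑ k, (⟪n k, x⟫ + c k) - ∑ k, c k := by
    rw [sum_inner, Finset.sum_add_distrib]; ring
  have h4 : 1 / (2 * (K:ℝ)) * ‖x‖ ≤ (∑ k, (⟪n k, x⟫ + c k) + ∑ k, |c k|) / 2 := by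
    calc 1 / (2 * (K:ℝ)) * ‖x‖ ≤ 1 / (2 * (K:ℝ)) * (K * ‖A x‖) := by gcongr; exact hb x
      _ = ‖A x‖ / 2 := by field_simp
      _ ≤ _ := by gcongr
  unfold gC
  rw [h3]
  linarith
end CY
end

section
open scoped ContDiff
open scoped ContDiff Topology
namespace CY
variable {m : ℕ}
open Filter in
/-- approximating sequences -/
def Appr (Ω : Set (Euc m)) (s : ℕ → Sol m) : Prop :=
  ∀ᶠ j : ℕ in atTop, (∀ x ∈ Ω ∩ Metric.ball 0 j, (s j).h x = 0) ∧ ∀ z ∈ frontier (Ω ∩ Metric.ball 0 (j:ℝ)), (j:ℝ) ≤ (s j).u z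

theorem exists_appr {Ω : Set (Euc m)} (ho : IsOpen Ω) (hc : Convex ℝ Ω) (hne : Ω.Nonempty) : ∃ s, Appr Ω s := by
  obtain ⟨p, hp⟩ := hne
  obtain ⟨N, hN⟩ := exists_nat_gt ‖p‖
  have key : ∀ j : ℕ, N ≤ j → ∃ s : Sol m, (∀ x ∈ Ω ∩ Metric.ball 0 j, s.h x = 0) ∧ ∀ z ∈ frontier (Ω ∩ Metric.ball 0 (j:ℝ)), (j:ℝ) ≤ s.u z :=
    fun j hj => prop1 (ho.inter Metric.isOpen_ball) (hc.inter (convex_ball _ _))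
      ⟨p, hp, by rw [mem_ball_zero_iff]; exact hN.trans_le (by exact_mod_cast hj)⟩ (ρ := j) (fun x hx => mem_ball_zero_iff.1 hx.2) j
  have key2 : ∀ j : ℕ, ∃ s : Sol m, N ≤ j → (∀ x ∈ Ω ∩ Metric.ball 0 j, s.h x = 0) ∧ ∀ z ∈ frontier (Ω ∩ Metric.ball 0 (j:ℝ)), (j:ℝ) ≤ s.u z := fun j => by
    by_cases hj : N ≤ j
    · obtain ⟨s, h⟩ := key j hj
      exact ⟨s, fun _ => h⟩
    · obtain ⟨s, -⟩ := key N le_rfl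
      exact ⟨s, fun h => absurd h hj⟩
  choose s hs using key2
  exact ⟨s, Filter.eventually_atTop.2 ⟨N, hs⟩⟩

variable {Ω : Set (Euc m)} {s : ℕ → Sol m}

theorem Appr.cone (hA : Appr Ω s) (ho : IsOpen Ω) {n : Fin m → Euc m} {c : Fin m → ℝ} (hn : (nM n).det ≠ 0)
    (hpos : ∀ x ∈ Ω, ∀ k, 0 ≤ ⟪n k, x⟫ + c k) {δ : ℝ} (hδ : 0 < δ) :
    ∀ᶠ j : ℕ in Filter.atTop, ∀ x ∈ Ω ∩ Metric.ball 0 (j:ℝ), gC n c δ x ≤ (s j).u x := by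
  filter_upwards [hA, tendsto_natCast_atTop_atTop.eventually_ge_atTop (Real.log |(nM n).det| - m * Real.log δ)] with j hj hj2
  exact cone_lower hn (ho.inter Metric.isOpen_ball) (fun x hx => mem_ball_zero_iff.1 hx.2) (fun x hx => hpos x hx.1) hδ (s j) hj.1 hj2 hj.2

theorem gC_cont {n : Fin m → Euc m} {c : Fin m → ℝ} {δ : ℝ} (hδ : 0 < δ) {x : Euc m} (hx : ∀ k, 0 ≤ ⟪n k, x⟫ + c k) :
    ContinuousAt (gC n c δ) x := by
  unfold gC
  refine continuousAt_const.sub (tendsto_finsetSum _ fun k _ => ?_)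
  have h1 : Continuous fun x : Euc m => ⟪n k, x⟫ + c k + δ := by fun_prop
  exact h1.continuousAt.log (by linarith [hx k])

theorem pos_closure {n : Euc m} {c : ℝ} (hpos : ∀ x ∈ Ω, 0 ≤ ⟪n, x⟫ + c) {z : Euc m} (hz : z ∈ closure Ω) : 0 ≤ ⟪n, z⟫ + c := by
  have hcl : IsClosed {x : Euc m | 0 ≤ ⟪n, x⟫ + c} := isClosed_le continuous_const (by fun_prop)
  exact closure_minimal (fun x hx => hpos x hx) hcl hz

theorem Appr.bdry (hA : Appr Ω s) (ho : IsOpen Ω) (hc : Convex ℝ Ω) (hne : Ω.Nonempty)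
    (hp : ¬ ∃ p v : Euc m, v ≠ 0 ∧ ∀ t : ℝ, p + t • v ∈ closure Ω) {z : Euc m} (hz : z ∈ frontier Ω) (A : ℝ) :
    ∃ r > 0, ∀ᶠ j : ℕ in Filter.atTop, ∀ x ∈ Ω ∩ Metric.ball 0 (j:ℝ), dist x z < r → A ≤ (s j).u x := by
  rw [ho.frontier_eq] at hz
  obtain ⟨v0, hv1, hv2⟩ := support ho hc hne hz.2
  have hv0 : v0 ≠ 0 := fun h => by rw [h, norm_zero] at hv1; exact zero_ne_one hv1
  obtain ⟨n, c, hn, hpos, k0, hk1, hk2⟩ := cone_data hc hne hp hv0 (c0 := -⟪v0, z⟫) (fun x hx => by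
    have := hv2 x hx
    rw [inner_sub_right] at this; linarith)
  have hzpos : ∀ k, 0 ≤ ⟪n k, z⟫ + c k := fun k => pos_closure (fun x hx => hpos x hx k) hz.1
  have hz0 : ⟪n k0, z⟫ + c k0 = 0 := by rw [hk1, hk2]; ring
  set Q : ℝ := Real.log |(nM n).det| - ∑ k ∈ Finset.univ.erase k0, Real.log (⟪n k, z⟫ + c k + 1) with hQ
  set δ : ℝ := min 1 (Real.exp (Q - A - 1)) with hδ
  have hδ0 : 0 < δ := lt_min one_pos (Real.exp_pos _)
  have hδl : Real.log δ ≤ Q - A - 1 := by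
    rw [Real.log_le_iff_le_exp hδ0]; exact min_le_right _ _
  have hgz : A < gC n c δ z := by
    unfold gC
    rw [← Finset.add_sum_erase _ _ (Finset.mem_univ k0), hz0, zero_add]
    have : ∑ k ∈ Finset.univ.erase k0, Real.log (⟪n k, z⟫ + c k + δ) ≤ ∑ k ∈ Finset.univ.erase k0, Real.log (⟪n k, z⟫ + c k + 1) := by
      refine Finset.sum_le_sum fun k _ => Real.log_le_log (by linarith [hzpos k]) ?_
      have := min_le_left 1 (Real.exp (Q - A - 1))
      linarith
    linarith
  have hev := (gC_cont hδ0 hzpos).eventually (lt_mem_nhds hgz)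
  obtain ⟨r, hr, hball⟩ := Metric.eventually_nhds_iff.1 hev
  refine ⟨r, hr, ?_⟩
  filter_upwards [hA.cone ho hn hpos hδ0] with j hj x hx hxz
  exact (hball hxz).le.trans (hj x hx)

theorem Appr.coerc (hA : Appr Ω s) (ho : IsOpen Ω) {n : Fin m → Euc m} {c : Fin m → ℝ} (hn : (nM n).det ≠ 0)
    (hpos : ∀ x ∈ Ω, ∀ k, 0 ≤ ⟪n k, x⟫ + c k) : ∃ a : Euc m, ∀ M : ℝ, ∃ R0 : ℝ, ∀ᶠ j : ℕ in Filter.atTop,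
      ∀ x ∈ Ω ∩ Metric.ball 0 (j:ℝ), R0 ≤ ‖x‖ → M - ⟪a, x⟫ ≤ (s j).u x := by
  obtain ⟨a, κ, K, hκ, h⟩ := CY.coerc hn c
  refine ⟨a, fun M => ⟨(M + K) / κ, ?_⟩⟩
  filter_upwards [hA.cone ho hn hpos one_pos] with j hj x hx hxR
  have h1 := h x (hpos x hx.1)
  have h2 := hj x hx
  rw [div_le_iff₀ hκ] at hxR
  linarith

theorem bdd_ev {E : Set (Euc m)} (hE : IsCompact E) : ∀ᶠ j : ℕ in Filter.atTop, E ⊆ Metric.ball 0 (j:ℝ) := by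
  obtain ⟨R, hR⟩ := hE.isBounded.subset_ball 0
  filter_upwards [tendsto_natCast_atTop_atTop.eventually_ge_atTop R] with j hj
  exact hR.trans (Metric.ball_subset_ball hj)

theorem Appr.lower (hA : Appr Ω s) (ho : IsOpen Ω) {n : Fin m → Euc m} {c : Fin m → ℝ} (hn : (nM n).det ≠ 0)
    (hpos : ∀ x ∈ Ω, ∀ k, 0 ≤ ⟪n k, x⟫ + c k) {E : Set (Euc m)} (hE : IsCompact E) (hEΩ : E ⊆ Ω) :
    ∃ C : ℝ, ∀ᶠ j : ℕ in Filter.atTop, ∀ x ∈ E, -C ≤ (s j).u x := by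
  obtain ⟨C, hC⟩ := hE.exists_bound_of_continuousOn (f := gC n c 1)
    fun x hx => (gC_cont one_pos (hpos x (hEΩ hx))).continuousWithinAt
  refine ⟨C, ?_⟩
  filter_upwards [hA.cone ho hn hpos one_pos, bdd_ev hE] with j hj hj2 x hx
  exact (abs_le.1 (hC x hx)).1.trans (hj x ⟨hEΩ hx, hj2 hx⟩)

theorem Appr.upper (hm : 0 < m) (hA : Appr Ω s) (ho : IsOpen Ω) {E : Set (Euc m)} (hE : IsCompact E) (hEΩ : E ⊆ Ω) :
    ∃ C : ℝ, ∀ᶠ j : ℕ in Filter.atTop, ∀ x ∈ E, (s j).u x ≤ C := by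
  obtain ⟨ρ, hρ, hsub⟩ := hE.exists_cthickening_subset_open ho hEΩ
  obtain ⟨C, hC⟩ := CY.upper hm hρ
  refine ⟨C, ?_⟩
  filter_upwards [hA, bdd_ev hE.cthickening] with j hj hj2 x hx
  refine hC (s j) x (fun y hy => hj.1 y ?_) x (Metric.mem_ball_self (half_pos hρ))
  have : y ∈ Metric.cthickening ρ E := Metric.mem_cthickening_of_dist_le y x ρ E hx (Metric.mem_ball.1 hy).le
  exact ⟨hsub this, hj2 this⟩

theorem dl_zero {f : SF m} {O : Set (Euc m)} (hO : IsOpen O) (h : ∀ x ∈ O, f x = 0) (l : List (Fin m)) : ∀ x ∈ O, dl l f x = 0 := by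
  induction l with
  | nil => exact h
  | cons j l ih =>
    intro x hx
    rw [dl_cons]
    have h1 := hasDerivAt_line (dl l f) x (e j) 0
    have hc : Continuous fun t : ℝ => x + t • (e j : Euc m) := by fun_prop
    have h2 : (fun t : ℝ => dl l f (x + t • (e j : Euc m))) =ᶠ[𝓝 0] fun _ => 0 := by
      filter_upwards [(hO.preimage hc).mem_nhds (show (0:ℝ) ∈ _ by simpa using hx)] with t ht
      exact ih _ ht
    have := h1.unique ((hasDerivAt_const (0:ℝ) (0:ℝ)).congr_of_eventuallyEq h2)
    rwa [zero_smul, add_zero] at this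

theorem Appr.LB (hm : 0 < m) (hA : Appr Ω s) (ho : IsOpen Ω) (hc : Convex ℝ Ω) (hne : Ω.Nonempty)
    (hp : ¬ ∃ p v : Euc m, v ≠ 0 ∧ ∀ t : ℝ, p + t • v ∈ closure Ω) : LB Filter.atTop (fun j => (s j).u) Ω := by
  have hz : ∃ z, z ∉ Ω := by
    by_contra hcon
    push Not at hcon
    refine hp ⟨0, e ⟨0, hm⟩, fun h => ?_, fun t => subset_closure (hcon _)⟩
    have := congrArg norm h
    simp [e] at this
  obtain ⟨z, hz⟩ := hz
  obtain ⟨v0, hv1, hv2⟩ := support ho hc hne hz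
  have hv0 : v0 ≠ 0 := fun h => by rw [h, norm_zero] at hv1; exact zero_ne_one hv1
  obtain ⟨n, c, hn, hpos, -⟩ := cone_data hc hne hp hv0 (c0 := -⟪v0, z⟫) (fun x hx => by
    have := hv2 x hx
    rw [inner_sub_right] at this; linarith)
  obtain ⟨a, hco⟩ := hA.coerc ho hn hpos
  intro x hx l
  obtain ⟨r, hr, hrΩ⟩ := Metric.nhds_basis_closedBall.mem_iff.1 (ho.mem_nhds hx)
  obtain ⟨C1, hC1⟩ := hA.upper hm ho (isCompact_closedBall x r) hrΩ
  set M : ℝ := C1 + ‖a‖ * (‖x‖ + r) + 1 with hM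
  obtain ⟨R0, hR0⟩ := hco M
  set R : ℝ := max R0 (‖x‖ + r) with hR
  set A : ℝ := M + ‖a‖ * R with hAd
  have hV : ∃ V, IsOpen V ∧ frontier Ω ∩ Metric.closedBall 0 R ⊆ V ∧ ∀ᶠ j : ℕ in Filter.atTop,
      ∀ y ∈ Ω ∩ Metric.ball 0 (j:ℝ), y ∈ closure V → A ≤ (s j).u y := by
    have hK : IsCompact (frontier Ω ∩ Metric.closedBall 0 R) := (isCompact_closedBall 0 R).inter_left isClosed_frontier
    refine hK.induction_on (p := fun S => ∃ V, IsOpen V ∧ S ⊆ V ∧ ∀ᶠ j : ℕ in Filter.atTop,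
      ∀ y ∈ Ω ∩ Metric.ball 0 (j:ℝ), y ∈ closure V → A ≤ (s j).u y) ?_ ?_ ?_ ?_
    · exact ⟨∅, isOpen_empty, Set.empty_subset _, Filter.Eventually.of_forall fun j y _ hy => by simp at hy⟩
    · rintro S T hST ⟨V, h1, h2, h3⟩
      exact ⟨V, h1, hST.trans h2, h3⟩
    · rintro S T ⟨V, h1, h2, h3⟩ ⟨V', h1', h2', h3'⟩
      refine ⟨V ∪ V', h1.union h1', Set.union_subset_union h2 h2', ?_⟩
      filter_upwards [h3, h3'] with j hj hj' y hy hyV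
      rw [closure_union] at hyV
      exact hyV.elim (hj y hy) (hj' y hy)
    · intro z hz
      obtain ⟨r', hr', h⟩ := hA.bdry ho hc hne hp hz.1 A
      refine ⟨Metric.ball z (r' / 2), mem_nhdsWithin_of_mem_nhds (Metric.ball_mem_nhds z (half_pos hr')),
        Metric.ball z (r' / 2), Metric.isOpen_ball, subset_rfl, ?_⟩
      filter_upwards [h] with j hj y hy hyV
      have := Metric.mem_closedBall.1 (Metric.closure_ball_subset_closedBall hyV)
      exact hj y hy (by linarith)
  obtain ⟨V, hVo, hVZ, hVA⟩ := hV
  set E : Set (Euc m) := (closure Ω ∩ Metric.closedBall 0 R) \ V with hEd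
  have hE : IsCompact E := ((isCompact_closedBall 0 R).inter_left isClosed_closure).diff hVo
  have hEΩ : E ⊆ Ω := fun y hy => by
    by_contra hyn
    exact hy.2 (hVZ ⟨by rw [ho.frontier_eq]; exact ⟨hy.1.1, hyn⟩, hy.1.2⟩)
  have hfrE : ∀ y ∈ frontier E, y ∈ E ∧ (‖y‖ = R ∨ y ∈ closure V) := fun y hy => by
    have hyE : y ∈ E := hE.isClosed.frontier_subset hy
    refine ⟨hyE, ?_⟩
    by_contra hcon
    push Not at hcon
    have hlt : ‖y‖ < R := lt_of_le_of_ne (mem_closedBall_zero_iff.1 hyE.1.2) hcon.1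
    have hopen : IsOpen (Ω ∩ Metric.ball 0 R ∩ (closure V)ᶜ) := (ho.inter Metric.isOpen_ball).inter isClosed_closure.isOpen_compl
    refine hy.2 (mem_interior.2 ⟨_, fun w hw => ?_, hopen, ⟨hEΩ hyE, mem_ball_zero_iff.2 hlt⟩, hcon.2⟩)
    exact ⟨⟨subset_closure hw.1.1, Metric.ball_subset_closedBall hw.1.2⟩, fun h => hw.2 (subset_closure h)⟩
  have haR : ∀ y : Euc m, ‖y‖ ≤ R → -⟪a, y⟫ ≤ ‖a‖ * R := fun y hy => by
    have h1 := abs_real_inner_le_norm a y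
    have h2 : ‖a‖ * ‖y‖ ≤ ‖a‖ * R := by gcongr
    linarith [neg_abs_le ⟪a, y⟫]
  have hnorm : ∀ y ∈ Metric.closedBall x r, ‖y‖ ≤ ‖x‖ + r := fun y hy => by
    rw [Metric.mem_closedBall, dist_eq_norm] at hy
    have : ‖y‖ ≤ ‖x‖ + ‖y - x‖ := by simpa using norm_add_le x (y - x)
    linarith
  have hR' : 0 ≤ R := le_trans (by positivity) (le_max_right R0 (‖x‖ + r))
  have hBE : Metric.closedBall x r ⊆ E := fun y hy => by
    refine ⟨⟨subset_closure (hrΩ hy), mem_closedBall_zero_iff.2 ((hnorm y hy).trans (le_max_right _ _))⟩, fun hyV => ?_⟩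
    obtain ⟨j, h1, h2, h3⟩ := (hVA.and (hC1.and (bdd_ev (isCompact_closedBall x r)))).exists
    have e1 := h1 y ⟨hrΩ hy, h3 hy⟩ (subset_closure hyV)
    have e2 := h2 y hy
    have e3 : 0 ≤ ‖a‖ * (‖x‖ + r) := by positivity
    have e4 : 0 ≤ ‖a‖ * R := by positivity
    linarith
  obtain ⟨r', hr', hr'Ω⟩ := hE.exists_cthickening_subset_open ho hEΩ
  obtain ⟨C2, hC2⟩ := hA.upper hm ho hE.cthickening hr'Ω
  obtain ⟨C3, hC3⟩ := hA.lower ho hn hpos hE.cthickening hr'Ω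
  have hall := hA.and (hC1.and (hR0.and (hVA.and (hC2.and (hC3.and (bdd_ev hE))))))
  set P : ℕ → Prop := _ with hP
  change ∀ᶠ j in Filter.atTop, P j at hall
  have hest := est (fun i : {j // P j} => s i.1) hE hr' (C := max C2 C3) (fun i y hy v hv => by
      obtain ⟨-, -, -, -, h2, h3, -⟩ := i.2
      have hmem : y + v ∈ Metric.cthickening r' E :=
        Metric.mem_cthickening_of_dist_le _ y r' E hy (by simpa [dist_eq_norm] using hv)
      rw [abs_le]
      exact ⟨(neg_le_neg (le_max_right _ _)).trans (h3 _ hmem), (h2 _ hmem).trans (le_max_left _ _)⟩) a M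
    (fun i y hy => by
      obtain ⟨-, -, h1, h2, -, -, h3⟩ := i.2
      obtain ⟨hyE, hy2⟩ := hfrE y hy
      have hyj : y ∈ Ω ∩ Metric.ball 0 (i.1:ℝ) := ⟨hEΩ hyE, h3 hyE⟩
      rcases hy2 with hy2 | hy2
      · exact h1 y hyj (by rw [hy2]; exact le_max_left _ _)
      · have := h2 y hyj hy2
        have := haR y (mem_closedBall_zero_iff.1 hyE.1.2)
        linarith)
    (fun l' => ⟨0, fun i y hy => by
      obtain ⟨h0, -, -, -, -, -, h3⟩ := i.2
      have := dl_zero (ho.inter Metric.isOpen_ball) h0.1 l' y ⟨hEΩ hy, h3 hy⟩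
      rw [this, abs_zero]⟩) one_pos l
  obtain ⟨B, hB⟩ := hest
  refine ⟨r, hr, B, ?_⟩
  filter_upwards [hall] with j hj y hy
  have hy' := Metric.ball_subset_closedBall hy
  refine hB ⟨j, hj⟩ y (hBE hy') ?_
  have e1 := hj.2.1 y hy'
  have e2 := (le_abs_self _).trans (abs_real_inner_le_norm a y)
  have e3 : ‖a‖ * ‖y‖ ≤ ‖a‖ * (‖x‖ + r) := by gcongr; exact hnorm y hy'
  change (s j).u y + 1 ≤ M - ⟪a, y⟫
  linarith

theorem main (hm : 0 < m) (hΩ : IsOpenProperConvexDomain Ω) :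
    ∃ F : Euc m → ℝ, ContDiffOn ℝ ∞ F Ω ∧ (∀ x ∈ Ω, (hessMatrix F x).PosDef) ∧
      (∀ x ∈ Ω, (hessMatrix F x).det = Real.exp (2 * F x)) ∧ BlowsUpOnBoundary Ω F := by
  obtain ⟨hne, ho, hc, hp⟩ := hΩ
  obtain ⟨s, hA⟩ := exists_appr ho hc hne
  have hLB := hA.LB hm ho hc hne hp
  have hU : ((Filter.hyperfilter ℕ : Ultrafilter ℕ) : Filter ℕ) ≤ Filter.atTop := Nat.hyperfilter_le_atTop
  have hball : ∀ x : Euc m, ∀ᶠ j : ℕ in Filter.atTop, x ∈ Metric.ball (0 : Euc m) (j:ℝ) := fun x =>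
    (bdd_ev (isCompact_singleton (x := x))).mono fun j hj => hj rfl
  obtain ⟨F, h1, h2, h3, h4⟩ := sol_limit (Filter.hyperfilter ℕ) s ho
    (fun x hx l => by
      obtain ⟨r, hr, C, h⟩ := hLB x hx l
      exact ⟨r, hr, C, h.filter_mono hU⟩) (fun _ => 0)
    (fun x hx => by
      refine tendsto_const_nhds.congr' (Filter.Eventually.filter_mono hU ?_)
      filter_upwards [hA, hball x] with j hj hj2
      exact (hj.1 x ⟨hx, hj2⟩).symm)
  refine ⟨F, h1, h3, fun x hx => by rw [h4 x hx, sub_zero], ?_⟩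
  intro z hz x hx hxz
  refine Filter.tendsto_atTop.2 fun A => ?_
  obtain ⟨r, hr, h⟩ := hA.bdry ho hc hne hp hz A
  filter_upwards [hxz (Metric.ball_mem_nhds z hr)] with k hk
  refine ge_of_tendsto (h2 (x k) (hx k)) (Filter.Eventually.filter_mono hU ?_)
  filter_upwards [h, hball (x k)] with j hj hj2
  exact hj (x k) ⟨hx k, hj2⟩ hk
end CY
end

/-- On a nonempty proper open convex domain `Ω ⊆ ℝ^{n+1}` there exists a smooth function
`F` with positive definite Hessian satisfying `det D²F = e^{2F}` and blowing up at the
boundary of `Ω`. -/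
theorem exists_canonical_potential_of_properConvexDomain
    (n : ℕ) (Ω : Set (Euc (n + 1))) (hΩ : IsOpenProperConvexDomain Ω) :
    ∃ F : Euc (n + 1) → ℝ,
      ContDiffOn ℝ (⊤ : ℕ∞) F Ω ∧
      (∀ x ∈ Ω, (hessMatrix F x).PosDef) ∧
      (∀ x ∈ Ω, (hessMatrix F x).det = Real.exp (2 * F x)) ∧
      BlowsUpOnBoundary Ω F := by
  exact CY.main (Nat.succ_pos n) hΩ
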